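/- Let n > q ≥ 2. Let Π be a smooth Nambu structure of order q on an open neighborhood U of 0 in ℝⁿ with Π(0) = 0 whose linear part at 0 equals the elliptic model Π_{q+1,q} (i.e. the nondegenerate Type 1 linear Nambu structure with definite quadratic form, signature (q+1, 0)). Then Π is locally smoothly linearizable at 0: there exist an open neighborhood W ⊆ U of 0 and a C^∞ diffeomorphism φ from W onto an open neighborhood of 0 in ℝⁿ with φ(0) = 0 such that (φ_*Π)(y) = Π_{q+1,q}(y) for all y ∈ φ(W). -/

import Mathlib

open scoped ContDiff

namespace NambuLin

/-- Index set for the standard basis of the `q`-th exterior power of `ℝⁿ`: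
increasing multi-indices, encoded as `q`-element subsets of `Fin n`. -/
abbrev Idx (n q : ℕ) := {s : Finset (Fin n) // s.card = q}

/-- A `q`-vector of `ℝⁿ`, given by its coordinates in the standard basis
`{e_{i₁} ∧ ⋯ ∧ e_{i_q}}` of `⋀^q(ℝⁿ)`. -/
abbrev MultiVec (n q : ℕ) := Idx n q → ℝ

/-- The Jacobian matrix of a map `φ : ℝⁿ → ℝⁿ` at a point `x`. -/
noncomputable def jac {n : ℕ} (φ : (Fin n → ℝ) → (Fin n → ℝ)) (x : Fin n → ℝ) :
    Matrix (Fin n) (Fin n) ℝ :=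
  Matrix.of fun i j => fderiv ℝ φ x (Pi.single j 1) i

/-- The `q`-th exterior power `⋀^q A` of a matrix `A`, acting on `q`-vectors in
coordinates: `((⋀^q A) w)_J = ∑_I det(A[J,I]) w_I`. -/
noncomputable def extPow (n q : ℕ) (A : Matrix (Fin n) (Fin n) ℝ) (w : MultiVec n q) :
    MultiVec n q :=
  fun J => ∑ I : Idx n q,
    (A.submatrix (J.1.orderEmbOfFin J.2) (I.1.orderEmbOfFin I.2)).det * w I

/-- The constant `q`-vector `e₁ ∧ ⋯ ∧ e_q` in coordinates. -/
def stdVec (n q : ℕ) : MultiVec n q :=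
  fun J => if (J : Finset (Fin n)) = Finset.univ.filter (fun i : Fin n => (i : ℕ) < q) then 1 else 0

/-- `φ` is a `C^∞` diffeomorphism from the open set `W` onto the open set `φ '' W`. -/
def IsSmoothDiffeoOn {n : ℕ} (φ : (Fin n → ℝ) → (Fin n → ℝ)) (W : Set (Fin n → ℝ)) : Prop :=
  IsOpen W ∧ IsOpen (φ '' W) ∧ ContDiffOn ℝ ∞ φ W ∧
    ∃ ψ : (Fin n → ℝ) → (Fin n → ℝ), ContDiffOn ℝ ∞ ψ (φ '' W) ∧
      (∀ x ∈ W, ψ (φ x) = x) ∧ (∀ y ∈ φ '' W, φ (ψ y) = y)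

/-- `P` is a (smooth) Nambu structure of order `q` on `U`: it is a smooth `q`-vector
field, and around every point where it does not vanish there is a local `C^∞`
coordinate system in which it becomes the constant `q`-vector `e₁ ∧ ⋯ ∧ e_q`. -/
def IsNambu (n q : ℕ) (P : (Fin n → ℝ) → MultiVec n q) (U : Set (Fin n → ℝ)) : Prop :=
  ContDiffOn ℝ ∞ P U ∧
    ∀ p ∈ U, P p ≠ 0 →
      ∃ W, p ∈ W ∧ W ⊆ U ∧ ∃ φ, IsSmoothDiffeoOn φ W ∧
        ∀ x ∈ W, extPow n q (jac φ x) (P x) = stdVec n q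

/-- The signs `ε_j` (`= 1` for the first `k` indices, `= -1` afterwards;
`0`-based indexing, so `ε_j = 1` iff `j < k`). -/
def eps {n : ℕ} (k : ℕ) (j : Fin n) : ℝ := if (j : ℕ) < k then 1 else -1

/-- The set of indices `{1, …, q+1}` (in `0`-based form: `{0,…,q}`). -/
def topIdx (n q : ℕ) : Finset (Fin n) := Finset.univ.filter (fun i : Fin n => (i : ℕ) < q + 1)

/-- The nondegenerate Type 1 linear Nambu structure `Π_{k,q}` of order `q` and
signature `(k, q+1-k)`:
`Π_{k,q}(x) = ∑_{j=1}^{q+1} (−1)^{j−1} ε_j x_j e₁ ∧ ⋯ ∧ ê_j ∧ ⋯ ∧ e_{q+1}`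
(here written with `0`-based indices `j`, whence the sign `(−1)^j`). -/
def modelPi (n q k : ℕ) (x : Fin n → ℝ) : MultiVec n q :=
  fun J => ∑ j : Fin n,
    if ((j : ℕ) < q + 1 ∧ (J : Finset (Fin n)) = (topIdx n q).erase j)
    then (-1 : ℝ) ^ (j : ℕ) * eps k j * x j else 0

set_option linter.unusedSectionVars false

open MeasureTheory Set Filter Topology

section ParamInt

theorem eventually_forall_compact {E K : Type} [TopologicalSpace E] [TopologicalSpace K]
    {S : Set K} (hS : IsCompact S) {x0 : E} {O : Set (E × K)}
    (h : ∀ k ∈ S, O ∈ 𝓝 (x0, k)) : ∀ᶠ x in 𝓝 x0, ∀ k ∈ S, (x, k) ∈ O := by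
  have := hS.eventually_forall_of_forall_eventually (x₀ := x0) (P := fun x k => (x, k) ∈ O)
    (by intro k hk; exact h k hk)
  exact this

variable {E K F : Type} [NormedAddCommGroup E] [NormedSpace ℝ E]
  [NormedAddCommGroup K] [NormedSpace ℝ K] [NormedAddCommGroup F] [NormedSpace ℝ F]

theorem slice_continuousOn {S : Set K} (g : E × K → F) (x : E)
    (hg : ∀ k ∈ S, ContinuousAt g (x, k)) : ContinuousOn (fun k => g (x, k)) S := by
  intro k hk
  exact (ContinuousAt.comp (f := fun k => (x, k)) (hg k hk) (by fun_prop)).continuousWithinAt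

theorem slice_bdd {S : Set K} (hS : IsCompact S) (g : E × K → F) (x0 : E)
    (hg : ∀ k ∈ S, ContinuousAt g (x0, k)) : ∃ C, ∀ᶠ x in 𝓝 x0, ∀ k ∈ S, ‖g (x, k)‖ ≤ C := by
  obtain ⟨C, hC⟩ := hS.exists_bound_of_continuousOn (slice_continuousOn g x0 hg)
  refine ⟨C + 1, eventually_forall_compact (O := {p | ‖g p‖ ≤ C + 1}) hS ?_⟩
  intro k hk
  have h1 := (hg k hk).norm
  have : ∀ᶠ p in 𝓝 (x0, k), ‖g p‖ < C + 1 :=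
    h1.eventually_lt continuousAt_const (by have := hC k hk; linarith)
  filter_upwards [this] with p hp using hp.le

variable [MeasurableSpace K] [BorelSpace K] [CompleteSpace F]

theorem hasFDerivAt_integral
    (μ : Measure K) [IsFiniteMeasureOnCompacts μ]
    {S : Set K} (hS : IsCompact S) (f : E × K → F) (x0 : E)
    (h : ∀ k ∈ S, ContDiffAt ℝ 1 f (x0, k)) :
    HasFDerivAt (fun x => ∫ k in S, f (x, k) ∂μ)
      (∫ k in S, (fderiv ℝ f (x0, k)).comp (ContinuousLinearMap.inl ℝ E K) ∂μ) x0 := by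
  have hmS : MeasurableSet S := hS.isClosed.measurableSet
  have : IsFiniteMeasure (μ.restrict S) := ⟨by simpa using hS.measure_lt_top⟩
  set g : E × K → (E →L[ℝ] F) := fun p => (fderiv ℝ f p).comp (ContinuousLinearMap.inl ℝ E K)
    with hg
  have hgn : ∀ p, ContDiffAt ℝ 1 f p → ContinuousAt g p := by
    intro p hp
    have : ContDiffAt ℝ 0 (fderiv ℝ f) p := hp.fderiv_right (by simp)
    exact (this.clm_comp contDiffAt_const).continuousAt
  obtain ⟨C, hC⟩ := slice_bdd hS g x0 (fun k hk => hgn _ (h k hk))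
  have hev2 : ∀ᶠ x in 𝓝 x0, ∀ k ∈ S, (x, k) ∈ {p | ContDiffAt ℝ 1 f p} :=
    eventually_forall_compact hS fun k hk => (h k hk).eventually (by simp)
  refine hasFDerivAt_integral_of_dominated_of_fderiv_le (bound := fun _ => C)
    (F' := fun x k => g (x, k)) (hC.and hev2) ?_ ?_ ?_ ?_ (integrable_const _) ?_
  · filter_upwards [hev2] with x' hx'
    exact (slice_continuousOn f x' fun k hk =>
      (hx' k hk).continuousAt).aestronglyMeasurable_of_isCompact hS hmS
  · exact (slice_continuousOn f x0 fun k hk => (h k hk).continuousAt).integrableOn_compact hS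
  · exact (slice_continuousOn g x0 fun k hk =>
      (hgn _ (h k hk))).aestronglyMeasurable_of_isCompact hS hmS
  · refine (ae_restrict_iff' hmS).2 (Eventually.of_forall fun k hk => ?_)
    intro x' hx'
    exact hx'.1 k hk
  · refine (ae_restrict_iff' hmS).2 (Eventually.of_forall fun k hk => ?_)
    intro x' hx'
    have h0 : ContDiffAt ℝ 1 f (x', k) := hx'.2 k hk
    have h1 : HasFDerivAt f (fderiv ℝ f (x', k)) (x', k) :=
      (h0.differentiableAt (by simp)).hasFDerivAt
    have h2 : HasFDerivAt (fun x : E => (x, k)) (ContinuousLinearMap.inl ℝ E K) x' :=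
      hasFDerivAt_prodMk_left x' k
    exact h1.comp x' h2

theorem contDiffAt_integral_nat
    (μ : Measure K) [IsFiniteMeasureOnCompacts μ]
    {S : Set K} (hS : IsCompact S) (n : ℕ) : ∀ {F : Type} [NormedAddCommGroup F]
    [NormedSpace ℝ F] [CompleteSpace F] (f : E × K → F) (x0 : E),
    (∀ k ∈ S, ContDiffAt ℝ n f (x0, k)) →
    ContDiffAt ℝ n (fun x => ∫ k in S, f (x, k) ∂μ) x0 := by
  have hmS : MeasurableSet S := hS.isClosed.measurableSet
  have : IsFiniteMeasure (μ.restrict S) := ⟨by simpa using hS.measure_lt_top⟩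
  induction n with
  | zero =>
    intro F _ _ _ f x0 hf
    have hev : ∀ᶠ x in 𝓝 x0, ∀ k ∈ S, (x, k) ∈ {p | ContDiffAt ℝ 0 f p} :=
      eventually_forall_compact hS fun k hk => (hf k hk).eventually (by simp)
    have main : ∀ x, (∀ k ∈ S, ContDiffAt ℝ 0 f (x, k)) →
        ContinuousAt (fun x => ∫ k in S, f (x, k) ∂μ) x := by
      intro x hx
      obtain ⟨C, hC⟩ := slice_bdd hS f x (fun k hk => (hx k hk).continuousAt)
      have hev : ∀ᶠ x in 𝓝 x, ∀ k ∈ S, (x, k) ∈ {p | ContDiffAt ℝ 0 f p} :=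
        eventually_forall_compact hS fun k hk => (hx k hk).eventually (by simp)
      refine continuousAt_of_dominated (bound := fun _ => C) ?_ ?_ (integrable_const _) ?_
      · filter_upwards [hev] with x' hx'
        exact (slice_continuousOn f x' fun k hk =>
          (hx' k hk).continuousAt).aestronglyMeasurable_of_isCompact hS hmS
      · filter_upwards [hC] with x' hx'
        exact (ae_restrict_iff' hmS).2 (Eventually.of_forall hx')
      · refine (ae_restrict_iff' hmS).2 (Eventually.of_forall fun k hk => ?_)
        exact ContinuousAt.comp (f := fun x => (x, k)) (hx k hk).continuousAt (by fun_prop)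
    have : ContDiffAt ℝ ((0 : ℕ) : WithTop ℕ∞) (fun x => ∫ k in S, f (x, k) ∂μ) x0 := by
      rw [Nat.cast_zero]
      rw [contDiffAt_zero]
      refine ⟨_, hev, fun x hx => (main x hx).continuousWithinAt⟩
    exact this
  | succ n ih =>
    intro F _ _ _ f x0 hf
    have hev : ∀ᶠ x in 𝓝 x0, ∀ k ∈ S, (x, k) ∈ {p | ContDiffAt ℝ (n + 1 : ℕ) f p} :=
      eventually_forall_compact hS fun k hk => (hf k hk).eventually (by simp)
    set g : E × K → (E →L[ℝ] F) := fun p => (fderiv ℝ f p).comp (ContinuousLinearMap.inl ℝ E K)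
    have hgn : ∀ p, ContDiffAt ℝ (n + 1 : ℕ) f p → ContDiffAt ℝ n g p := by
      intro p hp
      have : ContDiffAt ℝ n (fderiv ℝ f) p := hp.fderiv_right (by simp)
      exact this.clm_comp contDiffAt_const
    have key := contDiffAt_succ_iff_hasFDerivAt (𝕜 := ℝ) (n := n)
      (f := fun x => ∫ k in S, f (x, k) ∂μ) (x := x0)
    have goal : ContDiffAt ℝ (n + 1) (fun x => ∫ k in S, f (x, k) ∂μ) x0 := by
      rw [key]
      refine ⟨fun x => ∫ k in S, g (x, k) ∂μ, ⟨_, hev, ?_⟩, ih g x0 fun k hk => hgn _ (hf k hk)⟩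
      intro x hx
      have hx' : ∀ k ∈ S, ContDiffAt ℝ (n + 1 : ℕ) f (x, k) := hx
      exact hasFDerivAt_integral μ hS f x fun k hk => (hx' k hk).of_le (by simp)
    exact goal

/-- Smoothness of integrals over a compact set depending smoothly on parameters. -/
theorem contDiffAt_integral
    (μ : Measure K) [IsFiniteMeasureOnCompacts μ]
    {S : Set K} (hS : IsCompact S) (f : E × K → F) (x0 : E)
    (h : ∀ k ∈ S, ContDiffAt ℝ ∞ f (x0, k)) :
    ContDiffAt ℝ ∞ (fun x => ∫ k in S, f (x, k) ∂μ) x0 := by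
  rw [contDiffAt_infty]
  intro n
  exact contDiffAt_integral_nat μ hS n f x0 fun k hk => (h k hk).of_le (by exact_mod_cast le_top)

end ParamInt

open MeasureTheory Set Filter Topology

section Hadamard
variable {Y Z F : Type} [NormedAddCommGroup Y] [NormedSpace ℝ Y]
  [NormedAddCommGroup Z] [NormedSpace ℝ Z] [NormedAddCommGroup F] [NormedSpace ℝ F]
  [CompleteSpace F]

/-- The Hadamard quotient. -/
noncomputable def hadA (f : Y × Z → F) (x : Y × Z) : Y →L[ℝ] F :=
  ∫ s in Icc (0:ℝ) 1, (fderiv ℝ f (s • x.1, x.2)).comp (ContinuousLinearMap.inl ℝ Y Z)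

theorem hadA_contDiffAt (f : Y × Z → F) (x : Y × Z)
    (h : ∀ s ∈ Icc (0:ℝ) 1, ContDiffAt ℝ ∞ f (s • x.1, x.2)) : ContDiffAt ℝ ∞ (hadA f) x := by
  unfold hadA
  refine contDiffAt_integral volume isCompact_Icc
    (fun p : (Y × Z) × ℝ => (fderiv ℝ f (p.2 • p.1.1, p.1.2)).comp
      (ContinuousLinearMap.inl ℝ Y Z)) x fun s hs => ?_
  have h1 : ContDiffAt ℝ ∞ (fderiv ℝ f) (s • x.1, x.2) := (h s hs).fderiv_right (by simp)
  have h2 : ContDiffAt ℝ ∞ (fun p : (Y × Z) × ℝ => (p.2 • p.1.1, p.1.2)) (x, s) := by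
    fun_prop
  have h3 : ContDiffAt ℝ ∞ (fun p : (Y × Z) × ℝ => fderiv ℝ f (p.2 • p.1.1, p.1.2)) (x, s) :=
    ContDiffAt.comp (x, s) (f := fun p : (Y × Z) × ℝ => (p.2 • p.1.1, p.1.2)) h1 h2
  exact h3.clm_comp contDiffAt_const

theorem hadA_zero (f : Y × Z → F) (z : Z) :
    hadA f (0, z) = (fderiv ℝ f (0, z)).comp (ContinuousLinearMap.inl ℝ Y Z) := by
  simp [hadA]

theorem hadA_spec (f : Y × Z → F) (y : Y) (z : Z)
    (h : ∀ s ∈ Icc (0:ℝ) 1, ContDiffAt ℝ 1 f (s • y, z)) :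
    f (y, z) - f (0, z) = hadA f (y, z) y := by
  have hd : ∀ s ∈ uIcc (0:ℝ) 1, HasDerivAt (fun s : ℝ => f (s • y, z))
      ((fderiv ℝ f (s • y, z)) (y, 0)) s := by
    intro s hs
    rw [uIcc_of_le zero_le_one] at hs
    have h1 : HasFDerivAt f (fderiv ℝ f (s • y, z)) (s • y, z) :=
      ((h s hs).differentiableAt (by simp)).hasFDerivAt
    have h2 : HasDerivAt (fun s : ℝ => (s • y, z)) (y, (0:Z)) s := by
      have := ((hasDerivAt_id s).smul_const y)
      simpa using this.prodMk (hasDerivAt_const s z)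
    exact h1.comp_hasDerivAt s h2
  have hcont : ContinuousOn (fun s : ℝ => fderiv ℝ f (s • y, z)) (Icc 0 1) := by
    intro s hs
    have h1 : ContDiffAt ℝ 0 (fderiv ℝ f) (s • y, z) := (h s hs).fderiv_right (by simp)
    exact (ContinuousAt.comp (f := fun s : ℝ => (s • y, z)) h1.continuousAt
      (by fun_prop)).continuousWithinAt
  have hint : IntervalIntegrable (fun s : ℝ => (fderiv ℝ f (s • y, z)) (y, 0)) volume 0 1 := by
    apply ContinuousOn.intervalIntegrable
    rw [uIcc_of_le zero_le_one]
    exact hcont.clm_apply continuousOn_const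
  have := intervalIntegral.integral_eq_sub_of_hasDerivAt hd hint
  simp only [one_smul, zero_smul] at this
  rw [← this, intervalIntegral.integral_of_le zero_le_one, ← integral_Icc_eq_integral_Ioc, hadA,
    ContinuousLinearMap.integral_apply]
  · simp
  · have : ContinuousOn (fun s : ℝ => (fderiv ℝ f (s • y, z)).comp
      (ContinuousLinearMap.inl ℝ Y Z)) (Icc 0 1) := hcont.clm_comp continuousOn_const
    exact this.integrableOn_compact isCompact_Icc

end Hadamard

section PartFlow
open scoped ContDiff unitInterval
open MeasureTheory Set Filter Topology

section Nemytskii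
variable {E : Type} [NormedAddCommGroup E] [NormedSpace ℝ E] 

/-- The Nemytskii (superposition) operator. -/
noncomputable def nem {F : Type} [NormedAddCommGroup F] (v : E → F) (hv : Continuous v)
    (u : C(I, E)) : C(I, F) := (⟨v, hv⟩ : C(E, F)).comp u

theorem nem_apply {F : Type} [NormedAddCommGroup F] (v : E → F) (hv : Continuous v)
    (u : C(I, E)) (t : I) : nem v hv u t = v (u t) := rfl

/-- Pointwise application of a curve of operators. -/
noncomputable def pw (E F : Type) [NormedAddCommGroup E] [NormedSpace ℝ E]
    [NormedAddCommGroup F] [NormedSpace ℝ F] : C(I, E →L[ℝ] F) →L[ℝ] C(I, E) →L[ℝ] C(I, F) :=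
  LinearMap.mkContinuous₂ (LinearMap.mk₂ ℝ
    (fun (L : C(I, E →L[ℝ] F)) (h : C(I, E)) => (⟨fun t => L t (h t), by fun_prop⟩ : C(I, F)))
    (by intro a b c; ext t; simp) (by intro a b c; ext t; simp)
    (by intro a b c; ext t; simp) (by intro a b c; ext t; simp)) 1 (by
      intro L h
      rw [ContinuousMap.norm_le _ (by positivity)]
      intro t
      simp only [LinearMap.mk₂_apply, ContinuousMap.coe_mk, one_mul]
      exact (ContinuousLinearMap.le_opNorm _ _).trans
        (mul_le_mul (L.norm_coe_le_norm t) (h.norm_coe_le_norm t) (norm_nonneg _)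
        (norm_nonneg L)))

theorem pw_apply {F : Type} [NormedAddCommGroup F] [NormedSpace ℝ F]
    (L : C(I, E →L[ℝ] F)) (h : C(I, E)) (t : I) : pw E F L h t = L t (h t) := rfl

theorem taylor_lip {F : Type} [NormedAddCommGroup F] [NormedSpace ℝ F]
    (v : E → F) (hv : Differentiable ℝ v) {C : NNReal} (hC : LipschitzWith C (fderiv ℝ v))
    (a h : E) : ‖v (a + h) - v a - fderiv ℝ v a h‖ ≤ C * ‖h‖ * ‖h‖ := by
  have := (convex_closedBall a ‖h‖).norm_image_sub_le_of_norm_hasFDerivWithin_le' (f := v)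
    (f' := fderiv ℝ v) (φ := fderiv ℝ v a) (C := C * ‖h‖) (x := a) (y := a + h)
    (fun x _ => (hv x).hasFDerivAt.hasFDerivWithinAt) (fun x hx => by
      have h1 := hC.dist_le_mul x a
      rw [dist_eq_norm, dist_eq_norm] at h1
      refine h1.trans ?_
      have : ‖x - a‖ ≤ ‖h‖ := by simpa [dist_eq_norm] using hx
      gcongr) (by simp) (by simp)
  simpa using this

theorem nem_hasFDerivAt {F : Type} [NormedAddCommGroup F] [NormedSpace ℝ F]
    (v : E → F) (hv : ContDiff ℝ ∞ v) (hc : HasCompactSupport v) (u : C(I, E)) :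
    HasFDerivAt (nem v hv.continuous)
      (pw E F (nem (fderiv ℝ v) (hv.continuous_fderiv (by simp)) u)) u := by
  have h1 : ContDiff ℝ 1 (fderiv ℝ v) := hv.fderiv_right (by norm_cast)
  obtain ⟨C, hC⟩ := h1.lipschitzWith_of_hasCompactSupport (hc.fderiv ℝ) (by simp)
  rw [hasFDerivAt_iff_isLittleO_nhds_zero]
  have : (fun h : C(I, E) => nem v hv.continuous (u + h) - nem v hv.continuous u -
      (pw E F (nem (fderiv ℝ v) (hv.continuous_fderiv (by simp)) u)) h) =O[𝓝 0]
      fun h => ‖h‖ ^ 2 := by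
    refine Asymptotics.IsBigO.of_bound C (Eventually.of_forall fun h => ?_)
    rw [ContinuousMap.norm_le _ (by positivity)]
    intro t
    have := taylor_lip v (hv.differentiable (by simp)) hC (u t) (h t)
    refine this.trans ?_
    have h3 := h.norm_coe_le_norm t
    rw [norm_pow, norm_norm, mul_assoc, ← sq]
    gcongr
  exact this.trans_isLittleO (Asymptotics.isLittleO_norm_pow_id one_lt_two)

theorem nem_contDiff_nat (n : ℕ) : ∀ {F : Type} [NormedAddCommGroup F] [NormedSpace ℝ F]
    (v : E → F) (hv : ContDiff ℝ ∞ v) (_ : HasCompactSupport v),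
    ContDiff ℝ n (nem v hv.continuous) := by
  induction n with
  | zero =>
    intro F _ _ v hv hc
    exact contDiff_zero.2 (continuous_iff_continuousAt.2 fun u =>
      (nem_hasFDerivAt v hv hc u).continuousAt)
  | succ n ih =>
    intro F _ _ v hv hc
    have : ContDiff ℝ (n + 1) (nem v hv.continuous) := by
      rw [contDiff_succ_iff_hasFDerivAt]
      refine ⟨_, ?_, nem_hasFDerivAt v hv hc⟩
      have h1 : ContDiff ℝ ∞ (fderiv ℝ v) := hv.fderiv_right (by simp)
      have hp : ContDiff ℝ n (fun L : C(I, E →L[ℝ] F) => pw E F L) := by fun_prop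
      exact hp.comp (ih (fderiv ℝ v) h1 (hc.fderiv ℝ))
    exact this

theorem nem_contDiff {F : Type} [NormedAddCommGroup F] [NormedSpace ℝ F]
    (v : E → F) (hv : ContDiff ℝ ∞ v) (hc : HasCompactSupport v) :
    ContDiff ℝ ∞ (nem v hv.continuous) :=
  contDiff_infty.2 fun n => nem_contDiff_nat n v hv hc

variable [CompleteSpace E]

/-- Extension of a curve to the real line. -/
noncomputable def ex {E : Type} [NormedAddCommGroup E] (u : C(I, E)) (s : ℝ) : E :=
  u (projIcc 0 1 zero_le_one s)

theorem ex_continuous (u : C(I, E)) : Continuous (ex u) := by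
  unfold ex; exact u.continuous.comp continuous_projIcc

theorem ex_coe (u : C(I, E)) (t : I) : ex u t = u t := by simp [ex]

theorem ex_norm_le (u : C(I, E)) (s : ℝ) : ‖ex u s‖ ≤ ‖u‖ := u.norm_coe_le_norm _

/-- Integration operator. -/
noncomputable def Jop (E : Type) [NormedAddCommGroup E] [NormedSpace ℝ E] [CompleteSpace E] :
    C(I, E) →L[ℝ] C(I, E) :=
  LinearMap.mkContinuous
    { toFun := fun u => ⟨fun t => ∫ s in (0:ℝ)..t, ex u s, by
        have := intervalIntegral.continuous_primitive (μ := volume) (f := ex u)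
          (fun a b => (ex_continuous u).intervalIntegrable a b) 0
        exact this.comp continuous_subtype_val⟩
      map_add' := by
        intro u w; ext t
        exact intervalIntegral.integral_add ((ex_continuous u).intervalIntegrable _ _)
          ((ex_continuous w).intervalIntegrable _ _)
      map_smul' := by
        intro c u; ext t
        exact intervalIntegral.integral_smul c _ } 1 (by
      intro u
      rw [ContinuousMap.norm_le _ (by positivity)]
      intro t
      have := intervalIntegral.norm_integral_le_of_norm_le_const (a := 0) (b := (t:ℝ)) (C := ‖u‖)
        (f := ex u) (fun s _ => ex_norm_le u s)
      refine this.trans ?_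
      have h0 := t.2.1
      have h1 := t.2.2
      rw [sub_zero, abs_of_nonneg h0, one_mul]
      exact mul_le_of_le_one_right (norm_nonneg _) h1)

theorem Jop_apply (u : C(I, E)) (t : I) : Jop E u t = ∫ s in (0:ℝ)..t, ex u s := rfl

/-- Volterra-type fixed point theorem. -/
theorem volterra (T : C(I, E) → C(I, E)) (K : ℝ) (hK : 0 ≤ K)
    (hT : ∀ u w : C(I, E), ∀ t : I, ‖T u t - T w t‖ ≤ K * ∫ s in (0:ℝ)..t, ‖ex (u - w) s‖) :
    ∃ u, T u = u ∧ ∀ w, T w = w → w = u := by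
  have hit : ∀ (m : ℕ) (u w : C(I, E)) (t : I),
      ‖T^[m] u t - T^[m] w t‖ ≤ (K * t) ^ m / m.factorial * ‖u - w‖ := by
    intro m
    induction m with
    | zero => intro u w t; simpa using (u - w).norm_coe_le_norm t
    | succ m ih =>
      intro u w t
      rw [Function.iterate_succ_apply', Function.iterate_succ_apply']
      refine (hT _ _ t).trans ?_
      have h0 := t.2.1
      have h1 := t.2.2
      have hle : (∫ s in (0:ℝ)..t, ‖ex (T^[m] u - T^[m] w) s‖) ≤
          ∫ s in (0:ℝ)..t, (K * s) ^ m / m.factorial * ‖u - w‖ := by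
        apply intervalIntegral.integral_mono_on h0
        · exact ((ex_continuous _).norm).intervalIntegrable _ _
        · exact Continuous.intervalIntegrable (by fun_prop) _ _
        · intro s hs
          have hsI : s ∈ Icc (0:ℝ) 1 := ⟨hs.1, hs.2.trans h1⟩
          have := ih u w ⟨s, hsI⟩
          have e : ex (T^[m] u - T^[m] w) s = (T^[m] u - T^[m] w) ⟨s, hsI⟩ :=
            ex_coe _ ⟨s, hsI⟩
          rw [e]; exact this
      refine (mul_le_mul_of_nonneg_left hle hK).trans (le_of_eq ?_)
      simp_rw [mul_pow, mul_div_assoc, mul_assoc]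
      rw [intervalIntegral.integral_const_mul]
      have : (∫ s in (0:ℝ)..t, s ^ m * ((1 / (m.factorial : ℝ)) * ‖u - w‖)) =
          (t:ℝ) ^ (m + 1) / (m + 1) * ((1 / (m.factorial : ℝ)) * ‖u - w‖) := by
        rw [intervalIntegral.integral_mul_const, integral_pow]; simp
      have e2 : (∫ s in (0:ℝ)..t, s ^ m / (m.factorial : ℝ) * ‖u - w‖) =
          ∫ s in (0:ℝ)..t, s ^ m * ((1 / (m.factorial : ℝ)) * ‖u - w‖) := by
        congr 1; ext s; ring
      rw [e2, this, Nat.factorial_succ]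
      push_cast
      field_simp
      ring
  obtain ⟨m, hm⟩ : ∃ m : ℕ, K ^ m / m.factorial < 1 :=
    ((FloorSemiring.tendsto_pow_div_factorial_atTop K).eventually
      (gt_mem_nhds zero_lt_one)).exists
  have hm0 : 0 ≤ K ^ m / m.factorial := by positivity
  have hcon : ContractingWith ⟨K ^ m / m.factorial, hm0⟩ (T^[m]) := by
    refine ⟨by exact_mod_cast hm, LipschitzWith.of_dist_le_mul fun u w => ?_⟩
    rw [dist_eq_norm, dist_eq_norm]
    rw [ContinuousMap.norm_le _ (by positivity)]
    intro t
    refine (hit m u w t).trans ?_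
    have h0 := t.2.1
    have h1 := t.2.2
    have h3 : K * t ≤ K := mul_le_of_le_one_right hK h1
    change (K * t) ^ m / m.factorial * ‖u - w‖ ≤ K ^ m / m.factorial * ‖u - w‖
    gcongr
  refine ⟨hcon.fixedPoint, hcon.isFixedPt_fixedPoint_iterate, fun w hw => ?_⟩
  exact hcon.fixedPoint_unique (Function.IsFixedPt.iterate hw m)

end Nemytskii
end PartFlow

section PartFlow2
open scoped ContDiff unitInterval
open MeasureTheory Set Filter Topology

section FlowThm
variable {Q E : Type} [NormedAddCommGroup E] [NormedSpace ℝ E] [CompleteSpace E]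
  [NormedAddCommGroup Q] [NormedSpace ℝ Q] [CompleteSpace Q]

/-- The linear part of the curve `t ↦ (t, π, u t)`. -/
noncomputable def crv (Q E : Type) [NormedAddCommGroup E] [NormedSpace ℝ E] 
    [NormedAddCommGroup Q] [NormedSpace ℝ Q] : (Q × C(I, E)) →L[ℝ] C(I, ℝ × Q × E) :=
  LinearMap.mkContinuous
    { toFun := fun p => ⟨fun t => (0, p.1, p.2 t), by fun_prop⟩
      map_add' := by intro u w; ext t <;> simp
      map_smul' := by intro c u; ext t <;> simp } 1 (by
      intro p
      rw [ContinuousMap.norm_le _ (by positivity)]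
      intro t
      have h2 := p.2.norm_coe_le_norm t
      have h3 := norm_fst_le p
      have h4 := norm_snd_le p
      simp only [LinearMap.coe_mk, AddHom.coe_mk, ContinuousMap.coe_mk, Prod.norm_def, norm_zero]
      rw [one_mul, ← Prod.norm_def]
      exact max_le (norm_nonneg _) (max_le h3 (h2.trans h4)))

theorem crv_apply (p : Q × C(I, E)) (t : I) : crv Q E p t = (0, p.1, p.2 t) := rfl

/-- The base curve. -/
noncomputable def bcrv (Q E : Type) [NormedAddCommGroup E] [NormedAddCommGroup Q] :
    C(I, ℝ × Q × E) := ⟨fun t => ((t : ℝ), 0, 0), by fun_prop⟩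

/-- Constant curves. -/
noncomputable def ccrv (E : Type) [NormedAddCommGroup E] [NormedSpace ℝ E] : E →L[ℝ] C(I, E) :=
  LinearMap.mkContinuous
    { toFun := fun x => ContinuousMap.const I x
      map_add' := by intro u w; ext t; simp
      map_smul' := by intro c u; ext t; simp } 1 (by
      intro p
      rw [ContinuousMap.norm_le _ (by positivity)]
      intro t
      simp)

theorem ccrv_apply (x : E) (t : I) : ccrv E x t = x := rfl

theorem Jop_volterra (K : ℝ) (u w : C(I, E)) (d : C(I, E))
    (h : ∀ t : I, ‖u t - w t‖ ≤ K * ‖d t‖) (t : I) :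
    ‖Jop E u t - Jop E w t‖ ≤ K * ∫ s in (0:ℝ)..t, ‖ex d s‖ := by
  rw [← ContinuousMap.sub_apply, ← map_sub, Jop_apply, ← intervalIntegral.integral_const_mul]
  have h0 := t.2.1
  refine intervalIntegral.norm_integral_le_of_norm_le h0 ?_ ?_
  · refine Eventually.of_forall fun s _ => ?_
    exact h _
  · exact (continuous_const.mul (ex_continuous d).norm).intervalIntegrable _ _

theorem flow_thm (g : ℝ × Q × E → E) (hg : ContDiff ℝ ∞ g) (hc : HasCompactSupport g) :
    ∃ U : Q × E → C(I, E), ContDiff ℝ ∞ U ∧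
      (∀ p, U p = ccrv E p.2 + Jop E (nem g hg.continuous (crv Q E (p.1, U p) + bcrv Q E))) ∧
      (∀ p u, u = ccrv E p.2 + Jop E (nem g hg.continuous (crv Q E (p.1, u) + bcrv Q E)) →
        u = U p) := by
  obtain ⟨K, hK⟩ := hg.lipschitzWith_of_hasCompactSupport hc (by simp)
  have hlip : ∀ (π : Q) (u w : C(I, E)) (t : I),
      ‖nem g hg.continuous (crv Q E (π, u) + bcrv Q E) t -
        nem g hg.continuous (crv Q E (π, w) + bcrv Q E) t‖ ≤ K * ‖(u - w) t‖ := by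
    intro π u w t
    have := hK.dist_le_mul ((crv Q E (π, u) + bcrv Q E) t) ((crv Q E (π, w) + bcrv Q E) t)
    rw [dist_eq_norm, dist_eq_norm, ← ContinuousMap.sub_apply (crv Q E (π, u) + bcrv Q E),
      add_sub_add_right_eq_sub, ← map_sub, crv_apply] at this
    refine this.trans (le_of_eq ?_)
    simp [Prod.norm_def]
  have hfix : ∀ p : Q × E, ∃ u, (ccrv E p.2 +
      Jop E (nem g hg.continuous (crv Q E (p.1, u) + bcrv Q E))) = u ∧
      ∀ w, (ccrv E p.2 + Jop E (nem g hg.continuous (crv Q E (p.1, w) + bcrv Q E))) = w → w = u := by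
    intro p
    refine volterra (fun u => ccrv E p.2 +
      Jop E (nem g hg.continuous (crv Q E (p.1, u) + bcrv Q E))) K K.2 ?_
    intro u w t
    have := Jop_volterra K _ _ (u - w) (hlip p.1 u w) t
    simpa using this
  choose U hU1 hU2 using hfix
  refine ⟨U, ?_, fun p => (hU1 p).symm, fun p u hu => hU2 p u hu.symm⟩
  set N : Q × C(I, E) → C(I, E) := fun r => nem g hg.continuous (crv Q E r + bcrv Q E) with hN
  have hNs : ContDiff ℝ ∞ N := (nem_contDiff g hg hc).comp
    ((crv Q E).contDiff.add contDiff_const)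
  set Θ : (Q × E) × C(I, E) → (Q × E) × C(I, E) :=
    fun r => (r.1, r.2 - ccrv E r.1.2 - Jop E (N (r.1.1, r.2))) with hΘ
  have hNs2 : ContDiff ℝ ∞ (fun r : (Q × E) × C(I, E) => N (r.1.1, r.2)) :=
    hNs.comp (contDiff_fst.fst.prodMk contDiff_snd)
  have hJ : ContDiff ℝ ∞ (fun r : (Q × E) × C(I, E) => Jop E (N (r.1.1, r.2))) :=
    (Jop E).contDiff.comp hNs2
  have hcc : ContDiff ℝ ∞ (fun r : (Q × E) × C(I, E) => ccrv E r.1.2) :=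
    (ccrv E).contDiff.comp contDiff_fst.snd
  have hΘs : ContDiff ℝ ∞ Θ := contDiff_fst.prodMk ((contDiff_snd.sub hcc).sub hJ)
  rw [contDiff_iff_contDiffAt]
  intro p0
  set a : (Q × E) × C(I, E) := (p0, U p0) with ha
  -- derivative
  have hN' : ∀ r, HasFDerivAt N ((pw (ℝ × Q × E) E (nem (fderiv ℝ g)
      (hg.continuous_fderiv (by simp)) (crv Q E r + bcrv Q E))).comp (crv Q E)) r := by
    intro r
    have h1 := nem_hasFDerivAt g hg hc (crv Q E r + bcrv Q E)
    have h2 : HasFDerivAt (fun r => crv Q E r + bcrv Q E) (crv Q E) r :=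
      (crv Q E).hasFDerivAt.add_const _
    exact h1.comp r h2
  set M := (pw (ℝ × Q × E) E (nem (fderiv ℝ g)
      (hg.continuous_fderiv (by simp)) (crv Q E (p0.1, U p0) + bcrv Q E))).comp (crv Q E) with hM
  have hMb : ∀ (d : C(I, E)) (t : I), ‖M (0, d) t‖ ≤ K * ‖d t‖ := by
    intro d t
    rw [hM]
    simp only [ContinuousLinearMap.comp_apply, pw_apply, nem_apply, crv_apply]
    refine (ContinuousLinearMap.le_opNorm _ _).trans ?_
    have := norm_fderiv_le_of_lipschitz ℝ (x₀ := (crv Q E (p0.1, U p0) + bcrv Q E) t) hK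
    simp only [Prod.norm_def, norm_zero]
    have e : max 0 (max 0 ‖d t‖) = ‖d t‖ := by simp
    rw [e]
    gcongr
  set D : ((Q × E) × C(I, E)) →L[ℝ] ((Q × E) × C(I, E)) :=
    (ContinuousLinearMap.fst ℝ (Q × E) C(I, E)).prod
      ((ContinuousLinearMap.snd ℝ (Q × E) C(I, E) -
        (ccrv E).comp ((ContinuousLinearMap.snd ℝ Q E).comp
          (ContinuousLinearMap.fst ℝ (Q × E) C(I, E)))) -
        (Jop E).comp (M.comp (((ContinuousLinearMap.fst ℝ Q E).comp
          (ContinuousLinearMap.fst ℝ (Q × E) C(I, E))).prod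
            (ContinuousLinearMap.snd ℝ (Q × E) C(I, E))))) with hD
  have hDa : HasFDerivAt Θ D a := by
    refine HasFDerivAt.prodMk hasFDerivAt_fst ((hasFDerivAt_snd.sub ?_).sub ?_)
    · exact (ccrv E).hasFDerivAt.comp a hasFDerivAt_fst.snd
    · refine (Jop E).hasFDerivAt.comp a ?_
      have h2 : HasFDerivAt (fun r : (Q × E) × C(I, E) => (r.1.1, r.2))
          (((ContinuousLinearMap.fst ℝ Q E).comp
          (ContinuousLinearMap.fst ℝ (Q × E) C(I, E))).prod
            (ContinuousLinearMap.snd ℝ (Q × E) C(I, E))) a :=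
        HasFDerivAt.prodMk hasFDerivAt_fst.fst hasFDerivAt_snd
      exact (hN' (a.1.1, a.2)).comp a h2
  have hDapp : ∀ b : Q × E, ∀ d : C(I, E), D (b, d) = (b, d - ccrv E b.2 - Jop E (M (b.1, d))) := by
    intro b d; rfl
  have hsolve : ∀ (b : Q × E) (c : C(I, E)), ∃ d, D (b, d) = (b, c) ∧
      ∀ d', D (b, d') = (b, c) → d' = d := by
    intro b c
    obtain ⟨d, hd1, hd2⟩ := volterra (fun d => c + ccrv E b.2 + Jop E (M (b.1, d))) K K.2 (by
      intro u w t
      have := Jop_volterra K (M (b.1, u)) (M (b.1, w)) (u - w) (by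
        intro t
        rw [← ContinuousMap.sub_apply, ← map_sub]
        simpa using hMb (u - w) t) t
      simpa using this)
    refine ⟨d, ?_, fun d' hd' => hd2 d' ?_⟩
    · rw [hDapp]; congr 1
      nth_rewrite 1 [← hd1]; abel
    · rw [hDapp] at hd'
      have := (Prod.ext_iff.1 hd').2
      simp only at this ⊢
      rw [← this]; abel
  have hinj : D.toLinearMap.ker = ⊥ := by
    rw [LinearMap.ker_eq_bot']
    rintro ⟨b, d⟩ hbd
    have hbd' : D (b, d) = 0 := hbd
    have hb : b = 0 := by
      have := hDapp b d; rw [hbd'] at this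
      exact (Prod.ext_iff.1 this).1.symm
    subst hb
    obtain ⟨d0, -, h2⟩ := hsolve 0 0
    have e1 := h2 d hbd'
    have e2 := h2 0 (map_zero D)
    rw [e1, ← e2]; rfl
  have hsurj : D.toLinearMap.range = ⊤ := by
    rw [LinearMap.range_eq_top]
    rintro ⟨b, c⟩
    obtain ⟨d, h1, -⟩ := hsolve b c
    exact ⟨(b, d), h1⟩
  set D' := ContinuousLinearEquiv.ofBijective D hinj hsurj
  have hDa' : HasFDerivAt Θ (D' : _ →L[ℝ] _) a := by
    rw [ContinuousLinearEquiv.coe_ofBijective]; exact hDa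
  have hinv := ContDiffAt.to_localInverse (hΘs.contDiffAt (x := a)) hDa' (by simp)
  have hstrict := (hΘs.contDiffAt (x := a)).hasStrictFDerivAt' hDa' (by simp)
  have hright := hstrict.eventually_right_inverse
  have hΘa : Θ a = (p0, 0) := by
    simp only [hΘ, ha]
    congr 1
    nth_rewrite 1 [← hU1 p0]; simp [hN]
  rw [hΘa] at hinv hright
  have hcont : ContinuousAt (fun p : Q × E => (p, (0 : C(I, E)))) p0 := by fun_prop
  have hloc : ∀ᶠ p in 𝓝 p0, U p = ((hΘs.contDiffAt (x := a)).localInverse hDa' (by simp)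
      (p, 0)).2 := by
    filter_upwards [hcont.eventually hright] with p hp
    set r := hstrict.localInverse Θ _ a (p, 0) with hr
    have h1 : r.1 = p := (Prod.ext_iff.1 hp).1
    have h2 : r.2 - ccrv E r.1.2 - Jop E (N (r.1.1, r.2)) = 0 := (Prod.ext_iff.1 hp).2
    rw [h1] at h2
    have h3 : r.2 = U p := hU2 p r.2 (by
      rw [sub_sub, sub_eq_zero] at h2
      exact h2.symm)
    exact h3.symm
  refine ContDiffAt.congr_of_eventuallyEq ?_ hloc
  have h4 : ContDiffAt ℝ ∞ (fun p : Q × E => (p, (0 : C(I, E)))) p0 := by fun_prop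
  exact (ContDiffAt.comp p0 (f := fun p : Q × E => (p, (0 : C(I, E)))) hinv h4).snd

theorem flow_ode (g : ℝ × Q × E → E) (hg : ContDiff ℝ ∞ g) (hc : HasCompactSupport g) :
    ∃ (fl : Q × E → ℝ → E) (dl : Q × E → Q × E → ℝ → E),
      (∀ t ∈ Icc (0:ℝ) 1, ContDiff ℝ ∞ fun p => fl p t) ∧ (∀ p, fl p 0 = p.2) ∧
      (∀ p, ∀ t ∈ Icc (0:ℝ) 1, HasDerivAt (fl p) (g (t, p.1, fl p t)) t) ∧
      (∀ p δ, ∀ t ∈ Icc (0:ℝ) 1, fderiv ℝ (fun p => fl p t) p δ = dl p δ t) ∧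
      (∀ p δ, dl p δ 0 = δ.2) ∧
      (∀ p δ, ∀ t ∈ Icc (0:ℝ) 1,
        HasDerivAt (dl p δ) (fderiv ℝ g (t, p.1, fl p t) (0, δ.1, dl p δ t)) t) ∧
      (Continuous fun r : (Q × E) × I => fl r.1 r.2) ∧
      (∀ p (c : ℝ → E), (∀ t ∈ Icc (0:ℝ) 1, HasDerivAt c (g (t, p.1, c t)) t) → c 0 = p.2 →
        ∀ t ∈ Icc (0:ℝ) 1, c t = fl p t) := by
  obtain ⟨U, hU, hU1, -⟩ := flow_thm g hg hc
  have hgd : Continuous (fderiv ℝ g) := hg.continuous_fderiv (by simp)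
  set h1 : Q × E → C(I, E) := fun p => nem g hg.continuous (crv Q E (p.1, U p) + bcrv Q E) with hh1
  set h2 : Q × E → Q × E → C(I, E) := fun p δ =>
    pw (ℝ × Q × E) E (nem (fderiv ℝ g) hgd (crv Q E (p.1, U p) + bcrv Q E))
      (crv Q E (δ.1, fderiv ℝ U p δ)) with hh2
  have hflI : ∀ p, ∀ t : I, (p.2 + ∫ s in (0:ℝ)..t, ex (h1 p) s) = U p t := by
    intro p t
    conv_rhs => rw [hU1 p]
    rfl
  have hdlI : ∀ p δ, ∀ t : I, (δ.2 + ∫ s in (0:ℝ)..t, ex (h2 p δ) s) = fderiv ℝ U p δ t := by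
    intro p δ t
    have hUd : HasFDerivAt U (fderiv ℝ U p) p := (hU.differentiable (by simp) p).hasFDerivAt
    have hcr : HasFDerivAt (fun p : Q × E => crv Q E (p.1, U p) + bcrv Q E)
        ((crv Q E).comp ((ContinuousLinearMap.fst ℝ Q E).prod (fderiv ℝ U p))) p :=
      ((crv Q E).hasFDerivAt.comp p (HasFDerivAt.prodMk hasFDerivAt_fst hUd)).add_const _
    have hR := ((ccrv E).hasFDerivAt.comp p (hasFDerivAt_snd (p := p))).add
      ((Jop E).hasFDerivAt.comp p ((nem_hasFDerivAt g hg hc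
        (crv Q E (p.1, U p) + bcrv Q E)).comp p hcr))
    have hR' : HasFDerivAt U _ p := hR.congr_of_eventuallyEq (Eventually.of_forall hU1)
    rw [hUd.unique hR']
    rfl
  have hflI' : ∀ p, ∀ t (ht : t ∈ Icc (0:ℝ) 1), (p.2 + ∫ s in (0:ℝ)..t, ex (h1 p) s) = U p ⟨t, ht⟩ :=
    fun p t ht => hflI p ⟨t, ht⟩
  have hdlI' : ∀ p δ, ∀ t (ht : t ∈ Icc (0:ℝ) 1), (δ.2 + ∫ s in (0:ℝ)..t, ex (h2 p δ) s) =
      fderiv ℝ U p δ ⟨t, ht⟩ := fun p δ t ht => hdlI p δ ⟨t, ht⟩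
  have hev : ∀ t (ht : t ∈ Icc (0:ℝ) 1), (fun p : Q × E => p.2 + ∫ s in (0:ℝ)..t, ex (h1 p) s) =
      fun p => ContinuousMap.evalCLM ℝ (⟨t, ht⟩ : I) (U p) := by
    intro t ht
    funext p
    rw [hflI' p t ht]; rfl
  have hex : ∀ (h : C(I, E)) t (ht : t ∈ Icc (0:ℝ) 1), ex h t = h ⟨t, ht⟩ :=
    fun h t ht => ex_coe h ⟨t, ht⟩
  have hderiv : ∀ (x : E) (h : C(I, E)) (t : ℝ),
      HasDerivAt (fun t : ℝ => x + ∫ s in (0:ℝ)..t, ex h s) (ex h t) t := by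
    intro x h t
    have := intervalIntegral.integral_hasDerivAt_right
      ((ex_continuous h).intervalIntegrable 0 t)
      ((ex_continuous h).stronglyMeasurableAtFilter _ _) (ex_continuous h).continuousAt
    exact this.const_add x
  have hfl : ∀ p : Q × E, ∀ t ∈ Icc (0:ℝ) 1,
      HasDerivAt (fun t : ℝ => p.2 + ∫ s in (0:ℝ)..t, ex (h1 p) s)
        (g (t, p.1, p.2 + ∫ s in (0:ℝ)..t, ex (h1 p) s)) t := by
    intro p t ht
    have := hderiv p.2 (h1 p) t
    rw [hex _ t ht] at this
    rw [hflI' p t ht]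
    convert this using 1
    simp [hh1, nem_apply, crv_apply, bcrv]
  refine ⟨fun p t => p.2 + ∫ s in (0:ℝ)..t, ex (h1 p) s,
    fun p δ t => δ.2 + ∫ s in (0:ℝ)..t, ex (h2 p δ) s, ?_, by simp, hfl, ?_, by simp, ?_, ?_, ?_⟩
  · intro t ht
    rw [hev t ht]
    exact (ContinuousMap.evalCLM ℝ (⟨t, ht⟩ : I)).contDiff.comp hU
  · intro p δ t ht
    beta_reduce
    rw [hev t ht, hdlI' p δ t ht]
    have hUd : HasFDerivAt U (fderiv ℝ U p) p := (hU.differentiable (by simp) p).hasFDerivAt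
    have := (ContinuousMap.evalCLM ℝ (⟨t, ht⟩ : I)).hasFDerivAt.comp p hUd
    rw [show (fun p => (ContinuousMap.evalCLM ℝ (⟨t, ht⟩ : I)) (U p)) =
      (⇑(ContinuousMap.evalCLM ℝ (⟨t, ht⟩ : I)) ∘ U) from rfl, this.fderiv]
    rfl
  · intro p δ t ht
    have := hderiv δ.2 (h2 p δ) t
    rw [hex _ t ht] at this
    beta_reduce
    rw [hflI' p t ht, hdlI' p δ t ht]
    convert this using 1
    simp [hh2, pw_apply, nem_apply, crv_apply, bcrv]
  · have : (fun r : (Q × E) × I => r.1.2 + ∫ s in (0:ℝ)..r.2, ex (h1 r.1) s) =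
        fun r => U r.1 r.2 := by funext r; exact hflI r.1 r.2
    rw [this]
    have hUc := hU.continuous
    fun_prop
  · intro p c hc1 hc0 t ht
    obtain ⟨K, hK⟩ := hg.lipschitzWith_of_hasCompactSupport hc (by simp)
    have hv : ∀ t : ℝ, LipschitzWith K (fun x => g (t, p.1, x)) := by
      intro t
      refine LipschitzWith.of_dist_le_mul fun x y => ?_
      have := hK.dist_le_mul (t, p.1, x) (t, p.1, y)
      simpa [Prod.dist_eq] using this
    have := ODE_solution_unique (v := fun t x => g (t, p.1, x)) (K := K) (a := 0) (b := 1)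
      (f := c) (g := fun t : ℝ => p.2 + ∫ s in (0:ℝ)..t, ex (h1 p) s) hv
      (fun t ht => (hc1 t ht).continuousAt.continuousWithinAt)
      (fun t ht => (hc1 t (Ico_subset_Icc_self ht)).hasDerivWithinAt)
      (fun t ht => (hfl p t ht).continuousAt.continuousWithinAt)
      (fun t ht => (hfl p t (Ico_subset_Icc_self ht)).hasDerivWithinAt) (by simp [hc0])
    exact this ht

end FlowThm
end PartFlow2

section Haar1
open MeasureTheory Set Filter Topology

variable {E : Type} [NormedAddCommGroup E] [InnerProductSpace ℝ E] [FiniteDimensional ℝ E]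

/-- small neighbourhood of the identity in the orthogonal group -/
def onb (E : Type) [NormedAddCommGroup E] [InnerProductSpace ℝ E] [FiniteDimensional ℝ E] :
    Set (E →L[ℝ] E) := {κ | κ ∈ unitary (E →L[ℝ] E) ∧ ‖κ - 1‖ ≤ 1/2}

noncomputable def cayA (κ : E →L[ℝ] E) : E →L[ℝ] E := (1 - κ) * Ring.inverse (1 + κ)

theorem onb_unit {κ : E →L[ℝ] E} (h : κ ∈ onb E) : IsUnit (1 + κ) := by
  have h1 : ‖(2:ℝ)⁻¹ • (1 - κ)‖ < 1 := by
    rw [norm_smul, ← norm_neg, ← norm_neg]; simp only [norm_neg]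
    rw [norm_sub_rev]; have := h.2; norm_num; linarith
  have h2 := isUnit_one_sub_of_norm_lt_one h1
  have h3 : (1 : E →L[ℝ] E) + κ = (algebraMap ℝ (E →L[ℝ] E) 2) * (1 - (2:ℝ)⁻¹ • (1 - κ)) := by
    rw [← Algebra.smul_def]
    simp only [smul_sub, smul_smul]
    norm_num
    module
  rw [h3]
  exact (IsUnit.map (algebraMap ℝ (E →L[ℝ] E)) (by norm_num)).mul h2

theorem cayA_norm {κ : E →L[ℝ] E} (h : κ ∈ onb E) : ‖cayA κ‖ ≤ 1/2 := by
  set W := Ring.inverse (1 + κ) with hW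
  have h1 : (1 + κ) * W = 1 := Ring.mul_inverse_cancel _ (onb_unit h)
  have h2 : (2:ℝ) • W = 1 + (1 - κ) * W := by
    have e : (2:ℝ) • W = (1 + κ) * W + (1 - κ) * W := by
      simp only [add_mul, sub_mul, one_mul]; module
    rw [e, h1]
  have h3 : ‖(1:E →L[ℝ] E) - κ‖ ≤ 1/2 := by rw [norm_sub_rev]; exact h.2
  have h4 : 2 * ‖W‖ ≤ 1 + 1/2 * ‖W‖ := by
    calc 2 * ‖W‖ = ‖(2:ℝ) • W‖ := by rw [norm_smul]; simp
      _ ≤ ‖(1 : E →L[ℝ] E)‖ + ‖(1-κ) * W‖ := by rw [h2]; exact norm_add_le _ _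
      _ ≤ 1 + 1/2 * ‖W‖ := by
        gcongr
        · exact ContinuousLinearMap.norm_id_le
        · exact (norm_mul_le _ _).trans (by gcongr)
  calc ‖cayA κ‖ ≤ ‖1-κ‖ * ‖W‖ := norm_mul_le _ _
    _ ≤ 1/2 * 1 := by gcongr; linarith
    _ = 1/2 := by norm_num

theorem commute_inv {x y : E →L[ℝ] E} (h : Commute x y) : Commute x (Ring.inverse y) := by
  by_cases hy : IsUnit y
  · obtain ⟨u, rfl⟩ := hy
    rw [Ring.inverse_unit]
    exact h.units_inv_right
  · rw [Ring.inverse_non_unit _ hy]; exact Commute.zero_right x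

theorem cayA_star {κ : E →L[ℝ] E} (h : κ ∈ onb E) : star (cayA κ) = - cayA κ := by
  have hu := onb_unit h
  have hus : IsUnit (1 + star κ) := by have := hu.star; simpa using this
  have hk1 : star κ * κ = 1 := Unitary.star_mul_self_of_mem h.1
  have hk2 : κ * star κ = 1 := Unitary.mul_star_self_of_mem h.1
  have e : star (cayA κ) = Ring.inverse (1 + star κ) * (1 - star κ) := by
    rw [cayA, star_mul, ← Ring.inverse_star]; simp
  have hc : Commute (1 - κ) (1 + κ) := by
    simp only [commute_iff_eq]; noncomm_ring
  rw [e, cayA]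
  -- multiply by units
  have h1 : (1 + star κ) * (Ring.inverse (1 + star κ) * (1 - star κ)) * (1+κ) =
      (1 + star κ) * (-((1 - κ) * Ring.inverse (1 + κ))) * (1 + κ) := by
    rw [← mul_assoc, Ring.mul_inverse_cancel _ hus, mul_neg, neg_mul, mul_assoc (1 + star κ),
      mul_assoc (1 - κ), Ring.inverse_mul_cancel _ hu]
    simp only [sub_mul, add_mul, mul_add, mul_sub, one_mul, mul_one, hk1]
    abel
  exact hus.mul_left_cancel (hu.mul_right_cancel h1)

theorem skew_unit {A : E →L[ℝ] E} (hA : ‖A‖ ≤ 1/2) {s : ℝ} (hs : s ∈ Icc (-1:ℝ) 1) :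
    IsUnit (1 + s • A) := by
  have : ‖(-s) • A‖ < 1 := by
    rw [norm_smul, norm_neg]
    have h1 : |s| ≤ 1 := abs_le.2 hs
    have := norm_nonneg A
    rw [Real.norm_eq_abs]
    nlinarith
  have := isUnit_one_sub_of_norm_lt_one this
  simpa using this

noncomputable def cayk (p : (E →L[ℝ] E) × ℝ) : E →L[ℝ] E :=
  (1 - p.2 • cayA p.1) * Ring.inverse (1 + p.2 • cayA p.1)

noncomputable def cayb (p : (E →L[ℝ] E) × ℝ) : E →L[ℝ] E :=
  (-2:ℝ) • (cayA p.1 * (Ring.inverse (1 + p.2 • cayA p.1) * Ring.inverse (1 - p.2 • cayA p.1)))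

theorem inv_contOn {X : Type} [TopologicalSpace X] {f : X → E →L[ℝ] E} {S : Set X}
    (hf : ContinuousOn f S) (hu : ∀ x ∈ S, IsUnit (f x)) :
    ContinuousOn (fun x => Ring.inverse (f x)) S := by
  intro x hx
  obtain ⟨u, hu⟩ := hu x hx
  have := NormedRing.inverse_continuousAt u
  rw [hu] at this
  exact this.comp_continuousWithinAt (hf x hx)

theorem cayA_cont : ContinuousOn (cayA (E := E)) (onb E) := by
  unfold cayA
  refine ContinuousOn.mul (by fun_prop) (inv_contOn (by fun_prop) fun x hx => onb_unit hx)

theorem cay_mem {p : (E →L[ℝ] E) × ℝ} (hp : p ∈ onb E ×ˢ Icc (0:ℝ) 1) :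
    IsUnit (1 + p.2 • cayA p.1) ∧ IsUnit (1 - p.2 • cayA p.1) := by
  obtain ⟨h1, h2, h3⟩ := hp
  refine ⟨skew_unit (cayA_norm h1) ⟨by linarith, h3⟩, ?_⟩
  have := skew_unit (s := -p.2) (cayA_norm h1) ⟨by linarith, by linarith⟩
  rw [neg_smul, ← sub_eq_add_neg] at this
  exact this

theorem cayk_cont : ContinuousOn (cayk (E := E)) (onb E ×ˢ Icc (0:ℝ) 1) := by
  have hA : ContinuousOn (fun p : (E →L[ℝ] E) × ℝ => cayA p.1) (onb E ×ˢ Icc (0:ℝ) 1) :=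
    cayA_cont.comp continuousOn_fst (fun p hp => hp.1)
  unfold cayk
  refine ContinuousOn.mul (by fun_prop) (inv_contOn (by fun_prop) fun x hx => (cay_mem hx).1)

theorem cayb_cont : ContinuousOn (cayb (E := E)) (onb E ×ˢ Icc (0:ℝ) 1) := by
  have hA : ContinuousOn (fun p : (E →L[ℝ] E) × ℝ => cayA p.1) (onb E ×ˢ Icc (0:ℝ) 1) :=
    cayA_cont.comp continuousOn_fst (fun p hp => hp.1)
  unfold cayb
  refine ContinuousOn.const_smul (c := (-2:ℝ)) (hA.mul ((inv_contOn (by fun_prop) fun x hx => (cay_mem hx).1).mul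
    (inv_contOn (by fun_prop) fun x hx => (cay_mem hx).2)))

theorem cayk_zero (κ : E →L[ℝ] E) : cayk (κ, 0) = 1 := by simp [cayk]

theorem cayk_one {κ : E →L[ℝ] E} (h : κ ∈ onb E) : cayk (κ, 1) = κ := by
  have hu := onb_unit h
  have h1 : (1 + cayA κ) * (1 + κ) = (2:ℝ) • 1 := by
    rw [cayA, add_mul, mul_assoc, Ring.inverse_mul_cancel _ hu]; simp; module
  have h2 : (1 - cayA κ) * (1 + κ) = (2:ℝ) • κ := by
    rw [cayA, sub_mul, mul_assoc, Ring.inverse_mul_cancel _ hu]; simp; module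
  have hv : IsUnit (1 + cayA κ) := by
    have := (cay_mem (p := (κ, 1)) ⟨h, by simp⟩).1; simpa using this
  have hc : (1 - cayA κ) * Ring.inverse (1 + cayA κ) = Ring.inverse (1 + cayA κ) * (1 - cayA κ) :=
    (commute_inv (by simp only [commute_iff_eq]; noncomm_ring))
  have h3 : (1 + cayA κ) * (cayk (κ,1)) * (1 + κ) = (1 + cayA κ) * κ * (1 + κ) := by
    simp only [cayk, one_smul]
    rw [hc, ← mul_assoc, Ring.mul_inverse_cancel _ hv, one_mul, h2, mul_assoc]
    have : κ * (1 + κ) = (1 + κ) * κ := by noncomm_ring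
    rw [this, ← mul_assoc, h1]; simp
  exact hv.mul_left_cancel (hu.mul_right_cancel h3)

theorem cayk_unitary {p : (E →L[ℝ] E) × ℝ} (hp : p ∈ onb E ×ˢ Icc (0:ℝ) 1) :
    cayk p ∈ unitary (E →L[ℝ] E) := by
  obtain ⟨hu, hv⟩ := cay_mem hp
  have hs := cayA_star hp.1
  set A := p.2 • cayA p.1 with hA
  have hsA : star A = - A := by rw [hA, star_smul, hs]; simp
  have hst : star (cayk p) = Ring.inverse (1 - A) * (1 + A) := by
    rw [cayk, star_mul, ← Ring.inverse_star, ← hA]; simp [hsA, sub_eq_add_neg]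
  have hc : Commute (1 - A) (1 + A) := by simp only [commute_iff_eq]; noncomm_ring
  have hk : cayk p = (1 - A) * Ring.inverse (1 + A) := rfl
  have hk2 : cayk p = Ring.inverse (1 + A) * (1 - A) := commute_inv hc
  have hst2 : star (cayk p) = (1 + A) * Ring.inverse (1 - A) := by
    rw [hst]; exact (commute_inv hc.symm).symm
  rw [Unitary.mem_iff]
  constructor
  · rw [hst, hk2, mul_assoc, ← mul_assoc (1 + A), Ring.mul_inverse_cancel _ hu, one_mul,
      Ring.inverse_mul_cancel _ hv]
  · rw [hst2, hk, mul_assoc, ← mul_assoc (Ring.inverse (1 + A)), Ring.inverse_mul_cancel _ hu,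
      one_mul, Ring.mul_inverse_cancel _ hv]

theorem cayb_skew {p : (E →L[ℝ] E) × ℝ} (hp : p ∈ onb E ×ˢ Icc (0:ℝ) 1) :
    star (cayb p) = - cayb p := by
  obtain ⟨hu, hv⟩ := cay_mem hp
  have hs := cayA_star hp.1
  have hsA : star (p.2 • cayA p.1) = - (p.2 • cayA p.1) := by rw [star_smul, hs]; simp
  rw [cayb, star_smul, star_mul, star_mul, ← Ring.inverse_star, ← Ring.inverse_star, hs]
  have e1 : star (1 - p.2 • cayA p.1) = 1 + p.2 • cayA p.1 := by
    rw [star_sub, hsA]; simp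
  have e2 : star (1 + p.2 • cayA p.1) = 1 - p.2 • cayA p.1 := by
    rw [star_add, hsA]; simp [sub_eq_add_neg]
  rw [e1, e2]
  have c1 : Commute (cayA p.1) (Ring.inverse (1 + p.2 • cayA p.1)) :=
    commute_inv ((Commute.one_right _).add_right ((Commute.refl _).smul_right _))
  have c2 : Commute (cayA p.1) (Ring.inverse (1 - p.2 • cayA p.1)) :=
    commute_inv ((Commute.one_right _).sub_right ((Commute.refl _).smul_right _))
  have := (c1.mul_right c2).eq
  rw [this]
  simp

theorem cayk_deriv {κ : E →L[ℝ] E} (hκ : κ ∈ onb E) {s : ℝ} (hs : s ∈ Icc (0:ℝ) 1) :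
    HasDerivAt (fun s => cayk (κ, s)) (cayb (κ, s) * cayk (κ, s)) s := by
  obtain ⟨hu, hv⟩ := cay_mem (p := (κ, s)) ⟨hκ, hs⟩
  simp only at hu hv
  set A := cayA κ with hA
  have hl : HasDerivAt (fun s : ℝ => 1 + s • A) A s := by
    have := ((hasDerivAt_id s).smul_const A).const_add 1; simpa using this
  have hl2 : HasDerivAt (fun s : ℝ => 1 - s • A) (-A) s := by
    have := ((hasDerivAt_id s).smul_const A).const_sub 1; simpa using this
  obtain ⟨u, hu'⟩ := hu
  have hi := hasFDerivAt_ringInverse (𝕜 := ℝ) u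
  rw [hu'] at hi
  have hinv : (↑u⁻¹ : E →L[ℝ] E) = Ring.inverse (1 + s • A) := by
    rw [← hu', Ring.inverse_unit]
  have h1 := hi.comp_hasDerivAt s hl
  have h2 := hl2.mul h1
  refine h2.congr_deriv ?_
  simp only [hinv, cayb, cayk, ← hA, _root_.neg_apply,
    ContinuousLinearMap.mulLeftRight_apply, Function.comp]
  set R := Ring.inverse (1 + s • A) with hR
  set T := Ring.inverse (1 - s • A) with hT
  have hu : IsUnit (1 + s • A) := ⟨u, hu'⟩
  have r1 : (1 + s • A) * R = 1 := Ring.mul_inverse_cancel _ hu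
  have r2 : R * (1 + s • A) = 1 := Ring.inverse_mul_cancel _ hu
  have t1 : T * (1 - s • A) = 1 := Ring.inverse_mul_cancel _ hv
  have c1 : A * R = R * A :=
    commute_inv ((Commute.one_right _).add_right ((Commute.refl _).smul_right _))
  have c3 : (1 - s • A) * R = R * (1 - s • A) := by
    simp only [sub_mul, mul_sub, one_mul, mul_one, smul_mul_assoc, mul_smul_comm, c1]
  have e1 : (-2:ℝ) • (A * (R * T)) * ((1 - s • A) * R) = (-2:ℝ) • (A * (R * R)) := by
    rw [smul_mul_assoc, mul_assoc A, mul_assoc R, ← mul_assoc T, t1, one_mul]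
  rw [e1]
  have e2 : (1 - s • A) * -(R * A * R) = - (A * (R * ((1 - s • A) * R))) := by
    rw [mul_neg, ← c1, mul_assoc, ← mul_assoc, show (1 - s • A) * A = A * (1 - s • A) by
      simp [sub_mul, mul_sub], mul_assoc A, ← mul_assoc (1 - s • A), c3, mul_assoc R, c3]
  rw [e2]
  have e3 : -A * R = -(A * (R * ((1 + s • A) * R))) := by rw [r1]; simp
  rw [e3, ← neg_add, ← mul_add, ← mul_add, ← add_mul]
  have : (1 + s • A + (1 - s • A)) = (2:ℝ) • (1 : E →L[ℝ] E) := by module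
  rw [this]; simp

end Haar1

section Haar2
open MeasureTheory Set Filter Topology

variable {E : Type} [NormedAddCommGroup E] [InnerProductSpace ℝ E] [FiniteDimensional ℝ E]

instance secL : SecondCountableTopology (E →L[ℝ] E) := by
  haveI : ProperSpace (E →L[ℝ] E) := FiniteDimensional.proper_real _
  infer_instance

theorem integ_of {X F : Type} [TopologicalSpace X] [T2Space X] [MeasurableSpace X] [BorelSpace X]
    [SecondCountableTopology X]
    [NormedAddCommGroup F] {m : Measure X} [IsFiniteMeasure m] {S : Set X} (hS : IsCompact S)
    (hm : m Sᶜ = 0) {f : X → F} (hf : ContinuousOn f S) : Integrable f m := by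
  have h1 : m.restrict S = m := Measure.restrict_eq_self_of_ae_mem (by
    rw [ae_iff]; exact hm)
  have := hf.integrableOn_compact (μ := m) hS
  rwa [IntegrableOn, h1] at this

def S2 (E : Type) [NormedAddCommGroup E] [InnerProductSpace ℝ E] [FiniteDimensional ℝ E] (C : ℝ) :
    Set ((E →L[ℝ] E) × (E →L[ℝ] E)) :=
  {p | p.1 ∈ unitary (E →L[ℝ] E) ∧ star p.2 = - p.2 ∧ ‖p.2‖ ≤ C}

theorem unitary_norm_le {κ : E →L[ℝ] E} (h : κ ∈ unitary (E →L[ℝ] E)) : ‖κ‖ ≤ 1 :=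
  ContinuousLinearMap.opNorm_le_bound _ zero_le_one fun x => by
    rw [ContinuousLinearMap.norm_map_of_mem_unitary h]; simp

theorem unitary_compact : IsCompact (unitary (E →L[ℝ] E) : Set (E →L[ℝ] E)) := by
  haveI : ProperSpace (E →L[ℝ] E) := FiniteDimensional.proper_real _
  refine (isCompact_closedBall (0 : E →L[ℝ] E) 1).of_isClosed_subset isClosed_unitary ?_
  intro κ h
  simpa using unitary_norm_le h

theorem onb_compact : IsCompact (onb E) := by
  have : onb E = (unitary (E →L[ℝ] E) : Set (E →L[ℝ] E)) ∩ {κ | ‖κ - 1‖ ≤ 1/2} := rfl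
  rw [this]
  exact unitary_compact.inter_right (isClosed_le (by fun_prop) (by fun_prop))

theorem S2_compact (C : ℝ) : IsCompact (S2 E C) := by
  haveI : ProperSpace (E →L[ℝ] E) := FiniteDimensional.proper_real _
  refine (unitary_compact.prod (isCompact_closedBall (0 : E →L[ℝ] E) C)).of_isClosed_subset ?_ ?_
  · have e : S2 E C = (Prod.fst ⁻¹' (unitary (E →L[ℝ] E) : Set (E →L[ℝ] E))) ∩
      ({p | star p.2 = - p.2} ∩ {p | ‖p.2‖ ≤ C}) := rfl
    rw [e]
    exact (isClosed_unitary.preimage continuous_fst).inter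
      ((isClosed_eq (by fun_prop) (by fun_prop)).inter (isClosed_le (by fun_prop) (by fun_prop)))
  · rintro p ⟨h1, -, h3⟩
    exact ⟨h1, by simpa using h3⟩

theorem S2_mono {C C' : ℝ} (h : C ≤ C') : S2 E C ⊆ S2 E C' := fun _ hp => ⟨hp.1, hp.2.1, hp.2.2.trans h⟩

/-- representation formula -/
def RepF (m : Measure (E →L[ℝ] E)) (ν : Measure ((E →L[ℝ] E) × (E →L[ℝ] E))) : Prop :=
  ∀ (F : Type) [NormedAddCommGroup F] [NormedSpace ℝ F] [CompleteSpace F] (g : E → F)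
    (g' : E → E →L[ℝ] F) (y : E),
    (∀ y', ‖y'‖ = ‖y‖ → HasFDerivAt g (g' y') y') → ContinuousOn g' {y' | ‖y'‖ = ‖y‖} →
    ∫ κ, (g (κ y) - g y) ∂m = ∫ p, g' (p.1 y) (p.2 (p.1 y)) ∂ν

def Good (m : Measure (E →L[ℝ] E)) : Prop :=
  ∃ ν : Measure ((E →L[ℝ] E) × (E →L[ℝ] E)), IsFiniteMeasure ν ∧ (∃ C, ν (S2 E C)ᶜ = 0) ∧ RepF m ν

theorem rep_contOn {F : Type} [NormedAddCommGroup F] [NormedSpace ℝ F] {g' : E → E →L[ℝ] F} {y : E}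
    (h : ContinuousOn g' {y' | ‖y'‖ = ‖y‖}) (C : ℝ) :
    ContinuousOn (fun p : (E →L[ℝ] E) × (E →L[ℝ] E) => g' (p.1 y) (p.2 (p.1 y))) (S2 E C) := by
  have : ContinuousOn (fun p : (E →L[ℝ] E) × (E →L[ℝ] E) => g' (p.1 y)) (S2 E C) :=
    h.comp (by fun_prop) (fun p hp => ContinuousLinearMap.norm_map_of_mem_unitary hp.1 y)
  exact this.clm_apply (by fun_prop)

theorem orb_contOn {F : Type} [NormedAddCommGroup F] {g : E → F} {y : E}
    (h : ContinuousOn g {y' | ‖y'‖ = ‖y‖}) :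
    ContinuousOn (fun κ : E →L[ℝ] E => g (κ y)) (unitary (E →L[ℝ] E)) :=
  h.comp (by fun_prop) (fun p hp => ContinuousLinearMap.norm_map_of_mem_unitary hp y)

theorem good_small (m : Measure (E →L[ℝ] E)) [IsFiniteMeasure m] (hm : m (onb E)ᶜ = 0) : Good m := by
  set v : Measure ℝ := volume.restrict (Icc 0 1) with hv
  haveI : IsFiniteMeasure v := ⟨by simp [hv]⟩
  have hcomp : IsCompact (onb E ×ˢ Icc (0:ℝ) 1) := onb_compact.prod isCompact_Icc
  have hconc : (m.prod v) (onb E ×ˢ Icc (0:ℝ) 1)ᶜ = 0 := by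
    rw [compl_prod_eq_union]
    refine measure_union_null ?_ ?_
    · rw [Measure.prod_prod, hm, zero_mul]
    · rw [Measure.prod_prod, hv, Measure.restrict_apply measurableSet_Icc.compl]; simp
  have hφc : ContinuousOn (fun p : (E →L[ℝ] E) × ℝ => (cayk p, cayb p)) (onb E ×ˢ Icc (0:ℝ) 1) :=
    cayk_cont.prodMk cayb_cont
  have hφ : AEMeasurable (fun p : (E →L[ℝ] E) × ℝ => (cayk p, cayb p)) (m.prod v) := by
    have h1 : (m.prod v).restrict (onb E ×ˢ Icc (0:ℝ) 1) = m.prod v :=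
      Measure.restrict_eq_self_of_ae_mem (by rw [ae_iff]; exact hconc)
    have := hφc.aemeasurable (μ := m.prod v) hcomp.measurableSet
    rwa [h1] at this
  obtain ⟨C, hC⟩ := hcomp.exists_bound_of_continuousOn (cayb_cont (E := E))
  have hmap : ((m.prod v).map (fun p => (cayk p, cayb p))) (S2 E C)ᶜ = 0 := by
    rw [Measure.map_apply_of_aemeasurable hφ (S2_compact C).measurableSet.compl]
    refine measure_mono_null ?_ hconc
    intro p hp hp'
    exact hp ⟨cayk_unitary hp', cayb_skew hp', hC p hp'⟩
  refine ⟨(m.prod v).map (fun p => (cayk p, cayb p)), inferInstance, ⟨C, hmap⟩, ?_⟩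
  intro F _ _ _ g g' y hg hg'
  rw [integral_map hφ (integ_of (S2_compact C) hmap (rep_contOn hg' C)).aestronglyMeasurable]
  have hci : ContinuousOn (fun p : (E →L[ℝ] E) × ℝ => g' (cayk p y) (cayb p (cayk p y)))
      (onb E ×ˢ Icc (0:ℝ) 1) :=
    (rep_contOn hg' C).comp hφc (fun p hp' => ⟨cayk_unitary hp', cayb_skew hp', hC p hp'⟩)
  rw [integral_prod _ (integ_of hcomp hconc hci)]
  refine integral_congr_ae ?_
  have hae : ∀ᵐ κ ∂m, κ ∈ onb E := by rw [ae_iff]; exact hm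
  filter_upwards [hae] with κ hκ
  have hd : ∀ s ∈ Icc (0:ℝ) 1, HasDerivAt (fun s => g (cayk (κ, s) y))
      (g' (cayk (κ, s) y) (cayb (κ, s) (cayk (κ, s) y))) s := by
    intro s hs
    have h1 := (cayk_deriv hκ hs).clm_apply (hasDerivAt_const s y)
    have h2 := hg (cayk (κ,s) y)
      (ContinuousLinearMap.norm_map_of_mem_unitary (cayk_unitary (p := (κ, s)) ⟨hκ, hs⟩) y)
    have h3 : HasDerivAt (fun s => g (cayk (κ, s) y)) _ s := h2.comp_hasDerivAt s h1
    simpa using h3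
  have := intervalIntegral.integral_eq_sub_of_hasDerivAt (a := 0) (b := 1)
    (f := fun s => g (cayk (κ, s) y)) (fun s hs => hd s (by simpa using hs))
    (by
      refine ContinuousOn.intervalIntegrable ?_
      rw [uIcc_of_le zero_le_one]
      exact hci.comp (f := fun s : ℝ => (κ, s)) (by fun_prop) (fun s hs => ⟨hκ, hs⟩))
  rw [cayk_zero, cayk_one hκ] at this
  rw [hv, integral_Icc_eq_integral_Ioc, ← intervalIntegral.integral_of_le zero_le_one, this]
  rfl

theorem hg_cont {F : Type} [NormedAddCommGroup F] [NormedSpace ℝ F] {g : E → F}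
    {g' : E → E →L[ℝ] F} {r : ℝ} (hg : ∀ y', ‖y'‖ = r → HasFDerivAt g (g' y') y') :
    ContinuousOn g {y' | ‖y'‖ = r} := fun y hy => (hg y hy).continuousAt.continuousWithinAt

theorem good_mul (m : Measure (E →L[ℝ] E)) [IsFiniteMeasure m] (hm : m (unitary (E →L[ℝ] E))ᶜ = 0)
    (κ0 : E →L[ℝ] E) (hκ0 : κ0 ∈ unitary (E →L[ℝ] E)) (h : Good m) (h0 : Good (Measure.dirac κ0)) :
    Good (m.map (· * κ0)) := by
  obtain ⟨ν, hν, ⟨C, hC⟩, hr⟩ := h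
  obtain ⟨ν0, hν0, ⟨C0, hC0⟩, hr0⟩ := h0
  have hψ : Continuous (fun p : (E →L[ℝ] E) × (E →L[ℝ] E) => (p.1 * κ0, p.2)) := by fun_prop
  have hsub1 : ∀ p ∈ S2 E C, (p.1 * κ0, p.2) ∈ S2 E (max C C0) := fun p hp =>
    ⟨mul_mem hp.1 hκ0, hp.2.1, hp.2.2.trans (le_max_left _ _)⟩
  have c1 : (ν.map (fun p => (p.1 * κ0, p.2))) (S2 E (max C C0))ᶜ = 0 := by
    rw [Measure.map_apply hψ.measurable (S2_compact _).measurableSet.compl]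
    exact measure_mono_null (fun p hp hp' => hp (hsub1 p hp')) hC
  have c0 : ν0 (S2 E (max C C0))ᶜ = 0 :=
    measure_mono_null (compl_subset_compl.2 (S2_mono (le_max_right _ _))) hC0
  refine ⟨ν.map (fun p => (p.1 * κ0, p.2)) + m univ • ν0, ?_, ⟨max C C0, ?_⟩, ?_⟩
  · haveI : IsFiniteMeasure (m univ • ν0) := ⟨by
      rw [Measure.smul_apply, smul_eq_mul]
      exact ENNReal.mul_lt_top (measure_lt_top _ _) (measure_lt_top _ _)⟩
    infer_instance
  · rw [Measure.add_apply, c1, Measure.smul_apply, c0]; simp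
  · intro F _ _ _ g g' y hg hg'
    have hny : ‖κ0 y‖ = ‖y‖ := ContinuousLinearMap.norm_map_of_mem_unitary hκ0 y
    have e1 := hr F g g' (κ0 y) (by rwa [hny]) (by rwa [hny])
    have e0 := hr0 F g g' y hg hg'
    rw [integral_dirac] at e0
    have i1 := integ_of (S2_compact _) c1 (rep_contOn hg' (max C C0))
    have i0 := integ_of (S2_compact _) c0 (rep_contOn hg' (max C C0))
    rw [integral_add_measure i1 (i0.smul_measure (measure_ne_top _ _)), integral_smul_measure,
      integral_map hψ.aemeasurable i1.aestronglyMeasurable]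
    have hcg := orb_contOn (hg_cont hg)
    have hm1 : Continuous (fun κ : E →L[ℝ] E => κ * κ0) := by fun_prop
    have cm : (m.map (· * κ0)) (unitary (E →L[ℝ] E))ᶜ = 0 := by
      rw [Measure.map_apply hm1.measurable unitary_compact.measurableSet.compl]
      exact measure_mono_null (fun p hp hp' => hp (mul_mem hp' hκ0)) hm
    have i2 : Integrable (fun κ : E →L[ℝ] E => g (κ y) - g y) (m.map (· * κ0)) :=
      integ_of unitary_compact cm (hcg.sub continuousOn_const)
    rw [integral_map hm1.aemeasurable i2.aestronglyMeasurable, ← e0]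
    have i3 : Integrable (fun κ : E →L[ℝ] E => g (κ (κ0 y)) - g (κ0 y)) m :=
      integ_of unitary_compact hm ((orb_contOn (hg_cont (by rwa [hny]))).sub continuousOn_const)
    have e2 : ∫ κ, (g ((κ * κ0) y) - g y) ∂m = ∫ κ, ((g (κ (κ0 y)) - g (κ0 y)) + (g (κ0 y) - g y)) ∂m := by
      refine integral_congr_ae (Eventually.of_forall fun κ => ?_)
      simp
    rw [e2, integral_add i3 (integrable_const _), e1, integral_const]
    rfl

theorem good_add (m1 m2 : Measure (E →L[ℝ] E)) [IsFiniteMeasure m1] [IsFiniteMeasure m2]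
    (hm1 : m1 (unitary (E →L[ℝ] E))ᶜ = 0) (hm2 : m2 (unitary (E →L[ℝ] E))ᶜ = 0)
    (h1 : Good m1) (h2 : Good m2) : Good (m1 + m2) := by
  obtain ⟨ν, hν, ⟨C, hC⟩, hr⟩ := h1
  obtain ⟨ν0, hν0, ⟨C0, hC0⟩, hr0⟩ := h2
  have c1 : ν (S2 E (max C C0))ᶜ = 0 :=
    measure_mono_null (compl_subset_compl.2 (S2_mono (le_max_left _ _))) hC
  have c0 : ν0 (S2 E (max C C0))ᶜ = 0 :=
    measure_mono_null (compl_subset_compl.2 (S2_mono (le_max_right _ _))) hC0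
  refine ⟨ν + ν0, inferInstance, ⟨max C C0, ?_⟩, ?_⟩
  · rw [Measure.add_apply, c1, c0]; simp
  · intro F _ _ _ g g' y hg hg'
    have hcg := orb_contOn (hg_cont hg)
    have hcg' : ContinuousOn (fun κ : E →L[ℝ] E => g (κ y) - g y) (unitary (E →L[ℝ] E)) :=
      hcg.sub continuousOn_const
    rw [integral_add_measure (integ_of unitary_compact hm1 hcg')
      (integ_of unitary_compact hm2 hcg'),
      integral_add_measure (integ_of (S2_compact _) c1 (rep_contOn hg' (max C C0)))
      (integ_of (S2_compact _) c0 (rep_contOn hg' (max C C0))), hr F g g' y hg hg',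
      hr0 F g g' y hg hg']

theorem good_smul (m : Measure (E →L[ℝ] E)) (c : ENNReal) (hc : c ≠ ⊤) (h : Good m) : Good (c • m) := by
  obtain ⟨ν, hν, ⟨C, hC⟩, hr⟩ := h
  refine ⟨c • ν, ⟨?_⟩, ⟨C, by simp [hC]⟩, ?_⟩
  · rw [Measure.smul_apply, smul_eq_mul]
    exact ENNReal.mul_lt_top hc.lt_top (measure_lt_top _ _)
  · intro F _ _ _ g g' y hg hg'
    rw [integral_smul_measure, integral_smul_measure, hr F g g' y hg hg']

end Haar2

section Haar3
open MeasureTheory Set Filter Topology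

variable {E : Type} [NormedAddCommGroup E] [InnerProductSpace ℝ E] [FiniteDimensional ℝ E]

instance compU : CompactSpace (unitary (E →L[ℝ] E)) := isCompact_iff_compactSpace.1 unitary_compact

/-- preimage of `onb` in the group -/
def onbG (E : Type) [NormedAddCommGroup E] [InnerProductSpace ℝ E] [FiniteDimensional ℝ E] :
    Set (unitary (E →L[ℝ] E)) := {κ | ‖(κ : E →L[ℝ] E) - 1‖ ≤ 1/2}

theorem onbG_nhds : onbG E ∈ 𝓝 (1 : unitary (E →L[ℝ] E)) := by
  have h : Continuous (fun κ : unitary (E →L[ℝ] E) => ‖(κ : E →L[ℝ] E) - 1‖) := by fun_prop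
  have := h.continuousAt (x := (1 : unitary (E →L[ℝ] E)))
  have h2 : ∀ᶠ κ : unitary (E →L[ℝ] E) in 𝓝 1, ‖(κ : E →L[ℝ] E) - 1‖ < 1/2 :=
    this.eventually (Iio_mem_nhds (by simp))
  filter_upwards [h2] with κ hκ using le_of_lt hκ

theorem onbG_closed : IsClosed (onbG E) := isClosed_le (by fun_prop) (by fun_prop)

theorem onbG_inv {κ : unitary (E →L[ℝ] E)} (h : κ ∈ onbG E) : κ⁻¹ ∈ onbG E := by
  have : ((κ⁻¹ : unitary (E →L[ℝ] E)) : E →L[ℝ] E) - 1 = star ((κ : E →L[ℝ] E) - 1) := by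
    rw [star_sub, star_one]; rfl
  change ‖(κ : E →L[ℝ] E) - 1‖ ≤ 1/2 at h
  change ‖((κ⁻¹ : unitary (E →L[ℝ] E)) : E →L[ℝ] E) - 1‖ ≤ 1/2
  rw [this, ContinuousLinearMap.star_eq_adjoint, LinearIsometryEquiv.norm_map]; exact h

noncomputable def HG (E : Type) [NormedAddCommGroup E] [InnerProductSpace ℝ E] [FiniteDimensional ℝ E] :
    Subgroup (unitary (E →L[ℝ] E)) := Subgroup.closure (onbG E)

theorem HG_open : IsOpen (HG E : Set (unitary (E →L[ℝ] E))) :=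
  Subgroup.isOpen_of_mem_nhds _ (mem_of_superset onbG_nhds Subgroup.subset_closure)

theorem HG_compact : IsCompact (HG E : Set (unitary (E →L[ℝ] E))) :=
  (Subgroup.isClosed_of_isOpen _ HG_open).isCompact

theorem good_dirac_onb (κ : unitary (E →L[ℝ] E)) (h : κ ∈ onbG E) :
    Good (Measure.dirac (κ : E →L[ℝ] E)) := by
  refine good_small _ ?_
  rw [Measure.dirac_apply' _ onb_compact.measurableSet.compl]
  simp only [indicator_apply_eq_zero]
  intro hk
  exact absurd ⟨κ.2, h⟩ hk

theorem good_dirac (κ : unitary (E →L[ℝ] E)) (h : κ ∈ HG E) :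
    Good (Measure.dirac (κ : E →L[ℝ] E)) := by
  refine Subgroup.closure_induction'' (p := fun (κ : unitary (E →L[ℝ] E)) _ => Good (Measure.dirac (κ : E →L[ℝ] E)))
    ?_ ?_ ?_ ?_ h
  · intro x hx; exact good_dirac_onb x hx
  · intro x hx; exact good_dirac_onb _ (onbG_inv hx)
  · exact good_dirac_onb 1 (mem_of_mem_nhds onbG_nhds)
  · intro x y _ _ hx hy
    have := good_mul (Measure.dirac (x : E →L[ℝ] E)) (by
      rw [Measure.dirac_apply' _ unitary_compact.measurableSet.compl]
      simp) y y.2 hx hy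
    have hm1 : Continuous (fun κ : E →L[ℝ] E => κ * (y : E →L[ℝ] E)) := by fun_prop
    rw [Measure.map_dirac' hm1.measurable] at this
    exact this

theorem conc_map (m : Measure (unitary (E →L[ℝ] E))) :
    (m.map (Subtype.val)) (unitary (E →L[ℝ] E) : Set (E →L[ℝ] E))ᶜ = 0 := by
  rw [Measure.map_apply measurable_subtype_coe unitary_compact.measurableSet.compl]
  convert measure_empty (μ := m)
  ext x; simp

theorem good_piece (μ : Measure (unitary (E →L[ℝ] E))) [IsFiniteMeasure μ]
    (h : unitary (E →L[ℝ] E)) (hh : h ∈ HG E) (D : Set (unitary (E →L[ℝ] E))) (hD : MeasurableSet D)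
    (hsub : ∀ κ ∈ D, κ * h⁻¹ ∈ onbG E) : Good ((μ.restrict D).map Subtype.val) := by
  have hc : Continuous (fun κ : unitary (E →L[ℝ] E) => ((κ * h⁻¹ : unitary (E →L[ℝ] E)) : E →L[ℝ] E)) := by
    fun_prop
  set m := (μ.restrict D).map (fun κ => ((κ * h⁻¹ : unitary (E →L[ℝ] E)) : E →L[ℝ] E)) with hm
  have h1 : m (onb E)ᶜ = 0 := by
    rw [hm, Measure.map_apply hc.measurable onb_compact.measurableSet.compl,
      Measure.restrict_apply (hc.measurable onb_compact.measurableSet.compl)]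
    convert measure_empty (μ := μ)
    ext x
    simp only [mem_inter_iff, mem_preimage, mem_compl_iff, mem_empty_iff_false, iff_false, not_and]
    intro hx hxD
    exact hx ⟨(x * h⁻¹).2, hsub x hxD⟩
  have h2 : m (unitary (E →L[ℝ] E) : Set (E →L[ℝ] E))ᶜ = 0 :=
    measure_mono_null (compl_subset_compl.2 fun κ hκ => hκ.1) h1
  have h3 := good_mul m h2 h h.2 (good_small m h1) (good_dirac h hh)
  have hm1 : Continuous (fun κ : E →L[ℝ] E => κ * (h : E →L[ℝ] E)) := by fun_prop
  rw [hm, Measure.map_map hm1.measurable hc.measurable] at h3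
  convert h3 using 2
  funext κ
  have : κ = κ * h⁻¹ * h := by group
  nth_rewrite 1 [this]; rfl

theorem good_cover (μ : Measure (unitary (E →L[ℝ] E))) [IsFiniteMeasure μ]
    (t : Finset (unitary (E →L[ℝ] E))) : ∀ (_ : ∀ h ∈ t, h ∈ HG E)
    (D : Set (unitary (E →L[ℝ] E))) (_ : MeasurableSet D)
    (_ : ∀ κ ∈ D, ∃ h ∈ t, κ * h⁻¹ ∈ onbG E), Good ((μ.restrict D).map Subtype.val) := by
  classical
  induction t using Finset.induction_on with
  | empty =>
    intro _ D hD hsub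
    have : D = ∅ := by
      ext κ; simp only [mem_empty_iff_false, iff_false]
      intro hκ; obtain ⟨h, hh, -⟩ := hsub κ hκ; simp at hh
    subst this
    refine good_small _ ?_
    simp
  | insert a t ha ih =>
    intro ht D hD hsub
    have hc : Continuous (fun κ : unitary (E →L[ℝ] E) => κ * a⁻¹) := by fun_prop
    set A := (fun κ : unitary (E →L[ℝ] E) => κ * a⁻¹) ⁻¹' onbG E with hA
    have hAm : MeasurableSet A := (onbG_closed.preimage hc).measurableSet
    have g1 := good_piece μ a (ht a (by simp)) (D ∩ A) (hD.inter hAm) (fun κ hκ => hκ.2)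
    have g2 := ih (fun h hh => ht h (by simp [hh])) (D \ A) (hD.diff hAm) (by
      rintro κ ⟨h1, h2⟩
      obtain ⟨h, hh, hk⟩ := hsub κ h1
      rcases Finset.mem_insert.1 hh with rfl | hh
      · exact absurd hk h2
      · exact ⟨h, hh, hk⟩)
    have := good_add _ _ (conc_map _) (conc_map _) g1 g2
    rwa [← Measure.map_add _ _ measurable_subtype_coe, Measure.restrict_inter_add_sdiff _ hAm] at this

theorem good_HG (μ : Measure (unitary (E →L[ℝ] E))) [IsFiniteMeasure μ] :
    Good ((μ.restrict (HG E)).map Subtype.val) := by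
  have hcov : ∀ h ∈ (HG E : Set (unitary (E →L[ℝ] E))),
      (fun κ : unitary (E →L[ℝ] E) => κ * h⁻¹) ⁻¹' onbG E ∈ 𝓝 h := by
    intro h _
    have hc : Continuous (fun κ : unitary (E →L[ℝ] E) => κ * h⁻¹) := by fun_prop
    refine hc.continuousAt (x := h) ?_
    simpa using onbG_nhds
  obtain ⟨t, ht, hsub⟩ := HG_compact.elim_nhds_subcover _ hcov
  refine good_cover μ t ht _ HG_open.measurableSet ?_
  intro κ hκ
  simpa using hsub hκ

noncomputable def rf (v x : E) : E := x - (2 * inner ℝ v x / inner ℝ v v) • v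

/-- rotation moving `y` to `y'` -/
noncomputable def refl (v : E) : E →L[ℝ] E :=
  1 - (2 / inner ℝ v v : ℝ) • ((innerSL ℝ v).smulRight v)

theorem refl_apply (v x : E) : refl v x = x - (2 / inner ℝ v v * inner ℝ v x : ℝ) • v := by
  simp [refl, smul_smul]

theorem refl_star (v : E) : star (refl v) = refl v := by
  rw [ContinuousLinearMap.star_eq_adjoint]
  symm
  rw [ContinuousLinearMap.eq_adjoint_iff]
  intro x y
  simp only [refl_apply, inner_sub_left, inner_sub_right, inner_smul_left, inner_smul_right]
  rw [real_inner_comm v x]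
  simp; ring

theorem refl_sq {v : E} (hv : v ≠ 0) : refl v * refl v = 1 := by
  ext x
  have h : inner ℝ v v ≠ (0:ℝ) := by simpa using hv
  simp only [_root_.mul_apply_eq_comp, refl_apply, inner_sub_right, inner_smul_right,
    _root_.one_apply_eq_self]
  rw [sub_sub, ← add_smul]
  have : (2 / inner ℝ v v * inner ℝ v x + 2 / inner ℝ v v * (inner ℝ v x -
    2 / inner ℝ v v * inner ℝ v x * inner ℝ v v) : ℝ) = 0 := by field_simp; ring
  rw [this]; simp

theorem refl_mem {v : E} (hv : v ≠ 0) : refl v ∈ unitary (E →L[ℝ] E) := by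
  rw [Unitary.mem_iff, refl_star]; exact ⟨refl_sq hv, refl_sq hv⟩

theorem rot_near {y : E} (hy : y ≠ 0) : ∀ᶠ y' in 𝓝 y, ‖y'‖ = ‖y‖ → ∃ κ ∈ onb E, κ y = y' := by
  have hne : ∀ᶠ y' in 𝓝 y, y + y' ≠ 0 := by
    have : ContinuousAt (fun y' => y + y') y := by fun_prop
    refine this.eventually_ne ?_
    intro h
    have : (2:ℝ) • y = 0 := by rw [two_smul]; exact h
    exact hy (by simpa using this)
  have hcont : ContinuousAt (fun y' => refl (y + y') * refl y) y := by
    have h2 : inner ℝ (y + y) (y + y) ≠ (0:ℝ) := by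
      have := hne.self_of_nhds; simpa using this
    have h1 : ContinuousAt (fun y' : E => (2 / inner ℝ (y+y') (y+y') : ℝ)) y :=
      ContinuousAt.div (by fun_prop) (by fun_prop) h2
    unfold refl
    have h3 : ContinuousAt (fun y' : E => (innerSL ℝ (y + y')).smulRight (y + y')) y := by
      have : Continuous (fun y' : E => (ContinuousLinearMap.smulRightL ℝ E E)
        (innerSL ℝ (y + y')) (y + y')) := by fun_prop
      exact this.continuousAt
    fun_prop
  have h1 : refl (y + y) * refl y = 1 := by
    have : refl (y + y) = refl y := by
      ext x
      have h : inner ℝ y y ≠ (0:ℝ) := by simpa using hy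
      rw [refl_apply, refl_apply, ← two_smul ℝ y]
      simp only [inner_smul_left, inner_smul_right, smul_smul]
      congr 2
      simp
      field_simp
      try ring
    rw [this, refl_sq hy]
  have hcl : ∀ᶠ y' in 𝓝 y, ‖refl (y + y') * refl y - 1‖ < 1/2 := by
    have := (hcont.sub (continuousAt_const (y := (1 : E →L[ℝ] E)))).norm
    refine this.eventually (gt_mem_nhds ?_)
    change ‖refl (y + y) * refl y - 1‖ < 1/2
    rw [h1]; simp
  filter_upwards [hne, hcl] with y' h2 h3 hn
  refine ⟨refl (y + y') * refl y, ⟨mul_mem (refl_mem h2) (refl_mem hy), h3.le⟩, ?_⟩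
  have hyy : refl y y = -y := by
    have h : inner ℝ y y ≠ (0:ℝ) := by simpa using hy
    rw [refl_apply, div_mul_cancel₀ _ h]; module
  rw [_root_.mul_apply_eq_comp, hyy, refl_apply]
  have h4 : inner ℝ (y + y') (y + y') = (2 * inner ℝ (y + y') y : ℝ) := by
    simp only [inner_add_left, inner_add_right, real_inner_self_eq_norm_sq, hn,
      real_inner_comm y y']; ring
  have h5 : inner ℝ (y + y') (y + y') ≠ (0:ℝ) := by simpa using h2
  have h6 : (2 / inner ℝ (y + y') (y + y') * inner ℝ (y + y') (-y) : ℝ) = -1 := by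
    rw [inner_neg_right]
    have h7 : (inner ℝ (y + y') y : ℝ) ≠ 0 := by
      intro h; rw [h] at h4; simp at h4; exact h2 h4
    rw [h4]; field_simp
  rw [h6]; module

theorem haar_avg (hdim : 1 < Module.rank ℝ E) : ∃ (μ : Measure (E →L[ℝ] E))
    (ν : Measure ((E →L[ℝ] E) × (E →L[ℝ] E))) (C : ℝ), IsProbabilityMeasure μ ∧ IsFiniteMeasure ν ∧
    μ (unitary (E →L[ℝ] E) : Set (E →L[ℝ] E))ᶜ = 0 ∧ ν (S2 E C)ᶜ = 0 ∧ RepF μ ν ∧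
    ∀ (F : Type) [NormedAddCommGroup F] [NormedSpace ℝ F] [CompleteSpace F] (g : E → F) (y y' : E),
      ‖y'‖ = ‖y‖ → ContinuousOn g {y' | ‖y'‖ = ‖y‖} → ∫ κ, g (κ y) ∂μ = ∫ κ, g (κ y') ∂μ := by
  set μ0 : Measure (unitary (E →L[ℝ] E)) := (Measure.haar).inv with hμ0
  have hpos : (μ0.restrict (HG E)) univ ≠ 0 := by
    rw [Measure.restrict_apply_univ, hμ0, Measure.inv_apply]
    have : ((HG E : Set (unitary (E →L[ℝ] E))))⁻¹ = HG E := by ext x; simp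
    rw [this]
    exact (HG_open.measure_pos _ ⟨1, one_mem _⟩).ne'
  set m := ((μ0.restrict (HG E)).map Subtype.val) with hm
  have hmu : m univ = (μ0.restrict (HG E)) univ := by
    rw [hm, Measure.map_apply measurable_subtype_coe MeasurableSet.univ]; simp
  have hfin : m univ ≠ ⊤ := measure_ne_top _ _
  have hm0 : m univ ≠ 0 := by rwa [hmu]
  obtain ⟨ν, hν, ⟨C, hC⟩, hr⟩ := good_smul m (m univ)⁻¹ (ENNReal.inv_ne_top.2 hm0) (good_HG μ0)
  have hconc : m (unitary (E →L[ℝ] E) : Set (E →L[ℝ] E))ᶜ = 0 := conc_map _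
  refine ⟨(m univ)⁻¹ • m, ν, C, ⟨?_⟩, hν, ?_, hC, hr, ?_⟩
  · rw [Measure.smul_apply, smul_eq_mul]; exact ENNReal.inv_mul_cancel hm0 hfin
  · rw [Measure.smul_apply, hconc]; simp
  intro F _ _ _ g y y' hyy' hg
  simp only [integral_smul_measure]
  congr 1
  -- invariance
  have hval : ∀ y1, ‖y1‖ = ‖y‖ → ∫ κ, g (κ y1) ∂m = ∫ κ in (HG E : Set (unitary (E →L[ℝ] E))),
      g ((κ : E →L[ℝ] E) y1) ∂μ0 := by
    intro y1 h1
    have hi : Integrable (fun κ : E →L[ℝ] E => g (κ y1)) m :=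
      integ_of unitary_compact hconc (orb_contOn (by rwa [h1]))
    rw [hm, integral_map measurable_subtype_coe.aemeasurable hi.aestronglyMeasurable]
  have hinv : ∀ y1, ‖y1‖ = ‖y‖ → ∀ κ ∈ onb E, ∫ k, g (k (κ y1)) ∂m = ∫ k, g (k y1) ∂m := by
    intro y1 h1 κ hκ
    have h2 : ‖κ y1‖ = ‖y‖ := by rw [ContinuousLinearMap.norm_map_of_mem_unitary hκ.1, h1]
    rw [hval _ h1, hval _ h2]
    set k0 : unitary (E →L[ℝ] E) := ⟨κ, hκ.1⟩
    have hk0 : k0 ∈ HG E := Subgroup.subset_closure hκ.2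
    rw [← integral_indicator HG_open.measurableSet, ← integral_indicator HG_open.measurableSet]
    rw [← integral_mul_right_eq_self (μ := μ0) (fun x => (HG E : Set (unitary (E →L[ℝ] E))).indicator
      (fun κ : unitary (E →L[ℝ] E) => g ((κ : E →L[ℝ] E) y1)) x) k0]
    refine integral_congr_ae (Eventually.of_forall fun x => ?_)
    have hmem : x * k0 ∈ (HG E : Set (unitary (E →L[ℝ] E))) ↔ x ∈ (HG E : Set (unitary (E →L[ℝ] E))) :=
      Subgroup.mul_mem_cancel_right _ hk0
    by_cases hx : x ∈ (HG E : Set (unitary (E →L[ℝ] E)))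
    · rw [indicator_of_mem hx]
      change _ = indicator _ _ _
      rw [indicator_of_mem (hmem.2 hx)]; rfl
    · rw [indicator_of_notMem hx]
      change _ = indicator _ _ _
      rw [indicator_of_notMem (fun h => hx (hmem.1 h))]
  by_cases hy : y = 0
  · subst hy
    have : y' = 0 := by simpa using hyy'
    rw [this]
  have hpre := isPreconnected_sphere hdim (0:E) ‖y‖
  have hloc : ∀ y1 ∈ Metric.sphere (0:E) ‖y‖, ∀ᶠ y2 in 𝓝[Metric.sphere (0:E) ‖y‖] y1,
      ∫ k, g (k y2) ∂m = ∫ k, g (k y1) ∂m := by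
    intro y1 h1
    have h1' : ‖y1‖ = ‖y‖ := by simpa using h1
    have hy1 : y1 ≠ 0 := by
      intro h; rw [h] at h1'; simp at h1'; exact hy (norm_eq_zero.1 h1'.symm)
    filter_upwards [self_mem_nhdsWithin, (rot_near hy1).filter_mono nhdsWithin_le_nhds] with y2 h2 h3
    obtain ⟨κ, hκ, rfl⟩ := h3 (by rw [h1']; simpa using h2)
    exact hinv y1 h1' κ hκ
  exact IsPreconnected.induction₂ hpre (fun a b => ∫ k, g (k a) ∂m = ∫ k, g (k b) ∂m)
    (fun a ha => by filter_upwards [hloc a ha] with b hb using hb.symm)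
    (fun a b c _ _ _ h1 h2 => h1.trans h2) (fun _ _ _ _ h => h.symm) (by simp) (by simpa using hyy')

end Haar3

section Cut
open MeasureTheory Set Filter Topology
variable {V F : Type} [NormedAddCommGroup V] [NormedSpace ℝ V] [FiniteDimensional ℝ V]
  [NormedAddCommGroup F] [NormedSpace ℝ F]

theorem cutoff {K O : Set V} (hK : IsCompact K) (hO : IsOpen O) (hKO : K ⊆ O) :
    ∃ χ : V → ℝ, ContDiff ℝ ∞ χ ∧ HasCompactSupport χ ∧ tsupport χ ⊆ O ∧
      ∃ N, IsOpen N ∧ K ⊆ N ∧ N ⊆ O ∧ ∀ x ∈ N, χ x = 1 := by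
  obtain ⟨L, hL, hKL, hLO⟩ := exists_compact_between hK hO hKO
  haveI : ProperSpace V := FiniteDimensional.proper ℝ V
  obtain ⟨f, hf1, hf0, -⟩ := exists_contMDiffMap_one_nhds_of_subset_interior (n := ⊤)
    (modelWithCornersSelf ℝ V) hK.isClosed hKL
  have hs : tsupport f ⊆ L := closure_minimal (fun x hx => by
    by_contra h; exact hx (hf0 x h)) hL.isClosed
  obtain ⟨N, hN, hKN, hN1⟩ := mem_nhdsSet_iff_exists.1 hf1
  refine ⟨f, f.contMDiff.contDiff, HasCompactSupport.of_support_subset_isCompact hL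
    ((subset_tsupport _).trans hs), hs.trans hLO, N ∩ O, hN.inter hO,
    subset_inter hKN hKO, inter_subset_right, fun x hx => hN1 hx.1⟩

theorem cut_smul {O : Set V} {χ : V → ℝ} {f : V → F} (hχ : ContDiff ℝ ∞ χ) (hO : IsOpen O)
    (hs : tsupport χ ⊆ O) (hf : ContDiffOn ℝ ∞ f O) : ContDiff ℝ ∞ fun x => χ x • f x := by
  rw [contDiff_iff_contDiffAt]
  intro x
  by_cases hx : x ∈ O
  · exact hχ.contDiffAt.smul (hf.contDiffAt (hO.mem_nhds hx))
  · have : (fun x => χ x • f x) =ᶠ[𝓝 x] fun _ => 0 := by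
      have := notMem_tsupport_iff_eventuallyEq.1 (fun h => hx (hs h))
      filter_upwards [this] with y hy
      simp [hy]
    exact contDiffAt_const.congr_of_eventuallyEq this

end Cut

section Flat1
open MeasureTheory Set Filter Topology
variable {E T : Type} [NormedAddCommGroup E] [NormedSpace ℝ E] [FiniteDimensional ℝ E]
  [NormedAddCommGroup T] [NormedSpace ℝ T] [FiniteDimensional ℝ T]

/-- Flatness of a connection form on an open set. -/
def FlatOn (Γ : E × T → E →L[ℝ] T) (O : Set (E × T)) : Prop :=
  ∀ x ∈ O, ∀ v w, (fderiv ℝ Γ x (v, Γ x v)) w = (fderiv ℝ Γ x (w, Γ x w)) v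

theorem lin_ode_zero {u u' : ℝ → T} {L : ℝ → T →L[ℝ] T} (hL : ContinuousOn L (Icc 0 1))
    (hu : ∀ t ∈ Icc (0:ℝ) 1, HasDerivAt u (u' t) t) (hu' : ∀ t ∈ Icc (0:ℝ) 1, u' t = L t (u t))
    (h0 : u 0 = 0) : ∀ t ∈ Icc (0:ℝ) 1, u t = 0 := by
  obtain ⟨K, hK⟩ := isCompact_Icc.exists_bound_of_continuousOn hL
  refine eq_zero_of_abs_deriv_le_mul_abs_self_of_eq_zero_right (f' := u') (K := K)
    (fun t ht => (hu t ht).continuousAt.continuousWithinAt)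
    (fun t ht => (hu t (Ico_subset_Icc_self ht)).hasDerivWithinAt) h0 fun t ht => ?_
  have ht' := Ico_subset_Icc_self ht
  rw [hu' t ht']
  exact ((L t).le_opNorm _).trans (mul_le_mul_of_nonneg_right (hK t ht') (norm_nonneg _))

/-- Parallel transport along segments for a flat connection. -/
theorem transport (Γ : E × T → E →L[ℝ] T) {O : Set (E × T)} (hO : IsOpen O)
    (hΓ : ContDiffOn ℝ ∞ Γ O) (h0 : ∀ θ, (θ, (0:T)) ∈ O → Γ (θ, 0) = 0) (hflat : FlatOn Γ O)
    {C : Set (E × E)} (hC : IsCompact C)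
    (hCO : ∀ p ∈ C, ∀ t ∈ Icc (0:ℝ) 1, (p.1 + t • (p.2 - p.1), (0:T)) ∈ O) :
    ∃ 𝒯 : (E × E) × T → T, ContDiff ℝ ∞ 𝒯 ∧ (∀ p ∈ C, 𝒯 (p, 0) = 0) ∧
      (∀ p : E × E, p.1 = p.2 → ∀ τ, 𝒯 (p, τ) = τ) ∧ ∃ δ > 0, ∀ p ∈ C, ∀ τ, ‖τ‖ < δ →
        (p.1, τ) ∈ O ∧ (p.2, 𝒯 (p, τ)) ∈ O ∧
        (∀ v w, fderiv ℝ 𝒯 (p, τ) ((v, w), Γ (p.1, τ) v) = Γ (p.2, 𝒯 (p, τ)) w) ∧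
        (p.swap ∈ C → 𝒯 (p.swap, 𝒯 (p, τ)) = τ) := by
  set m : ℝ × (E × E) × T → E × T := fun x => (x.2.1.1 + x.1 • (x.2.1.2 - x.2.1.1), x.2.2) with hm
  have hmc : ContDiff ℝ ∞ m := by rw [hm]; fun_prop
  set O' := m ⁻¹' O with hO'
  have hO'o : IsOpen O' := hO.preimage hmc.continuous
  set G : ℝ × (E × E) × T → T := fun x => Γ (m x) (x.2.1.2 - x.2.1.1) with hG
  have hΓm : ContDiffOn ℝ ∞ (fun x => Γ (m x)) O' :=
    hΓ.comp (hmc.contDiffOn) (fun x hx => hx)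
  have hGc : ContDiffOn ℝ ∞ G O' :=
    hΓm.clm_apply (ContDiff.contDiffOn (by fun_prop))
  have hKc : IsCompact (Icc (0:ℝ) 1 ×ˢ C ×ˢ ({0} : Set T)) :=
    isCompact_Icc.prod (hC.prod isCompact_singleton)
  obtain ⟨χ, hχ, hχc, hχs, N, hN, hKN, hNO, hN1⟩ := cutoff hKc hO'o (by
    rintro ⟨t, p, τ⟩ ⟨h1, h2, h3⟩
    simp only [mem_singleton_iff] at h3
    subst h3
    exact hCO p h2 t h1)
  set g : ℝ × (E × E) × T → T := fun x => χ x • G x with hg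
  have hgc : ContDiff ℝ ∞ g := cut_smul hχ hO'o hχs hGc
  have hgs : HasCompactSupport g := hχc.smul_right
  have hgN : ∀ x ∈ N, g x = G x := fun x hx => by simp [hg, hN1 x hx]
  have hgNf : ∀ x ∈ N, fderiv ℝ g x = fderiv ℝ G x := fun x hx =>
    Filter.EventuallyEq.fderiv_eq (by
      filter_upwards [hN.mem_nhds hx] with y hy using hgN y hy)
  obtain ⟨fl, dl, hfl, hfl0, hflt, hfd, hdl0, hdlt, hcont, huniq⟩ := flow_ode g hgc hgs
  have h1I : (1:ℝ) ∈ Icc (0:ℝ) 1 := by simp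
  have hg0 : ∀ t p, g (t, p, 0) = 0 := by
    intro t p
    by_cases h : (t, p, (0:T)) ∈ O'
    · have h' : (p.1 + t • (p.2 - p.1), (0:T)) ∈ O := h
      simp [hg, hG, hm, h0 _ h']
    · have : χ (t, p, 0) = 0 := by
        by_contra h'
        exact h (hχs (subset_tsupport _ h'))
      simp [hg, this]
  have hz : ∀ p, ∀ t ∈ Icc (0:ℝ) 1, fl (p, 0) t = 0 := fun p t ht =>
    (huniq (p, 0) (fun _ => 0) (fun t _ => by
      beta_reduce; rw [hg0]; exact hasDerivAt_const _ _) rfl t ht).symm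
  -- tube
  obtain ⟨δ1, hδ1, hδ1N⟩ : ∃ δ1 > 0, ∀ p ∈ C, ∀ t ∈ Icc (0:ℝ) 1, ∀ τ : T, ‖τ‖ < δ1 →
      (t, p, τ) ∈ N := by
    have := eventually_forall_compact (isCompact_Icc.prod hC) (x0 := (0:T))
      (O := {x | (x.2.1, x.2.2, x.1) ∈ N}) (S := Icc (0:ℝ) 1 ×ˢ C) (fun k hk => by
        refine (hN.preimage (f := fun x : T × ℝ × (E × E) => (x.2.1, x.2.2, x.1))
          (by fun_prop)).mem_nhds ?_
        exact hKN ⟨hk.1, hk.2, rfl⟩)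
    obtain ⟨δ, hδ, h⟩ := Metric.eventually_nhds_iff.1 this
    exact ⟨δ, hδ, fun p hp t ht τ hτ => h (by simpa using hτ) (t, p) ⟨ht, hp⟩⟩
  obtain ⟨δ, hδ, hδs⟩ : ∃ δ > 0, ∀ p ∈ C, ∀ t ∈ Icc (0:ℝ) 1, ∀ τ : T, ‖τ‖ < δ →
      ‖fl (p, τ) t‖ < δ1 := by
    have := eventually_forall_compact (hC.prod isCompact_univ) (x0 := (0:T))
      (O := {x : T × (E × E) × unitInterval | ‖fl (x.2.1, x.1) x.2.2‖ < δ1})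
      (S := C ×ˢ univ) (fun k hk => by
        have hc : Continuous fun x : T × (E × E) × unitInterval => ‖fl (x.2.1, x.1) x.2.2‖ :=
          (hcont.comp (f := fun x : T × (E × E) × unitInterval => ((x.2.1, x.1), x.2.2))
            (by fun_prop)).norm
        refine (isOpen_lt hc continuous_const).mem_nhds ?_
        change ‖fl (k.1, 0) k.2‖ < δ1
        rw [hz k.1 k.2 k.2.2]; simpa using hδ1)
    obtain ⟨δ, hδ, h⟩ := Metric.eventually_nhds_iff.1 this
    exact ⟨δ, hδ, fun p hp t ht τ hτ => h (by simpa using hτ) (p, ⟨t, ht⟩) ⟨hp, mem_univ _⟩⟩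
  refine ⟨fun x => fl x 1, hfl 1 h1I, fun p hp => hz p 1 h1I, ?_, δ, hδ, ?_⟩
  · intro p hp τ
    exact (huniq (p, τ) (fun _ => τ) (fun t _ => by
      have : g (t, p, τ) = 0 := by simp [hg, hG, hp]
      beta_reduce; rw [this]; exact hasDerivAt_const _ _) rfl 1 h1I).symm
  intro p hp τ hτ
  have hin : ∀ t ∈ Icc (0:ℝ) 1, (t, p, fl (p, τ) t) ∈ N := fun t ht =>
    hδ1N p hp t ht _ (hδs p hp t ht τ hτ)
  have hinO : ∀ t ∈ Icc (0:ℝ) 1, (p.1 + t • (p.2 - p.1), fl (p, τ) t) ∈ O := fun t ht =>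
    hNO (hin t ht)
  refine ⟨?_, ?_, ?_, ?_⟩
  · simpa [hfl0] using hinO 0 (by simp)
  · simpa using hinO 1 h1I
  · intro v w
    set e := p.2 - p.1 with he
    set x : ℝ → E × T := fun t => (p.1 + t • e, fl (p, τ) t) with hx
    set d := dl (p, τ) ((v, w), Γ (p.1, τ) v) with hd
    have hxd : ∀ t ∈ Icc (0:ℝ) 1, HasDerivAt x (e, Γ (x t) e) t := by
      intro t ht
      have h1 := hflt (p, τ) t ht
      rw [hgN _ (hin t ht)] at h1
      refine HasDerivAt.prodMk ?_ h1
      simpa using ((hasDerivAt_id t).smul_const e).const_add p.1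
    have hΓd : ∀ t ∈ Icc (0:ℝ) 1, HasFDerivAt Γ (fderiv ℝ Γ (x t)) (x t) := fun t ht =>
      ((hΓ.contDiffAt (hO.mem_nhds (hinO t ht))).differentiableAt (by simp)).hasFDerivAt
    have hdd : ∀ t ∈ Icc (0:ℝ) 1, HasDerivAt d
        ((fderiv ℝ Γ (x t) (v + t • (w - v), d t)) e + Γ (x t) (w - v)) t := by
      intro t ht
      have h1 := hdlt (p, τ) ((v, w), Γ (p.1, τ) v) t ht
      rw [hgNf _ (hin t ht)] at h1
      convert h1 using 1
      have hmd : HasFDerivAt m (fderiv ℝ m (t, p, fl (p, τ) t)) (t, p, fl (p, τ) t) :=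
        (hmc.differentiable (by simp) _).hasFDerivAt
      have hmd2 : fderiv ℝ m (t, p, fl (p, τ) t) (0, (v, w), d t) = (v + t • (w - v), d t) := by
        have h2 : HasDerivAt (fun s : ℝ => ((t, p, fl (p, τ) t) : ℝ × (E × E) × T) +
            s • ((0, (v, w), d t) : ℝ × (E × E) × T)) (0, (v, w), d t) 0 := by
          simpa using ((hasDerivAt_id (0:ℝ)).smul_const
            ((0, (v, w), d t) : ℝ × (E × E) × T)).const_add ((t, p, fl (p, τ) t) : ℝ × (E × E) × T)
        have h3 := HasFDerivAt.comp_hasDerivAt (x := (0:ℝ)) (l := m) (l' := fderiv ℝ m (t, p, fl (p, τ) t))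
          (f := fun s : ℝ => ((t, p, fl (p, τ) t) : ℝ × (E × E) × T) +
            s • ((0, (v, w), d t) : ℝ × (E × E) × T)) (by simpa using hmd) h2
        have h4 : HasDerivAt (fun s : ℝ => m (((t, p, fl (p, τ) t) : ℝ × (E × E) × T) +
            s • ((0, (v, w), d t) : ℝ × (E × E) × T))) (v + t • (w - v), d t) 0 := by
          have : (fun s : ℝ => m (((t, p, fl (p, τ) t) : ℝ × (E × E) × T) +
            s • ((0, (v, w), d t) : ℝ × (E × E) × T))) = fun s : ℝ => m (t, p, fl (p, τ) t) +
              s • (v + t • (w - v), d t) := by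
            funext s
            simp only [hm, Prod.smul_mk, Prod.mk_add_mk, Prod.fst_add, Prod.snd_add,
              Prod.smul_fst, Prod.smul_snd, smul_zero, add_zero, Prod.mk.injEq, and_true]
            module
          rw [this]
          simpa using ((hasDerivAt_id (0:ℝ)).smul_const
            (v + t • (w - v), d t)).const_add (m (t, p, fl (p, τ) t))
        exact h3.unique h4
      have hc : HasFDerivAt (fun x => Γ (m x)) ((fderiv ℝ Γ (x t)).comp
          (fderiv ℝ m (t, p, fl (p, τ) t))) (t, p, fl (p, τ) t) :=
        HasFDerivAt.comp (t, p, fl (p, τ) t) (f := m) (hΓd t ht) hmd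
      have hl : HasFDerivAt (fun x : ℝ × (E × E) × T => x.2.1.2 - x.2.1.1)
          (((ContinuousLinearMap.snd ℝ E E) - (ContinuousLinearMap.fst ℝ E E)).comp
            ((ContinuousLinearMap.fst ℝ (E × E) T).comp
              (ContinuousLinearMap.snd ℝ ℝ ((E × E) × T)))) (t, p, fl (p, τ) t) := 
        ContinuousLinearMap.hasFDerivAt (((ContinuousLinearMap.snd ℝ E E) - (ContinuousLinearMap.fst ℝ E E)).comp
            ((ContinuousLinearMap.fst ℝ (E × E) T).comp
              (ContinuousLinearMap.snd ℝ ℝ ((E × E) × T))))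
      have hGd := hc.clm_apply hl
      rw [show G = fun x => Γ (m x) (x.2.1.2 - x.2.1.1) from rfl, hGd.fderiv]
      have hd' : dl (p, τ) ((v, w), Γ (p.1, τ) v) t = d t := rfl
      rw [hd']
      simp only [_root_.add_apply, ContinuousLinearMap.comp_apply,
        ContinuousLinearMap.flip_apply, hmd2]
      simp [hx, hm, he, add_comm]
    -- the defect
    set u : ℝ → T := fun t => d t - Γ (x t) (v + t • (w - v)) with hu
    have hud : ∀ t ∈ Icc (0:ℝ) 1, HasDerivAt u (((fderiv ℝ Γ (x t) (v + t • (w - v), d t)) e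
        + Γ (x t) (w - v)) - ((fderiv ℝ Γ (x t) (e, Γ (x t) e)) (v + t • (w - v)) +
          Γ (x t) (w - v))) t := by
      intro t ht
      have h1 : HasDerivAt (fun t => Γ (x t)) (fderiv ℝ Γ (x t) (e, Γ (x t) e)) t :=
        (hΓd t ht).comp_hasDerivAt t (hxd t ht)
      have h2 : HasDerivAt (fun t : ℝ => v + t • (w - v)) (w - v) t := by
        simpa using ((hasDerivAt_id t).smul_const (w - v)).const_add v
      exact (hdd t ht).sub (h1.clm_apply h2)
    have hxc : ContinuousOn x (Icc 0 1) := fun t ht =>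
      (hxd t ht).continuousAt.continuousWithinAt
    have hDc : ContinuousOn (fun t => fderiv ℝ Γ (x t)) (Icc 0 1) :=
      (hΓ.continuousOn_fderiv_of_isOpen hO (by simp)).comp hxc (fun t ht => hinO t ht)
    have hz1 := lin_ode_zero (L := fun t => ((ContinuousLinearMap.apply ℝ T e).comp
        (fderiv ℝ Γ (x t))).comp (ContinuousLinearMap.inr ℝ E T)) (u := u) (by
          exact (continuousOn_const.clm_comp hDc).clm_comp continuousOn_const) hud (by
          intro t ht
          rw [hflat _ (hinO t ht) e (v + t • (w - v))]
          have : (((v + t • (w - v), d t) : E × T)) = (v + t • (w - v), Γ (x t) (v + t • (w - v)))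
              + (0, u t) := by simp [hu]
          rw [this, map_add]
          simp [hx]) (by simp [hu, hd, hdl0, hx, hfl0]) 1 h1I
    have h5 := hfd (p, τ) ((v, w), Γ (p.1, τ) v) 1 h1I
    beta_reduce
    rw [h5]
    have h6 : d 1 - Γ (x 1) (v + (1:ℝ) • (w - v)) = 0 := hz1
    rw [sub_eq_zero] at h6
    rw [← hd, h6]
    simp [hx, he]
  · intro hsw
    have := huniq (p.swap, fl (p, τ) 1) (fun t => fl (p, τ) (1 - t)) (by
      intro t ht
      have ht' : 1 - t ∈ Icc (0:ℝ) 1 := ⟨by linarith [ht.2], by linarith [ht.1]⟩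
      have h1 := hflt (p, τ) (1 - t) ht'
      have h2 : HasDerivAt (fun t : ℝ => 1 - t) (-1) t := by
        simpa using (hasDerivAt_id t).const_sub 1
      have h3 : HasDerivAt (fun t => fl (p, τ) (1 - t)) _ t := h1.scomp t h2
      have h4 := hδ1N p.swap hsw t ht _ (hδs p hp (1 - t) ht' τ hτ)
      convert h3 using 1
      rw [hgN _ h4, hgN _ (hin _ ht')]
      simp only [hG, hm, Prod.fst_swap, Prod.snd_swap]
      rw [show p.2 + t • (p.1 - p.2) = p.1 + (1 - t) • (p.2 - p.1) by module,
        show p.1 - p.2 = (-1 : ℝ) • (p.2 - p.1) by module, map_smul]) (by simp) 1 h1I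
    simpa [hfl0] using this.symm
end Flat1

section Flat2
open MeasureTheory Set Filter Topology
variable {E T : Type} [NormedAddCommGroup E] [InnerProductSpace ℝ E] [FiniteDimensional ℝ E]
  [NormedAddCommGroup T] [NormedSpace ℝ T] [FiniteDimensional ℝ T]

/-- Component orthogonal to a unit vector. -/
noncomputable def wpart (N a : E) : E := a - (inner ℝ N a) • N

theorem wpart_continuous (N : E) : Continuous (wpart N) := by unfold wpart; fun_prop

theorem inner_wpart {N : E} (hN : ‖N‖ = 1) (a : E) : inner ℝ N (wpart N a) = 0 := by
  simp [wpart, inner_sub_right, inner_smul_right, hN]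

theorem norm_sq_wpart {N : E} (hN : ‖N‖ = 1) (a : E) :
    ‖a‖ ^ 2 = (inner ℝ N a) ^ 2 + ‖wpart N a‖ ^ 2 := by
  have h : a = (inner ℝ N a) • N + wpart N a := by simp [wpart]
  have h2 : inner ℝ ((inner ℝ N a : ℝ) • N) (wpart N a) = 0 := by
    rw [inner_smul_left, inner_wpart hN]; simp
  have := norm_add_sq_eq_norm_sq_add_norm_sq_of_inner_eq_zero _ _ h2
  rw [← h, norm_smul, hN] at this
  simp only [mul_one, Real.norm_eq_abs, abs_mul_abs_self] at this
  nlinarith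

/-- The band around the equator. -/
def band (N : E) : Set E :=
  {e | |inner ℝ N e| < ‖wpart N e‖ ∧ 1/4 < ‖wpart N e‖ ∧ ‖wpart N e‖ < 4}

theorem band_open (N : E) : IsOpen (band N) := by
  have h := (wpart_continuous N).norm
  refine (isOpen_lt (by fun_prop) h).inter ((isOpen_lt continuous_const h).inter
    (isOpen_lt h continuous_const))

theorem wpart_comb {N : E} (hN : ‖N‖ = 1) {u : E} (hu : inner ℝ N u = 0) (s : ℝ) :
    wpart N (u + s • N) = u ∧ inner ℝ N (u + s • N) = s := by
  have : inner ℝ N (u + s • N) = s := by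
    rw [inner_add_right, hu, inner_smul_right, real_inner_self_eq_norm_sq, hN]; simp
  exact ⟨by rw [wpart, this]; simp, this⟩

theorem band_preconnected {N : E} (hN : ‖N‖ = 1) (hdim : 3 ≤ Module.finrank ℝ E) :
    IsPreconnected (band N) := by
  have hN0 : N ≠ 0 := by intro h; simp [h] at hN
  have hr : 1 < Module.rank ℝ (ℝ ∙ N)ᗮ := by
    have h1 := (ℝ ∙ N).finrank_add_finrank_orthogonal
    have h2 : Module.finrank ℝ (ℝ ∙ N) = 1 := finrank_span_singleton hN0
    rw [← Module.finrank_eq_rank]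
    norm_cast
    omega
  have hs := isPreconnected_sphere hr (0 : (ℝ ∙ N)ᗮ) 1
  have hp := (hs.prod ((isPreconnected_Ioo (a := (-1:ℝ)) (b := 1)).prod
    (isPreconnected_Ioo (a := (1/4:ℝ)) (b := 4)))).image
    (fun x : (ℝ ∙ N)ᗮ × ℝ × ℝ => x.2.2 • ((x.1 : E) + x.2.1 • N)) (by fun_prop)
  convert hp
  ext e
  constructor
  · rintro ⟨h1, h2, h3⟩
    have hw0 : ‖wpart N e‖ ≠ 0 := by linarith
    have hwp : 0 < ‖wpart N e‖ := by linarith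
    refine ⟨(⟨‖wpart N e‖⁻¹ • wpart N e, ?_⟩, ‖wpart N e‖⁻¹ * inner ℝ N e, ‖wpart N e‖),
      ⟨?_, ?_, h2, h3⟩, ?_⟩
    · rw [Submodule.mem_orthogonal_singleton_iff_inner_right, inner_smul_right, inner_wpart hN]
      simp
    · simp [norm_smul, hw0]
    · rw [abs_lt] at h1
      constructor
      · change -1 < ‖wpart N e‖⁻¹ * inner ℝ N e
        rw [inv_mul_eq_div, lt_div_iff₀ hwp]; linarith
      · change ‖wpart N e‖⁻¹ * inner ℝ N e < 1
        rw [inv_mul_eq_div, div_lt_iff₀ hwp]; linarith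
    · simp only [smul_add, smul_smul, ← mul_assoc, mul_inv_cancel₀ hw0, one_mul, one_smul]
      simp [wpart]
  · rintro ⟨⟨⟨u, hu⟩, s, ρ⟩, ⟨h1, h2, h3⟩, rfl⟩
    rw [Submodule.mem_orthogonal_singleton_iff_inner_right] at hu
    have hu1 : ‖u‖ = 1 := by simpa using h1
    have hρ : 0 < ρ := by have := h3.1; simp only at this; linarith
    have h4 : inner ℝ N (ρ • u) = 0 := by rw [inner_smul_right, hu]; simp
    have h5 := wpart_comb hN h4 (ρ * s)
    have h6 : ρ • (u + s • N) = ρ • u + (ρ * s) • N := by rw [smul_add, smul_smul]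
    change ρ • (u + s • N) ∈ band N
    have h7 : ‖ρ • u‖ = ρ := by rw [norm_smul, hu1, Real.norm_of_nonneg hρ.le, mul_one]
    rw [h6]
    refine ⟨?_, ?_, ?_⟩
    · rw [h5.1, h5.2, h7, abs_mul, abs_of_pos hρ]
      have : |s| < 1 := abs_lt.2 h2
      nlinarith
    · rw [h5.1, h7]; exact h3.1
    · rw [h5.1, h7]; exact h3.2

/-- One of the two caps. -/
def capSet (N : E) (ς : ℝ) : Set (E × E) :=
  {p | p.2 = ς • N ∧ 1/8 ≤ ‖p.1‖ ∧ ‖p.1‖ ≤ 8 ∧ -‖wpart N p.1‖ ≤ ς * inner ℝ N p.1}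

theorem capSet_compact (N : E) (ς : ℝ) : IsCompact (capSet N ς) := by
  have hw := (wpart_continuous N)
  have hc : IsClosed (capSet N ς) := by
    have c1 : IsClosed {p : E × E | p.2 = ς • N} := isClosed_eq (by fun_prop) (by fun_prop)
    have c2 : IsClosed {p : E × E | 1/8 ≤ ‖p.1‖} := isClosed_le (by fun_prop) (by fun_prop)
    have c3 : IsClosed {p : E × E | ‖p.1‖ ≤ 8} := isClosed_le (by fun_prop) (by fun_prop)
    have c4 : IsClosed {p : E × E | -‖wpart N p.1‖ ≤ ς * inner ℝ N p.1} :=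
      isClosed_le (by fun_prop) (by fun_prop)
    exact c1.inter (c2.inter (c3.inter c4))
  refine ((isCompact_closedBall (0:E) 8).prod (isCompact_singleton (x := ς • N))).of_isClosed_subset
    hc fun p hp => ⟨by simpa using hp.2.2.1, hp.1⟩

theorem capSet_seg {N : E} (hN : ‖N‖ = 1) {ς : ℝ} (hς : ς * ς = 1) {p : E × E}
    (hp : p ∈ capSet N ς) {t : ℝ} (ht : t ∈ Icc (0:ℝ) 1) : p.1 + t • (p.2 - p.1) ≠ 0 := by
  obtain ⟨h1, h2, h3, h4⟩ := hp
  intro h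
  have hN1 : inner ℝ N N = (1:ℝ) := by rw [real_inner_self_eq_norm_sq, hN]; simp
  have e1 : inner ℝ N (p.1 + t • (p.2 - p.1)) = (0:ℝ) := by rw [h]; simp
  rw [h1] at e1
  simp only [inner_add_right, inner_smul_right, inner_sub_right, hN1] at e1
  have e2 : (1 - t) • wpart N p.1 = 0 := by
    have : wpart N (p.1 + t • (p.2 - p.1)) = (1 - t) • wpart N p.1 := by
      rw [h1]
      simp only [wpart, inner_add_right, inner_smul_right, inner_sub_right, hN1]
      module
    rw [← this, h]; simp [wpart]
  rcases smul_eq_zero.1 e2 with h5 | h5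
  · have : t = 1 := by linarith
    subst this
    have : ς = 0 := by linarith
    subst this; norm_num at hς
  · rw [h5] at h4
    simp only [norm_zero, neg_zero] at h4
    have e3 : (1 - t) * (ς * inner ℝ N p.1) + t * (ς * ς) = 0 := by linear_combination ς * e1
    rw [hς] at e3
    have h6 : 0 ≤ (1 - t) * (ς * inner ℝ N p.1) := mul_nonneg (by linarith [ht.2]) h4
    have h7 : t = 0 := by nlinarith [ht.1]
    subst h7
    have h8 : ς * inner ℝ N p.1 = 0 := by linarith
    have h9 : inner ℝ N p.1 = (0:ℝ) := by
      have : ς * (ς * inner ℝ N p.1) = 0 := by rw [h8]; simp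
      rw [← mul_assoc, hς, one_mul] at this; exact this
    have := norm_sq_wpart hN p.1
    rw [h9, h5] at this
    simp only [norm_zero] at this
    nlinarith

theorem small_of_zero {C : Set (E × E)} (hC : IsCompact C) (f : (E × E) × T → T)
    (hf : Continuous f) (h0 : ∀ p ∈ C, f (p, 0) = 0) (ε : ℝ) (hε : 0 < ε) :
    ∃ δ > 0, ∀ p ∈ C, ∀ τ, ‖τ‖ < δ → ‖f (p, τ)‖ < ε := by
  have := eventually_forall_compact hC (x0 := (0:T)) (O := {x : T × (E × E) | ‖f (x.2, x.1)‖ < ε})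
    (fun k hk => by
      have hc : Continuous fun x : T × (E × E) => ‖f (x.2, x.1)‖ := by fun_prop
      refine (isOpen_lt hc continuous_const).mem_nhds ?_
      change ‖f (k, 0)‖ < ε
      rw [h0 k hk]; simpa using hε)
  obtain ⟨δ, hδ, h⟩ := Metric.eventually_nhds_iff.1 this
  exact ⟨δ, hδ, fun p hp τ hτ => h (by simpa using hτ) p hp⟩

theorem flat_integral (Γ : E × T → E →L[ℝ] T) {O : Set (E × T)} (hO : IsOpen O)
    (hΓ : ContDiffOn ℝ ∞ Γ O) (hO0 : ∀ θ : E, θ ≠ 0 → (θ, (0:T)) ∈ O)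
    (h0 : ∀ θ, Γ (θ, 0) = 0) (hflat : FlatOn Γ O)
    (hdim : 3 ≤ Module.finrank ℝ E) {N : E} (hN : ‖N‖ = 1) :
    ∃ (F : E × T → T) (Ψ : T → T), ContDiff ℝ ∞ Ψ ∧ Ψ 0 = 0 ∧ (∀ τ, F (N, τ) = τ) ∧ ∃ δ > 0,
      (∀ x : E × T, 1/4 < ‖x.1‖ → ‖x.1‖ < 4 → ‖x.2‖ < δ →
        x ∈ O ∧ ContDiffAt ℝ ∞ F x ∧ ∀ v, fderiv ℝ F x (v, Γ x v) = 0) ∧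
      (∀ τ, ‖τ‖ < δ → F (-N, Ψ τ) = τ) := by
  have hN0 : N ≠ 0 := by intro h; simp [h] at hN
  have hN1 : inner ℝ N N = (1:ℝ) := by rw [real_inner_self_eq_norm_sq, hN]; simp
  obtain ⟨e0, he0, he0N⟩ : ∃ e0 : E, ‖e0‖ = 1 ∧ inner ℝ N e0 = 0 := by
    have h1 := (ℝ ∙ N).finrank_add_finrank_orthogonal
    have h2 : Module.finrank ℝ (ℝ ∙ N) = 1 := finrank_span_singleton hN0
    haveI : Nontrivial (ℝ ∙ N)ᗮ := Module.nontrivial_of_finrank_pos (R := ℝ) (by omega)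
    obtain ⟨u, hu⟩ := exists_ne (0 : (ℝ ∙ N)ᗮ)
    have hu' : ‖(u:E)‖ ≠ 0 := by simpa using hu
    refine ⟨‖(u:E)‖⁻¹ • (u:E), by simp [norm_smul, hu'], ?_⟩
    rw [inner_smul_right, Submodule.mem_orthogonal_singleton_iff_inner_right.1 u.2]; simp
  have hwe0 : wpart N e0 = e0 := by simp [wpart, he0N]
  set D : Set (E × E) := capSet N 1 ∪ capSet N (-1) with hD
  have hDc : IsCompact D := (capSet_compact N 1).union (capSet_compact N (-1))
  have hDseg : ∀ p ∈ D, ∀ t ∈ Icc (0:ℝ) 1, p.1 + t • (p.2 - p.1) ≠ 0 := by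
    rintro p (hp | hp) t ht
    · exact capSet_seg hN (by norm_num) hp ht
    · exact capSet_seg hN (by norm_num) hp ht
  set C : Set (E × E) := D ∪ Prod.swap '' D with hC
  have hCc : IsCompact C := hDc.union (hDc.image continuous_swap)
  obtain ⟨𝒯, hT, hT0, hTid, δ0, hδ0, hTδ⟩ := transport Γ hO hΓ (fun θ _ => h0 θ) hflat hCc (by
    rintro p (hp | ⟨p, hp, rfl⟩) t ht
    · exact hO0 _ (hDseg p hp t ht)
    · apply hO0
      have := hDseg p hp (1 - t) ⟨by linarith [ht.2], by linarith [ht.1]⟩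
      convert this using 1
      simp only [Prod.fst_swap, Prod.snd_swap]
      module)
  have hsw : ∀ p ∈ C, p.swap ∈ C := by
    rintro p (hp | ⟨p, hp, rfl⟩)
    · exact Or.inr ⟨p, hp, rfl⟩
    · left; simpa using hp
  -- membership
  have mN : ∀ a : E, 1/8 ≤ ‖a‖ → ‖a‖ ≤ 8 → -‖wpart N a‖ ≤ inner ℝ N a → (a, N) ∈ C :=
    fun a h1 h2 h3 => Or.inl (Or.inl ⟨by simp, h1, h2, by simpa using h3⟩)
  have mS : ∀ a : E, 1/8 ≤ ‖a‖ → ‖a‖ ≤ 8 → inner ℝ N a ≤ ‖wpart N a‖ → (a, -N) ∈ C :=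
    fun a h1 h2 h3 => Or.inl (Or.inr ⟨by simp, h1, h2, by simpa using h3⟩)
  have mB : ∀ e ∈ band N, (e, N) ∈ C ∧ (e, -N) ∈ C := by
    rintro e ⟨h1, h2, h3⟩
    have h4 := norm_sq_wpart hN e
    have h5 := abs_lt.1 h1
    have h6 : 1/8 ≤ ‖e‖ := by
      by_contra h
      push Not at h
      nlinarith [norm_nonneg e, sq_nonneg (inner ℝ N e : ℝ)]
    have h7 : ‖e‖ ≤ 8 := by
      by_contra h
      push Not at h
      have : (inner ℝ N e : ℝ) ^ 2 ≤ ‖wpart N e‖ ^ 2 := sq_le_sq' h5.1.le h5.2.le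
      nlinarith
    exact ⟨mN e h6 h7 h5.1.le, mS e h6 h7 h5.2.le⟩
  have he0B : e0 ∈ band N := by
    refine ⟨?_, ?_, ?_⟩ <;> rw [hwe0] <;> simp only [he0, he0N, abs_zero] <;> norm_num
  have mSS : (-N, -N) ∈ C := mS _ (by rw [norm_neg, hN]; norm_num) (by rw [norm_neg, hN]; norm_num) (by
    rw [inner_neg_right, hN1]; linarith [norm_nonneg (wpart N (-N))])
  have c1 := (mB e0 he0B).1
  have c2 := (mB e0 he0B).2
  -- smallness
  have sm := small_of_zero hCc 𝒯 hT.continuous hT0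
  obtain ⟨δ1, hδ1, s1⟩ := sm δ0 hδ0
  obtain ⟨δ2, hδ2, s2⟩ := sm (min δ0 δ1) (lt_min hδ0 hδ1)
  obtain ⟨δ3, hδ3, s3⟩ := sm (min δ0 δ2) (lt_min hδ0 hδ2)
  have inv : ∀ p ∈ C, ∀ τ, ‖τ‖ < δ0 → 𝒯 (p.swap, 𝒯 (p, τ)) = τ := fun p hp τ hτ =>
    (hTδ p hp τ hτ).2.2.2 (hsw p hp)
  set R : T → T := fun τ => 𝒯 ((e0, N), 𝒯 ((-N, e0), τ)) with hR
  have hRc : ContDiff ℝ ∞ R := by rw [hR]; fun_prop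
  set FN : E × T → T := fun x => 𝒯 ((x.1, N), x.2) with hFN
  have hFNc : ContDiff ℝ ∞ FN := by rw [hFN]; fun_prop
  set FS : E × T → T := fun x => R (𝒯 ((x.1, -N), x.2)) with hFS
  have hFSc : ContDiff ℝ ∞ FS := by rw [hFS]; fun_prop
  have dA : ∀ (M : E) (x : E × T), (x.1, M) ∈ C → ‖x.2‖ < δ0 → ∀ v, ∃ L : E × T →L[ℝ] T,
      HasFDerivAt (fun x : E × T => 𝒯 ((x.1, M), x.2)) L x ∧ L (v, Γ x v) = 0 := by
    intro M x hx hx2 v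
    have h1 : HasFDerivAt 𝒯 (fderiv ℝ 𝒯 ((x.1, M), x.2)) ((x.1, M), x.2) :=
      (hT.differentiable (by simp) _).hasFDerivAt
    have h2 : HasFDerivAt (fun x : E × T => ((x.1, M), x.2))
      ((((ContinuousLinearMap.fst ℝ E T).prod 0)).prod (ContinuousLinearMap.snd ℝ E T)) x :=
      ((hasFDerivAt_fst).prodMk (hasFDerivAt_const M x)).prodMk hasFDerivAt_snd
    refine ⟨_, HasFDerivAt.comp x (f := fun x : E × T => ((x.1, M), x.2)) h1 h2, ?_⟩
    have := (hTδ _ hx x.2 hx2).2.2.1 v 0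
    simpa using this
  have dN : ∀ x : E × T, (x.1, N) ∈ C → ‖x.2‖ < δ0 → ∀ v, fderiv ℝ FN x (v, Γ x v) = 0 := by
    intro x hx hx2 v
    obtain ⟨L, hL, hL0⟩ := dA N x hx hx2 v
    rw [hL.fderiv, hL0]
  have dS : ∀ x : E × T, (x.1, -N) ∈ C → ‖x.2‖ < δ0 → ∀ v, fderiv ℝ FS x (v, Γ x v) = 0 := by
    intro x hx hx2 v
    obtain ⟨L, hL, hL0⟩ := dA (-N) x hx hx2 v
    have h1 : HasFDerivAt FS _ x :=
      HasFDerivAt.comp x (g := R) (f := fun x : E × T => 𝒯 ((x.1, -N), x.2))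
        (hRc.differentiable (by simp) _).hasFDerivAt hL
    rw [h1.fderiv, ContinuousLinearMap.comp_apply, hL0, map_zero]
  have hRΨ : ∀ τ, ‖τ‖ < δ2 → ‖τ‖ < δ0 → R (𝒯 ((e0, -N), 𝒯 ((N, e0), τ))) = τ := by
    intro τ h1 h2
    have i1 := inv _ c2 (𝒯 ((N, e0), τ)) ((s2 _ (hsw _ c1) τ h1).trans_le (min_le_left _ _))
    have i2 := inv _ (hsw _ c1) τ h2
    simp only [Prod.swap] at i1 i2
    simp only [hR]
    rw [i1, i2]
  -- agreement on the band
  have hK : ∀ τ, ‖τ‖ < δ2 → ‖τ‖ < δ0 → ∀ e ∈ band N, FS (e, 𝒯 ((N, e), τ)) = τ := by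
    intro τ h1 h2 e he
    have hd : ∀ e ∈ band N, HasFDerivAt (fun e => FS (e, 𝒯 ((N, e), τ))) (0 : E →L[ℝ] T) e := by
      intro e he
      have hm := hsw _ (mB e he).1
      have g1 : HasFDerivAt 𝒯 (fderiv ℝ 𝒯 ((N, e), τ)) ((N, e), τ) :=
        (hT.differentiable (by simp) _).hasFDerivAt
      have g2 : HasFDerivAt (fun e : E => ((N, e), τ))
        (((0 : E →L[ℝ] E).prod (ContinuousLinearMap.id ℝ E)).prod 0) e :=
        ((hasFDerivAt_const N e).prodMk (hasFDerivAt_id e)).prodMk (hasFDerivAt_const τ e)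
      have g3 : HasFDerivAt (fun e : E => 𝒯 ((N, e), τ)) _ e :=
        HasFDerivAt.comp e (f := fun e : E => ((N, e), τ)) g1 g2
      have g4 : HasFDerivAt FS (fderiv ℝ FS (e, 𝒯 ((N, e), τ))) (e, 𝒯 ((N, e), τ)) :=
        (hFSc.differentiable (by simp) _).hasFDerivAt
      have g5 := HasFDerivAt.comp e (f := fun e : E => (e, 𝒯 ((N, e), τ))) g4
        ((hasFDerivAt_id e).prodMk g3)
      refine g5.congr_fderiv ?_
      ext w
      have g6 := (hTδ _ hm τ h2).2.2.1 0 w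
      simp only [map_zero, Prod.swap] at g6
      have g7 := dS (e, 𝒯 ((N, e), τ)) (mB e he).2
        ((s2 _ hm τ h1).trans_le (min_le_left _ _)) w
      simp only [ContinuousLinearMap.comp_apply, ContinuousLinearMap.prod_apply,
        _root_.zero_apply, ContinuousLinearMap.id_apply, g6, g7]
    have := (band_open N).is_const_of_fderiv_eq_zero (𝕜 := ℝ) (band_preconnected hN hdim)
      (fun e he => (hd e he).differentiableAt.differentiableWithinAt)
      (fun e he => (hd e he).fderiv) he he0B
    rw [this]
    exact hRΨ τ h1 h2
  have hag : ∀ e ∈ band N, ∀ τ, ‖τ‖ < δ3 → ‖τ‖ < δ0 → FS (e, τ) = FN (e, τ) := by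
    intro e he τ h1 h2
    have h3 := s3 _ (mB e he).1 τ h1
    have h4 := hK (𝒯 ((e, N), τ)) (h3.trans_le (min_le_right _ _)) (h3.trans_le (min_le_left _ _))
      e he
    have h5 := inv _ (mB e he).1 τ h2
    simp only [Prod.swap] at h5
    rw [h5] at h4
    exact h4
  set F : E × T → T := fun x => if 0 ≤ (inner ℝ N x.1 : ℝ) then FN x else FS x with hF
  refine ⟨F, fun τ => 𝒯 ((e0, -N), 𝒯 ((N, e0), τ)), by fun_prop, ?_, ?_,
    min (min δ0 δ2) δ3, by positivity, ?_, ?_⟩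
  · beta_reduce
    rw [hT0 (N, e0) (hsw _ c1), hT0 _ c2]
  · intro τ
    simp [hF, hN1, hFN, hTid]
  · intro x h1 h2 h3
    have h30 : ‖x.2‖ < δ0 := h3.trans_le ((min_le_left _ _).trans (min_le_left _ _))
    have hic : Continuous fun y : E × T => (inner ℝ N y.1 : ℝ) := by fun_prop
    have key : ∀ H : E × T → T, ContDiff ℝ ∞ H → F =ᶠ[𝓝 x] H →
        (∀ v, fderiv ℝ H x (v, Γ x v) = 0) →
        ContDiffAt ℝ ∞ F x ∧ ∀ v, fderiv ℝ F x (v, Γ x v) = 0 := by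
      intro H hH hFH hv
      refine ⟨hH.contDiffAt.congr_of_eventuallyEq hFH, fun v => ?_⟩
      rw [hFH.fderiv_eq]; exact hv v
    rcases lt_trichotomy (inner ℝ N x.1 : ℝ) 0 with h | h | h
    · have hm := mS x.1 (by linarith) (by linarith) (h.le.trans (norm_nonneg _))
      refine ⟨(hTδ _ hm x.2 h30).1, key FS hFSc ?_ (dS x hm h30)⟩
      filter_upwards [(isOpen_lt hic continuous_const).mem_nhds h] with y hy
      have hy' : ¬ (0 ≤ (inner ℝ N y.1 : ℝ)) := not_le.2 hy
      simp [hF, hy']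
    · have hm := mN x.1 (by linarith) (by linarith) (by rw [h]; simp)
      refine ⟨(hTδ _ hm x.2 h30).1, key FN hFNc ?_ (dN x hm h30)⟩
      have hb : x.1 ∈ band N := by
        have : wpart N x.1 = x.1 := by simp [wpart, h]
        refine ⟨?_, ?_, ?_⟩ <;> rw [this]
        · rw [h]; simp only [abs_zero]; linarith
        · exact h1
        · exact h2
      have o1 : IsOpen {y : E × T | y.1 ∈ band N} := (band_open N).preimage continuous_fst
      have o2 : IsOpen {y : E × T | ‖y.2‖ < min (min δ0 δ2) δ3} :=
        isOpen_lt (by fun_prop) continuous_const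
      filter_upwards [o1.mem_nhds hb, o2.mem_nhds h3] with y hy1 hy2
      have hy2' : ‖y.2‖ < min (min δ0 δ2) δ3 := hy2
      by_cases hy : 0 ≤ (inner ℝ N y.1 : ℝ)
      · simp [hF, hy]
      · simp only [hF, hy, if_false]
        exact hag y.1 hy1 y.2 (hy2'.trans_le (min_le_right _ _))
          (hy2'.trans_le ((min_le_left _ _).trans (min_le_left _ _)))
    · have hm := mN x.1 (by linarith) (by linarith) (by linarith [norm_nonneg (wpart N x.1)])
      refine ⟨(hTδ _ hm x.2 h30).1, key FN hFNc ?_ (dN x hm h30)⟩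
      filter_upwards [(isOpen_lt continuous_const hic).mem_nhds h] with y hy
      have hy' : (0 ≤ (inner ℝ N y.1 : ℝ)) := le_of_lt hy
      simp [hF, hy']
  · intro τ h3
    have h30 : ‖τ‖ < δ0 := h3.trans_le ((min_le_left _ _).trans (min_le_left _ _))
    have h32 : ‖τ‖ < δ2 := h3.trans_le ((min_le_left _ _).trans (min_le_right _ _))
    have : ¬ (0 ≤ (inner ℝ N (-N) : ℝ)) := by rw [inner_neg_right, hN1]; norm_num
    simp only [hF, this, if_false, hFS]
    rw [hTid _ rfl]
    exact hRΨ τ h32 h30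

end Flat2

section Blow1
open MeasureTheory Set Filter Topology
variable {E Z W : Type} [NormedAddCommGroup E] [InnerProductSpace ℝ E] [FiniteDimensional ℝ E]
  [NormedAddCommGroup Z] [NormedSpace ℝ Z] [FiniteDimensional ℝ Z]
  [NormedAddCommGroup W] [NormedSpace ℝ W]

/-- Blow-down map. -/
def bl (x : E × (ℝ × Z)) : E × Z := (x.2.1 • x.1, x.2.2)

/-- Domain upstairs. -/
def Om (E Z : Type) [NormedAddCommGroup E] [NormedAddCommGroup Z] (δ : ℝ) : Set (E × (ℝ × Z)) :=
  {x | 1/2 < ‖x.1‖ ∧ ‖x.1‖ < 2 ∧ |x.2.1| < δ ∧ ‖x.2.2‖ < δ}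

/-- Domain downstairs. -/
def Vd (E Z : Type) [NormedAddCommGroup E] [NormedAddCommGroup Z] (δ : ℝ) : Set (E × Z) :=
  {x | ‖x.1‖ < δ ∧ ‖x.2‖ < δ}

theorem bl_contDiff : ContDiff ℝ ∞ (bl : E × (ℝ × Z) → E × Z) := by unfold bl; fun_prop

theorem Om_open (δ : ℝ) : IsOpen (Om E Z δ) := by
  have c1 : IsOpen {x : E × (ℝ × Z) | 1/2 < ‖x.1‖} := isOpen_lt (by fun_prop) (by fun_prop)
  have c2 : IsOpen {x : E × (ℝ × Z) | ‖x.1‖ < 2} := isOpen_lt (by fun_prop) (by fun_prop)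
  have c3 : IsOpen {x : E × (ℝ × Z) | |x.2.1| < δ} := isOpen_lt (by fun_prop) (by fun_prop)
  have c4 : IsOpen {x : E × (ℝ × Z) | ‖x.2.2‖ < δ} := isOpen_lt (by fun_prop) (by fun_prop)
  exact c1.inter (c2.inter (c3.inter c4))

theorem Vd_open (δ : ℝ) : IsOpen (Vd E Z δ) := by
  have c3 : IsOpen {x : E × Z | ‖x.1‖ < δ} := isOpen_lt (by fun_prop) (by fun_prop)
  have c4 : IsOpen {x : E × Z | ‖x.2‖ < δ} := isOpen_lt (by fun_prop) (by fun_prop)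
  exact c3.inter c4

/-- Functions of order `k` along the exceptional divisor. -/
def OO (δ : ℝ) (k : ℕ) (h : E × Z → W) (G : E × (ℝ × Z) → W) : Prop :=
  ContDiffOn ℝ ∞ G (Om E Z δ) ∧ ∀ x ∈ Om E Z δ, h (bl x) = x.2.1 ^ k • G x

/-- The rescaling map. -/
noncomputable def resc (E Z : Type) [NormedAddCommGroup E] [InnerProductSpace ℝ E]
    [NormedAddCommGroup Z] [NormedSpace ℝ Z] (a b : ℝ) : E × Z →L[ℝ] E × (ℝ × Z) :=
  (a • ContinuousLinearMap.fst ℝ E Z).prod ((0 : E × Z →L[ℝ] ℝ).prod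
    (b • ContinuousLinearMap.snd ℝ E Z))

theorem resc_apply (a b : ℝ) (v : E × Z) : resc E Z a b v = (a • v.1, (0, b • v.2)) := rfl

theorem OO_hasFDerivAt {δ : ℝ} {k : ℕ} {h : E × Z → W} {G : E × (ℝ × Z) → W} (hG : OO δ k h G)
    {x : E × (ℝ × Z)} (hx : x ∈ Om E Z δ) (hr : x.2.1 ≠ 0) :
    HasFDerivAt h (x.2.1 ^ k • (fderiv ℝ G x).comp (resc E Z x.2.1⁻¹ 1)) (bl x) := by
  set r := x.2.1 with hrdef
  have h1 : HasFDerivAt G (fderiv ℝ G x) x :=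
    ((hG.1.contDiffAt ((Om_open δ).mem_nhds hx)).differentiableAt (by simp)).hasFDerivAt
  set s : E × Z → E × (ℝ × Z) := fun y => (r⁻¹ • y.1, (r, y.2)) with hs
  have hs2 : s = fun y => resc E Z r⁻¹ 1 y + (0, (r, 0)) := by
    funext y; simp [hs, resc_apply]
  have h2 : HasFDerivAt s (resc E Z r⁻¹ 1) (bl x) := by
    rw [hs2]
    exact (resc E Z r⁻¹ 1).hasFDerivAt.add_const _
  have hsx : s (bl x) = x := by
    ext <;> simp [hs, bl, ← hrdef, smul_smul, inv_mul_cancel₀ hr]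
  rw [← hsx] at h1
  have h3 := (HasFDerivAt.comp (bl x) (f := s) h1 h2).const_smul (r ^ k)
  rw [hsx] at h3
  refine h3.congr_of_eventuallyEq ?_
  have : ∀ᶠ y in 𝓝 (bl x), s y ∈ Om E Z δ :=
    h2.continuousAt.eventually (by rw [hsx]; exact (Om_open δ).mem_nhds hx)
  filter_upwards [this] with y hy
  have := hG.2 _ hy
  have hb : bl (s y) = y := by
    ext <;> simp [hs, bl, smul_smul, mul_inv_cancel₀ hr]
  rw [hb] at this
  exact this

theorem unit_lift [Nontrivial E] (y : E) : ∃ θ : E, ‖θ‖ = 1 ∧ ‖y‖ • θ = y := by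
  by_cases h : y = 0
  · obtain ⟨u, hu⟩ := exists_norm_eq E (zero_le_one)
    exact ⟨u, hu, by simp [h]⟩
  · have : ‖y‖ ≠ 0 := by simpa using h
    exact ⟨‖y‖⁻¹ • y, by simp [norm_smul, this], by rw [smul_smul, mul_inv_cancel₀ this, one_smul]⟩

theorem lift_Om [Nontrivial E] {δ : ℝ} {x : E × Z} (hx : x ∈ Vd E Z δ) :
    ∃ θ : E, ‖θ‖ = 1 ∧ (θ, (‖x.1‖, x.2)) ∈ Om E Z δ ∧ bl (θ, (‖x.1‖, x.2)) = x := by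
  obtain ⟨θ, h1, h2⟩ := unit_lift x.1
  refine ⟨θ, h1, ⟨?_, ?_, ?_, hx.2⟩, ?_⟩
  · rw [h1]; norm_num
  · rw [h1]; norm_num
  · simpa using hx.1
  · ext <;> simp [bl, h2]

theorem OO_bound [Nontrivial E] {δ : ℝ} {k : ℕ} {h : E × Z → W} {G : E × (ℝ × Z) → W}
    (hG : OO δ k h G) {z : Z} (hz : ((0:E), z) ∈ Vd E Z δ) :
    ∃ M, ∀ᶠ x in 𝓝 ((0:E), z), ‖h x‖ ≤ M * ‖x.1‖ ^ k := by
  have hδ : 0 < δ := by simpa using hz.1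
  have hS : IsCompact (Metric.sphere (0:E) 1) := isCompact_sphere 0 1
  have hmem : ∀ θ ∈ Metric.sphere (0:E) 1, (θ, ((0:ℝ), z)) ∈ Om E Z δ := by
    intro θ hθ
    have hθ' : ‖θ‖ = 1 := by simpa using hθ
    refine ⟨?_, ?_, by simpa using hδ, hz.2⟩ <;> simp only [hθ'] <;> norm_num
  have hcont : ∀ θ ∈ Metric.sphere (0:E) 1, ContinuousAt G (θ, ((0:ℝ), z)) := fun θ hθ =>
    hG.1.continuousOn.continuousAt ((Om_open δ).mem_nhds (hmem θ hθ))
  obtain ⟨M, hM⟩ := hS.exists_bound_of_continuousOn (f := fun θ => G (θ, ((0:ℝ), z)))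
    (fun θ hθ => (ContinuousAt.comp (f := fun θ : E => (θ, ((0:ℝ), z))) (hcont θ hθ)
      (by fun_prop)).continuousWithinAt)
  have hev := eventually_forall_compact hS (x0 := ((0:ℝ), z))
    (O := {q : (ℝ × Z) × E | ‖G (q.2, q.1)‖ < M + 1}) (fun θ hθ => by
      have h1 : ContinuousAt (fun q : (ℝ × Z) × E => ‖G (q.2, q.1)‖) (((0:ℝ), z), θ) :=
        (ContinuousAt.comp (f := fun q : (ℝ × Z) × E => (q.2, q.1)) (hcont θ hθ)
          (by fun_prop)).norm
      exact h1.eventually_lt_const (by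
        have := hM θ hθ; change ‖G (θ, ((0:ℝ), z))‖ < M + 1; linarith))
  have ht : Tendsto (fun x : E × Z => (‖x.1‖, x.2)) (𝓝 ((0:E), z)) (𝓝 ((0:ℝ), z)) := by
    have : Continuous (fun x : E × Z => (‖x.1‖, x.2)) := by fun_prop
    simpa using this.tendsto ((0:E), z)
  refine ⟨M + 1, ?_⟩
  filter_upwards [ht.eventually hev, (Vd_open δ).mem_nhds hz] with x hx hxV
  obtain ⟨θ, h1, h2, h3⟩ := lift_Om hxV
  have h4 := hG.2 _ h2
  rw [h3] at h4
  have h5 : ‖G (θ, (‖x.1‖, x.2))‖ < M + 1 := hx θ (by simpa using h1)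
  rw [h4, norm_smul, norm_pow, norm_norm, mul_comm]
  exact mul_le_mul_of_nonneg_right h5.le (by positivity)

theorem OO_zero_eq [Nontrivial E] {δ : ℝ} {k : ℕ} {h : E × Z → W} {G : E × (ℝ × Z) → W}
    (hG : OO δ (k + 1) h G) {z : Z} (hz : ((0:E), z) ∈ Vd E Z δ) : h (0, z) = 0 := by
  obtain ⟨θ, h1, h2, h3⟩ := lift_Om hz
  have h4 := hG.2 _ h2
  rw [h3] at h4
  simpa using h4

theorem OO_hasFDerivAt_zero [Nontrivial E] {δ : ℝ} {k : ℕ} {h : E × Z → W}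
    {G : E × (ℝ × Z) → W} (hG : OO δ (k + 2) h G) {z : Z} (hz : ((0:E), z) ∈ Vd E Z δ) :
    HasFDerivAt h (0 : E × Z →L[ℝ] W) (0, z) := by
  obtain ⟨M, hM⟩ := OO_bound hG hz
  have h0 : h (0, z) = 0 := OO_zero_eq (k := k + 1) hG hz
  rw [hasFDerivAt_iff_isLittleO]
  have h1 : (fun x : E × Z => h x) =O[𝓝 (0, z)] fun x => ‖x - (0, z)‖ ^ 2 := by
    apply Asymptotics.IsBigO.of_bound |M|
    have : ∀ᶠ x : E × Z in 𝓝 (0, z), ‖x.1‖ < 1 := by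
      have : Continuous fun x : E × Z => ‖x.1‖ := by fun_prop
      exact (this.tendsto _).eventually_lt_const (by simp)
    filter_upwards [hM, this] with x hx hx1
    refine hx.trans ?_
    rw [norm_pow, norm_norm]
    have e1 : ‖x.1‖ ≤ ‖x - (0, z)‖ := by
      have := norm_fst_le (x - ((0:E), z)); simpa using this
    have e2 : ‖x.1‖ ^ (k + 2) ≤ ‖x.1‖ ^ 2 :=
      pow_le_pow_of_le_one (norm_nonneg _) hx1.le (by omega)
    calc M * ‖x.1‖ ^ (k+2) ≤ |M| * ‖x.1‖ ^ (k+2) :=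
          mul_le_mul_of_nonneg_right (le_abs_self M) (by positivity)
      _ ≤ |M| * ‖x - (0, z)‖ ^ 2 := by
        gcongr
        exact e2.trans (by gcongr)
  have h2 : (fun x : E × Z => ‖x - (0, z)‖ ^ 2) =o[𝓝 (0, z)] fun x => x - (0, z) := by
    exact Asymptotics.isLittleO_pow_sub_sub (0, z) (by norm_num)
  simpa [h0] using h1.trans_isLittleO h2

theorem OO_fderiv [Nontrivial E] {δ : ℝ} {k : ℕ} {h : E × Z → W}
    {G : E × (ℝ × Z) → W} (hG : OO δ (k + 2) h G) :
    OO δ (k + 1) (fderiv ℝ h) (fun x => (fderiv ℝ G x).comp (resc E Z 1 x.2.1)) := by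
  constructor
  · have h1 : ContDiffOn ℝ ∞ (fderiv ℝ G) (Om E Z δ) :=
      hG.1.fderiv_of_isOpen (Om_open δ) (by simp)
    refine h1.clm_comp (ContDiff.contDiffOn ?_)
    unfold resc
    have e : ∀ b : ℝ, (((1:ℝ) • ContinuousLinearMap.fst ℝ E Z).prod ((0 : E × Z →L[ℝ] ℝ).prod
        (b • ContinuousLinearMap.snd ℝ E Z))) =
        ((ContinuousLinearMap.fst ℝ E Z).prod (0 : E × Z →L[ℝ] ℝ × Z)) +
          b • ((0 : E × Z →L[ℝ] E).prod ((0 : E × Z →L[ℝ] ℝ).prod (ContinuousLinearMap.snd ℝ E Z))) := by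
      intro b; ext <;> simp
    simp only [e]
    fun_prop
  · intro x hx
    by_cases hr : x.2.1 = 0
    · have hb : bl x = (0, x.2.2) := by simp [bl, hr]
      have hV : ((0:E), x.2.2) ∈ Vd E Z δ := ⟨by
        have := hx.2.2.1; rw [hr] at this; simpa using this, hx.2.2.2⟩
      rw [hb, (OO_hasFDerivAt_zero hG hV).fderiv, hr]
      simp
    · rw [(OO_hasFDerivAt hG hx hr).fderiv]
      refine ContinuousLinearMap.ext fun v => ?_
      simp only [_root_.smul_apply, ContinuousLinearMap.comp_apply, resc_apply]
      rw [pow_succ, mul_smul, ← map_smul]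
      simp [smul_smul, hr]

theorem OO_contDiffOn [Nontrivial E] {δ : ℝ} (K : ℕ) : ∀ {W : Type} [NormedAddCommGroup W]
    [NormedSpace ℝ W] {h : E × Z → W}
    {G : E × (ℝ × Z) → W}, OO δ (K + 1) h G → ContDiffOn ℝ K h (Vd E Z δ) := by
  induction K with
  | zero =>
    intro W _ _ h G hG
    rw [Nat.cast_zero, contDiffOn_zero]
    intro x hx
    apply ContinuousAt.continuousWithinAt
    by_cases hr : x.1 = 0
    · have hxz : x = (0, x.2) := by ext <;> simp [hr]
      rw [hxz] at hx ⊢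
      obtain ⟨M, hM⟩ := OO_bound hG hx
      rw [ContinuousAt, OO_zero_eq (k := 0) hG hx]
      refine squeeze_zero_norm' hM ?_
      have : Continuous fun y : E × Z => M * ‖y.1‖ ^ (0 + 1) := by fun_prop
      simpa using this.tendsto (0, x.2)
    · obtain ⟨θ, h1, h2, h3⟩ := lift_Om hx
      have := (OO_hasFDerivAt hG h2 (by simpa using hr)).continuousAt
      rwa [h3] at this
  | succ K ih =>
    intro W _ _ h G hG
    have : ((K + 1 : ℕ) : ℕ∞ω) = (K : ℕ∞ω) + 1 := by simp
    rw [this, contDiffOn_succ_iff_fderiv_of_isOpen (Vd_open δ)]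
    refine ⟨fun x hx => ?_, by simp, ih (OO_fderiv hG)⟩
    apply DifferentiableAt.differentiableWithinAt
    by_cases hr : x.1 = 0
    · have hxz : x = (0, x.2) := by ext <;> simp [hr]
      rw [hxz] at hx ⊢
      exact (OO_hasFDerivAt_zero hG hx).differentiableAt
    · obtain ⟨θ, h1, h2, h3⟩ := lift_Om hx
      have := (OO_hasFDerivAt hG h2 (by simpa using hr)).differentiableAt
      rwa [h3] at this

/-- Radial derivative upstairs. -/
noncomputable def Lr (φ : E × (ℝ × Z) → W) (x : E × (ℝ × Z)) : W := fderiv ℝ φ x (0, (1, 0))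

theorem Lr_contDiffOn {O : Set (E × (ℝ × Z))} (hO : IsOpen O) {φ : E × (ℝ × Z) → W}
    (hφ : ContDiffOn ℝ ∞ φ O) : ContDiffOn ℝ ∞ (Lr φ) O :=
  (hφ.fderiv_of_isOpen hO (by simp)).clm_apply contDiffOn_const

theorem Lr_iter_contDiffOn {O : Set (E × (ℝ × Z))} (hO : IsOpen O) {φ : E × (ℝ × Z) → W}
    (hφ : ContDiffOn ℝ ∞ φ O) (k : ℕ) : ContDiffOn ℝ ∞ (Lr^[k] φ) O := by
  induction k with
  | zero => exact hφ
  | succ k ih => rw [Function.iterate_succ_apply']; exact Lr_contDiffOn hO ih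

theorem Lr_iter_pow {O : Set (E × (ℝ × Z))} (hO : IsOpen O) (k : ℕ) :
    ∀ {φ ψ : E × (ℝ × Z) → W}, ContDiffOn ℝ ∞ ψ O → (∀ x ∈ O, φ x = x.2.1 ^ k • ψ x) →
      ∀ x ∈ O, x.2.1 = 0 → (Lr^[k] φ) x = (k.factorial : ℝ) • ψ x := by
  induction k with
  | zero =>
    intro φ ψ hψ h x hx _
    simpa using h x hx
  | succ k ih =>
    intro φ ψ hψ h x hx hr
    rw [Function.iterate_succ_apply]
    have := ih (φ := Lr φ) (ψ := fun x => ((k:ℝ) + 1) • ψ x + x.2.1 • Lr ψ x) (by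
      have := Lr_contDiffOn hO hψ
      fun_prop) (by
      intro y hy
      have h1 : HasFDerivAt ψ (fderiv ℝ ψ y) y :=
        ((hψ.contDiffAt (hO.mem_nhds hy)).differentiableAt (by simp)).hasFDerivAt
      have h2 : HasFDerivAt (fun x : E × (ℝ × Z) => x.2.1)
        ((ContinuousLinearMap.fst ℝ ℝ Z).comp (ContinuousLinearMap.snd ℝ E (ℝ × Z))) y :=
        ((ContinuousLinearMap.fst ℝ ℝ Z).comp (ContinuousLinearMap.snd ℝ E (ℝ × Z))).hasFDerivAt
      have h3 := (h2.pow (k + 1)).smul h1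
      have h4 : HasFDerivAt φ _ y := h3.congr_of_eventuallyEq (by
        filter_upwards [hO.mem_nhds hy] with w hw using h w hw)
      simp only [Lr, h4.fderiv]
      simp [pow_succ, smul_smul, mul_comm, add_comm]) x hx hr
    rw [this, hr]
    simp [Nat.factorial_succ, smul_smul, mul_comm]

end Blow1

section Blow2
open MeasureTheory Set Filter Topology
variable {E Z W : Type} [NormedAddCommGroup E] [InnerProductSpace ℝ E] [FiniteDimensional ℝ E]
  [NormedAddCommGroup Z] [NormedSpace ℝ Z] [FiniteDimensional ℝ Z]
  [NormedAddCommGroup W] [NormedSpace ℝ W]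

/-- The tube downstairs. -/
def Dz (E Z : Type) [NormedAddCommGroup E] [NormedAddCommGroup Z] (δ : ℝ) : Set (E × Z) :=
  {x | ‖x.2‖ < δ}

/-- The tube upstairs. -/
def Oz (E Z : Type) [NormedAddCommGroup E] [NormedAddCommGroup Z] (δ : ℝ) : Set (E × (ℝ × Z)) :=
  {x | ‖x.2.2‖ < δ}

theorem Dz_open (δ : ℝ) : IsOpen (Dz E Z δ) := isOpen_lt (by fun_prop) (by fun_prop)
theorem Oz_open (δ : ℝ) : IsOpen (Oz E Z δ) := isOpen_lt (by fun_prop) (by fun_prop)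
theorem Om_sub_Oz (δ : ℝ) : Om E Z δ ⊆ Oz E Z δ := fun _ hx => hx.2.2.2

/-- Equality off the exceptional divisor extends to the divisor. -/
theorem ext_r {O : Set (E × (ℝ × Z))} (hO : IsOpen O) {φ ψ : E × (ℝ × Z) → W}
    (h1 : ContinuousOn φ O) (h2 : ContinuousOn ψ O) (h : ∀ x ∈ O, x.2.1 ≠ 0 → φ x = ψ x)
    (x) (hx : x ∈ O) : φ x = ψ x := by
  by_cases hr : x.2.1 = 0
  swap
  · exact h x hx hr
  have hc : Continuous fun t : ℝ => ((x.1, (t, x.2.2)) : E × (ℝ × Z)) := by fun_prop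
  have e : ((x.1, ((0:ℝ), x.2.2)) : E × (ℝ × Z)) = x := by rw [← hr]
  have ht : Tendsto (fun t : ℝ => ((x.1, (t, x.2.2)) : E × (ℝ × Z))) (𝓝[≠] 0) (𝓝 x) := by
    have := hc.tendsto 0
    rw [e] at this
    exact this.mono_left nhdsWithin_le_nhds
  have t1 := (h1.continuousAt (hO.mem_nhds hx)).tendsto.comp ht
  have t2 := (h2.continuousAt (hO.mem_nhds hx)).tendsto.comp ht
  refine tendsto_nhds_unique_of_eventuallyEq t1 t2 ?_
  filter_upwards [ht.eventually (hO.mem_nhds hx), self_mem_nhdsWithin] with t ht1 ht2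
  exact h _ ht1 ht2

theorem Lr_iter_clm {W' : Type} [NormedAddCommGroup W'] [NormedSpace ℝ W']
    {O : Set (E × (ℝ × Z))} (hO : IsOpen O) (L : W →L[ℝ] W') {φ : E × (ℝ × Z) → W}
    (hφ : ContDiffOn ℝ ∞ φ O) (k : ℕ) :
    ∀ x ∈ O, (Lr^[k] (fun x => L (φ x))) x = L ((Lr^[k] φ) x) := by
  induction k with
  | zero => intro x _; rfl
  | succ k ih =>
    intro x hx
    rw [Function.iterate_succ_apply', Function.iterate_succ_apply']
    have he : Lr^[k] (fun x => L (φ x)) =ᶠ[𝓝 x] fun y => L ((Lr^[k] φ) y) := by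
      filter_upwards [hO.mem_nhds hx] with y hy using ih y hy
    have hd : DifferentiableAt ℝ (Lr^[k] φ) x :=
      (((Lr_iter_contDiffOn hO hφ k).contDiffAt (hO.mem_nhds hx)).differentiableAt (by simp))
    unfold Lr at he hd ⊢
    rw [he.fderiv_eq]
    have := (L.hasFDerivAt.comp x hd.hasFDerivAt).fderiv
    change fderiv ℝ (L ∘ _) x _ = _
    rw [this]; rfl

theorem Lr_iter_deriv {δ : ℝ} {φ : E × (ℝ × Z) → W}
    (hφ : ContDiffOn ℝ ∞ φ (Oz E Z δ)) (k : ℕ) :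
    ∀ x ∈ Oz E Z δ, (Lr^[k] φ) x = iteratedDeriv k (fun r => φ (x.1, (r, x.2.2))) x.2.1 := by
  induction k with
  | zero => intro x _; simp
  | succ k ih =>
    intro x hx
    rw [Function.iterate_succ_apply', iteratedDeriv_succ]
    have hd : DifferentiableAt ℝ (Lr^[k] φ) x :=
      (((Lr_iter_contDiffOn (Oz_open δ) hφ k).contDiffAt
        ((Oz_open δ).mem_nhds hx)).differentiableAt (by simp))
    have e : iteratedDeriv k (fun r => φ (x.1, (r, x.2.2))) =
        fun r => (Lr^[k] φ) (x.1, (r, x.2.2)) := by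
      funext r
      rw [ih (x.1, (r, x.2.2)) hx]
    rw [e]
    have h2 : HasDerivAt (fun r : ℝ => ((x.1, (r, x.2.2)) : E × (ℝ × Z))) (0, (1, 0)) x.2.1 :=
      (hasDerivAt_const _ _).prodMk ((hasDerivAt_id _).prodMk (hasDerivAt_const _ _))
    exact (hd.hasFDerivAt.comp_hasDerivAt x.2.1 h2).deriv.symm

/-- The homogeneous part of degree `k`, up to a factor. -/
noncomputable def homp (k : ℕ) (g : E × Z → W) (x : E × Z) : W :=
  (k.factorial : ℝ)⁻¹ • (Lr^[k] (fun y => g (bl y))) (x.1, (0, x.2))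

theorem gbl_contDiffOn {δ : ℝ} {g : E × Z → W} (hg : ContDiffOn ℝ ∞ g (Dz E Z δ)) :
    ContDiffOn ℝ ∞ (fun y => g (bl y)) (Oz E Z δ) :=
  hg.comp bl_contDiff.contDiffOn fun _ hx => hx

theorem homp_contDiffOn {δ : ℝ} {k : ℕ} {g : E × Z → W} (hg : ContDiffOn ℝ ∞ g (Dz E Z δ)) :
    ContDiffOn ℝ ∞ (homp k g) (Dz E Z δ) := by
  have h1 := Lr_iter_contDiffOn (Oz_open δ) (gbl_contDiffOn hg) k
  have h2 : ContDiffOn ℝ ∞ (fun x : E × Z => ((x.1, ((0:ℝ), x.2)) : E × (ℝ × Z))) (Dz E Z δ) := by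
    fun_prop
  have h3 : ContDiffOn ℝ ∞ (fun x : E × Z => (Lr^[k] (fun y => g (bl y))) (x.1, ((0:ℝ), x.2)))
      (Dz E Z δ) := ContDiffOn.comp h1 h2 fun _ hx => hx
  exact h3.const_smul ((k.factorial : ℝ)⁻¹)

theorem homp_smul {δ : ℝ} {k : ℕ} {g : E × Z → W} (hg : ContDiffOn ℝ ∞ g (Dz E Z δ))
    (c : ℝ) (x : E × Z) (hx : x ∈ Dz E Z δ) : homp k g (c • x.1, x.2) = c ^ k • homp k g x := by
  unfold homp
  rw [Lr_iter_deriv (gbl_contDiffOn hg) k _ (by exact hx),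
    Lr_iter_deriv (gbl_contDiffOn hg) k _ (by exact hx)]
  simp only [bl]
  have e : (fun r : ℝ => g (r • c • x.1, x.2)) = fun r : ℝ => g ((c * r) • x.1, x.2) := by
    funext r; rw [smul_smul, mul_comm]
  have hs : ContDiff ℝ k (fun r : ℝ => g (r • x.1, x.2)) := by
    rw [← contDiffOn_univ]
    refine (hg.of_le (by exact_mod_cast le_top)).comp ?_ fun _ _ => hx
    fun_prop
  rw [e, iteratedDeriv_comp_const_smul hs c]
  simp only [mul_zero]
  rw [smul_comm]

end Blow2

section Blow3
open MeasureTheory Set Filter Topology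
variable {E Z W : Type} [NormedAddCommGroup E] [InnerProductSpace ℝ E] [FiniteDimensional ℝ E]
  [NormedAddCommGroup Z] [NormedSpace ℝ Z] [FiniteDimensional ℝ Z]
  [NormedAddCommGroup W] [NormedSpace ℝ W] [CompleteSpace W]

/-- The field data: smooth, vanishing on `y = 0`, `p = y + O(y²)`. -/
structure FieldData (δ : ℝ) (p : E × Z → E) (Ξ : E × Z → (E →L[ℝ] E) →L[ℝ] Z) : Prop where
  pos : 0 < δ
  hp : ContDiff ℝ ∞ p
  hX : ContDiff ℝ ∞ Ξ
  p0 : ∀ z, ‖z‖ < δ → p (0, z) = 0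
  X0 : ∀ z, ‖z‖ < δ → Ξ (0, z) = 0
  dp : ∀ z, ‖z‖ < δ → ∀ v, fderiv ℝ p (0, z) (v, 0) = v

/-- blown-up quotient -/
noncomputable def pt {F : Type} [NormedAddCommGroup F] [NormedSpace ℝ F]
    (p : E × Z → F) (x : E × (ℝ × Z)) : F := hadA p (bl x) x.1

theorem pt_contDiff {F : Type} [NormedAddCommGroup F] [NormedSpace ℝ F] [CompleteSpace F]
    {p : E × Z → F} (hp : ContDiff ℝ ∞ p) : ContDiff ℝ ∞ (pt p) := by
  have h1 : ContDiff ℝ ∞ (hadA p) :=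
    contDiff_iff_contDiffAt.2 fun x => hadA_contDiffAt p x fun s _ => hp.contDiffAt
  exact (h1.comp bl_contDiff).clm_apply contDiff_fst

theorem pt_spec {F : Type} [NormedAddCommGroup F] [NormedSpace ℝ F] [CompleteSpace F]
    {p : E × Z → F} (hp : ContDiff ℝ ∞ p) (x : E × (ℝ × Z)) (h0 : p (0, x.2.2) = 0) :
    p (bl x) = x.2.1 • pt p x := by
  have := hadA_spec p (x.2.1 • x.1) x.2.2 fun s _ => (hp.contDiffAt).of_le (by simp)
  rw [h0, sub_zero] at this
  rw [pt, ← map_smul]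
  exact this

theorem pt_zero {F : Type} [NormedAddCommGroup F] [NormedSpace ℝ F] [CompleteSpace F]
    (p : E × Z → F) (θ : E) (z : Z) : pt p (θ, (0, z)) = fderiv ℝ p (0, z) (θ, 0) := by
  unfold pt bl
  simp [hadA_zero]

/-- `B ↦ fderiv a x (B (p x), Ξ x B)` -/
noncomputable def Qf (p : E × Z → E) (Ξ : E × Z → (E →L[ℝ] E) →L[ℝ] Z) (a : E × Z → W) (x : E × Z) :
    (E →L[ℝ] E) →L[ℝ] W :=
  (fderiv ℝ a x).comp ((ContinuousLinearMap.apply ℝ E (p x)).prod (Ξ x))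

theorem Qf_apply (p : E × Z → E) (Ξ : E × Z → (E →L[ℝ] E) →L[ℝ] Z) (a : E × Z → W) (x : E × Z)
    (B : E →L[ℝ] E) : Qf p Ξ a x B = fderiv ℝ a x (B (p x), Ξ x B) := rfl

theorem Qf_contDiffOn {δ : ℝ} {p : E × Z → E} {Ξ : E × Z → (E →L[ℝ] E) →L[ℝ] Z}
    (hd : FieldData δ p Ξ) {a : E × Z → W} (ha : ContDiffOn ℝ ∞ a (Dz E Z δ)) :
    ContDiffOn ℝ ∞ (Qf p Ξ a) (Dz E Z δ) := by
  unfold Qf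
  refine (ha.fderiv_of_isOpen (Dz_open δ) (by simp)).clm_comp ?_
  have h1 : ContDiff ℝ ∞ fun x => ContinuousLinearMap.apply ℝ E (p x) :=
    contDiff_clm_apply_iff.2 fun B => B.contDiff.comp hd.hp
  have h2 : ContDiff ℝ ∞ fun x => (ContinuousLinearMap.apply ℝ E (p x)).prod (Ξ x) := by
    have : (fun x => (ContinuousLinearMap.apply ℝ E (p x)).prod (Ξ x)) = fun x =>
        (ContinuousLinearMap.inl ℝ E Z).comp (ContinuousLinearMap.apply ℝ E (p x)) +
        (ContinuousLinearMap.inr ℝ E Z).comp (Ξ x) := by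
      funext x; refine ContinuousLinearMap.ext fun B => ?_; simp
    rw [this]
    exact (contDiff_const.clm_comp h1).add (contDiff_const.clm_comp hd.hX)
  exact h2.contDiffOn

/-- key equation -/
theorem key_eq {δ : ℝ} {p : E × Z → E} {Ξ : E × Z → (E →L[ℝ] E) →L[ℝ] Z}
    (hd : FieldData δ p Ξ) {f a : E × Z → W} (ha : ContDiffOn ℝ ∞ a (Dz E Z δ))
    {k : ℕ} {G : E × (ℝ × Z) → W} (hG : OO δ k (f - a) G)
    (hinv : ∀ x ∈ Om E Z δ, x.2.1 ≠ 0 → ∀ B : E →L[ℝ] E, star B = -B →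
      fderiv ℝ f (bl x) (B (p (bl x)), Ξ (bl x) B) = 0)
    (θ : E) (z : Z) (hx : (θ, ((0:ℝ), z)) ∈ Om E Z δ) (B : E →L[ℝ] E) (hB : star B = -B) :
    fderiv ℝ G (θ, (0, z)) (B θ, (0, 0)) = - homp k (Qf p Ξ a) (θ, z) B := by
  set ψ : E × (ℝ × Z) → W := fun x => fderiv ℝ G x (B (pt p x), ((0:ℝ), x.2.1 • pt Ξ x B)) with hψd
  have hp1 := pt_contDiff hd.hp
  have hX1 := pt_contDiff hd.hX
  have hψ : ContDiffOn ℝ ∞ ψ (Om E Z δ) := by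
    refine (hG.1.fderiv_of_isOpen (Om_open δ) (by simp)).clm_apply (ContDiff.contDiffOn ?_)
    have : ContDiff ℝ ∞ fun x : E × (ℝ × Z) => pt Ξ x B := hX1.clm_apply contDiff_const
    have : ContDiff ℝ ∞ fun x : E × (ℝ × Z) => B (pt p x) := B.contDiff.comp hp1
    fun_prop
  have hQ := Qf_contDiffOn hd ha
  have hQb := (gbl_contDiffOn hQ).neg
  have hφ : ContDiffOn ℝ ∞ (fun x : E × (ℝ × Z) => -(Qf p Ξ a (bl x)) B) (Om E Z δ) :=
    ((gbl_contDiffOn hQ).mono (Om_sub_Oz δ)).clm_apply contDiffOn_const |>.neg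
  have heq : ∀ x ∈ Om E Z δ, -(Qf p Ξ a (bl x)) B = x.2.1 ^ k • ψ x := by
    refine ext_r (Om_open δ) hφ.continuousOn (ContDiffOn.continuousOn (n := ∞) (𝕜 := ℝ) ?_) ?_
    · have : ContDiff ℝ ∞ fun x : E × (ℝ × Z) => x.2.1 ^ k := by fun_prop
      exact this.contDiffOn.smul hψ
    · intro x hx hr
      have h1 := OO_hasFDerivAt hG hx hr
      have h2 : HasFDerivAt a (fderiv ℝ a (bl x)) (bl x) :=
        ((ha.contDiffAt ((Dz_open δ).mem_nhds hx.2.2.2)).differentiableAt (by simp)).hasFDerivAt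
      have h3 := h1.add h2
      rw [sub_add_cancel] at h3
      have h4 := hinv x hx hr B hB
      rw [h3.fderiv] at h4
      have e1 := pt_spec hd.hp x (hd.p0 _ hx.2.2.2)
      have e2 := pt_spec hd.hX x (hd.X0 _ hx.2.2.2)
      rw [Qf_apply, hψd]
      simp only [_root_.add_apply, _root_.smul_apply, ContinuousLinearMap.comp_apply,
        resc_apply] at h4
      rw [eq_comm, ← sub_eq_zero, sub_neg_eq_add, ← h4, e1, e2]
      simp only [map_smul, smul_smul, inv_mul_cancel₀ hr, one_smul, one_mul, _root_.smul_apply]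
  have h5 := Lr_iter_pow (Om_open δ) k hψ heq (θ, (0, z)) hx rfl
  have h6 := Lr_iter_clm (Oz_open δ) (-(ContinuousLinearMap.apply ℝ W B)) (gbl_contDiffOn hQ) k
    (θ, (0, z)) (Om_sub_Oz δ hx)
  have h7 : ψ (θ, (0, z)) = fderiv ℝ G (θ, (0, z)) (B θ, (0, 0)) := by
    rw [hψd]
    simp [pt_zero, hd.dp z hx.2.2.2]
  rw [← h7]
  have h8 : (k.factorial : ℝ) ≠ 0 := by exact_mod_cast k.factorial_ne_zero
  have h9 : ((k.factorial : ℝ)) • ψ (θ, (0, z)) =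
      (-(ContinuousLinearMap.apply ℝ W B)) ((Lr^[k] fun y => Qf p Ξ a (bl y)) (θ, (0, z))) := by
    rw [← h5, ← h6]; rfl
  have h10 : ψ (θ, (0, z)) = (k.factorial : ℝ)⁻¹ • ((k.factorial : ℝ) • ψ (θ, (0, z))) := by
    rw [smul_smul, inv_mul_cancel₀ h8, one_smul]
  rw [h10, h9]
  simp [homp]

end Blow3

section Blow4
open MeasureTheory Set Filter Topology
variable {E Z W : Type} [NormedAddCommGroup E] [InnerProductSpace ℝ E] [FiniteDimensional ℝ E]
  [NormedAddCommGroup Z] [NormedSpace ℝ Z] [FiniteDimensional ℝ Z]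
  [NormedAddCommGroup W] [NormedSpace ℝ W] [CompleteSpace W]

theorem restrict_full {X : Type} [MeasurableSpace X] {m : Measure X} {S : Set X} (hm : m Sᶜ = 0) :
    m.restrict S = m := Measure.restrict_eq_self_of_ae_mem (by rw [ae_iff]; exact hm)

theorem integral_full {X : Type} [MeasurableSpace X] {m : Measure X} {S : Set X} (hm : m Sᶜ = 0)
    {f g : X → W} (h : ∀ x ∈ S, f x = g x) : ∫ x, f x ∂m = ∫ x, g x ∂m := by
  refine integral_congr_ae ?_
  have : ∀ᵐ x ∂m, x ∈ S := by rw [ae_iff]; exact hm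
  filter_upwards [this] with x hx using h x hx

theorem G_homog {δ : ℝ} {k : ℕ} {h : E × Z → W} {G : E × (ℝ × Z) → W} (hG : OO δ k h G)
    (θ : E) (z : Z) (c : ℝ) (_hc : c ≠ 0) (h1 : (θ, ((0:ℝ), z)) ∈ Om E Z δ)
    (h2 : (c • θ, ((0:ℝ), z)) ∈ Om E Z δ) : G (c • θ, (0, z)) = c ^ k • G (θ, (0, z)) := by
  have hO := Om_open (E := E) (Z := Z) δ
  have t1 : Tendsto (fun t : ℝ => ((c • θ, (t, z)) : E × (ℝ × Z))) (𝓝[≠] 0) (𝓝 (c • θ, (0, z))) :=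
    ((by fun_prop : Continuous fun t : ℝ => ((c • θ, (t, z)) : E × (ℝ × Z))).tendsto 0).mono_left
      nhdsWithin_le_nhds
  have t2 : Tendsto (fun t : ℝ => ((θ, (c * t, z)) : E × (ℝ × Z))) (𝓝[≠] 0) (𝓝 (θ, (0, z))) := by
    have := ((by fun_prop : Continuous fun t : ℝ => ((θ, (c * t, z)) : E × (ℝ × Z))).tendsto 0)
    rw [mul_zero] at this
    exact this.mono_left nhdsWithin_le_nhds
  have u1 := (hG.1.continuousOn.continuousAt (hO.mem_nhds h2)).tendsto.comp t1
  have u2 := ((hG.1.continuousOn.continuousAt (hO.mem_nhds h1)).tendsto.comp t2).const_smul (c ^ k)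
  refine tendsto_nhds_unique_of_eventuallyEq u1 u2 ?_
  filter_upwards [t1.eventually (hO.mem_nhds h2), t2.eventually (hO.mem_nhds h1),
    self_mem_nhdsWithin] with t a1 a2 a3
  have e1 := hG.2 (c • θ, (t, z)) a1
  have e2 := hG.2 (θ, (c * t, z)) a2
  have e3 : bl ((c • θ, (t, z)) : E × (ℝ × Z)) = bl (θ, (c * t, z)) := by
    simp only [bl, smul_smul, mul_comm]
  rw [e3, e2] at e1
  have a4 : t ^ k ≠ 0 := pow_ne_zero _ a3
  simp only [Function.comp, mul_pow] at e1 ⊢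
  have e4 : t ^ k • (c ^ k • G (θ, (c * t, z))) = t ^ k • G (c • θ, (t, z)) := by
    rw [← e1, smul_smul, mul_comm]
  exact (smul_right_injective W a4 e4).symm

theorem step_A {δ : ℝ} {p : E × Z → E} {Ξ : E × Z → (E →L[ℝ] E) →L[ℝ] Z}
    (hd : FieldData δ p Ξ) (hdim : 1 < Module.rank ℝ E)
    {f a : E × Z → W} (ha : ContDiffOn ℝ ∞ a (Dz E Z δ))
    {k : ℕ} {G : E × (ℝ × Z) → W} (hG : OO δ k (f - a) G)
    (hinv : ∀ x ∈ Om E Z δ, x.2.1 ≠ 0 → ∀ B : E →L[ℝ] E, star B = -B →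
      fderiv ℝ f (bl x) (B (p (bl x)), Ξ (bl x) B) = 0) :
    ∃ A : E × Z → W, ContDiffOn ℝ ∞ A (Dz E Z δ) ∧ 
      ∀ x ∈ Om E Z δ, A (bl x) = x.2.1 ^ k • G (x.1, (0, x.2.2)) := by
  haveI : Nontrivial E := by
    rw [← rank_pos_iff_nontrivial (R := ℝ)]
    exact lt_trans zero_lt_one hdim
  obtain ⟨μ, ν, C, hμ, hν, hμs, hνs, hrep, hinvt⟩ := haar_avg hdim
  obtain ⟨e, he⟩ : ∃ e : E, ‖e‖ = 1 := by
    obtain ⟨θ, h, -⟩ := unit_lift (0 : E); exact ⟨θ, h⟩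
  have hmem : ∀ z : Z, ‖z‖ < δ → ∀ θ : E, ‖θ‖ = 1 → (θ, ((0:ℝ), z)) ∈ Om E Z δ := by
    intro z hz θ hθ
    refine ⟨?_, ?_, by simpa using hd.pos, hz⟩ <;> simp only [hθ] <;> norm_num
  have hO := Om_open (E := E) (Z := Z) δ
  set qq := homp k (Qf p Ξ a) with hqq
  have hqs : ContDiffOn ℝ ∞ qq (Dz E Z δ) := homp_contDiffOn (Qf_contDiffOn hd ha)
  have hqh : ∀ (c : ℝ) (x : E × Z), x ∈ Dz E Z δ → qq (c • x.1, x.2) = c ^ k • qq x :=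
    homp_smul (Qf_contDiffOn hd ha)
  set c : Z → W := fun z => ∫ κ, G (κ e, (0, z)) ∂μ with hc
  set I : E × Z → W := fun x => ∫ b, qq (b.1 x.1, x.2) b.2 ∂ν with hI
  have hcs : ∀ z : Z, ‖z‖ < δ → ContDiffAt ℝ ∞ c z := by
    intro z hz
    have := contDiffAt_integral μ unitary_compact (fun y : Z × (E →L[ℝ] E) => G (y.2 e, (0, y.1))) z
      (by
        intro κ hκ
        have h1 : ContDiffAt ℝ ∞ G (κ e, ((0:ℝ), z)) := hG.1.contDiffAt (hO.mem_nhds (hmem z hz _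
          (by rw [ContinuousLinearMap.norm_map_of_mem_unitary hκ, he])))
        exact ContDiffAt.comp (z, κ) (g := G)
          (f := fun y : Z × (E →L[ℝ] E) => ((y.2 e, ((0:ℝ), y.1)) : E × (ℝ × Z))) h1 (by fun_prop))
    rw [restrict_full hμs] at this
    exact this
  have hIs : ContDiffOn ℝ ∞ I (Dz E Z δ) := by
    intro x hx
    refine ContDiffAt.contDiffWithinAt ?_
    have := contDiffAt_integral ν (S2_compact C) (fun y : (E × Z) × ((E →L[ℝ] E) × (E →L[ℝ] E)) =>
      qq (y.2.1 y.1.1, y.1.2) y.2.2) x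
      (by
        intro κ hκ
        have h1 : ContDiffAt ℝ ∞ qq (κ.1 x.1, x.2) := hqs.contDiffAt ((Dz_open δ).mem_nhds hx)
        have h2 : ContDiffAt ℝ ∞ (fun y : (E × Z) × ((E →L[ℝ] E) × (E →L[ℝ] E)) =>
            qq (y.2.1 y.1.1, y.1.2)) (x, κ) :=
          ContDiffAt.comp (x, κ) (g := qq)
            (f := fun y : (E × Z) × ((E →L[ℝ] E) × (E →L[ℝ] E)) => (y.2.1 y.1.1, y.1.2)) h1
            (by fun_prop)
        exact h2.clm_apply (by fun_prop))
    rw [restrict_full hνs] at this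
    exact this
  have hIh : ∀ (t : ℝ) (x : E × Z), x ∈ Dz E Z δ → I (t • x.1, x.2) = t ^ k • I x := by
    intro t x hx
    simp only [hI]
    rw [← integral_smul]
    congr 1
    funext b
    rw [map_smul, hqh t (b.1 x.1, x.2) hx]; rfl
  have hunit : ∀ z : Z, ‖z‖ < δ → ∀ θ : E, ‖θ‖ = 1 → G (θ, (0, z)) = c z + I (θ, z) := by
    intro z hz θ hθ
    have hfd : ∀ y' : E, ‖y'‖ = ‖θ‖ → HasFDerivAt (fun y => G (y, (0, z)))
        ((fderiv ℝ G (y', (0, z))).comp (ContinuousLinearMap.inl ℝ E (ℝ × Z))) y' := by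
      intro y' hy'
      have h1 : HasFDerivAt G (fderiv ℝ G (y', (0, z))) (y', (0, z)) :=
        ((hG.1.contDiffAt (hO.mem_nhds (hmem z hz y' (by rw [hy', hθ])))).differentiableAt
          (by simp)).hasFDerivAt
      exact h1.comp y' (hasFDerivAt_prodMk_left y' ((0:ℝ), z))
    have hcont : ContinuousOn (fun y' : E => (fderiv ℝ G (y', (0, z))).comp
        (ContinuousLinearMap.inl ℝ E (ℝ × Z))) {y' | ‖y'‖ = ‖θ‖} := by
      have h1 : ContinuousOn (fderiv ℝ G) (Om E Z δ) :=
        (hG.1.fderiv_of_isOpen (m := ∞) hO (by simp)).continuousOn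
      have h2 : ContinuousOn (fun y' : E => fderiv ℝ G (y', ((0:ℝ), z))) {y' | ‖y'‖ = ‖θ‖} :=
        h1.comp (by fun_prop) fun y' hy' => hmem z hz y' (by rw [hy', hθ])
      exact h2.clm_comp continuousOn_const
    have h1 := hrep W (fun y => G (y, (0, z))) _ θ hfd hcont
    have hGc : ContinuousOn (fun y => G (y, ((0:ℝ), z))) {y' | ‖y'‖ = ‖θ‖} := fun y hy =>
      (hfd y hy).continuousAt.continuousWithinAt
    rw [integral_sub (integ_of unitary_compact hμs (orb_contOn hGc)) (integrable_const _)] at h1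
    have h2 := hinvt W (fun y => G (y, (0, z))) θ e (by rw [hθ, he]) hGc
    have h3 : ∫ b, ((fderiv ℝ G (b.1 θ, (0, z))).comp (ContinuousLinearMap.inl ℝ E (ℝ × Z)))
        (b.2 (b.1 θ)) ∂ν = - I (θ, z) := by
      rw [hI]; simp only
      rw [← integral_neg]
      refine integral_full hνs fun b hb => ?_
      exact key_eq hd ha hG hinv (b.1 θ) z (hmem z hz _
        (by rw [ContinuousLinearMap.norm_map_of_mem_unitary hb.1, hθ])) b.2 hb.2.1
    rw [h3, h2] at h1
    simp only [integral_const, probReal_univ, one_smul] at h1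
    have h4 : c z = ∫ κ, G (κ e, (0, z)) ∂μ := rfl
    rw [← h4] at h1
    have : G (θ, (0, z)) = c z - (c z - G (θ, (0, z))) := by abel
    rw [this, h1, sub_neg_eq_add]
  have hodd : ¬ Even k → ∀ z : Z, ‖z‖ < δ → c z = 0 := by
    intro hk z hz
    have hGc : ContinuousOn (fun y => G (y, ((0:ℝ), z))) {y' | ‖y'‖ = ‖e‖} := fun y hy =>
      (ContinuousAt.comp (g := G) (f := fun y : E => (y, ((0:ℝ), z)))
        (hG.1.continuousOn.continuousAt (hO.mem_nhds (hmem z hz y (by rw [hy, he]))))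
        (by fun_prop)).continuousWithinAt
    have h1 := hinvt W (fun y => G (y, (0, z))) e (-e) (by simp) hGc
    have h2 : ∫ κ : E →L[ℝ] E, G (κ (-e), (0, z)) ∂μ = - c z := by
      rw [hc]; simp only
      rw [← integral_neg]
      refine integral_full hμs fun κ hκ => ?_
      have n1 : ‖κ e‖ = 1 := by rw [ContinuousLinearMap.norm_map_of_mem_unitary hκ, he]
      have := G_homog hG (κ e) z (-1) (by norm_num) (hmem z hz _ n1)
        (hmem z hz _ (by simpa using n1))
      rw [(Nat.not_even_iff_odd.1 hk).neg_one_pow] at this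
      simpa using this
    rw [h2] at h1
    have h1' : c z = - c z := h1
    have h3 : (2:ℝ) • c z = 0 := by
      rw [two_smul]; nth_rewrite 1 [h1']; exact neg_add_cancel _
    exact (smul_eq_zero.1 h3).resolve_left (by norm_num)
  set S : E × Z → W := fun x => if Even k then (‖x.1‖ ^ 2) ^ (k / 2) • c x.2 else 0 with hS
  have hSs : ContDiffOn ℝ ∞ S (Dz E Z δ) := by
    rw [hS]
    by_cases hk : Even k
    · simp only [hk, if_true]
      refine ContDiffOn.smul ?_ ?_
      · exact (((contDiff_norm_sq ℝ).comp contDiff_fst).pow _).contDiffOn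
      · intro x hx
        exact ((hcs x.2 hx).comp x contDiffAt_snd).contDiffWithinAt
    · simp only [hk, if_false]; exact contDiffOn_const
  have hSh : ∀ (t : ℝ) (x : E × Z), S (t • x.1, x.2) = t ^ k • S x := by
    intro t x
    rw [hS]
    by_cases hk : Even k
    · simp only [hk, if_true]
      obtain ⟨j, hj⟩ := hk
      have : k / 2 = j := by omega
      rw [this, norm_smul, smul_smul, hj]
      congr 1
      rw [mul_pow, mul_pow, Real.norm_eq_abs, sq_abs, ← pow_mul]
      congr 2; ring
    · simp only [hk, if_false, smul_zero]
  have hSu : ∀ z : Z, ‖z‖ < δ → ∀ θ : E, ‖θ‖ = 1 → S (θ, z) = c z := by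
    intro z hz θ hθ
    rw [hS]
    by_cases hk : Even k
    · simp [hk, hθ]
    · simp [hk, hodd hk z hz]
  refine ⟨fun x => S x + I x, hSs.add hIs, ?_⟩
  intro x hx
  have hxz : ‖x.2.2‖ < δ := hx.2.2.2
  have hx0 : (x.1, ((0:ℝ), x.2.2)) ∈ Om E Z δ := ⟨hx.1, hx.2.1, by simpa using hd.pos, hxz⟩
  obtain ⟨u, hu1, hu2⟩ := unit_lift x.1
  have hn : ‖x.1‖ ≠ 0 := by have := hx.1; linarith
  have h1 := G_homog hG u x.2.2 ‖x.1‖ hn (hmem _ hxz u hu1) (by rw [hu2]; exact hx0)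
  rw [hu2, hunit _ hxz u hu1, ← hSu _ hxz u hu1] at h1
  have e1 : bl x = (x.2.1 • ((x.1, x.2.2) : E × Z).1, ((x.1, x.2.2) : E × Z).2) := rfl
  have e2 : ((x.1, x.2.2) : E × Z) = (‖x.1‖ • ((u, x.2.2) : E × Z).1, ((u, x.2.2) : E × Z).2) := by
    simp [hu2]
  rw [h1, e1]
  simp only
  have a1 := hSh x.2.1 (x.1, x.2.2)
  have a2 := hIh x.2.1 (x.1, x.2.2) hxz
  have b1 := hSh ‖x.1‖ (u, x.2.2)
  have b2 := hIh ‖x.1‖ (u, x.2.2) hxz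
  simp only [hu2] at a1 a2 b1 b2
  rw [a1, a2, b1, b2, smul_add, smul_add]

theorem blow_ind {δ : ℝ} {p : E × Z → E} {Ξ : E × Z → (E →L[ℝ] E) →L[ℝ] Z}
    (hd : FieldData δ p Ξ) (hdim : 1 < Module.rank ℝ E)
    {f : E × Z → W} {G : E × (ℝ × Z) → W} (hG : OO δ 0 f G)
    (hinv : ∀ x ∈ Om E Z δ, x.2.1 ≠ 0 → ∀ B : E →L[ℝ] E, star B = -B →
      fderiv ℝ f (bl x) (B (p (bl x)), Ξ (bl x) B) = 0) (k : ℕ) :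
    ∃ a : E × Z → W, ContDiffOn ℝ ∞ a (Dz E Z δ) ∧ ∃ G, OO δ k (f - a) G := by
  induction k with
  | zero => exact ⟨0, contDiffOn_const, G, by simpa using hG⟩
  | succ k ih =>
    obtain ⟨a, ha, G, hG⟩ := ih
    obtain ⟨A, hA, hAG⟩ := step_A hd hdim ha hG hinv
    set g : ℝ × (E × Z) → W := fun y => G (y.2.1, (y.1, y.2.2)) with hg
    have hgs : ∀ x ∈ Om E Z δ, ∀ s ∈ Icc (0:ℝ) 1, ContDiffAt ℝ ∞ g (s • x.2.1, (x.1, x.2.2)) := by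
      intro x hx s hs
      have hm : (x.1, (s • x.2.1, x.2.2)) ∈ Om E Z δ := by
        refine ⟨hx.1, hx.2.1, ?_, hx.2.2.2⟩
        rw [smul_eq_mul, abs_mul, abs_of_nonneg hs.1]
        have := hx.2.2.1
        have := abs_nonneg x.2.1
        nlinarith [hs.1, hs.2]
      have h1 := hG.1.contDiffAt ((Om_open δ).mem_nhds hm)
      exact ContDiffAt.comp (s • x.2.1, (x.1, x.2.2)) (g := G)
        (f := fun y : ℝ × (E × Z) => ((y.2.1, (y.1, y.2.2)) : E × (ℝ × Z))) h1 (by fun_prop)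
    refine ⟨a + A, ha.add hA, fun x => hadA g (x.2.1, (x.1, x.2.2)) 1, ?_, ?_⟩
    · intro x hx
      refine ContDiffAt.contDiffWithinAt ?_
      have h1 := hadA_contDiffAt g (x.2.1, (x.1, x.2.2)) (hgs x hx)
      have h2 : ContDiffAt ℝ ∞ (fun x : E × (ℝ × Z) => hadA g (x.2.1, (x.1, x.2.2))) x :=
        ContDiffAt.comp x (g := hadA g) (f := fun x : E × (ℝ × Z) => (x.2.1, (x.1, x.2.2))) h1
          (by fun_prop)
      exact h2.clm_apply contDiffAt_const
    · intro x hx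
      have h1 := hadA_spec g x.2.1 (x.1, x.2.2) fun s hs => (hgs x hx s hs).of_le (by simp)
      have h2 : hadA g (x.2.1, (x.1, x.2.2)) x.2.1 = x.2.1 • hadA g (x.2.1, (x.1, x.2.2)) 1 := by
        rw [← map_smul, smul_eq_mul, mul_one]
      rw [pow_succ, mul_smul, ← h2, ← h1, smul_sub]
      have h3 := hG.2 x hx
      have h4 := hAG x hx
      simp only [Pi.sub_apply, Pi.add_apply] at h3 ⊢
      rw [h4, ← sub_sub, h3]

/-- **Blow-down theorem.** -/
theorem blow_down {δ : ℝ} {p : E × Z → E} {Ξ : E × Z → (E →L[ℝ] E) →L[ℝ] Z}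
    (hd : FieldData δ p Ξ) (hdim : 1 < Module.rank ℝ E)
    {f : E × Z → W} {G : E × (ℝ × Z) → W} (hG : OO δ 0 f G)
    (hinv : ∀ x ∈ Om E Z δ, x.2.1 ≠ 0 → ∀ B : E →L[ℝ] E, star B = -B →
      fderiv ℝ f (bl x) (B (p (bl x)), Ξ (bl x) B) = 0) : ContDiffOn ℝ ∞ f (Vd E Z δ) := by
  haveI : Nontrivial E := by
    rw [← rank_pos_iff_nontrivial (R := ℝ)]
    exact lt_trans zero_lt_one hdim
  rw [contDiffOn_infty]
  intro K
  obtain ⟨a, ha, G', hG'⟩ := blow_ind hd hdim hG hinv (K + 1)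
  have h1 := OO_contDiffOn K hG'
  have h2 : ContDiffOn ℝ K a (Vd E Z δ) :=
    (ha.of_le (by exact_mod_cast le_top)).mono fun x hx => hx.2
  have := h1.add h2
  simpa using this

end Blow4

section FF1
open MeasureTheory Set Filter Topology
variable {E Z W : Type} [NormedAddCommGroup E] [InnerProductSpace ℝ E] [FiniteDimensional ℝ E]
  [NormedAddCommGroup Z] [NormedSpace ℝ Z] [FiniteDimensional ℝ Z]
  [NormedAddCommGroup W] [NormedSpace ℝ W]

/-- The skew endomorphism `y ↦ ⟨p,y⟩u − ⟨u,y⟩p`. -/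
noncomputable def wedge (u p : E) : E →L[ℝ] E :=
  (innerSL ℝ p).smulRight u - (innerSL ℝ u).smulRight p

theorem wedge_apply (u p y : E) : wedge u p y = inner ℝ p y • u - inner ℝ u y • p := by
  simp [wedge]

theorem wedge_skew (u p : E) : star (wedge u p) = - wedge u p := by
  rw [ContinuousLinearMap.star_eq_adjoint, eq_comm, ContinuousLinearMap.eq_adjoint_iff]
  intro x y
  simp only [_root_.neg_apply, wedge_apply, inner_neg_left, inner_sub_left, inner_sub_right,
    inner_smul_left, inner_smul_right]
  rw [real_inner_comm x u, real_inner_comm x p]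
  simp; ring

theorem wedge_add (u v p : E) : wedge (u + v) p = wedge u p + wedge v p := by
  refine ContinuousLinearMap.ext fun y => ?_
  simp only [_root_.add_apply, wedge_apply, inner_add_left, smul_add, add_smul]; abel

theorem wedge_smul (c : ℝ) (u p : E) : wedge (c • u) p = c • wedge u p := by
  refine ContinuousLinearMap.ext fun y => ?_
  simp only [_root_.smul_apply, wedge_apply, real_inner_smul_left, smul_sub, smul_smul, mul_comm]

theorem wedge_neg_neg (u p : E) : wedge (-u) (-p) = wedge u p := by
  refine ContinuousLinearMap.ext fun y => ?_
  simp [wedge_apply]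

theorem wedge_zero (p : E) : wedge 0 p = 0 := by
  refine ContinuousLinearMap.ext fun y => ?_
  simp [wedge_apply]

theorem skew_inner {B : E →L[ℝ] E} (hB : star B = -B) (v : E) : inner ℝ v (B v) = 0 := by
  have h := ContinuousLinearMap.adjoint_inner_left B v v
  rw [← ContinuousLinearMap.star_eq_adjoint, hB, _root_.neg_apply, inner_neg_left,
    real_inner_comm] at h
  linarith

/-- Integrability data: local first integrals away from `y = 0`. -/
def Integ (T' : Type) [NormedAddCommGroup T'] [NormedSpace ℝ T'] (δ : ℝ) (p : E × Z → E)
    (Ξ : E × Z → (E →L[ℝ] E) →L[ℝ] Z) : Prop :=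
  ∀ x ∈ Vd E Z δ, p x ≠ 0 → ∃ (g : E × Z → T') (N : Set (E × Z)), IsOpen N ∧ x ∈ N ∧
    ContDiffOn ℝ ∞ g N ∧ (∀ x' ∈ N, ∀ B : E →L[ℝ] E, star B = -B →
      fderiv ℝ g x' (B (p x'), Ξ x' B) = 0) ∧
    (∀ v, fderiv ℝ g x v = 0 → inner ℝ (p x) v.1 = 0) ∧
    (∀ ζ, fderiv ℝ g x (0, ζ) = 0 → ζ = 0)

/-- projection along `θ` onto the complement of `pt`. -/
noncomputable def uu (p : E × Z → E) (x : E × (ℝ × Z)) (v : E) : E :=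
  v - (inner ℝ (pt p x) v / inner ℝ (pt p x) x.1) • x.1

/-- The connection upstairs. -/
noncomputable def Gam (p : E × Z → E) (Ξ : E × Z → (E →L[ℝ] E) →L[ℝ] Z) (x : E × (ℝ × Z)) :
    E →L[ℝ] ℝ × Z :=
  LinearMap.toContinuousLinearMap
    { toFun := fun v => (-x.2.1 * (inner ℝ (pt p x) v / inner ℝ (pt p x) x.1),
        (x.2.1 * (‖pt p x‖ ^ 2)⁻¹) • pt Ξ x (wedge (uu p x v) (pt p x)))
      map_add' := by
        intro v w
        have : uu p x (v + w) = uu p x v + uu p x w := by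
          simp only [uu, inner_add_right, add_div, add_smul]; abel
        rw [this, wedge_add, map_add, inner_add_right]
        ext
        · simp; ring
        · simp
      map_smul' := by
        intro c v
        have : uu p x (c • v) = c • uu p x v := by
          simp only [uu, inner_smul_right, smul_sub, smul_smul, mul_div_assoc]
        rw [this, wedge_smul, map_smul, inner_smul_right]
        ext
        · simp; ring
        · simp [smul_smul, mul_comm] }

theorem Gam_apply (p : E × Z → E) (Ξ : E × Z → (E →L[ℝ] E) →L[ℝ] Z) (x : E × (ℝ × Z)) (v : E) :
    Gam p Ξ x v = (-x.2.1 * (inner ℝ (pt p x) v / inner ℝ (pt p x) x.1),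
        (x.2.1 * (‖pt p x‖ ^ 2)⁻¹) • pt Ξ x (wedge (uu p x v) (pt p x))) := rfl

theorem Gam_zero (p : E × Z → E) (Ξ : E × Z → (E →L[ℝ] E) →L[ℝ] Z) (x : E × (ℝ × Z))
    (h : x.2.1 = 0) : Gam p Ξ x = 0 := by
  refine ContinuousLinearMap.ext fun v => ?_
  rw [Gam_apply, h]; simp

/-- domain of the connection -/
def Og (δ : ℝ) (p : E × Z → E) : Set (E × (ℝ × Z)) :=
  {x | ‖x.2.1 • x.1‖ < δ ∧ ‖x.2.2‖ < δ ∧ 0 < inner ℝ (pt p x) x.1}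

theorem Og_open {δ : ℝ} {p : E × Z → E} {Ξ : E × Z → (E →L[ℝ] E) →L[ℝ] Z}
    (hd : FieldData δ p Ξ) : IsOpen (Og δ p) := by
  have hc : Continuous (pt p) := (pt_contDiff hd.hp).continuous
  have c1 : IsOpen {x : E × (ℝ × Z) | ‖x.2.1 • x.1‖ < δ} := isOpen_lt (by fun_prop) (by fun_prop)
  have c2 : IsOpen {x : E × (ℝ × Z) | ‖x.2.2‖ < δ} := isOpen_lt (by fun_prop) (by fun_prop)
  have c3 : IsOpen {x : E × (ℝ × Z) | 0 < inner ℝ (pt p x) x.1} :=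
    isOpen_lt (by fun_prop) (by fun_prop)
  exact c1.inter (c2.inter c3)

theorem Gam_contDiffOn {δ : ℝ} {p : E × Z → E} {Ξ : E × Z → (E →L[ℝ] E) →L[ℝ] Z}
    (hd : FieldData δ p Ξ) : ContDiffOn ℝ ∞ (Gam p Ξ) (Og δ p) := by
  have h1 : ContDiffOn ℝ ∞ (pt p) (Og δ p) := (pt_contDiff hd.hp).contDiffOn
  have h2 : ContDiffOn ℝ ∞ (pt Ξ) (Og δ p) := (pt_contDiff hd.hX).contDiffOn
  rw [contDiffOn_clm_apply]
  intro v
  have hc : ContDiffOn ℝ ∞ (fun x => inner ℝ (pt p x) v / inner ℝ (pt p x) x.1) (Og δ p) := by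
    refine ContDiffOn.div (h1.inner ℝ contDiffOn_const) (h1.inner ℝ contDiffOn_fst) ?_
    intro x hx; exact hx.2.2.ne'
  have hu : ContDiffOn ℝ ∞ (fun x => uu p x v) (Og δ p) := by
    unfold uu; exact contDiffOn_const.sub (hc.smul contDiffOn_fst)
  have hw : ContDiffOn ℝ ∞ (fun x => wedge (uu p x v) (pt p x)) (Og δ p) := by
    rw [contDiffOn_clm_apply]
    intro y
    simp only [wedge_apply]
    exact ((h1.inner ℝ contDiffOn_const).smul hu).sub ((hu.inner ℝ contDiffOn_const).smul h1)
  have hn : ContDiffOn ℝ ∞ (fun x => (‖pt p x‖ ^ 2)⁻¹) (Og δ p) := by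
    refine ContDiffOn.inv (h1.norm_sq ℝ) ?_
    intro x hx h0
    have : pt p x = 0 := by simpa using h0
    have h3 := hx.2.2
    rw [this] at h3; simp at h3
  have hr : ContDiffOn ℝ ∞ (fun x : E × (ℝ × Z) => x.2.1) (Og δ p) := by fun_prop
  simp only [Gam_apply]
  exact (hr.neg.mul hc).prodMk ((hr.mul hn).smul (h2.clm_apply hw))

theorem Og_zero {δ : ℝ} {p : E × Z → E} {Ξ : E × Z → (E →L[ℝ] E) →L[ℝ] Z}
    (hd : FieldData δ p Ξ) (θ : E) (hθ : θ ≠ 0) (z : Z) (hz : ‖z‖ < δ) :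
    (θ, ((0:ℝ), z)) ∈ Og δ p := by
  refine ⟨by simpa using hd.pos, hz, ?_⟩
  rw [pt_zero, hd.dp z hz]
  rw [real_inner_self_eq_norm_sq]
  have := norm_pos_iff.2 hθ
  positivity

/-- derivative of `bl` -/
theorem bl_hasFDerivAt (x : E × (ℝ × Z)) : HasFDerivAt (bl : E × (ℝ × Z) → E × Z)
    (fderiv ℝ bl x) x := ((bl_contDiff.differentiable (by simp)) x).hasFDerivAt

theorem bl_fderiv (x v : E × (ℝ × Z)) :
    fderiv ℝ (bl : E × (ℝ × Z) → E × Z) x v = (x.2.1 • v.1 + v.2.1 • x.1, v.2.2) := by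
  have h1 : HasFDerivAt (fun x : E × (ℝ × Z) => x.2.1)
      ((ContinuousLinearMap.fst ℝ ℝ Z).comp (ContinuousLinearMap.snd ℝ E (ℝ × Z))) x :=
    ((ContinuousLinearMap.fst ℝ ℝ Z).comp (ContinuousLinearMap.snd ℝ E (ℝ × Z))).hasFDerivAt
  have h2 : HasFDerivAt (fun x : E × (ℝ × Z) => x.2.2)
      ((ContinuousLinearMap.snd ℝ ℝ Z).comp (ContinuousLinearMap.snd ℝ E (ℝ × Z))) x :=
    ((ContinuousLinearMap.snd ℝ ℝ Z).comp (ContinuousLinearMap.snd ℝ E (ℝ × Z))).hasFDerivAt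
  have h3 : HasFDerivAt (fun x : E × (ℝ × Z) => x.1) (ContinuousLinearMap.fst ℝ E (ℝ × Z)) x :=
    (ContinuousLinearMap.fst ℝ E (ℝ × Z)).hasFDerivAt
  have h4 : HasFDerivAt (bl : E × (ℝ × Z) → E × Z) _ x := (h1.smul h3).prodMk h2
  rw [h4.fderiv]
  simp

/-- `Dβ(v, Γv)` is one of the fields. -/
theorem bl_Gam {δ : ℝ} {p : E × Z → E} {Ξ : E × Z → (E →L[ℝ] E) →L[ℝ] Z}
    (hd : FieldData δ p Ξ) {x : E × (ℝ × Z)} (hx : x ∈ Og δ p) (v : E) :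
    ∃ B : E →L[ℝ] E, star B = -B ∧
      fderiv ℝ (bl : E × (ℝ × Z) → E × Z) x (v, Gam p Ξ x v) = (B (p (bl x)), Ξ (bl x) B) := by
  have hc := hx.2.2
  have hp : ‖pt p x‖ ^ 2 ≠ 0 := by
    intro h0
    have : pt p x = 0 := by simpa using h0
    rw [this] at hc; simp at hc
  refine ⟨(‖pt p x‖ ^ 2)⁻¹ • wedge (uu p x v) (pt p x), ?_, ?_⟩
  · rw [star_smul, wedge_skew]; simp
  · have e1 := pt_spec hd.hp x (hd.p0 _ hx.2.1)
    have e2 := pt_spec hd.hX x (hd.X0 _ hx.2.1)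
    rw [bl_fderiv, e1, e2, Gam_apply]
    have e3 : inner ℝ (uu p x v) (pt p x) = 0 := by
      rw [uu, inner_sub_left, real_inner_smul_left, real_inner_comm, real_inner_comm (pt p x) x.1]
      field_simp; ring
    ext
    · simp only [map_smul, _root_.smul_apply, wedge_apply, e3, real_inner_self_eq_norm_sq]
      rw [zero_smul, sub_zero, smul_smul (‖pt p x‖ ^ 2)⁻¹, inv_mul_cancel₀ hp, one_smul, uu,
        smul_sub, smul_smul, sub_eq_add_neg, ← neg_smul]
      congr 2; ring
    · simp only [map_smul, _root_.smul_apply, smul_smul]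
      congr 1; ring

end FF1

section FF2
open MeasureTheory Set Filter Topology
variable {E Z T' : Type} [NormedAddCommGroup E] [InnerProductSpace ℝ E] [FiniteDimensional ℝ E]
  [NormedAddCommGroup Z] [NormedSpace ℝ Z] [FiniteDimensional ℝ Z]
  [NormedAddCommGroup T'] [NormedSpace ℝ T']

/-- A local first integral with transversal injectivity forces flatness at a point. -/
theorem flat_of_integral {T : Type} [NormedAddCommGroup T] [NormedSpace ℝ T]
    {Γ : E × T → E →L[ℝ] T} {G : E × T → T'} {M : Set (E × T)} (hM : IsOpen M) {x : E × T}
    (hx : x ∈ M) (hΓ : ContDiffOn ℝ ∞ Γ M) (hG : ContDiffOn ℝ ∞ G M)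
    (h0 : ∀ x' ∈ M, ∀ v, fderiv ℝ G x' (v, Γ x' v) = 0)
    (hinj : ∀ τ, fderiv ℝ G x (0, τ) = 0 → τ = 0) (v w : E) :
    (fderiv ℝ Γ x (v, Γ x v)) w = (fderiv ℝ Γ x (w, Γ x w)) v := by
  have hn := hM.mem_nhds hx
  have hΓ' : HasFDerivAt Γ (fderiv ℝ Γ x) x :=
    ((hΓ.contDiffAt hn).differentiableAt (by simp)).hasFDerivAt
  have hG' : HasFDerivAt (fderiv ℝ G) (fderiv ℝ (fderiv ℝ G) x) x :=
    (((hG.contDiffAt hn).fderiv_right (m := ∞) (by simp)).differentiableAt (by simp)).hasFDerivAt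
  have key : ∀ w u, fderiv ℝ (fderiv ℝ G) x u (w, Γ x w) + fderiv ℝ G x (0, fderiv ℝ Γ x u w) = 0 := by
    intro w u
    have h1 : HasFDerivAt (fun x' => Γ x' w) ((fderiv ℝ Γ x).flip w) x := by
      have := hΓ'.clm_apply (hasFDerivAt_const w x)
      refine this.congr_fderiv (ContinuousLinearMap.ext fun u => ?_)
      simp
    have h2 : HasFDerivAt (fun x' => (w, Γ x' w)) ((0 : E × T →L[ℝ] E).prod ((fderiv ℝ Γ x).flip w)) x :=
      (hasFDerivAt_const w x).prodMk h1
    have h3 := hG'.clm_apply h2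
    have h4 : (fun x' => fderiv ℝ G x' (w, Γ x' w)) =ᶠ[𝓝 x] fun _ => 0 := by
      filter_upwards [hn] with x' hx' using h0 x' hx' w
    have h5 := h3.unique (h4.hasFDerivAt_iff.2 (hasFDerivAt_const (0:T') x))
    have h6 := congrArg (fun L => L u) h5
    simpa [add_comm] using h6
  have hsym : IsSymmSndFDerivAt ℝ G x := (hG.contDiffAt hn).isSymmSndFDerivAt
    (by simp only [minSmoothness_of_isRCLikeNormedField]; exact WithTop.coe_le_coe.2 (le_top : (2:ℕ∞) ≤ ⊤))
  have a1 := key w (v, Γ x v)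
  have a2 := key v (w, Γ x w)
  rw [hsym] at a1
  have a3 : fderiv ℝ G x (0, (fderiv ℝ Γ x (v, Γ x v)) w) =
      fderiv ℝ G x (0, (fderiv ℝ Γ x (w, Γ x w)) v) := by
    have := a1.trans a2.symm
    exact add_left_cancel this
  rw [← sub_eq_zero]
  refine hinj _ ?_
  have : ((0 : E), (fderiv ℝ Γ x (v, Γ x v)) w - (fderiv ℝ Γ x (w, Γ x w)) v) =
    ((0 : E), (fderiv ℝ Γ x (v, Γ x v)) w) - (0, (fderiv ℝ Γ x (w, Γ x w)) v) := by simp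
  rw [this, map_sub, a3, sub_self]

theorem Gam_flat {δ : ℝ} {p : E × Z → E} {Ξ : E × Z → (E →L[ℝ] E) →L[ℝ] Z}
    (hd : FieldData δ p Ξ) (hI : Integ T' δ p Ξ) : FlatOn (Gam p Ξ) (Og δ p) := by
  intro x hx v w
  have hO := Og_open hd
  have hs := Gam_contDiffOn hd
  have hs' : ContinuousOn (fderiv ℝ (Gam p Ξ)) (Og δ p) :=
    (hs.fderiv_of_isOpen (m := ∞) hO (by simp)).continuousOn
  have hcv : ∀ v w : E, ContinuousOn (fun x => (fderiv ℝ (Gam p Ξ) x (v, Gam p Ξ x v)) w) (Og δ p) := by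
    intro v w
    have : ContinuousOn (fun x => Gam p Ξ x v) (Og δ p) := hs.continuousOn.clm_apply continuousOn_const
    exact (hs'.clm_apply (continuousOn_const.prodMk this)).clm_apply continuousOn_const
  refine ext_r hO (hcv v w) (hcv w v) ?_ x hx
  intro x hx hr
  have hθ : x.1 ≠ 0 := by
    intro h; have := hx.2.2; rw [h] at this; simp at this
  have hptx : p (bl x) ≠ 0 := by
    rw [pt_spec hd.hp x (hd.p0 _ hx.2.1)]
    refine smul_ne_zero hr ?_
    intro h; have := hx.2.2; rw [h] at this; simp at this
  obtain ⟨g, N, hN, hxN, hg, h1, h2, h3⟩ := hI (bl x) ⟨hx.1, hx.2.1⟩ hptx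
  have hbc : Continuous (bl : E × (ℝ × Z) → E × Z) := bl_contDiff.continuous
  have hgd : ∀ x' : E × (ℝ × Z), bl x' ∈ N → ∀ v, fderiv ℝ (fun y => g (bl y)) x' v =
      fderiv ℝ g (bl x') (fderiv ℝ bl x' v) := by
    intro x' hx' v
    have a1 : HasFDerivAt g (fderiv ℝ g (bl x')) (bl x') :=
      ((hg.contDiffAt (hN.mem_nhds hx')).differentiableAt (by simp)).hasFDerivAt
    have a2 : HasFDerivAt (fun y => g (bl y)) _ x' := a1.comp x' (bl_hasFDerivAt x')
    rw [a2.fderiv]; rfl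
  refine flat_of_integral (G := fun y => g (bl y)) (M := Og δ p ∩ bl ⁻¹' N)
    (hO.inter (hN.preimage hbc)) ⟨hx, hxN⟩ (hs.mono inter_subset_left)
    (hg.comp bl_contDiff.contDiffOn inter_subset_right) ?_ ?_ v w
  · intro x' hx' v
    obtain ⟨B, hB, e⟩ := bl_Gam hd hx'.1 v
    rw [hgd x' hx'.2, e]
    exact h1 _ hx'.2 B hB
  · intro τ hτ
    rw [hgd x hxN, bl_fderiv] at hτ
    simp only [smul_zero, zero_add] at hτ
    have e1 := h2 _ hτ
    simp only [inner_smul_right] at e1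
    rw [pt_spec hd.hp x (hd.p0 _ hx.2.1), real_inner_smul_left] at e1
    have e2 : τ.1 = 0 := by
      rcases mul_eq_zero.1 e1 with h | h
      · exact h
      · rcases mul_eq_zero.1 h with h | h
        · exact absurd h hr
        · exact absurd h hx.2.2.ne'
    rw [e2, zero_smul] at hτ
    exact Prod.ext e2 (h3 _ hτ)

/-- The antipodal involution upstairs. -/
def RR (x : E × (ℝ × Z)) : E × (ℝ × Z) := (-x.1, (-x.2.1, x.2.2))

theorem bl_RR (x : E × (ℝ × Z)) : bl (RR x) = bl x := by simp [bl, RR]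

theorem pt_RR {F : Type} [NormedAddCommGroup F] [NormedSpace ℝ F]
    (p : E × Z → F) (x : E × (ℝ × Z)) : pt p (RR x) = - pt p x := by
  rw [pt, bl_RR]; simp [RR, pt]

theorem Gam_RR (p : E × Z → E) (Ξ : E × Z → (E →L[ℝ] E) →L[ℝ] Z) (x : E × (ℝ × Z)) (v : E) :
    Gam p Ξ (RR x) (-v) = (-(Gam p Ξ x v).1, (Gam p Ξ x v).2) := by
  have hu : uu p (RR x) (-v) = - uu p x v := by
    simp only [uu, pt_RR]
    simp [RR]; abel
  simp only [Gam_apply, pt_RR, hu, wedge_neg_neg]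
  simp [RR]

/-- skew fields killing `p` have no `z`-part -/
theorem skew_eq {δ : ℝ} {p : E × Z → E} {Ξ : E × Z → (E →L[ℝ] E) →L[ℝ] Z}
    (hI : Integ T' δ p Ξ) {x : E × Z} (hx : x ∈ Vd E Z δ) (hp : p x ≠ 0)
    {B B' : E →L[ℝ] E} (hB : star B = -B) (hB' : star B' = -B') (h : B (p x) = B' (p x)) :
    Ξ x B = Ξ x B' := by
  obtain ⟨g, N, hN, hxN, hg, h1, h2, h3⟩ := hI x hx hp
  rw [← sub_eq_zero, ← map_sub]
  refine h3 _ ?_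
  have := h1 x hxN (B - B') (by rw [star_sub, hB, hB']; abel)
  rw [_root_.sub_apply, h, sub_self] at this
  exact this

/-- Every field lifts to a horizontal vector. -/
theorem field_lift {δ : ℝ} {p : E × Z → E} {Ξ : E × Z → (E →L[ℝ] E) →L[ℝ] Z}
    (hd : FieldData δ p Ξ) (hI : Integ T' δ p Ξ)
    {x : E × (ℝ × Z)} (hx : x ∈ Og δ p) (hr : x.2.1 ≠ 0) (B : E →L[ℝ] E) (hB : star B = -B) :
    ∃ v, fderiv ℝ (bl : E × (ℝ × Z) → E × Z) x (v, Gam p Ξ x v) = (B (p (bl x)), Ξ (bl x) B) := by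
  have e1 := pt_spec hd.hp x (hd.p0 _ hx.2.1)
  have hpt : pt p x ≠ 0 := by
    intro h; have := hx.2.2; rw [h] at this; simp at this
  have hptx : p (bl x) ≠ 0 := by
    rw [e1]
    exact smul_ne_zero hr hpt
  refine ⟨B (pt p x), ?_⟩
  obtain ⟨B', hB', e⟩ := bl_Gam (Ξ := Ξ) hd hx (B (pt p x))
  have h1 : B (p (bl x)) = B' (p (bl x)) := by
    have := congrArg Prod.fst e
    rw [bl_fderiv, Gam_apply] at this
    simp only [skew_inner hB] at this
    rw [← this, e1]
    simp
  rw [e, h1, skew_eq hI ⟨hx.1, hx.2.1⟩ hptx hB hB' h1]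

end FF2

section FF3
open MeasureTheory Set Filter Topology
variable {E Z T' : Type} [NormedAddCommGroup E] [InnerProductSpace ℝ E] [FiniteDimensional ℝ E]
  [NormedAddCommGroup Z] [NormedSpace ℝ Z] [FiniteDimensional ℝ Z]
  [NormedAddCommGroup T'] [NormedSpace ℝ T']

theorem FieldData.mono {δ δ' : ℝ} {p : E × Z → E} {Ξ : E × Z → (E →L[ℝ] E) →L[ℝ] Z}
    (hd : FieldData δ p Ξ) (h0 : 0 < δ') (h : δ' ≤ δ) : FieldData δ' p Ξ :=
  ⟨h0, hd.hp, hd.hX, fun z hz => hd.p0 z (hz.trans_le h), fun z hz => hd.X0 z (hz.trans_le h),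
    fun z hz => hd.dp z (hz.trans_le h)⟩

/-- The big annulus upstairs. -/
def An (E Z : Type) [NormedAddCommGroup E] [NormedAddCommGroup Z] (δ : ℝ) : Set (E × (ℝ × Z)) :=
  {x | 1/4 < ‖x.1‖ ∧ ‖x.1‖ < 4 ∧ ‖x.2‖ < δ}

theorem An_open (δ : ℝ) : IsOpen (An E Z δ) := by
  have c1 : IsOpen {x : E × (ℝ × Z) | 1/4 < ‖x.1‖} := isOpen_lt (by fun_prop) (by fun_prop)
  have c2 : IsOpen {x : E × (ℝ × Z) | ‖x.1‖ < 4} := isOpen_lt (by fun_prop) (by fun_prop)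
  have c3 : IsOpen {x : E × (ℝ × Z) | ‖x.2‖ < δ} := isOpen_lt (by fun_prop) (by fun_prop)
  exact c1.inter (c2.inter c3)

theorem RR_An {δ : ℝ} {x : E × (ℝ × Z)} (hx : x ∈ An E Z δ) : RR x ∈ An E Z δ := by
  refine ⟨by simpa [RR] using hx.1, by simpa [RR] using hx.2.1, ?_⟩
  have := hx.2.2
  rw [Prod.norm_def] at this ⊢
  simpa [RR] using this

theorem RR_RR (x : E × (ℝ × Z)) : RR (RR x) = x := by simp [RR]

theorem RR_contDiff : ContDiff ℝ ∞ (RR : E × (ℝ × Z) → E × (ℝ × Z)) := by unfold RR; fun_prop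

/-- Symmetrization map. -/
noncomputable def SS (a : (ℝ × Z) × (ℝ × Z)) : Z × ℝ :=
  ((1/2 : ℝ) • (a.1.2 + a.2.2), -(a.1.1 * a.2.1))

theorem SS_contDiff : ContDiff ℝ ∞ (SS : (ℝ × Z) × (ℝ × Z) → Z × ℝ) := by unfold SS; fun_prop

/-- Symmetrized first integral. -/
noncomputable def FS (F : E × (ℝ × Z) → ℝ × Z) (x : E × (ℝ × Z)) : Z × ℝ := SS (F x, F (RR x))

theorem FS_RR (F : E × (ℝ × Z) → ℝ × Z) (x : E × (ℝ × Z)) : FS F (RR x) = FS F x := by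
  simp [FS, SS, RR_RR, add_comm, mul_comm]

/-- A first integral upstairs. -/
structure FI (δ₀ δ : ℝ) (p : E × Z → E) (Ξ : E × Z → (E →L[ℝ] E) →L[ℝ] Z)
    {W : Type} [NormedAddCommGroup W] [NormedSpace ℝ W] (F : E × (ℝ × Z) → W) : Prop where
  mem : ∀ x ∈ An E Z δ, x ∈ Og δ₀ p
  cd : ContDiffOn ℝ ∞ F (An E Z δ)
  inv : ∀ x ∈ An E Z δ, ∀ v, fderiv ℝ F x (v, Gam p Ξ x v) = 0

theorem FI.fd {δ₀ δ : ℝ} {p : E × Z → E} {Ξ : E × Z → (E →L[ℝ] E) →L[ℝ] Z}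
    {W : Type} [NormedAddCommGroup W] [NormedSpace ℝ W] {F : E × (ℝ × Z) → W}
    (h : FI δ₀ δ p Ξ F) {x : E × (ℝ × Z)} (hx : x ∈ An E Z δ) : HasFDerivAt F (fderiv ℝ F x) x :=
  ((h.cd.contDiffAt ((An_open δ).mem_nhds hx)).differentiableAt (by simp)).hasFDerivAt

theorem FI_FS {δ₀ δ : ℝ} {p : E × Z → E} {Ξ : E × Z → (E →L[ℝ] E) →L[ℝ] Z}
    {F : E × (ℝ × Z) → ℝ × Z} (h : FI δ₀ δ p Ξ F) : FI δ₀ δ p Ξ (FS F) := by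
  refine ⟨h.mem, ?_, ?_⟩
  · have h1 : ContDiffOn ℝ ∞ (fun x => F (RR x)) (An E Z δ) :=
      h.cd.comp RR_contDiff.contDiffOn fun x hx => RR_An hx
    exact SS_contDiff.comp_contDiffOn (h.cd.prodMk h1)
  · intro x hx v
    have e1 : HasFDerivAt (RR : E × (ℝ × Z) → E × (ℝ × Z))
        ((-ContinuousLinearMap.fst ℝ E (ℝ × Z)).prod
          ((-((ContinuousLinearMap.fst ℝ ℝ Z).comp (ContinuousLinearMap.snd ℝ E (ℝ × Z)))).prod
            ((ContinuousLinearMap.snd ℝ ℝ Z).comp (ContinuousLinearMap.snd ℝ E (ℝ × Z))))) x :=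
      ((-ContinuousLinearMap.fst ℝ E (ℝ × Z)).prod
          ((-((ContinuousLinearMap.fst ℝ ℝ Z).comp (ContinuousLinearMap.snd ℝ E (ℝ × Z)))).prod
            ((ContinuousLinearMap.snd ℝ ℝ Z).comp
              (ContinuousLinearMap.snd ℝ E (ℝ × Z))))).hasFDerivAt
    have e2 : HasFDerivAt (fun x => F (RR x)) _ x := (h.fd (RR_An hx)).comp x e1
    have e3 := (h.fd hx).prodMk e2
    have e4 : HasFDerivAt (SS : (ℝ × Z) × (ℝ × Z) → Z × ℝ) (fderiv ℝ SS (F x, F (RR x)))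
      (F x, F (RR x)) := ((SS_contDiff.differentiable (by simp)) _).hasFDerivAt
    have e5 : HasFDerivAt (FS F) _ x := HasFDerivAt.comp x (g := SS)
      (f := fun x => (F x, F (RR x))) e4 e3
    rw [e5.fderiv]
    have e6 := h.inv _ (RR_An hx) (-v)
    rw [Gam_RR] at e6
    simp only [ContinuousLinearMap.comp_apply, ContinuousLinearMap.prod_apply, h.inv x hx v,
      _root_.neg_apply, ContinuousLinearMap.coe_fst', ContinuousLinearMap.coe_snd']
    rw [e6]
    exact map_zero _

theorem annulus_preconn (hdim : 1 < Module.rank ℝ E) :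
    IsPreconnected {θ : E | 1/4 < ‖θ‖ ∧ ‖θ‖ < 4} := by
  have h1 := ((isPreconnected_sphere hdim (0:E) 1).prod
    (isPreconnected_Ioo (a := (1/4:ℝ)) (b := 4))).image (fun a : E × ℝ => a.2 • a.1) (by fun_prop)
  convert h1 using 1
  ext θ
  simp only [mem_image, mem_prod, mem_sphere_iff_norm, sub_zero, mem_Ioo, Prod.exists]
  constructor
  · rintro ⟨h1, h2⟩
    have : ‖θ‖ ≠ 0 := by linarith
    refine ⟨‖θ‖⁻¹ • θ, ‖θ‖, ⟨?_, h1, h2⟩, ?_⟩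
    · rw [norm_smul, norm_inv, norm_norm, inv_mul_cancel₀ this]
    · rw [smul_smul, mul_inv_cancel₀ this, one_smul]
  · rintro ⟨u, t, ⟨h1, h2, h3⟩, rfl⟩
    have : ‖t • u‖ = t := by rw [norm_smul, h1, Real.norm_eq_abs, abs_of_pos (by linarith), mul_one]
    change _ < ‖t • u‖ ∧ ‖t • u‖ < 4
    rw [this]; exact ⟨h2, h3⟩

theorem FI_zero {δ₀ δ : ℝ} {p : E × Z → E} {Ξ : E × Z → (E →L[ℝ] E) →L[ℝ] Z}
    {F : E × (ℝ × Z) → ℝ × Z} (h : FI δ₀ δ p Ξ F) (hdim : 1 < Module.rank ℝ E) (hδ : 0 < δ) {N : E}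
    (hN : ‖N‖ = 1) (hFN : ∀ τ, F (N, τ) = τ) (θ : E) (h1 : 1/4 < ‖θ‖) (h2 : ‖θ‖ < 4) (z : Z)
    (hz : ‖z‖ < δ) : F (θ, (0, z)) = (0, z) := by
  have hm : ∀ θ ∈ {θ : E | 1/4 < ‖θ‖ ∧ ‖θ‖ < 4}, (θ, ((0:ℝ), z)) ∈ An E Z δ := by
    rintro θ ⟨h1, h2⟩
    refine ⟨h1, h2, ?_⟩
    rw [Prod.norm_def]; simp [hz, hδ]
  have hfd : ∀ θ ∈ {θ : E | 1/4 < ‖θ‖ ∧ ‖θ‖ < 4}, HasFDerivAt (fun θ => F (θ, (0, z)))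
      (0 : E →L[ℝ] ℝ × Z) θ := by
    intro θ hθ
    have a1 : HasFDerivAt (fun θ => F (θ, ((0:ℝ), z))) _ θ :=
      (h.fd (hm θ hθ)).comp θ (hasFDerivAt_prodMk_left θ ((0:ℝ), z))
    refine a1.congr_fderiv (ContinuousLinearMap.ext fun v => ?_)
    have := h.inv _ (hm θ hθ) v
    rw [Gam_zero _ _ _ rfl] at this
    simpa using this
  have hop : IsOpen {θ : E | 1/4 < ‖θ‖ ∧ ‖θ‖ < 4} := by
    have c1 : IsOpen {x : E | 1/4 < ‖x‖} := isOpen_lt (by fun_prop) (by fun_prop)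
    have c2 : IsOpen {x : E | ‖x‖ < 4} := isOpen_lt (by fun_prop) (by fun_prop)
    exact c1.inter c2
  have := hop.is_const_of_fderiv_eq_zero (𝕜 := ℝ) (annulus_preconn hdim)
    (fun θ hθ => (hfd θ hθ).differentiableAt.differentiableWithinAt)
    (fun θ hθ => (hfd θ hθ).fderiv) (x := θ) (y := N) ⟨h1, h2⟩
    (by change _ < ‖N‖ ∧ ‖N‖ < _; rw [hN]; norm_num)
  rw [this, hFN]

theorem Om_An {ε δ : ℝ} (h : ε ≤ δ) : Om E Z ε ⊆ An E Z δ := by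
  intro x hx
  refine ⟨by linarith [hx.1], by linarith [hx.2.1], ?_⟩
  rw [Prod.norm_def]
  exact max_lt (hx.2.2.1.trans_le h) (hx.2.2.2.trans_le h)

/-- scaling invariance of first integrals -/
theorem FI_scale {δ₀ δ : ℝ} {p : E × Z → E} {Ξ : E × Z → (E →L[ℝ] E) →L[ℝ] Z}
    {W : Type} [NormedAddCommGroup W] [NormedSpace ℝ W] {F : E × (ℝ × Z) → W}
    (h : FI δ₀ δ p Ξ F) {x : E × (ℝ × Z)} (hx : x ∈ Om E Z (δ/2)) (l : ℝ) (hl : l ∈ Ioo (1/2:ℝ) 2) :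
    F (l • x.1, (l⁻¹ * x.2.1, x.2.2)) = F x := by
  have hm : ∀ l ∈ Ioo (1/2:ℝ) 2, (l • x.1, (l⁻¹ * x.2.1, x.2.2)) ∈ An E Z δ := by
    rintro l ⟨h1, h2⟩
    have hn : ‖l • x.1‖ = l * ‖x.1‖ := by
      rw [norm_smul, Real.norm_eq_abs, abs_of_pos (by linarith)]
    have hl' : l⁻¹ < 2 := by rw [inv_lt_comm₀ (by linarith) (by norm_num)]; linarith
    have hl0 : 0 < l⁻¹ := by rw [inv_pos]; linarith
    refine ⟨?_, ?_, ?_⟩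
    · change _ < ‖l • x.1‖; rw [hn]; nlinarith [hx.1]
    · change ‖l • x.1‖ < _; rw [hn]; nlinarith [hx.2.1, norm_nonneg x.1]
    · rw [Prod.norm_def]
      refine max_lt ?_ ?_
      · change |l⁻¹ * x.2.1| < δ
        rw [abs_mul, abs_of_pos hl0]
        nlinarith [hx.2.2.1, abs_nonneg x.2.1]
      · have := hx.2.2.2
        have := norm_nonneg x.2.2
        change ‖x.2.2‖ < δ
        linarith
  have hdv : ∀ l ∈ Ioo (1/2:ℝ) 2, HasDerivAt (fun l : ℝ => F (l • x.1, (l⁻¹ * x.2.1, x.2.2))) 0 l := by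
    intro l hl
    have hl0 : l ≠ 0 := by have := hl.1; intro h; rw [h] at this; norm_num at this
    have a1 : HasDerivAt (fun l : ℝ => ((l • x.1, (l⁻¹ * x.2.1, x.2.2)) : E × (ℝ × Z)))
        (x.1, (-(l^2)⁻¹ * x.2.1, 0)) l := by
      have b1 := (hasDerivAt_id l).smul_const x.1
      rw [one_smul] at b1
      exact b1.prodMk (((hasDerivAt_inv hl0).mul_const x.2.1).prodMk (hasDerivAt_const _ _))
    have a2 : HasDerivAt (fun l : ℝ => F (l • x.1, (l⁻¹ * x.2.1, x.2.2))) _ l :=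
      (h.fd (hm l hl)).comp_hasDerivAt l a1
    have a3 := h.inv _ (hm l hl) x.1
    have hc : inner ℝ (pt p (l • x.1, (l⁻¹ * x.2.1, x.2.2))) (l • x.1) ≠ 0 :=
      (h.mem _ (hm l hl)).2.2.ne'
    set P := pt p (l • x.1, (l⁻¹ * x.2.1, x.2.2)) with hP
    rw [inner_smul_right] at hc
    have hc' : inner ℝ P x.1 ≠ 0 := right_ne_zero_of_mul hc
    have hu : uu p (l • x.1, (l⁻¹ * x.2.1, x.2.2)) x.1 = 0 := by
      unfold uu
      rw [← hP]
      simp only [inner_smul_right, smul_smul]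
      rw [show inner ℝ P x.1 / (l * inner ℝ P x.1) * l = 1 by field_simp]
      simp
    rw [Gam_apply, hu, wedge_zero, map_zero, smul_zero] at a3
    rw [← hP] at a3
    simp only [inner_smul_right] at a3
    rw [show -(l⁻¹ * x.2.1) * (inner ℝ P x.1 / (l * inner ℝ P x.1)) = -(l^2)⁻¹ * x.2.1 by
      field_simp] at a3
    rw [a3] at a2
    exact a2
  have := isOpen_Ioo.is_const_of_deriv_eq_zero (𝕜 := ℝ) isPreconnected_Ioo
    (fun l hl => (hdv l hl).differentiableAt.differentiableWithinAt)
    (fun l hl => (hdv l hl).deriv) hl (show (1:ℝ) ∈ Ioo (1/2:ℝ) 2 by norm_num)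
  rw [this]; simp

end FF3

section FF4
open MeasureTheory Set Filter Topology
variable {E Z T' : Type} [NormedAddCommGroup E] [InnerProductSpace ℝ E] [FiniteDimensional ℝ E]
  [NormedAddCommGroup Z] [NormedSpace ℝ Z] [FiniteDimensional ℝ Z]
  [NormedAddCommGroup T'] [NormedSpace ℝ T']

theorem Vd_mono {δ ε : ℝ} (h : ε ≤ δ) : Vd E Z ε ⊆ Vd E Z δ :=
  fun _ hx => ⟨hx.1.trans_le h, hx.2.trans_le h⟩

theorem Om_mono {δ ε : ℝ} (h : ε ≤ δ) : Om E Z ε ⊆ Om E Z δ :=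
  fun _ hx => ⟨hx.1, hx.2.1, hx.2.2.1.trans_le h, hx.2.2.2.trans_le h⟩

open Classical in
/-- The first integrals downstairs. -/
noncomputable def fdn (F : E × (ℝ × Z) → ℝ × Z) (x : E × Z) : Z × ℝ :=
  if x.1 = 0 then (x.2, 0) else FS F (‖x.1‖⁻¹ • x.1, (‖x.1‖, x.2))

theorem fdn_bl {δ₀ δ : ℝ} {p : E × Z → E} {Ξ : E × Z → (E →L[ℝ] E) →L[ℝ] Z}
    {F : E × (ℝ × Z) → ℝ × Z} (h : FI δ₀ δ p Ξ F) (hdim : 1 < Module.rank ℝ E) (hδ : 0 < δ) {N : E}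
    (hN : ‖N‖ = 1) (hFN : ∀ τ, F (N, τ) = τ) {x : E × (ℝ × Z)} (hx : x ∈ Om E Z (δ/2)) :
    fdn F (bl x) = FS F x := by
  have hS := FI_FS h
  have key : ∀ x : E × (ℝ × Z), x ∈ Om E Z (δ/2) → 0 < x.2.1 → fdn F (bl x) = FS F x := by
    intro x hx hr
    have hn0 : 0 < ‖x.1‖ := by linarith [hx.1]
    have hne : x.2.1 • x.1 ≠ 0 := smul_ne_zero hr.ne' (norm_pos_iff.1 hn0)
    have hn : ‖x.2.1 • x.1‖ = x.2.1 * ‖x.1‖ := by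
      rw [norm_smul, Real.norm_eq_abs, abs_of_pos hr]
    have := FI_scale hS hx (‖x.1‖⁻¹) ⟨by
        rw [lt_inv_comm₀ (by norm_num) hn0]; linarith [hx.2.1], by
        rw [inv_lt_comm₀ hn0 (by norm_num)]; linarith [hx.1]⟩
    rw [← this]
    simp only [fdn, bl, hne, if_false, hn, inv_inv]
    congr 2
    · rw [smul_smul]; congr 1; field_simp
    · rw [mul_comm]
  rcases lt_trichotomy x.2.1 0 with hr | hr | hr
  · have h1 : RR x ∈ Om E Z (δ/2) := by
      refine ⟨by simpa [RR] using hx.1, by simpa [RR] using hx.2.1, ?_, hx.2.2.2⟩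
      simpa [RR] using hx.2.2.1
    have := key (RR x) h1 (by simpa [RR] using hr)
    rwa [bl_RR, FS_RR] at this
  · have hz : ‖x.2.2‖ < δ := by
      have := hx.2.2.2; linarith
    have e1 := FI_zero h hdim hδ hN hFN x.1 (by linarith [hx.1]) (by linarith [hx.2.1]) x.2.2 hz
    have e2 := FI_zero h hdim hδ hN hFN (-x.1) (by rw [norm_neg]; linarith [hx.1])
      (by rw [norm_neg]; linarith [hx.2.1]) x.2.2 hz
    have hx' : x = (x.1, ((0:ℝ), x.2.2)) := by ext <;> simp [hr]
    have e3 : FS F x = (x.2.2, 0) := by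
      rw [hx']
      simp only [FS, RR, neg_zero, e1, e2, SS]
      ext
      · simp only [← two_smul ℝ, smul_smul]; norm_num
      · simp
    rw [e3]
    simp [fdn, bl, hr]
  · exact key x hx hr

theorem first_integrals {δ : ℝ} {p : E × Z → E} {Ξ : E × Z → (E →L[ℝ] E) →L[ℝ] Z}
    (hd : FieldData δ p Ξ) (hI : Integ T' δ p Ξ) (hdim : 3 ≤ Module.finrank ℝ E) {N : E}
    (hN : ‖N‖ = 1) :
    ∃ (ε : ℝ) (f : E × Z → Z × ℝ), 0 < ε ∧ ε ≤ δ ∧ ContDiffOn ℝ ∞ f (Vd E Z ε) ∧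
      (∀ x ∈ Vd E Z ε, ∀ B : E →L[ℝ] E, star B = -B → fderiv ℝ f x (B (p x), Ξ x B) = 0) ∧
      (∀ z, f (0, z) = (z, 0)) ∧ (∀ z, ‖z‖ < ε → ∀ v, (fderiv ℝ f (0, z) (v, 0)).2 = 0) ∧
      ∃ c : ℝ, c ≠ 0 ∧ Tendsto (fun s : ℝ => (f (s • N, 0)).2 / s ^ 2) (𝓝[≠] 0) (𝓝 c) := by
  have hrk : 1 < Module.rank ℝ E := by
    rw [← Module.finrank_eq_rank]
    exact_mod_cast (by omega : 1 < Module.finrank ℝ E)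
  haveI : Nontrivial E := by
    refine Module.nontrivial_of_finrank_pos (R := ℝ) (by omega)
  obtain ⟨F, Ψ, hΨ, hΨ0, hFN, δ1, hδ1, hF, hFΨ⟩ := flat_integral (Gam p Ξ) (Og_open hd)
    (Gam_contDiffOn hd) (fun θ hθ => Og_zero hd θ hθ 0 (by simpa using hd.pos))
    (fun θ => Gam_zero _ _ _ rfl) (Gam_flat hd hI) hdim hN
  have hFI : FI δ δ1 p Ξ F := by
    refine ⟨fun x hx => (hF x hx.1 hx.2.1 hx.2.2).1, fun x hx =>
      (hF x hx.1 hx.2.1 hx.2.2).2.1.contDiffWithinAt, fun x hx =>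
      (hF x hx.1 hx.2.1 hx.2.2).2.2⟩
  have hFS := FI_FS hFI
  set ε := min δ (δ1/2) with hε
  have hε0 : 0 < ε := lt_min hd.pos (by linarith)
  have hε1 : ε ≤ δ := min_le_left _ _
  have hε2 : ε ≤ δ1/2 := min_le_right _ _
  have hbl : ∀ x ∈ Om E Z ε, fdn F (bl x) = FS F x := fun x hx =>
    fdn_bl hFI hrk hδ1 hN hFN (Om_mono hε2 hx)
  have hOO : OO ε 0 (fdn F) (FS F) := by
    refine ⟨hFS.cd.mono (Om_An (by linarith)), fun x hx => ?_⟩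
    rw [hbl x hx]; simp
  have hinv : ∀ x ∈ Om E Z ε, x.2.1 ≠ 0 → ∀ B : E →L[ℝ] E, star B = -B →
      fderiv ℝ (fdn F) (bl x) (B (p (bl x)), Ξ (bl x) B) = 0 := by
    intro x hx hr B hB
    have hxA : x ∈ An E Z δ1 := Om_An (by linarith) hx
    obtain ⟨v, hv⟩ := field_lift hd hI (hFI.mem x hxA) hr B hB
    have h1 : HasFDerivAt (fdn F) _ (bl x) := (OO_hasFDerivAt hOO hx hr).differentiableAt.hasFDerivAt
    have h2 : HasFDerivAt (bl : E × (ℝ × Z) → E × Z) (fderiv ℝ bl x) x :=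
      (bl_contDiff.differentiable (by simp) x).hasFDerivAt
    have h3 : HasFDerivAt (fun x => fdn F (bl x)) _ x := h1.comp x h2
    have h4 : (fun x => fdn F (bl x)) =ᶠ[𝓝 x] FS F := by
      filter_upwards [(Om_open ε).mem_nhds hx] with y hy using hbl y hy
    have h5 := hFS.inv x hxA v
    rw [← h4.fderiv_eq, h3.fderiv, ContinuousLinearMap.comp_apply, hv] at h5
    exact h5
  have hf0 : ∀ z, fdn F ((0:E), z) = (z, 0) := fun z => by simp [fdn]
  have hcd := blow_down (hd.mono hε0 hε1) hrk hOO hinv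
  have hpath : ∀ θ : E, ‖θ‖ = 1 → ∀ z : Z, ‖z‖ < ε → ∀ t : ℝ, |t| < ε →
      (fdn F (t • θ, z)).2 = -((F (θ, (t, z))).1 * (F (-θ, (-t, z))).1) := by
    intro θ hθ z hz t ht
    have := hbl (θ, (t, z)) ⟨by rw [hθ]; norm_num, by rw [hθ]; norm_num, ht, hz⟩
    rw [show bl (θ, (t, z)) = (t • θ, z) from rfl] at this
    rw [this]; rfl
  have hpath2 : ∀ θ : E, ‖θ‖ = 1 → ∀ z : Z, ‖z‖ < ε → ∀ᶠ t : ℝ in 𝓝 0,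
      (fdn F (t • θ, z)).2 = -((F (θ, (t, z))).1 * (F (-θ, (-t, z))).1) := by
    intro θ hθ z hz
    have : Metric.ball (0:ℝ) ε ∈ 𝓝 (0:ℝ) := Metric.ball_mem_nhds _ hε0
    filter_upwards [this] with t ht using hpath θ hθ z hz t (by simpa using ht)
  have hAn : ∀ θ : E, ‖θ‖ = 1 → ∀ z : Z, ‖z‖ < ε → (θ, ((0:ℝ), z)) ∈ An E Z δ1 := by
    intro θ hθ z hz
    refine ⟨by rw [hθ]; norm_num, by rw [hθ]; norm_num, ?_⟩
    rw [Prod.norm_def]; simp only [norm_zero]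
    exact max_lt hδ1 (by linarith)
  have hF0 : ∀ θ : E, ‖θ‖ = 1 → ∀ z : Z, ‖z‖ < ε → F (θ, (0, z)) = (0, z) := by
    intro θ hθ z hz
    exact FI_zero hFI hrk hδ1 hN hFN θ (by rw [hθ]; norm_num) (by rw [hθ]; norm_num) z (by linarith)
  have hFd : ∀ θ : E, ‖θ‖ = 1 → ∀ z : Z, ‖z‖ < ε → ∀ σ : ℝ,
      HasDerivAt (fun t : ℝ => (F (θ, (σ * t, z))).1)
        (fderiv ℝ F (θ, (0, z)) (0, (σ, 0))).1 0 := by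
    intro θ hθ z hz σ
    have a1 : HasDerivAt (fun t : ℝ => ((θ, (σ * t, z)) : E × (ℝ × Z))) (0, (σ, 0)) 0 := by
      have := (hasDerivAt_id (0:ℝ)).const_mul σ
      rw [mul_one] at this
      exact (hasDerivAt_const _ _).prodMk (this.prodMk (hasDerivAt_const _ _))
    have a0 : HasFDerivAt F (fderiv ℝ F (θ, (0, z))) ((fun t : ℝ => ((θ, (σ * t, z)) : E × (ℝ × Z))) 0) := by
      simp only [mul_zero]
      exact hFI.fd (hAn θ hθ z hz)
    have a2 : HasDerivAt (fun t : ℝ => F (θ, (σ * t, z))) _ 0 := a0.comp_hasDerivAt 0 a1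
    exact ((ContinuousLinearMap.fst ℝ ℝ Z).hasFDerivAt.comp_hasDerivAt 0 a2)
  refine ⟨ε, fdn F, hε0, hε1, hcd, ?_, hf0, ?_, ?_⟩
  · intro x hx B hB
    obtain ⟨θ, h1, h2, h3⟩ := lift_Om hx
    by_cases hx0 : x.1 = 0
    · have e1 : p x = 0 := by
        have := hd.p0 x.2 (hx.2.trans_le hε1)
        rwa [show ((0:E), x.2) = x by ext <;> simp [hx0]] at this
      have e2 : Ξ x = 0 := by
        have := hd.X0 x.2 (hx.2.trans_le hε1)
        rwa [show ((0:E), x.2) = x by ext <;> simp [hx0]] at this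
      rw [e1, e2, map_zero, _root_.zero_apply]
      exact map_zero _
    · have := hinv _ h2 (by simpa using hx0) B hB
      rwa [h3] at this
  · intro z hz v
    have hlin : ∀ θ : E, ‖θ‖ = 1 → (fderiv ℝ (fdn F) (0, z) (θ, 0)).2 = 0 := by
      intro θ hθ
      have b1 : HasDerivAt (fun t : ℝ => ((t • θ, z) : E × Z)) (θ, 0) 0 := by
        have := (hasDerivAt_id (0:ℝ)).smul_const θ
        rw [one_smul] at this
        exact this.prodMk (hasDerivAt_const _ _)
      have b0 : HasFDerivAt (fdn F) (fderiv ℝ (fdn F) (0, z))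
          ((fun t : ℝ => ((t • θ, z) : E × Z)) 0) := by
        simp only [zero_smul]
        exact ((hcd.contDiffAt ((Vd_open ε).mem_nhds ⟨by simpa using hε0, hz⟩)).differentiableAt
          (by simp)).hasFDerivAt
      have b2 := b0.comp_hasDerivAt 0 b1
      have b3 : HasDerivAt (fun t : ℝ => (fdn F (t • θ, z)).2) _ 0 :=
        ((ContinuousLinearMap.snd ℝ Z ℝ).hasFDerivAt.comp_hasDerivAt 0 b2)
      have c1 := hFd θ hθ z hz 1
      have c2 := hFd (-θ) (by rwa [norm_neg]) z hz (-1)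
      have c3 := (c1.mul c2).neg
      simp only [one_mul, mul_zero, hF0 θ hθ z hz, hF0 (-θ) (by rwa [norm_neg]) z hz, zero_mul,
        add_zero, neg_zero] at c3
      have c4 : HasDerivAt (fun t : ℝ => (fdn F (t • θ, z)).2) 0 0 := by
        refine c3.congr_of_eventuallyEq ?_
        filter_upwards [hpath2 θ hθ z hz] with t ht
        rw [ht]; simp
      exact b3.unique c4
    obtain ⟨θ, h1, h2⟩ := unit_lift v
    have : ((v, 0) : E × Z) = ‖v‖ • (θ, 0) := by ext <;> simp [h2]
    rw [this, map_smul, Prod.smul_snd, hlin θ h1, smul_zero]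
  · have hN' : ‖-N‖ = 1 := by rwa [norm_neg]
    have h0 : ‖(0:Z)‖ < ε := by simpa using hε0
    refine ⟨(fderiv ℝ F (-N, (0, 0)) (0, (1, 0))).1, ?_, ?_⟩
    · intro hc
      have hfd := hFI.fd (hAn (-N) hN' 0 h0)
      have d1 : HasFDerivAt Ψ (fderiv ℝ Ψ 0) 0 := (hΨ.differentiable (by simp) 0).hasFDerivAt
      have d2 : HasFDerivAt (fun τ : ℝ × Z => ((-N, Ψ τ) : E × (ℝ × Z)))
          ((0 : ℝ × Z →L[ℝ] E).prod (fderiv ℝ Ψ 0)) 0 := (hasFDerivAt_const _ _).prodMk d1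
      have d0 : HasFDerivAt F (fderiv ℝ F (-N, (0, 0)))
          ((fun τ : ℝ × Z => ((-N, Ψ τ) : E × (ℝ × Z))) 0) := by
        simp only [hΨ0]; exact hfd
      have d3 : HasFDerivAt (fun τ : ℝ × Z => F (-N, Ψ τ)) _ 0 := d0.comp 0 d2
      have d4 : HasFDerivAt (fun τ : ℝ × Z => F (-N, Ψ τ)) (ContinuousLinearMap.id ℝ _) 0 := by
        refine (hasFDerivAt_id (0 : ℝ × Z)).congr_of_eventuallyEq ?_
        have : Metric.ball (0:ℝ × Z) δ1 ∈ 𝓝 (0:ℝ × Z) := Metric.ball_mem_nhds _ hδ1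
        filter_upwards [this] with τ hτ using hFΨ τ (by simpa using hτ)
      have d5 := congrArg (fun L => L ((1:ℝ), (0:Z))) (d3.unique d4)
      have d6 : HasFDerivAt (fun z : Z => F (-N, ((0:ℝ), z)))
          ((fderiv ℝ F (-N, (0, 0))).comp ((0 : Z →L[ℝ] E).prod
            ((0 : Z →L[ℝ] ℝ).prod (ContinuousLinearMap.id ℝ Z)))) 0 :=
        HasFDerivAt.comp (0:Z) (f := fun z : Z => ((-N, ((0:ℝ), z)) : E × (ℝ × Z))) hfd
          ((hasFDerivAt_const _ _).prodMk ((hasFDerivAt_const _ _).prodMk (hasFDerivAt_id _)))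
      have d7 : HasFDerivAt (fun z : Z => F (-N, ((0:ℝ), z)))
          ((0 : Z →L[ℝ] ℝ).prod (ContinuousLinearMap.id ℝ Z)) 0 := by
        refine ((hasFDerivAt_const (0:ℝ) (0:Z)).prodMk (hasFDerivAt_id _)).congr_of_eventuallyEq ?_
        have : Metric.ball (0:Z) ε ∈ 𝓝 (0: Z) := Metric.ball_mem_nhds _ hε0
        filter_upwards [this] with z hz using hF0 (-N) hN' z (by simpa using hz)
      set w := fderiv ℝ Ψ 0 ((1:ℝ), (0:Z)) with hw
      have d8 := congrArg (fun L => L w.2) (d6.unique d7)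
      simp only [ContinuousLinearMap.comp_apply, ContinuousLinearMap.prod_apply,
        _root_.zero_apply, ContinuousLinearMap.id_apply, ← hw] at d5 d8
      have d9 : ((0:E), w) = (w.1 • ((0:E), ((1:ℝ), (0:Z)))) + ((0:E), ((0:ℝ), w.2)) := by
        ext <;> simp
      rw [d9, map_add, map_smul, d8] at d5
      have := congrArg Prod.fst d5
      simp [hc] at this
    · have c2 := hFd (-N) hN' 0 h0 (-1)
      have e1 : HasDerivAt (fun t : ℝ => -(F (-N, (-1 * t, 0))).1)
          (fderiv ℝ F (-N, (0, 0)) (0, (1, 0))).1 0 := by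
        refine c2.neg.congr_deriv ?_
        have : ((0:E), ((-1:ℝ), (0:Z))) = -((0:E), ((1:ℝ), (0:Z))) := by ext <;> simp
        rw [this, map_neg]; simp
      rw [hasDerivAt_iff_tendsto_slope_zero] at e1
      refine e1.congr' ?_
      have h3 : ∀ᶠ t : ℝ in 𝓝[≠] 0, _ := (hpath2 N hN 0 h0).filter_mono nhdsWithin_le_nhds
      filter_upwards [h3, self_mem_nhdsWithin] with t ht ht0
      have ht0' : t ≠ 0 := ht0
      rw [ht, hFN]
      simp only [zero_add, mul_zero, hF0 (-N) hN' 0 h0, neg_zero, sub_zero, smul_eq_mul, neg_one_mul]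
      field_simp
end FF4

section M1
open Set Filter Topology
variable {q m : ℕ} {V V' V'' : Type} [NormedAddCommGroup V] [NormedSpace ℝ V]
  [NormedAddCommGroup V'] [NormedSpace ℝ V'] [NormedAddCommGroup V''] [NormedSpace ℝ V'']

/-- `q`-vectors, as alternating forms on covectors. -/
abbrev QV (q : ℕ) (V : Type) [NormedAddCommGroup V] [NormedSpace ℝ V] :=
  (V →L[ℝ] ℝ) [⋀^Fin q]→ₗ[ℝ] ℝ

/-- Evaluation of a covector on a family. -/
def evL {r : ℕ} (v : Fin r → V) : (V →L[ℝ] ℝ) →ₗ[ℝ] (Fin r → ℝ) where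
  toFun α := fun k => α (v k)
  map_add' _ _ := rfl
  map_smul' _ _ := rfl

/-- Decomposable `q`-vector. -/
noncomputable def plu (v : Fin q → V) : QV q V := Matrix.detRowAlternating.compLinearMap (evL v)

theorem plu_apply (v : Fin q → V) (α : Fin q → V →L[ℝ] ℝ) :
    plu v α = (Matrix.of fun i j => α i (v j)).det := rfl

/-- precomposition -/
def preL (A : V →L[ℝ] V') : (V' →L[ℝ] ℝ) →ₗ[ℝ] (V →L[ℝ] ℝ) where
  toFun α := α.comp A
  map_add' _ _ := rfl
  map_smul' _ _ := rfl

/-- Pushforward of a `q`-vector. -/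
def push (A : V →L[ℝ] V') (P : QV q V) : QV q V' := P.compLinearMap (preL A)

theorem push_apply (A : V →L[ℝ] V') (P : QV q V) (α : Fin q → V' →L[ℝ] ℝ) :
    push A P α = P (fun i => (α i).comp A) := rfl

theorem push_push (A : V →L[ℝ] V') (B : V' →L[ℝ] V'') (P : QV q V) :
    push B (push A P) = push (B.comp A) P := rfl

theorem push_zero (A : V →L[ℝ] V') : push A (0 : QV q V) = 0 := rfl

theorem push_plu (A : V →L[ℝ] V') (v : Fin q → V) : push A (plu v) = plu (fun k => A (v k)) := rfl

theorem push_id (P : QV q V) : push (ContinuousLinearMap.id ℝ V) P = P := rfl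

/-- An alternating form of degree `q` on `ℝ^{q+1}` is a determinant. -/
theorem alt_eq (Q : (Fin (q+1) → ℝ) [⋀^Fin q]→ₗ[ℝ] ℝ) (a : Fin q → (Fin (q+1) → ℝ)) :
    Q a = (Matrix.of (Fin.cons (fun j : Fin (q+1) => (-1:ℝ)^(j:ℕ) *
      Q (fun i => Pi.single (j.succAbove i) 1)) a : Fin (q+1) → Fin (q+1) → ℝ)).det := by
  set c : Fin (q+1) → ℝ := fun j => (-1:ℝ)^(j:ℕ) * Q (fun i => Pi.single (j.succAbove i) 1) with hc
  have h2 : Q = AlternatingMap.curryLeft (Matrix.detRowAlternating (R := ℝ) (n := Fin (q+1))) c := by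
    refine Module.Basis.ext_alternating (Pi.basisFun ℝ (Fin (q+1))) fun r hr => ?_
    simp only [Pi.basisFun_apply]
    -- the missing index
    have hns : ¬ Function.Surjective r := by
      intro hs
      have := Fintype.card_le_of_surjective r hs
      simp at this
    obtain ⟨j, hj⟩ : ∃ j, ∀ i, r i ≠ j := by
      simpa [Function.Surjective] using hns
    have hs : ∀ i, ∃ k, j.succAbove k = r i := fun i => Fin.exists_succAbove_eq (hj i)
    choose σ hσ using hs
    have hσi : Function.Injective σ := by
      intro a b hab
      apply hr; rw [← hσ, ← hσ, hab]
    have hσb : Function.Bijective σ := Finite.injective_iff_bijective.1 hσi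
    have hr' : (fun i => (Pi.single (r i) 1 : Fin (q+1) → ℝ)) =
        (fun k => (Pi.single (j.succAbove k) 1 : Fin (q+1) → ℝ)) ∘ (Equiv.ofBijective σ hσb) := by
      funext i; simp [hσ]
    rw [hr', AlternatingMap.map_perm, AlternatingMap.map_perm]
    congr 1
    rw [AlternatingMap.curryLeft_apply_apply]
    change _ = Matrix.det (Matrix.of (Matrix.vecCons c fun k =>
      (Pi.single (j.succAbove k) 1 : Fin (q+1) → ℝ)) : Matrix (Fin (q+1)) (Fin (q+1)) ℝ)
    rw [Matrix.det_succ_row_zero, Finset.sum_eq_single j]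
    · have : (Matrix.of (Matrix.vecCons c fun k => (Pi.single (j.succAbove k) 1 : Fin (q+1) → ℝ)) :
        Matrix (Fin (q+1)) (Fin (q+1)) ℝ).submatrix Fin.succ j.succAbove = 1 := by
        ext i l
        simp [Matrix.one_apply, Pi.single_apply, Matrix.vecCons, eq_comm]
      rw [this]
      simp only [hc, Matrix.of_apply, Matrix.vecCons, Fin.cons_zero, Matrix.det_one, mul_one, ← mul_assoc, ← pow_add]
      rw [Even.neg_one_pow ⟨_, rfl⟩, one_mul]
    · intro k _ hkj
      obtain ⟨i, hi⟩ := Fin.exists_succAbove_eq hkj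
      rw [mul_eq_zero]; right
      refine Matrix.det_eq_zero_of_row_eq_zero i fun l => ?_
      simp [Matrix.vecCons, Pi.single_apply, hi, Fin.succAbove_ne]
    · simp
  conv_lhs => rw [h2]
  rw [AlternatingMap.curryLeft_apply_apply]
  rfl

/-- The Euclidean factor. -/
abbrev EE (q : ℕ) := EuclideanSpace ℝ (Fin (q+1))
/-- The parameter factor. -/
abbrev ZZ (m : ℕ) := Fin m → ℝ
/-- The ambient space. -/
abbrev VV (q m : ℕ) := EE q × ZZ m

/-- basis vectors -/
noncomputable def be (k : Fin (q+1)) : EE q := EuclideanSpace.single k 1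

/-- coordinate covectors -/
noncomputable def dyE (k : Fin (q+1)) : EE q →L[ℝ] ℝ := EuclideanSpace.proj k

noncomputable def dy (k : Fin (q+1)) : VV q m →L[ℝ] ℝ := (dyE k).comp (ContinuousLinearMap.fst ℝ _ _)

noncomputable def dz (k : Fin m) : VV q m →L[ℝ] ℝ :=
  (ContinuousLinearMap.proj k).comp (ContinuousLinearMap.snd ℝ _ _)

theorem dy_apply (k : Fin (q+1)) (v : VV q m) : dy k v = v.1 k := rfl
theorem dyE_apply (k : Fin (q+1)) (v : EE q) : dyE k v = v k := rfl
theorem dz_apply (k : Fin m) (v : VV q m) : dz k v = v.2 k := rfl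

/-- The top coefficient vector. -/
noncomputable def pvec (P : QV q (VV q m)) : EE q :=
  WithLp.toLp 2 fun j => (-1:ℝ)^(j:ℕ) * P (fun i => dy (j.succAbove i))

theorem pvec_apply (P : QV q (VV q m)) (j : Fin (q+1)) :
    pvec P j = (-1:ℝ)^(j:ℕ) * P (fun i => dy (j.succAbove i)) := rfl

/-- Row vectors of coefficients. -/
noncomputable def rowL : (VV q m →L[ℝ] ℝ) →ₗ[ℝ] (Fin (q+1) → ℝ) := evL fun k => (be k, 0)

/-- The linear model. -/
noncomputable def mdl (y : EE q) : QV q (VV q m) :=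
  (AlternatingMap.curryLeft (Matrix.detRowAlternating (R := ℝ) (n := Fin (q+1)))
    (fun k => y k)).compLinearMap rowL

theorem mdl_apply (y : EE q) (α : Fin q → VV q m →L[ℝ] ℝ) :
    mdl y α = (Matrix.of (Fin.cons (fun k => y k) (fun i k => α i (be k, 0)) :
      Fin (q+1) → Fin (q+1) → ℝ)).det := rfl

theorem inner_be (y : EE q) (k : Fin (q+1)) : inner ℝ y (be k) = y k := by
  simp [be, EuclideanSpace.inner_single_right]

theorem E_sum (y : EE q) : y = ∑ k, y k • be k := by
  ext i
  simp [be, Pi.single_apply, Finset.sum_apply]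

theorem inner_sum (y w : EE q) : inner ℝ y w = ∑ k, y k * w k := by
  simp [PiLp.inner_apply, mul_comm]

/-- `P` on `y`-covectors. -/
theorem P_y (P : QV q (VV q m)) (a : Fin q → EE q →L[ℝ] ℝ) :
    P (fun i => (a i).comp (ContinuousLinearMap.fst ℝ _ _)) =
      (Matrix.of (Fin.cons (fun k => pvec P k) (fun i k => a i (be k)) :
      Fin (q+1) → Fin (q+1) → ℝ)).det := by
  let L : (Fin (q+1) → ℝ) →ₗ[ℝ] (VV q m →L[ℝ] ℝ) :=
    { toFun := fun c => ∑ k, c k • dy k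
      map_add' := by intro c d; simp [add_smul, Finset.sum_add_distrib]
      map_smul' := by intro c d; simp [Finset.smul_sum, smul_smul] }
  have hL : ∀ j, L (Pi.single j 1) = dy j := by
    intro j
    change ∑ k, (Pi.single j (1:ℝ) : Fin (q+1) → ℝ) k • dy k = _
    rw [Finset.sum_eq_single j]
    · simp
    · intro b _ hb; simp [hb]
    · simp
  have h := alt_eq (P.compLinearMap L) (fun i k => a i (be k))
  have e1 : (P.compLinearMap L) (fun i k => a i (be k)) =
      P (fun i => (a i).comp (ContinuousLinearMap.fst ℝ _ _)) := by
    rw [AlternatingMap.compLinearMap_apply]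
    congr 1; funext i
    refine ContinuousLinearMap.ext fun v => ?_
    change (∑ k, a i (be k) • (dy k : VV q m →L[ℝ] ℝ)) v = a i v.1
    conv_rhs => rw [E_sum v.1]
    rw [map_sum, _root_.sum_apply]
    refine Finset.sum_congr rfl fun k _ => ?_
    simp [dy_apply, mul_comm]
  rw [← e1, h]
  simp only [AlternatingMap.compLinearMap_apply, hL, pvec_apply]

theorem pvec_mdl (y : EE q) : pvec (mdl y : QV q (VV q m)) = y := by
  ext j
  rw [pvec_apply, mdl_apply, Matrix.det_succ_row_zero, Finset.sum_eq_single j]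
  · have : ((Matrix.of (Fin.cons (fun k => y k) (fun i k => dy (j.succAbove i)
        ((be k, 0) : VV q m)))) : Matrix (Fin (q+1)) (Fin (q+1)) ℝ).submatrix Fin.succ j.succAbove
        = 1 := by
      ext i l
      simp [Matrix.one_apply, dy_apply, be, Pi.single_apply]
    rw [this]
    simp only [Matrix.of_apply, Fin.cons_zero, Matrix.det_one, mul_one, ← mul_assoc, ← pow_add]
    rw [Even.neg_one_pow ⟨_, rfl⟩, one_mul]
  · intro k _ hkj
    obtain ⟨i, hi⟩ := Fin.exists_succAbove_eq hkj
    rw [mul_eq_zero]; right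
    refine Matrix.det_eq_zero_of_row_eq_zero i fun l => ?_
    simp [dy_apply, be, Pi.single_apply, hi, (Fin.succAbove_ne k l).symm]
  · simp

/-- A `q`-vector killing the `z`-covectors is a model. -/
theorem eq_mdl (P : QV q (VV q m)) (h : ∀ α : Fin q → VV q m →L[ℝ] ℝ,
    (∃ i, ∀ u, α i (u, 0) = 0) → P α = 0) : P = mdl (pvec P) := by
  have key : ∀ (s : Finset (Fin q)) (α : Fin q → VV q m →L[ℝ] ℝ),
      P (s.piecewise (fun i => ((α i).comp (ContinuousLinearMap.inl ℝ _ _)).comp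
        (ContinuousLinearMap.fst ℝ _ _)) α) = P α := by
    intro s α
    induction s using Finset.induction_on with
    | empty => simp
    | insert i s hi ih =>
      rw [Finset.piecewise_insert]
      set β := s.piecewise (fun i => ((α i).comp (ContinuousLinearMap.inl ℝ _ _)).comp
        (ContinuousLinearMap.fst ℝ _ _)) α with hβ
      have hβi : β i = α i := by rw [hβ, Finset.piecewise_eq_of_notMem _ _ _ hi]
      have h1 := P.map_update_sub β i (α i) (((α i).comp (ContinuousLinearMap.inl ℝ _ _)).comp
        (ContinuousLinearMap.fst ℝ _ _))
      have h2 : P (Function.update β i (α i - ((α i).comp (ContinuousLinearMap.inl ℝ _ _)).comp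
        (ContinuousLinearMap.fst ℝ _ _))) = 0 := by
        refine h _ ⟨i, fun u => ?_⟩
        simp
      have h3 : Function.update β i (α i) = β := by rw [← hβi]; simp
      rw [h2, h3, ih] at h1
      linarith
  ext α
  have h1 := key Finset.univ α
  rw [Finset.piecewise_univ] at h1
  rw [← h1, P_y, mdl_apply]
  rfl

theorem pvec_plu (v : Fin q → VV q m) (w : EE q) : inner ℝ (pvec (plu v)) w =
    (Matrix.of fun i j => (Fin.cons w (fun k => (v k).1) : Fin (q+1) → EE q) j i).det := by
  rw [Matrix.det_succ_column_zero, inner_sum]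
  refine Finset.sum_congr rfl fun k _ => ?_
  rw [pvec_apply, plu_apply, mul_right_comm]
  rfl

theorem pvec_plu_perp (v : Fin q → VV q m) (k : Fin q) : inner ℝ (pvec (plu v)) (v k).1 = 0 := by
  rw [pvec_plu]
  refine Matrix.det_zero_of_column_eq (i := 0) (j := k.succ) (Fin.succ_ne_zero k).symm fun i => ?_
  simp

theorem pvec_eq_zero (v : Fin q → VV q m) (c : Fin q → ℝ) (hc : ∑ k, c k • (v k).1 = 0)
    (h0 : c ≠ 0) : pvec (plu v) = 0 := by
  refine ext_inner_right ℝ fun w => ?_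
  rw [pvec_plu, inner_zero_left]
  refine Matrix.exists_mulVec_eq_zero_iff.1 ⟨Fin.cons 0 c, ?_, ?_⟩
  · intro h
    apply h0
    funext k
    have := congrFun h k.succ
    simpa using this
  · funext i
    have := congrArg (fun y : EE q => y i) hc
    simp only [Matrix.mulVec, dotProduct, Fin.sum_univ_succ, Matrix.of_apply, Fin.cons_zero,
      Fin.cons_succ, mul_zero, zero_add, Pi.zero_apply]
    simpa [mul_comm] using this

/-- pushforward of the model -/
theorem push_mdl (A : VV q m →L[ℝ] VV q m) (B : EE q →L[ℝ] EE q) (hA : ∀ u, A (u, 0) = (B u, 0))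
    (y ζ : EE q) (h : ∀ u, inner ℝ ζ (B u) = inner ℝ y u) :
    push A (mdl y : QV q (VV q m)) =
      (Matrix.of fun i j => (B (be j)) i : Matrix (Fin (q+1)) (Fin (q+1)) ℝ).det • mdl ζ := by
  ext α
  rw [push_apply, mdl_apply, AlternatingMap.smul_apply, mdl_apply, smul_eq_mul, mul_comm,
    ← Matrix.det_mul]
  congr 1
  ext i k
  rw [Matrix.mul_apply]
  refine Fin.cases ?_ (fun i => ?_) i
  · simp only [Matrix.of_apply, Fin.cons_zero]
    rw [← inner_be, ← h, inner_sum]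
  · simp only [Matrix.of_apply, Fin.cons_succ, ContinuousLinearMap.comp_apply, hA]
    conv_lhs => rw [E_sum (B (be k))]
    have : ((∑ l, (B (be k)) l • be l, 0) : VV q m) = ∑ l, (B (be k)) l • ((be l, 0) : VV q m) := by
      ext <;> simp [Prod.fst_sum, Prod.snd_sum]
    rw [this, map_sum]
    refine Finset.sum_congr rfl fun l _ => ?_
    rw [map_smul, smul_eq_mul, mul_comm]

theorem pvec_push (A : VV q m →L[ℝ] VV q m) (B : EE q →L[ℝ] EE q) (hA : ∀ u, (A u).1 = B u.1)
    (P : QV q (VV q m)) (ζ : EE q) (h : ∀ u, inner ℝ ζ (B u) = inner ℝ (pvec P) u) :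
    pvec (push A P) =
      (Matrix.of fun i j => (B (be j)) i : Matrix (Fin (q+1)) (Fin (q+1)) ℝ).det • ζ := by
  have h1 := push_mdl (m := m) ((B.comp (ContinuousLinearMap.fst ℝ _ _)).prod 0) B
    (fun u => rfl) (pvec P) ζ h
  have h2 : pvec (push A P) =
      pvec (push ((B.comp (ContinuousLinearMap.fst ℝ (EE q) (ZZ m))).prod 0) (mdl (pvec P)) :
        QV q (VV q m)) := by
    ext j
    simp only [pvec_apply, push_apply]
    congr 1
    have h3 := P_y P (fun i => (dyE (j.succAbove i)).comp B)
    have h4 := P_y (mdl (pvec P) : QV q (VV q m)) (fun i => (dyE (j.succAbove i)).comp B)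
    rw [pvec_mdl] at h4
    rw [← h3] at h4
    have e1 : (fun i => (dy (j.succAbove i) : VV q m →L[ℝ] ℝ).comp A) = fun i =>
        ((dyE (j.succAbove i)).comp B).comp (ContinuousLinearMap.fst ℝ _ _) := by
      funext i
      refine ContinuousLinearMap.ext fun v => ?_
      simp [dy_apply, dyE_apply, hA]
    rw [e1, ← h4]
    congr 1
  rw [h2, h1]
  ext j
  conv_rhs => rw [← pvec_mdl (m := m) ζ]
  simp only [pvec_apply, AlternatingMap.smul_apply, PiLp.smul_apply, smul_eq_mul]
  ring
end M1

section M2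
open Set Filter Topology
variable {q m : ℕ}

theorem cdet {V : Type} [NormedAddCommGroup V] [NormedSpace ℝ V] (v : Fin q → V)
    (β : Fin (q+1) → V →L[ℝ] ℝ) (w : Fin (q+1) → ℝ) :
    ∑ j, w j * ((-1:ℝ)^(j:ℕ) * plu v (fun i => β (j.succAbove i))) =
    (Matrix.of fun i k => (Fin.cons (w i) (fun l => β i (v l)) : Fin (q+1) → ℝ) k).det := by
  rw [Matrix.det_succ_column_zero]
  refine Finset.sum_congr rfl fun k _ => ?_
  rw [plu_apply, ← mul_assoc, mul_comm (w k)]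
  rfl

/-- `z`-components of the basic fields -/
noncomputable def tau (P : QV q (VV q m)) (j i : Fin (q+1)) : ZZ m := fun k =>
  if i = j then 0 else (-1:ℝ)^(j:ℕ) * P (fun l => Function.update dy i (dz k) (j.succAbove l))

/-- The basic fields. -/
noncomputable def XX (P : QV q (VV q m)) (j i : Fin (q+1)) : VV q m :=
  (pvec P j • be i - pvec P i • be j, tau P j i)

theorem cov_sum (α : VV q m →L[ℝ] ℝ) :
    α = ∑ l, α (be l, 0) • dy l + ∑ k, α (0, Pi.single k 1) • dz k := by
  refine ContinuousLinearMap.ext fun v => ?_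
  have h : v = ∑ l, v.1 l • ((be l, 0) : VV q m) + ∑ k, v.2 k • ((0, Pi.single k 1) : VV q m) := by
    refine Prod.ext ?_ ?_
    · simp only [Prod.fst_add, Prod.fst_sum, Prod.smul_mk, smul_zero, Finset.sum_const_zero,
        add_zero]
      exact E_sum _
    · simp only [Prod.snd_add, Prod.snd_sum, Prod.smul_mk, smul_zero, Finset.sum_const_zero,
        zero_add]
      funext i
      simp [Finset.sum_apply, Pi.single_apply]
  conv_lhs => rw [h]
  simp only [map_add, map_sum, map_smul, _root_.add_apply, _root_.sum_apply, _root_.smul_apply,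
    dy_apply, dz_apply, smul_eq_mul]
  congr 1 <;> exact Finset.sum_congr rfl fun _ _ => mul_comm _ _

theorem XX_eq (v : Fin q → VV q m) {j i : Fin (q+1)} (hij : i ≠ j) (α : VV q m →L[ℝ] ℝ) :
    α (XX (plu v) j i) =
      (-1:ℝ)^(j:ℕ) * plu v (fun l => Function.update dy i α (j.succAbove l)) := by
  obtain ⟨a, ha⟩ := Fin.exists_succAbove_eq hij
  have hup : ∀ β : VV q m →L[ℝ] ℝ, (fun l => Function.update dy i β (j.succAbove l)) =
      Function.update (fun l => dy (j.succAbove l)) a β := by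
    intro β
    funext l
    by_cases hl : l = a
    · subst hl; rw [ha]; simp
    · have : j.succAbove l ≠ i := by
        rw [← ha]; exact fun h => hl (Fin.succAbove_right_injective h)
      simp [hl, this]
  let T : (VV q m →L[ℝ] ℝ) →ₗ[ℝ] ℝ := (-1:ℝ)^(j:ℕ) •
    ((plu v).toMultilinearMap.toLinearMap (fun l => dy (j.succAbove l)) a)
  have hT : ∀ β, T β = (-1:ℝ)^(j:ℕ) * plu v (fun l => Function.update dy i β (j.succAbove l)) := by
    intro β
    rw [hup]; rfl
  have hTz : ∀ k, T (dz k) = tau (plu v) j i k := by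
    intro k; rw [hT, tau, if_neg hij]
  have hTy : ∀ l, T (dy l) = dy l (XX (plu v) j i) := by
    intro l
    rw [hT, dy_apply]
    have hX : (XX (plu v) j i).1 l = (if l = i then pvec (plu v) j else 0) -
        (if l = j then pvec (plu v) i else 0) := by
      simp [XX, be, Pi.single_apply]
    rw [hX]
    by_cases h1 : l = i
    · subst h1
      simp [hij, pvec_apply, Function.update_eq_self]
    · by_cases h2 : l = j
      · subst h2
        have h3 := cdet v (Function.update dy i (dy l)) (Pi.single i 1 + Pi.single l 1)
        have h4 : (Matrix.of fun a k => (Fin.cons ((Pi.single i 1 + Pi.single l 1 : Fin (q+1) → ℝ) a)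
            (fun b => (Function.update dy i (dy l) : Fin (q+1) → VV q m →L[ℝ] ℝ) a (v b)) :
            Fin (q+1) → ℝ) k).det = 0 := by
          refine Matrix.det_zero_of_row_eq hij ?_
          funext k
          refine Fin.cases ?_ (fun k => ?_) k
          · simp [hij, Ne.symm hij]
          · simp [Ne.symm hij]
        rw [h4] at h3
        have h5 : ∑ a, (Pi.single i 1 + Pi.single l 1 : Fin (q+1) → ℝ) a *
            ((-1:ℝ)^(a:ℕ) * plu v (fun b => Function.update dy i (dy l) (a.succAbove b))) =
            ((-1:ℝ)^(i:ℕ) * plu v (fun b => Function.update dy i (dy l) (i.succAbove b))) +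
            ((-1:ℝ)^(l:ℕ) * plu v (fun b => Function.update dy i (dy l) (l.succAbove b))) := by
          simp [add_mul, Finset.sum_add_distrib, Pi.single_apply]
        rw [h5] at h3
        have h6 : (fun b => (Function.update dy i (dy l) : Fin (q+1) → VV q m →L[ℝ] ℝ)
            (i.succAbove b)) = fun b => dy (i.succAbove b) := by
          funext b; simp [Fin.succAbove_ne]
        rw [h6, ← pvec_apply] at h3
        simp only [h1, if_false, if_true]
        linarith
      · obtain ⟨b, hb⟩ := Fin.exists_succAbove_eq h2
        have : plu v (fun b => (Function.update dy i (dy l) : Fin (q+1) → VV q m →L[ℝ] ℝ)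
            (j.succAbove b)) = 0 := by
          refine (plu v).map_eq_zero_of_eq _ (i := a) (j := b) ?_ ?_
          · rw [ha, hb]; simp [h1]
          · intro h; rw [h, hb] at ha; exact h1 ha
        rw [this]; simp [h1, h2]
  rw [← hT]
  conv_rhs => rw [cov_sum α]
  conv_lhs => rw [cov_sum α]
  simp only [map_add, map_sum, map_smul, hTy, hTz, _root_.add_apply, _root_.sum_apply,
    _root_.smul_apply]
  rfl

theorem XX_self (P : QV q (VV q m)) (i : Fin (q+1)) : XX P i i = 0 := by
  refine Prod.ext ?_ ?_
  · simp [XX]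
  · funext k; simp [XX, tau]

theorem XX_ann (v : Fin q → VV q m) (j i : Fin (q+1)) (α : VV q m →L[ℝ] ℝ)
    (hα : ∀ k, α (v k) = 0) : α (XX (plu v) j i) = 0 := by
  by_cases hij : i = j
  · subst hij; rw [XX_self, map_zero]
  · rw [XX_eq v hij]
    obtain ⟨a, ha⟩ := Fin.exists_succAbove_eq hij
    rw [plu_apply, Matrix.det_eq_zero_of_row_eq_zero a, mul_zero]
    intro l
    simp [ha, hα]

/-- The `z`-part of the field attached to `B`. -/
noncomputable def Xi (P : QV q (VV q m)) : (EE q →L[ℝ] EE q) →L[ℝ] ZZ m :=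
  LinearMap.toContinuousLinearMap
    { toFun := fun B => ∑ i, ∑ j, ((1/2:ℝ) * (B (be j)) i) • tau P j i
      map_add' := by
        intro B C
        simp only [_root_.add_apply, PiLp.add_apply, mul_add, add_smul, Finset.sum_add_distrib]
      map_smul' := by
        intro c B
        simp only [_root_.smul_apply, PiLp.smul_apply, smul_eq_mul, RingHom.id_apply,
          Finset.smul_sum, smul_smul]
        refine Finset.sum_congr rfl fun i _ => Finset.sum_congr rfl fun j _ => ?_
        ring_nf }

theorem Xi_apply (P : QV q (VV q m)) (B : EE q →L[ℝ] EE q) :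
    Xi P B = ∑ i, ∑ j, ((1/2:ℝ) * (B (be j)) i) • tau P j i := rfl

theorem skew_coord {B : EE q →L[ℝ] EE q} (hB : star B = -B) (i j : Fin (q+1)) :
    (B (be j)) i = -(B (be i)) j := by
  have h := ContinuousLinearMap.adjoint_inner_left B (be j) (be i)
  rw [← ContinuousLinearMap.star_eq_adjoint, hB, _root_.neg_apply, inner_neg_left,
    inner_be, real_inner_comm, inner_be] at h
  linarith

theorem field_sum (P : QV q (VV q m)) {B : EE q →L[ℝ] EE q} (hB : star B = -B) :
    ((B (pvec P), Xi P B) : VV q m) = ∑ i, ∑ j, ((1/2:ℝ) * (B (be j)) i) • XX P j i := by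
  refine Prod.ext ?_ ?_
  · simp only [Prod.fst_sum, Prod.smul_fst]
    have h1 : B (pvec P) = ∑ i, ∑ j, ((B (be j)) i * pvec P j) • be i := by
      conv_lhs => rw [E_sum (B (pvec P))]
      refine Finset.sum_congr rfl fun i _ => ?_
      rw [← Finset.sum_smul]
      congr 1
      conv_lhs => rw [E_sum (pvec P)]
      simp [map_sum, mul_comm]
    have h2 : ∑ i, ∑ j, ((B (be j)) i * pvec P i) • be j = - B (pvec P) := by
      rw [h1, Finset.sum_comm, ← Finset.sum_neg_distrib]
      refine Finset.sum_congr rfl fun i _ => ?_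
      rw [← Finset.sum_neg_distrib]
      refine Finset.sum_congr rfl fun j _ => ?_
      rw [skew_coord hB, neg_mul, neg_smul]
    have h3 : ∑ i, ∑ j, ((1/2:ℝ) * (B (be j)) i) • (XX P j i).1 =
        (1/2:ℝ) • (∑ i, ∑ j, ((B (be j)) i * pvec P j) • be i) -
        (1/2:ℝ) • (∑ i, ∑ j, ((B (be j)) i * pvec P i) • be j) := by
      simp only [Finset.smul_sum, ← Finset.sum_sub_distrib, XX, smul_sub, smul_smul, mul_assoc]
    rw [h3, h2, ← h1, smul_neg, sub_neg_eq_add, ← add_smul]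
    norm_num
  · simp only [Prod.snd_sum, Prod.smul_snd]
    rfl

theorem field_ann (v : Fin q → VV q m) {B : EE q →L[ℝ] EE q} (hB : star B = -B)
    (α : VV q m →L[ℝ] ℝ) (hα : ∀ k, α (v k) = 0) :
    α (B (pvec (plu v)), Xi (plu v) B) = 0 := by
  rw [field_sum _ hB]
  simp [map_sum, XX_ann v _ _ α hα]

theorem field_mem_span (v : Fin q → VV q m) {B : EE q →L[ℝ] EE q} (hB : star B = -B) :
    ((B (pvec (plu v)), Xi (plu v) B) : VV q m) ∈ Submodule.span ℝ (range v) := by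
  by_contra h
  obtain ⟨f, hf1, hf2⟩ := Submodule.exists_dual_map_eq_bot_of_notMem h inferInstance
  apply hf1
  have hk : ∀ k, f (v k) = 0 := by
    intro k
    have : f (v k) ∈ (Submodule.span ℝ (range v)).map f :=
      ⟨v k, Submodule.subset_span ⟨k, rfl⟩, rfl⟩
    rw [hf2] at this
    exact this
  exact field_ann v hB (LinearMap.toContinuousLinearMap f) hk

end M2

section M3
open Set Filter Topology
variable {q m : ℕ} {X X' : Type} [NormedAddCommGroup X] [NormedSpace ℝ X]
  [NormedAddCommGroup X'] [NormedSpace ℝ X']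

/-- coordinate covectors -/
noncomputable def cb : Fin (q+1) ⊕ Fin m → (VV q m →L[ℝ] ℝ) := Sum.elim dy dz
/-- coordinate vectors -/
noncomputable def bv : Fin (q+1) ⊕ Fin m → VV q m :=
  Sum.elim (fun l => (be l, 0)) (fun k => (0, Pi.single k 1))

theorem cov_cb (α : VV q m →L[ℝ] ℝ) : α = ∑ i, α (bv i) • cb i := by
  conv_lhs => rw [cov_sum α]
  rw [Fintype.sum_sum_type]
  rfl

theorem QV_expand (P : QV q (VV q m)) (α : Fin q → VV q m →L[ℝ] ℝ) :
    P α = ∑ r : Fin q → Fin (q+1) ⊕ Fin m, (∏ i, α i (bv (r i))) * P (fun i => cb (r i)) := by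
  have h : α = fun i => ∑ j, α i (bv j) • cb j := funext fun i => cov_cb (α i)
  conv_lhs => rw [h]
  have h2 := P.toMultilinearMap.map_sum (fun i j => α i (bv j) • cb j)
  refine h2.trans (Finset.sum_congr rfl fun r _ => ?_)
  exact P.toMultilinearMap.map_smul_univ (fun i => α i (bv (r i))) fun i => cb (r i)

/-- smoothness of a `q`-vector valued map -/
def SmQ (P : X → QV q (VV q m)) (O : Set X) : Prop := ∀ α, ContDiffOn ℝ ∞ (fun x => P x α) O

theorem SmQ.eval {P : X → QV q (VV q m)} {O : Set X} (h : SmQ P O)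
    {α : X → Fin q → VV q m →L[ℝ] ℝ} (hα : ∀ i, ContDiffOn ℝ ∞ (fun x => α x i) O) :
    ContDiffOn ℝ ∞ (fun x => P x (α x)) O := by
  have he : (fun x => P x (α x)) = fun x => ∑ r : Fin q → Fin (q+1) ⊕ Fin m,
      (∏ i, α x i (bv (r i))) * P x (fun i => cb (r i)) := funext fun x => QV_expand _ _
  rw [he]
  refine ContDiffOn.sum fun r _ => ContDiffOn.mul (contDiffOn_prod fun i _ => ?_) (h _)
  exact (hα i).clm_apply contDiffOn_const

theorem SmQ.mono {P : X → QV q (VV q m)} {O O' : Set X} (h : SmQ P O) (hO : O' ⊆ O) : SmQ P O' :=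
  fun α => (h α).mono hO

theorem SmQ.comp {P : X → QV q (VV q m)} {O : Set X} (h : SmQ P O) {θ : X' → X} {O' : Set X'}
    (hθ : ContDiffOn ℝ ∞ θ O') (hm : MapsTo θ O' O) : SmQ (fun x => P (θ x)) O' :=
  fun α => (h α).comp hθ hm

theorem SmQ.push {P : X → QV q (VV q m)} {O : Set X} (h : SmQ P O)
    {A : X → VV q m →L[ℝ] VV q m} (hA : ContDiffOn ℝ ∞ A O) :
    SmQ (fun x => NambuLin.push (A x) (P x)) O := by
  intro α
  simp only [push_apply]
  exact h.eval fun i => contDiffOn_const.clm_comp hA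

theorem SmQ.pvec {P : X → QV q (VV q m)} {O : Set X} (h : SmQ P O) :
    ContDiffOn ℝ ∞ (fun x => NambuLin.pvec (P x)) O := by
  rw [contDiffOn_euclidean]
  intro j
  simp only [pvec_apply]
  exact contDiffOn_const.mul (h _)

theorem SmQ.Xi {P : X → QV q (VV q m)} {O : Set X} (h : SmQ P O) :
    ContDiffOn ℝ ∞ (fun x => NambuLin.Xi (P x)) O := by
  refine contDiffOn_clm_apply.2 fun B => ?_
  simp only [Xi_apply]
  refine ContDiffOn.sum fun i _ => ContDiffOn.sum fun j _ => ContDiffOn.const_smul _ ?_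
  rw [contDiffOn_pi]
  intro k
  unfold tau
  split_ifs
  · exact contDiffOn_const
  · exact contDiffOn_const.mul (h _)

theorem deriv_frozen {P : X → QV q (VV q m)} {O : Set X} (hO : IsOpen O) (h : SmQ P O)
    {x0 : X} (hx : x0 ∈ O) (h0 : P x0 = 0)
    {α : X → Fin q → VV q m →L[ℝ] ℝ} (hα : ∀ i, ContDiffOn ℝ ∞ (fun x => α x i) O) :
    fderiv ℝ (fun x => P x (α x)) x0 = fderiv ℝ (fun x => P x (α x0)) x0 := by
  have key : ∀ β : X → Fin q → VV q m →L[ℝ] ℝ, (∀ i, ContDiffOn ℝ ∞ (fun x => β x i) O) →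
      HasFDerivAt (fun x => P x (β x)) (∑ r : Fin q → Fin (q+1) ⊕ Fin m,
        (∏ i, β x0 i (bv (r i))) • fderiv ℝ (fun x => P x (fun i => cb (r i))) x0) x0 := by
    intro β hβ
    have he : (fun x => P x (β x)) = fun x => ∑ r : Fin q → Fin (q+1) ⊕ Fin m,
      (∏ i, β x i (bv (r i))) * P x (fun i => cb (r i)) := funext fun x => QV_expand _ _
    rw [he]
    refine HasFDerivAt.fun_sum fun r _ => ?_
    have h1 : HasFDerivAt (fun x => P x (fun i => cb (r i)))
        (fderiv ℝ (fun x => P x (fun i => cb (r i))) x0) x0 :=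
      (((h _).contDiffAt (hO.mem_nhds hx)).differentiableAt (by simp)).hasFDerivAt
    have h2 : DifferentiableAt ℝ (fun x => ∏ i, β x i (bv (r i))) x0 := by
      have : ContDiffOn ℝ ∞ (fun x => ∏ i, β x i (bv (r i))) O :=
        contDiffOn_prod fun i _ => (hβ i).clm_apply contDiffOn_const
      exact (this.contDiffAt (hO.mem_nhds hx)).differentiableAt (by simp)
    have h3 := h2.hasFDerivAt.mul h1
    refine h3.congr_fderiv ?_
    simp [h0]
  rw [(key α hα).fderiv, (key (fun _ => α x0) fun i => contDiffOn_const).fderiv]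

/-- Local diffeomorphisms with chosen domains and inverse. -/
structure LD (φ : X → X') (ψ : X' → X) (N : Set X) (M : Set X') : Prop where
  oN : IsOpen N
  oM : IsOpen M
  sN : ContDiffOn ℝ ∞ φ N
  sM : ContDiffOn ℝ ∞ ψ M
  mN : ∀ x ∈ N, φ x ∈ M
  mM : ∀ x ∈ M, ψ x ∈ N
  li : ∀ x ∈ N, ψ (φ x) = x
  ri : ∀ x ∈ M, φ (ψ x) = x

variable {φ : X → X'} {ψ : X' → X} {N : Set X} {M : Set X'}

theorem LD.symm (h : LD φ ψ N M) : LD ψ φ M N :=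
  ⟨h.oM, h.oN, h.sM, h.sN, h.mM, h.mN, h.ri, h.li⟩

theorem LD.restrict (h : LD φ ψ N M) {N' : Set X} (hN' : IsOpen N') :
    LD φ ψ (N ∩ N') (M ∩ ψ ⁻¹' N') :=
  ⟨h.oN.inter hN', h.sM.continuousOn.isOpen_inter_preimage h.oM hN', h.sN.mono inter_subset_left,
    h.sM.mono inter_subset_left,
    fun x hx => ⟨h.mN x hx.1, by rw [mem_preimage, h.li x hx.1]; exact hx.2⟩,
    fun x hx => ⟨h.mM x hx.1, hx.2⟩, fun x hx => h.li x hx.1, fun x hx => h.ri x hx.1⟩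

theorem LD.comp {X'' : Type} [NormedAddCommGroup X''] [NormedSpace ℝ X''] {φ' : X' → X''}
    {ψ' : X'' → X'} {L : Set X''} (h : LD φ ψ N M) (h' : LD φ' ψ' M L) :
    LD (fun x => φ' (φ x)) (fun y => ψ (ψ' y)) N L :=
  ⟨h.oN, h'.oM, h'.sN.comp h.sN h.mN, h.sM.comp h'.sM h'.mM,
    fun x hx => h'.mN _ (h.mN x hx), fun x hx => h.mM _ (h'.mM x hx),
    fun x hx => by rw [h'.li _ (h.mN x hx), h.li x hx],
    fun x hx => by rw [h.ri _ (h'.mM x hx), h'.ri x hx]⟩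

theorem LD.hasFDerivAt (h : LD φ ψ N M) {x : X} (hx : x ∈ N) : HasFDerivAt φ (fderiv ℝ φ x) x :=
  ((h.sN.contDiffAt (h.oN.mem_nhds hx)).differentiableAt (by simp)).hasFDerivAt

theorem LD.fderiv_left (h : LD φ ψ N M) {x : X} (hx : x ∈ N) (w : X) :
    fderiv ℝ ψ (φ x) (fderiv ℝ φ x w) = w := by
  have h1 := (h.symm.hasFDerivAt (h.mN x hx)).comp x (h.hasFDerivAt hx)
  have h2 : HasFDerivAt (ψ ∘ φ) (ContinuousLinearMap.id ℝ X) x := by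
    refine (hasFDerivAt_id x).congr_of_eventuallyEq ?_
    filter_upwards [h.oN.mem_nhds hx] with y hy using h.li y hy
  exact DFunLike.congr_fun (h1.unique h2) w

theorem LD.fderiv_right (h : LD φ ψ N M) {s : X'} (hs : s ∈ M) (w : X') :
    fderiv ℝ φ (ψ s) (fderiv ℝ ψ s w) = w := h.symm.fderiv_left hs w

theorem LD_of_bij [FiniteDimensional ℝ X] [FiniteDimensional ℝ X'] {O : Set X} (hO : IsOpen O)
    (hφ : ContDiffOn ℝ ∞ φ O) {x : X} (hx : x ∈ O) (hb : Function.Bijective (fderiv ℝ φ x)) :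
    ∃ ψ N M, LD φ ψ N M ∧ x ∈ N ∧ N ⊆ O := by
  have : CompleteSpace X := FiniteDimensional.complete ℝ X
  have : CompleteSpace X' := FiniteDimensional.complete ℝ X'
  let e : X ≃L[ℝ] X' := (LinearEquiv.ofBijective (fderiv ℝ φ x).toLinearMap hb).toContinuousLinearEquiv
  have he : (e : X →L[ℝ] X') = fderiv ℝ φ x := ContinuousLinearMap.ext fun v => rfl
  have h1 : ContDiffAt ℝ ∞ φ x := hφ.contDiffAt (hO.mem_nhds hx)
  have h2 : HasFDerivAt φ (e : X →L[ℝ] X') x := by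
    rw [he]; exact (h1.differentiableAt (by simp)).hasFDerivAt
  let G := h1.toOpenPartialHomeomorph φ h2 (by simp)
  have hG : ∀ y, G y = φ y := fun y => rfl
  have hxG : x ∈ G.source := h1.mem_toOpenPartialHomeomorph_source h2 (by simp)
  -- open set where the derivative is invertible
  have hfd : ContinuousOn (fderiv ℝ φ) O := hφ.continuousOn_fderiv_of_isOpen hO (by simp)
  let O2 : Set X := O ∩ fderiv ℝ φ ⁻¹' (range ((↑) : (X ≃L[ℝ] X') → (X →L[ℝ] X')))
  have hO2 : IsOpen O2 := hfd.isOpen_inter_preimage hO (ContinuousLinearEquiv.isOpen)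
  have hxO2 : x ∈ O2 := ⟨hx, e, he⟩
  refine ⟨G.symm, G.source ∩ O2, G.target ∩ G.symm ⁻¹' O2, ?_, ⟨hxG, hxO2⟩, fun y hy => hy.2.1⟩
  refine ⟨G.open_source.inter hO2, G.isOpen_inter_preimage_symm hO2, hφ.mono fun y hy => hy.2.1,
    ?_, ?_, ?_, ?_, ?_⟩
  · intro s hs
    obtain ⟨hs1, hs2, e', he'⟩ := hs
    refine ContDiffAt.contDiffWithinAt (G.contDiffAt_symm (f₀' := e') hs1 ?_ ?_)
    · rw [he']
      exact ((hφ.contDiffAt (hO.mem_nhds hs2)).differentiableAt (by simp)).hasFDerivAt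
    · exact hφ.contDiffAt (hO.mem_nhds hs2)
  · intro y hy
    refine ⟨G.map_source hy.1, ?_⟩
    change G.symm (G y) ∈ O2
    rw [G.left_inv hy.1]; exact hy.2
  · intro s hs
    exact ⟨G.map_target hs.1, hs.2⟩
  · intro y hy; exact G.left_inv hy.1
  · intro y hy; exact G.right_inv hy.1

end M3

section M4
open Set Filter Topology
variable {n q m : ℕ} {V V' : Type} [NormedAddCommGroup V] [NormedSpace ℝ V]
  [NormedAddCommGroup V'] [NormedSpace ℝ V']

/-- the coordinate frame -/
noncomputable def fb (hqn : q ≤ n) (k : Fin q) : Fin n → ℝ := Pi.single (Fin.castLE hqn k) 1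

/-- killing the first `q` coordinates -/
noncomputable def killq (n q : ℕ) : (Fin n → ℝ) →L[ℝ] (Fin n → ℝ) :=
  ContinuousLinearMap.pi fun i => if (i:ℕ) < q then 0 else ContinuousLinearMap.proj i

theorem killq_fb (hqn : q ≤ n) (k : Fin q) : killq n q (fb hqn k) = 0 := by
  funext i
  simp only [killq, fb, ContinuousLinearMap.coe_pi', Pi.zero_apply]
  split_ifs with h
  · rfl
  · have : i ≠ Fin.castLE hqn k := by
      rintro rfl; exact h (by simp)
    simp [this]

theorem killq_eq_zero (hqn : q ≤ n) {w : Fin n → ℝ} (h : killq n q w = 0) :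
    w ∈ Submodule.span ℝ (range (fb (n := n) hqn)) := by
  have hw : w = ∑ k : Fin q, w (Fin.castLE hqn k) • fb hqn k := by
    funext i
    simp only [Finset.sum_apply, Pi.smul_apply, smul_eq_mul, fb, Pi.single_apply]
    by_cases hi : (i:ℕ) < q
    · rw [Finset.sum_eq_single ⟨i, hi⟩]
      · simp
      · intro b _ hb
        rw [if_neg, mul_zero]
        rintro rfl
        exact hb (by ext; simp)
      · simp
    · have h1 := congrFun h i
      simp only [killq, ContinuousLinearMap.coe_pi', hi, if_false, Pi.zero_apply] at h1
      rw [Finset.sum_eq_zero]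
      · exact h1
      · intro k _
        rw [if_neg, mul_zero]
        rintro rfl
        exact hi (by simp)
  rw [hw]
  exact Submodule.sum_mem _ fun k _ => Submodule.smul_mem _ _ (Submodule.subset_span ⟨k, rfl⟩)

/-- A Nambu chart at `x`. -/
def NChart (hqn : q ≤ n) (P : V → QV q V) (x : V) : Prop :=
  ∃ (φ : V → (Fin n → ℝ)) (ψ : (Fin n → ℝ) → V) (N : Set V) (M : Set (Fin n → ℝ)),
    LD φ ψ N M ∧ x ∈ N ∧ ∀ s ∈ M, P (ψ s) = plu (fun k => fderiv ℝ ψ s (fb hqn k))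

/-- The frame of a Nambu chart. -/
theorem NChart.frame {hqn : q ≤ n} {P : V → QV q V} {x : V} (h : NChart hqn P x) :
    ∃ (N : Set V) (v : V → Fin q → V) (g : V → Fin n → ℝ), IsOpen N ∧ x ∈ N ∧
      (∀ k, ContDiffOn ℝ ∞ (fun x => v x k) N) ∧ ContDiffOn ℝ ∞ g N ∧ (∀ x' ∈ N, P x' = plu (v x')) ∧
      (∀ x' ∈ N, ∀ k, fderiv ℝ g x' (v x' k) = 0) ∧
      (∀ x' ∈ N, ∀ w, fderiv ℝ g x' w = 0 → w ∈ Submodule.span ℝ (range (v x'))) ∧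
      (∀ x' ∈ N, ∀ c : Fin q → ℝ, ∑ k, c k • v x' k = 0 → c = 0) ∧
      (∀ x' ∈ N, ∀ k l, fderiv ℝ (fun x => v x k) x' (v x' l) =
        fderiv ℝ (fun x => v x l) x' (v x' k)) := by
  obtain ⟨φ, ψ, N, M, hL, hx, hP⟩ := h
  have hdψ : ContDiffOn ℝ ∞ (fderiv ℝ ψ) M := hL.sM.fderiv_of_isOpen hL.oM (by simp)
  have hdg : ∀ x' ∈ N, ∀ w, fderiv ℝ (fun x => killq n q (φ x)) x' w =
      killq n q (fderiv ℝ φ x' w) := by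
    intro x' hx' w
    have h1 := ((killq n q).hasFDerivAt (x := φ x')).comp x' (hL.hasFDerivAt hx')
    exact DFunLike.congr_fun h1.fderiv w
  refine ⟨N, fun x k => fderiv ℝ ψ (φ x) (fb hqn k), fun x => killq n q (φ x), hL.oN, hx,
    fun k => ?_, ?_, ?_, ?_, ?_, ?_, ?_⟩
  · exact (hdψ.comp hL.sN hL.mN).clm_apply contDiffOn_const
  · exact (killq n q).contDiff.comp_contDiffOn hL.sN
  · intro x' hx'
    conv_lhs => rw [← hL.li x' hx']
    exact hP _ (hL.mN x' hx')
  · intro x' hx' k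
    rw [hdg x' hx']
    have := hL.fderiv_right (hL.mN x' hx') (fb hqn k)
    rw [hL.li x' hx'] at this
    rw [this, killq_fb]
  · intro x' hx' w hw
    rw [hdg x' hx'] at hw
    have h1 := killq_eq_zero hqn hw
    have h2 := Submodule.mem_map_of_mem (f := (fderiv ℝ ψ (φ x')).toLinearMap) h1
    rw [Submodule.map_span, ← range_comp] at h2
    have h3 : (fderiv ℝ ψ (φ x')).toLinearMap (fderiv ℝ φ x' w) = w := hL.fderiv_left hx' w
    rw [h3] at h2
    exact h2
  · intro x' hx' c hc
    have h1 := congrArg (fderiv ℝ φ x') hc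
    have h2 : ∀ k, fderiv ℝ φ x' (fderiv ℝ ψ (φ x') (fb hqn k)) = fb hqn k := by
      intro k
      have := hL.fderiv_right (hL.mN x' hx') (fb hqn k)
      rwa [hL.li x' hx'] at this
    simp only [map_sum, map_smul, h2, map_zero] at h1
    funext k
    have h3 := congrFun h1 (Fin.castLE hqn k)
    simpa [Finset.sum_apply, fb, Pi.single_apply] using h3
  · intro x' hx'
    have hs : φ x' ∈ M := hL.mN x' hx'
    have key : ∀ k l, fderiv ℝ (fun x => fderiv ℝ ψ (φ x) (fb hqn k)) x'
        (fderiv ℝ ψ (φ x') (fb hqn l)) =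
        fderiv ℝ (fderiv ℝ ψ) (φ x') (fb hqn l) (fb hqn k) := by
      intro k l
      have h1 : HasFDerivAt (fderiv ℝ ψ) (fderiv ℝ (fderiv ℝ ψ) (φ x')) (φ x') :=
        ((hdψ.contDiffAt (hL.oM.mem_nhds hs)).differentiableAt (by simp)).hasFDerivAt
      have h2 : HasFDerivAt (fun x => fderiv ℝ ψ (φ x)) _ x' := h1.comp x' (hL.hasFDerivAt hx')
      have h3 := h2.clm_apply (hasFDerivAt_const (fb hqn k) x')
      rw [h3.fderiv]
      have h4 := hL.fderiv_right hs (fb hqn l)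
      rw [hL.li x' hx'] at h4
      simp [h4]
    intro k l
    rw [key, key]
    have hsym : IsSymmSndFDerivAt ℝ ψ (φ x') := by
      refine (hL.sM.contDiffAt (hL.oM.mem_nhds hs)).isSymmSndFDerivAt ?_
      simp only [minSmoothness_of_isRCLikeNormedField]
      exact WithTop.coe_le_coe.2 (le_top : (2:ℕ∞) ≤ ⊤)
    exact hsym _ _

/-- Pushforward of a field by a local diffeomorphism. -/
noncomputable def pf (φ : V → V') (ψ : V' → V) (P : V → QV q V) : V' → QV q V' :=
  fun y => push (fderiv ℝ φ (ψ y)) (P (ψ y))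

theorem NChart.push {hqn : q ≤ n} {P : V → QV q V} {χ : V → V'} {θ : V' → V} {A : Set V}
    {B : Set V'} (hL : LD χ θ A B) {x : V} (hx : x ∈ A) (h : NChart hqn P x) :
    NChart hqn (pf χ θ P) (χ x) := by
  obtain ⟨φ, ψ, N, M, hL', hx', hP⟩ := h
  have hL1 := hL.restrict hL'.oN
  have hL2 := hL'.restrict hL.oN
  rw [inter_comm] at hL2
  refine ⟨_, _, _, _, hL1.symm.comp hL2, hL1.mN x ⟨hx, hx'⟩, fun s hs => ?_⟩
  have hψs : ψ s ∈ A := hs.2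
  have h1 : HasFDerivAt (fun y => χ (ψ y)) _ s :=
    (hL.hasFDerivAt hψs).comp s (hL'.symm.hasFDerivAt hs.1)
  simp only [pf, h1.fderiv, hL.li _ hψs, hP s hs.1, push_plu]
  rfl

/-- GoodF fields. -/
structure GoodF (hqn : q ≤ n) (P : VV q m → QV q (VV q m)) (O : Set (VV q m)) : Prop where
  o : IsOpen O
  mem : (0 : VV q m) ∈ O
  sm : SmQ P O
  ch : ∀ x ∈ O, P x ≠ 0 → NChart hqn P x
  z : P 0 = 0
  d : ∀ v, fderiv ℝ (fun x => pvec (P x)) 0 v = v.1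

/-- Local conjugacy at the origin. -/
def LinTo (P P' : VV q m → QV q (VV q m)) : Prop :=
  ∃ (φ : VV q m → VV q m) (O : Set (VV q m)), IsOpen O ∧ 0 ∈ O ∧ φ 0 = 0 ∧ ContDiffOn ℝ ∞ φ O ∧
    Function.Bijective (fderiv ℝ φ 0) ∧ ∀ x ∈ O, push (fderiv ℝ φ x) (P x) = P' (φ x)

theorem LinTo.trans {P P' P'' : VV q m → QV q (VV q m)} (h : LinTo P P') (h' : LinTo P' P'') :
    LinTo P P'' := by
  obtain ⟨φ, O, hO, h0, hφ0, hφ, hb, hP⟩ := h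
  obtain ⟨φ', O', hO', h0', hφ0', hφ', hb', hP'⟩ := h'
  have hd : ∀ x ∈ O ∩ φ ⁻¹' O', HasFDerivAt (fun x => φ' (φ x))
      ((fderiv ℝ φ' (φ x)).comp (fderiv ℝ φ x)) x := by
    intro x hx
    have h1 := ((hφ'.contDiffAt (hO'.mem_nhds hx.2)).differentiableAt (by simp)).hasFDerivAt
    have h2 := ((hφ.contDiffAt (hO.mem_nhds hx.1)).differentiableAt (by simp)).hasFDerivAt
    exact h1.comp x h2
  have h00 : (0 : VV q m) ∈ O ∩ φ ⁻¹' O' := ⟨h0, by rw [mem_preimage, hφ0]; exact h0'⟩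
  refine ⟨fun x => φ' (φ x), O ∩ φ ⁻¹' O', hφ.continuousOn.isOpen_inter_preimage hO hO', h00,
    by simp only [hφ0, hφ0'], hφ'.comp (hφ.mono inter_subset_left) fun x hx => hx.2, ?_, ?_⟩
  · rw [(hd 0 h00).fderiv, hφ0]
    exact hb'.comp hb
  · intro x hx
    rw [(hd x hx).fderiv, ← push_push, hP x hx.1, hP' _ hx.2]

theorem fderiv_E {X : Type} [NormedAddCommGroup X] [NormedSpace ℝ X] {f : X → EE q} {x : X}
    (hf : DifferentiableAt ℝ f x) (v : X) (j : Fin (q+1)) :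
    (fderiv ℝ f x v) j = fderiv ℝ (fun x => f x j) x v := by
  have h1 : HasFDerivAt (fun x => f x j) ((dyE j).comp (fderiv ℝ f x)) x :=
    (dyE j).hasFDerivAt.comp x hf.hasFDerivAt
  rw [h1.fderiv]; rfl

theorem fderiv_pvec_push {X : Type} [NormedAddCommGroup X] [NormedSpace ℝ X]
    {P : X → QV q (VV q m)} {M : Set X} (hM : IsOpen M) (hP : SmQ P M)
    {A : X → VV q m →L[ℝ] VV q m} (hA : ContDiffOn ℝ ∞ A M) {y0 : X} (hy0 : y0 ∈ M)
    (h0 : P y0 = 0) : fderiv ℝ (fun y => pvec (push (A y) (P y))) y0 =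
      fderiv ℝ (fun y => pvec (push (A y0) (P y))) y0 := by
  refine ContinuousLinearMap.ext fun v => ?_
  have d1 : ∀ A' : X → VV q m →L[ℝ] VV q m, ContDiffOn ℝ ∞ A' M →
      DifferentiableAt ℝ (fun y => pvec (push (A' y) (P y))) y0 := fun A' hA' =>
    ((hP.push hA').pvec.contDiffAt (hM.mem_nhds hy0)).differentiableAt (by simp)
  ext j
  rw [fderiv_E (d1 A hA), fderiv_E (d1 (fun _ => A y0) contDiffOn_const)]
  simp only [pvec_apply, push_apply]
  have hα : ∀ i : Fin q, ContDiffOn ℝ ∞ (fun y => (dy (j.succAbove i)).comp (A y)) M :=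
    fun i => contDiffOn_const.clm_comp hA
  have h1 := deriv_frozen hM hP hy0 h0 (α := fun y i => (dy (j.succAbove i)).comp (A y)) hα
  have dd : ∀ α : X → Fin q → VV q m →L[ℝ] ℝ, (∀ i, ContDiffOn ℝ ∞ (fun x => α x i) M) →
      DifferentiableAt ℝ (fun y => P y (α y)) y0 := fun α hα =>
    ((hP.eval hα).contDiffAt (hM.mem_nhds hy0)).differentiableAt (by simp)
  rw [fderiv_const_mul (dd _ hα), fderiv_const_mul (dd (fun _ i => (dy (j.succAbove i)).comp (A y0)) fun i => contDiffOn_const), h1]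

theorem good_push {hqn : q ≤ n} {P : VV q m → QV q (VV q m)} {O O1 : Set (VV q m)}
    (hg : GoodF hqn P O) {φ : VV q m → VV q m} (hO1 : IsOpen O1) (h01 : 0 ∈ O1) (hφ0 : φ 0 = 0)
    (hφ : ContDiffOn ℝ ∞ φ O1) (hd : ∀ v, (fderiv ℝ φ 0 v).1 = v.1)
    (hb : Function.Bijective (fderiv ℝ φ 0)) :
    ∃ ψ N M, LD φ ψ N M ∧ 0 ∈ N ∧ N ⊆ O ∩ O1 ∧ GoodF hqn (pf φ ψ P) M ∧ LinTo P (pf φ ψ P) := by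
  obtain ⟨ψ, N, M, hL, h0N, hN⟩ := LD_of_bij (hg.o.inter hO1) (hφ.mono inter_subset_right)
    ⟨hg.mem, h01⟩ hb
  have hψ0 : ψ 0 = 0 := by
    have := hL.li 0 h0N
    rwa [hφ0] at this
  have h0M : (0 : VV q m) ∈ M := by
    have := hL.mN 0 h0N
    rwa [hφ0] at this
  have hdφ : ContDiffOn ℝ ∞ (fderiv ℝ φ) N := hL.sN.fderiv_of_isOpen hL.oN (by simp)
  have hPψ : SmQ (fun y => P (ψ y)) M := hg.sm.comp hL.sM fun y hy => (hN (hL.mM y hy)).1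
  have hA : ContDiffOn ℝ ∞ (fun y => fderiv ℝ φ (ψ y)) M := hdφ.comp hL.sM hL.mM
  refine ⟨ψ, N, M, hL, h0N, hN, ⟨hL.oM, h0M, hPψ.push hA, ?_, ?_, ?_⟩,
    φ, N, hL.oN, h0N, hφ0, hL.sN, hb, ?_⟩
  · intro y hy hPy
    have h1 : P (ψ y) ≠ 0 := by
      intro h; apply hPy; simp only [pf, h, push_zero]
    have h2 := (hg.ch _ (hN (hL.mM y hy)).1 h1).push hL (hL.mM y hy)
    rwa [hL.ri y hy] at h2
  · simp only [pf, hψ0, hg.z, push_zero]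
  · intro v
    have h1 := fderiv_pvec_push hL.oM hPψ hA h0M (by simp only [hψ0, hg.z])
    simp only [pf]
    rw [h1]
    have h2 : ∀ y, pvec (push (fderiv ℝ φ (ψ 0)) (P (ψ y))) = pvec (P (ψ y)) := by
      intro y
      ext j
      simp only [pvec_apply, push_apply, hψ0]
      have : ∀ i, (dy (j.succAbove i)).comp (fderiv ℝ φ 0) = (dy (j.succAbove i) : VV q m →L[ℝ] ℝ) := by
        intro i
        refine ContinuousLinearMap.ext fun w => ?_
        simp only [ContinuousLinearMap.comp_apply, dy_apply, hd]
      simp only [this]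
    simp only [h2]
    have h3 : HasFDerivAt (fun x => pvec (P x)) (fderiv ℝ (fun x => pvec (P x)) 0) (ψ 0) := by
      rw [hψ0]
      exact ((hg.sm.pvec.contDiffAt (hg.o.mem_nhds hg.mem)).differentiableAt (by simp)).hasFDerivAt
    have h4 : HasFDerivAt (fun y => pvec (P (ψ y))) _ 0 := h3.comp 0 (hL.symm.hasFDerivAt h0M)
    rw [h4.fderiv, ContinuousLinearMap.comp_apply, hg.d, ← hd]
    have h5 := hL.fderiv_right h0M v
    rw [hψ0] at h5
    rw [h5]
  · intro x hx
    simp only [pf, hL.li x hx]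

end M4

section M5
open Set Filter Topology
variable {n q m : ℕ}

theorem GoodF.mono {hqn : q ≤ n} {P : VV q m → QV q (VV q m)} {O O' : Set (VV q m)}
    (h : GoodF hqn P O) (hO : IsOpen O') (h0 : 0 ∈ O') (hs : O' ⊆ O) : GoodF hqn P O' :=
  ⟨hO, h0, h.sm.mono hs, fun x hx => h.ch x (hs hx), h.z, h.d⟩

theorem GoodF.pd {hqn : q ≤ n} {P : VV q m → QV q (VV q m)} {O : Set (VV q m)}
    (h : GoodF hqn P O) {x : VV q m} (hx : x ∈ O) :
    HasFDerivAt (fun x => pvec (P x)) (fderiv ℝ (fun x => pvec (P x)) x) x :=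
  ((h.sm.pvec.contDiffAt (h.o.mem_nhds hx)).differentiableAt (by simp)).hasFDerivAt

theorem fderiv_det_zero {X : Type} [NormedAddCommGroup X] [NormedSpace ℝ X] (hq : 2 ≤ q)
    {M : X → Matrix (Fin q) (Fin q) ℝ} {x : X} (hM : ∀ i j, DifferentiableAt ℝ (fun x => M x i j) x)
    (h0 : ∀ i j, M x i j = 0) : HasFDerivAt (fun x => (M x).det) (0 : X →L[ℝ] ℝ) x := by
  obtain ⟨r, rfl⟩ : ∃ r, q = r + 2 := ⟨q - 2, by omega⟩
  simp only [Matrix.det_apply]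
  have : (0 : X →L[ℝ] ℝ) = ∑ σ : Equiv.Perm (Fin (r+2)), 0 := by simp
  rw [this]
  refine HasFDerivAt.fun_sum fun σ _ => ?_
  have h1 : HasFDerivAt (fun x => ∏ i, M x (σ i) i) (0 : X →L[ℝ] ℝ) x := by
    simp only [Fin.prod_univ_succ (n := r+1)]
    have d1 := (hM (σ 0) 0).hasFDerivAt
    have d2 : DifferentiableAt ℝ (fun x => ∏ i : Fin (r+1), M x (σ i.succ) i.succ) x := by
      fun_prop
    have h3 := d1.mul d2.hasFDerivAt
    refine h3.congr_fderiv ?_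
    simp [h0]
  have h2 := h1.const_smul (Equiv.Perm.sign σ)
  rw [smul_zero] at h2
  exact h2

theorem S1a {hqn : q ≤ n} {P : VV q m → QV q (VV q m)} {O : Set (VV q m)}
    (hg : GoodF hqn P O) (hq : 2 ≤ q) :
    ∃ O', IsOpen O' ∧ 0 ∈ O' ∧ O' ⊆ O ∧ ∀ x ∈ O', pvec (P x) = 0 → P x = 0 := by
  set D : VV q m → (VV q m →L[ℝ] EE q) := fderiv ℝ (fun x => pvec (P x)) with hD
  have hDc : ContinuousOn D O := hg.sm.pvec.continuousOn_fderiv_of_isOpen hg.o (by simp)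
  let A : VV q m → (EE q →L[ℝ] EE q) := fun x => (D x).comp (ContinuousLinearMap.inl ℝ _ _)
  have hAc : ContinuousOn A O := hDc.clm_comp continuousOn_const
  have hA0 : A 0 = 1 := ContinuousLinearMap.ext fun u => hg.d (u, 0)
  refine ⟨O ∩ A ⁻¹' {u | IsUnit u}, hAc.isOpen_inter_preimage hg.o Units.isOpen,
    ⟨hg.mem, ?_⟩, inter_subset_left, ?_⟩
  · change IsUnit (A 0)
    rw [hA0]; exact isUnit_one
  intro x hx hp
  by_contra hP
  obtain ⟨N, v, g, hN, hxN, hv, -, hPv, -, -, -, -⟩ := (hg.ch x hx.1 hP).frame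
  obtain ⟨U, hU⟩ := hx.2
  have hsurj : ∀ w : EE q, ∃ u, D x (u, 0) = w := by
    intro w
    refine ⟨(↑U⁻¹ : EE q →L[ℝ] EE q) w, ?_⟩
    change A x _ = w
    rw [← hU]
    change ((U : EE q →L[ℝ] EE q) * (↑U⁻¹ : EE q →L[ℝ] EE q)) w = w
    rw [U.mul_inv]; rfl
  have hvd : ∀ l, DifferentiableAt ℝ (fun x => v x l) x := fun l =>
    (((hv l).contDiffAt (hN.mem_nhds hxN)).differentiableAt (by simp))
  have hv0 : ∀ l, (v x l).1 = 0 := by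
    intro l
    have h1 : HasFDerivAt (fun x => (v x l).1) ((ContinuousLinearMap.fst ℝ _ _).comp
      (fderiv ℝ (fun x => v x l) x)) x :=
      (ContinuousLinearMap.fst ℝ (EE q) (ZZ m)).hasFDerivAt.comp x (hvd l).hasFDerivAt
    have h2 := (hg.pd hx.1).inner ℝ h1
    have h3 : HasFDerivAt (fun t => inner ℝ (pvec (P t)) (v t l).1) (0 : VV q m →L[ℝ] ℝ) x := by
      refine (hasFDerivAt_const (0:ℝ) x).congr_of_eventuallyEq ?_
      filter_upwards [hN.mem_nhds hxN] with t ht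
      rw [hPv t ht]; exact pvec_plu_perp _ _
    have h4 := h2.unique h3
    obtain ⟨u, hu⟩ := hsurj (v x l).1
    have h5 := DFunLike.congr_fun h4 ((u, 0) : VV q m)
    simp [fderivInnerCLM_apply, hp] at h5
    rw [hu] at h5
    exact inner_self_eq_zero.1 h5
  have hD0 : D x = 0 := by
    refine ContinuousLinearMap.ext fun w => ?_
    ext j
    rw [hD, fderiv_E (hg.pd hx.1).differentiableAt]
    have h1 : HasFDerivAt (fun t => (Matrix.of fun i k => (dy (j.succAbove i) : VV q m →L[ℝ] ℝ)
        (v t k)).det) (0 : VV q m →L[ℝ] ℝ) x := by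
      refine fderiv_det_zero hq (fun i k => ?_) fun i k => ?_
      · exact (dy (j.succAbove i) : VV q m →L[ℝ] ℝ).differentiableAt.comp x (hvd k)
      · simp only [Matrix.of_apply, dy_apply, hv0]; rfl
    have h2 : HasFDerivAt (fun t => pvec (P t) j) (0 : VV q m →L[ℝ] ℝ) x := by
      have h3 := h1.const_mul ((-1:ℝ)^(j:ℕ))
      rw [smul_zero] at h3
      refine h3.congr_of_eventuallyEq ?_
      filter_upwards [hN.mem_nhds hxN] with t ht
      rw [hPv t ht, pvec_apply, plu_apply]
    rw [h2.fderiv]; rfl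
  obtain ⟨u, hu⟩ := hsurj (be 0)
  rw [hD0] at hu
  have := congrArg (fun w : EE q => w 0) hu
  simp [be] at this

theorem S1 {hqn : q ≤ n} {P : VV q m → QV q (VV q m)} {O : Set (VV q m)}
    (hg : GoodF hqn P O) (hq : 2 ≤ q) :
    ∃ P1 O1, GoodF hqn P1 O1 ∧ LinTo P P1 ∧ ∀ x ∈ O1, x.1 = 0 → P1 x = 0 := by
  obtain ⟨O', hO', h0', hs, hz⟩ := S1a hg hq
  let χ : VV q m → VV q m := fun x => (pvec (P x), x.2)
  have hχd : HasFDerivAt χ (ContinuousLinearMap.id ℝ (VV q m)) 0 := by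
    have h1 := (hg.pd hg.mem).prodMk (hasFDerivAt_snd (p := (0 : VV q m)))
    refine h1.congr_fderiv (ContinuousLinearMap.ext fun u => ?_)
    exact Prod.ext (hg.d u) rfl
  obtain ⟨ψ, N, M, hL, h0N, hN, hG, hLin⟩ := good_push (φ := χ) (hg.mono hO' h0' hs) hO' h0'
    (by simp only [χ, hg.z]; refine Prod.ext ?_ rfl; ext j; simp [pvec_apply])
    ((hg.sm.pvec.mono hs).prodMk contDiffOn_snd) (fun v => by rw [hχd.fderiv]; rfl)
    (by rw [hχd.fderiv]; exact Function.bijective_id)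
  refine ⟨_, M, hG, hLin, fun y hy hy1 => ?_⟩
  have h1 : pvec (P (ψ y)) = 0 := by
    have h2 := congrArg Prod.fst (hL.ri y hy)
    exact h2.trans hy1
  simp only [pf]
  rw [hz _ (hN (hL.mM y hy)).1 h1, push_zero]

end M5

section M6
open Set Filter Topology
variable {n q m : ℕ}

theorem sq_deriv (A : Type) [NormedRing A] [NormedAlgebra ℝ A] :
    HasFDerivAt (fun N : A => N * N) ((2:ℝ) • ContinuousLinearMap.id ℝ A) 1 := by
  have h1 := (hasFDerivAt_id (𝕜 := ℝ) (1 : A)).mul' (hasFDerivAt_id (𝕜 := ℝ) (1 : A))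
  refine h1.congr_fderiv (ContinuousLinearMap.ext fun u => ?_)
  simp [two_smul]

theorem pvec_zero : pvec (0 : QV q (VV q m)) = 0 := by
  ext j; simp [pvec_apply]

theorem Xi_zero : Xi (0 : QV q (VV q m)) = 0 := by
  refine ContinuousLinearMap.ext fun B => ?_
  have : ∀ j i, tau (0 : QV q (VV q m)) j i = 0 := fun j i => by funext k; simp [tau]
  rw [Xi_apply]
  simp [this]

theorem mat_sqrt (E : Type) [NormedAddCommGroup E] [InnerProductSpace ℝ E] [FiniteDimensional ℝ E] :
    ∃ (R : (E →L[ℝ] E) → (E →L[ℝ] E)) (U : Set (E →L[ℝ] E)), IsOpen U ∧ 1 ∈ U ∧ R 1 = 1 ∧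
      ContDiffOn ℝ ∞ R U ∧ (∀ M ∈ U, R M * R M = M) ∧ (∀ M ∈ U, IsUnit (R M)) ∧
      (∀ M ∈ U, star M = M → star (R M) = R M) := by
  have hs : ContDiff ℝ ∞ (fun N : E →L[ℝ] E => N * N) := contDiff_id.mul contDiff_id
  have hd : HasFDerivAt (fun N : E →L[ℝ] E => N * N)
      ((2:ℝ) • ContinuousLinearMap.id ℝ (E →L[ℝ] E)) 1 := by
    exact sq_deriv _
  have hb : Function.Bijective (fderiv ℝ (fun N : E →L[ℝ] E => N * N) 1) := by
    rw [hd.fderiv]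
    constructor
    · intro a b hab
      have : (2:ℝ) • a = (2:ℝ) • b := hab
      exact smul_right_injective _ (two_ne_zero) this
    · intro b
      refine ⟨(2:ℝ)⁻¹ • b, ?_⟩
      change (2:ℝ) • (2:ℝ)⁻¹ • b = b
      rw [smul_smul]; norm_num
  obtain ⟨ψ, N, M, hL, h1N, -⟩ := LD_of_bij isOpen_univ hs.contDiffOn (mem_univ _) hb
  have h1M : (1 : E →L[ℝ] E) ∈ M := by simpa using hL.mN 1 h1N
  have hψ1 : ψ 1 = 1 := by simpa using hL.li 1 h1N
  have hc : ContinuousOn ψ M := hL.sM.continuousOn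
  have hc2 : ContinuousOn (fun x => star (ψ x)) M := continuous_star.comp_continuousOn hc
  let U := (M ∩ (fun x => star (ψ x)) ⁻¹' N) ∩ (M ∩ ψ ⁻¹' {u | IsUnit u})
  refine ⟨ψ, U, (hc2.isOpen_inter_preimage hL.oM hL.oN).inter
    (hc.isOpen_inter_preimage hL.oM Units.isOpen), ⟨⟨h1M, ?_⟩, h1M, ?_⟩, hψ1,
    hL.sM.mono fun x hx => hx.1.1, fun x hx => hL.ri x hx.1.1, fun x hx => hx.2.2, ?_⟩
  · change star (ψ 1) ∈ N
    rw [hψ1, star_one]; exact h1N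
  · change IsUnit (ψ 1)
    rw [hψ1]; exact isUnit_one
  · intro x hx hxs
    have h2 := hL.li _ hx.1.2
    have h3 : star (ψ x) * star (ψ x) = x := by
      rw [← star_mul, hL.ri x hx.1.1, hxs]
    simp only [h3] at h2
    exact h2.symm

theorem omega_symm {hqn : q ≤ n} {P : VV q m → QV q (VV q m)} {O : Set (VV q m)}
    (hg : GoodF hqn P O) {x : VV q m} (hx : x ∈ O) {B B' : EE q →L[ℝ] EE q}
    (hB : star B = -B) (hB' : star B' = -B') :
    inner ℝ (fderiv ℝ (fun x => pvec (P x)) x (B (pvec (P x)), Xi (P x) B)) (B' (pvec (P x))) =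
    inner ℝ (fderiv ℝ (fun x => pvec (P x)) x (B' (pvec (P x)), Xi (P x) B')) (B (pvec (P x))) := by
  by_cases hP : P x = 0
  · have : pvec (P x) = 0 := by rw [hP]; ext j; simp [pvec_apply]
    simp [this]
  obtain ⟨N, v, g, hN, hxN, hv, -, hPv, -, -, -, hcom⟩ := (hg.ch x hx hP).frame
  set D := fderiv ℝ (fun x => pvec (P x)) x with hD
  have hvd : ∀ l, DifferentiableAt ℝ (fun x => v x l) x := fun l =>
    (((hv l).contDiffAt (hN.mem_nhds hxN)).differentiableAt (by simp))
  have key : ∀ k l, inner ℝ (D (v x k)) (v x l).1 =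
      - inner ℝ (pvec (P x)) (fderiv ℝ (fun x => v x l) x (v x k)).1 := by
    intro k l
    have h1 : HasFDerivAt (fun x => (v x l).1) ((ContinuousLinearMap.fst ℝ _ _).comp
      (fderiv ℝ (fun x => v x l) x)) x :=
      (ContinuousLinearMap.fst ℝ (EE q) (ZZ m)).hasFDerivAt.comp x (hvd l).hasFDerivAt
    have h2 := (hg.pd hx).inner ℝ h1
    have h3 : HasFDerivAt (fun t => inner ℝ (pvec (P t)) (v t l).1) (0 : VV q m →L[ℝ] ℝ) x := by
      refine (hasFDerivAt_const (0:ℝ) x).congr_of_eventuallyEq ?_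
      filter_upwards [hN.mem_nhds hxN] with t ht
      rw [hPv t ht]; exact pvec_plu_perp _ _
    have h5 := DFunLike.congr_fun (h2.unique h3) (v x k)
    simp [fderivInnerCLM_apply] at h5
    rw [hD]; linarith
  have key2 : ∀ k l, inner ℝ (D (v x k)) (v x l).1 = inner ℝ (D (v x l)) (v x k).1 := by
    intro k l
    rw [key, key, hcom x hxN]
  have hsp : ∀ a ∈ Submodule.span ℝ (range (v x)), ∀ b ∈ Submodule.span ℝ (range (v x)),
      inner ℝ (D a) b.1 = inner ℝ (D b) a.1 := by
    intro a ha b hb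
    induction ha using Submodule.span_induction with
    | mem a ha =>
      obtain ⟨k, rfl⟩ := ha
      induction hb using Submodule.span_induction with
      | mem b hb => obtain ⟨l, rfl⟩ := hb; exact key2 k l
      | zero => simp
      | add b b' _ _ h h' => simp [inner_add_left, inner_add_right, h, h']
      | smul c b _ h => simp [inner_smul_left, inner_smul_right, h]
    | zero => simp
    | add b b' _ _ h h' => simp [inner_add_left, inner_add_right, h, h']
    | smul c b _ h => simp [inner_smul_left, inner_smul_right, h]
  rw [hPv x hxN]
  exact hsp _ (field_mem_span (v x) hB) _ (field_mem_span (v x) hB')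

theorem exists_perp (hq : 2 ≤ q) (u w : EE q) : ∃ π : EE q, inner ℝ π π = 1 ∧ inner ℝ u π = 0 ∧
    inner ℝ w π = 0 := by
  set S := Submodule.span ℝ ({u, w} : Set (EE q)) with hS
  have hne : Sᗮ ≠ ⊥ := by
    intro h
    rw [Submodule.orthogonal_eq_bot_iff] at h
    classical
    have h1 : Module.finrank ℝ S ≤ 2 := by
      have h2 := finrank_span_finset_le_card (R := ℝ) ({u, w} : Finset (EE q))
      simp only [Finset.coe_insert, Finset.coe_singleton] at h2
      exact h2.trans Finset.card_le_two
    rw [h, finrank_top, finrank_euclideanSpace_fin] at h1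
    omega
  obtain ⟨y, hy, hy0⟩ := Submodule.exists_mem_ne_zero_of_ne_bot hne
  have hyn : ‖y‖ ≠ 0 := norm_ne_zero_iff.2 hy0
  refine ⟨‖y‖⁻¹ • y, ?_, ?_, ?_⟩
  · rw [inner_smul_left, inner_smul_right, real_inner_self_eq_norm_sq]
    simp; field_simp
  · rw [inner_smul_right, hy u (Submodule.subset_span (by simp)), mul_zero]
  · rw [inner_smul_right, hy w (Submodule.subset_span (by simp)), mul_zero]

theorem W_symm {hqn : q ≤ n} {P : VV q m → QV q (VV q m)} {O : Set (VV q m)}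
    (hg : GoodF hqn P O) (hq : 2 ≤ q) (hz : ∀ x ∈ O, x.1 = 0 → P x = 0) {z : ZZ m}
    (hzO : ((0 : EE q), z) ∈ O) (hsurj : ∀ w, ∃ u, fderiv ℝ (fun x => pvec (P x)) (0, z) (u, 0) = w)
    (u w : EE q) :
    inner ℝ (fderiv ℝ (fun x => pvec (P x)) (0, z) (u, 0)) w =
    inner ℝ (fderiv ℝ (fun x => pvec (P x)) (0, z) (w, 0)) u := by
  set D := fderiv ℝ (fun x => pvec (P x)) with hD
  obtain ⟨π, hπ1, huπ, hwπ⟩ := exists_perp hq u w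
  obtain ⟨y0, hy0⟩ := hsurj π
  have hP0 : ∀ᶠ x in 𝓝 ((0 : EE q), z), x.1 = 0 → P x = 0 := by
    filter_upwards [hg.o.mem_nhds hzO] with x hx using hz x hx
  have hcz : Continuous fun ζ : ZZ m => ((0 : EE q), ζ) := by fun_prop
  have hDz : ∀ ζ, D (0, z) (0, ζ) = 0 := by
    intro ζ
    have h1 : HasFDerivAt (fun ζ : ZZ m => pvec (P (0, ζ)))
      ((D (0, z)).comp (ContinuousLinearMap.inr ℝ (EE q) (ZZ m))) z :=
      (hg.pd hzO).comp z (ContinuousLinearMap.inr ℝ (EE q) (ZZ m)).hasFDerivAt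
    have h2 : HasFDerivAt (fun ζ : ZZ m => pvec (P (0, ζ))) (0 : ZZ m →L[ℝ] EE q) z := by
      refine (hasFDerivAt_const (0 : EE q) z).congr_of_eventuallyEq ?_
      filter_upwards [hcz.continuousAt.eventually hP0] with ζ hζ
      rw [hζ rfl]; ext j; simp [pvec_apply]
    exact DFunLike.congr_fun (h1.unique h2) ζ
  -- limits along the ray
  have hray : HasDerivAt (fun t : ℝ => ((t • y0, z) : VV q m)) (y0, 0) 0 := by
    have h1 : HasDerivAt (fun t : ℝ => t • y0) y0 0 := by
      simpa using (hasDerivAt_id (0:ℝ)).smul_const y0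
    exact h1.prodMk (hasDerivAt_const _ _)
  have hray0 : ((0:ℝ) • y0, z) = ((0 : EE q), z) := by rw [zero_smul]
  have lim : ∀ {F : Type} [NormedAddCommGroup F] [NormedSpace ℝ F] (f : VV q m → F)
      (_ : DifferentiableAt ℝ f (0, z)) (_ : f (0, z) = 0),
      Tendsto (fun t : ℝ => t⁻¹ • f (t • y0, z)) (𝓝[≠] 0) (𝓝 (fderiv ℝ f (0, z) (y0, 0))) := by
    intro F _ _ f hf hf0
    have h1 : HasFDerivAt f (fderiv ℝ f (0, z)) ((0:ℝ) • y0, z) := by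
      rw [hray0]; exact hf.hasFDerivAt
    have h2 : HasDerivAt (fun t : ℝ => f (t • y0, z)) _ 0 := h1.comp_hasDerivAt 0 hray
    have h3 := h2.tendsto_slope
    refine h3.congr fun t => ?_
    rw [slope_def_module, hray0, hf0]; simp
  have hp0 : pvec (P (0, z)) = 0 := by rw [hz _ hzO rfl]; ext j; simp [pvec_apply]
  have hX0 : Xi (P (0, z)) = 0 := by
    rw [hz _ hzO rfl, Xi_zero]
  have l1 := lim (fun x => pvec (P x)) (hg.pd hzO).differentiableAt hp0
  have hXd : DifferentiableAt ℝ (fun x => Xi (P x)) (0, z) :=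
    (hg.sm.Xi.contDiffAt (hg.o.mem_nhds hzO)).differentiableAt (by simp)
  have l2 := lim (fun x => Xi (P x)) hXd hX0
  have hrc : Tendsto (fun t : ℝ => ((t • y0, z) : VV q m)) (𝓝[≠] 0) (𝓝 (0, z)) := by
    have : Continuous fun t : ℝ => ((t • y0, z) : VV q m) := by fun_prop
    have h := this.tendsto 0
    rw [hray0] at h
    exact h.mono_left nhdsWithin_le_nhds
  have l3 : Tendsto (fun t : ℝ => D (t • y0, z)) (𝓝[≠] 0) (𝓝 (D (0, z))) := by
    have : ContinuousAt D (0, z) := ((hg.sm.pvec.continuousOn_fderiv_of_isOpen hg.o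
      (by simp)).continuousAt (hg.o.mem_nhds hzO))
    exact this.tendsto.comp hrc
  change Tendsto _ _ (𝓝 (D (0, z) (y0, 0))) at l1
  rw [hy0] at l1
  have main : ∀ B B' : EE q →L[ℝ] EE q, star B = -B → star B' = -B' →
      inner ℝ (D (0, z) (B π, 0)) (B' π) = inner ℝ (D (0, z) (B' π, 0)) (B π) := by
    intro B B' hB hB'
    have L : ∀ B B' : EE q →L[ℝ] EE q, Tendsto (fun t : ℝ => inner ℝ (D (t • y0, z)
        (B (t⁻¹ • pvec (P (t • y0, z))), (t⁻¹ • Xi (P (t • y0, z))) B))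
        (B' (t⁻¹ • pvec (P (t • y0, z))))) (𝓝[≠] 0) (𝓝 (inner ℝ (D (0, z) (B π, 0)) (B' π))) := by
      intro B B'
      have e1 : D (0, z) (B π, 0) = D (0, z) (B π, fderiv ℝ (fun x => Xi (P x)) (0, z) (y0, 0) B) := by
        have : ∀ ζ, D (0, z) (B π, ζ) = D (0, z) (B π, 0) + D (0, z) (0, ζ) := fun ζ => by
          rw [← map_add]; simp
        rw [this (fderiv ℝ (fun x => Xi (P x)) (0, z) (y0, 0) B), hDz, add_zero]
      rw [e1]
      have a1 := ((B.continuous.tendsto π).comp l1)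
      have a2 := ((B'.continuous.tendsto π).comp l1)
      have a3 := ((ContinuousLinearMap.apply ℝ (ZZ m) B).continuous.tendsto _).comp l2
      have a4 := ((isBoundedBilinearMap_apply (𝕜 := ℝ) (E := VV q m) (F := EE q)).continuous.tendsto
        _).comp (l3.prodMk_nhds (a1.prodMk_nhds a3))
      exact a4.inner a2
    refine tendsto_nhds_unique (L B B') ((L B' B).congr' ?_)
    filter_upwards [hrc.eventually (hg.o.mem_nhds hzO)] with t ht
    have h := omega_symm hg ht hB hB'
    have e : ∀ B : EE q →L[ℝ] EE q, ((B (t⁻¹ • pvec (P (t • y0, z))), (t⁻¹ • Xi (P (t • y0, z))) B) : VV q m) =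
        t⁻¹ • (B (pvec (P (t • y0, z))), Xi (P (t • y0, z)) B) := by
      intro B; simp
    rw [e, e, map_smul, map_smul, map_smul, map_smul]
    simp only [inner_smul_left, inner_smul_right]
    rw [h]
  have hw : ∀ u : EE q, inner ℝ u π = 0 → (wedge u π) π = u := by
    intro u hu
    rw [wedge_apply, hπ1, hu]; simp
  have := main (wedge u π) (wedge w π) (wedge_skew _ _) (wedge_skew _ _)
  rwa [hw u huπ, hw w hwπ] at this

end M6

section M7
open Set Filter Topology
variable {n q m : ℕ}

/-- matrix determinant of an endomorphism -/
noncomputable def dE (B : EE q →L[ℝ] EE q) : ℝ := (Matrix.of fun i j => (B (be j)) i).det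

theorem unit_inv_apply (U : (EE q →L[ℝ] EE q)ˣ) (w : EE q) :
    (U : EE q →L[ℝ] EE q) ((↑U⁻¹ : EE q →L[ℝ] EE q) w) = w := by
  change ((U : EE q →L[ℝ] EE q) * (↑U⁻¹ : EE q →L[ℝ] EE q)) w = w
  rw [U.mul_inv]; rfl

theorem unit_inv_apply' (U : (EE q →L[ℝ] EE q)ˣ) (w : EE q) :
    (↑U⁻¹ : EE q →L[ℝ] EE q) ((U : EE q →L[ℝ] EE q) w) = w := by
  change ((↑U⁻¹ : EE q →L[ℝ] EE q) * (U : EE q →L[ℝ] EE q)) w = w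
  rw [U.inv_mul]; rfl

theorem stepTwo {hqn : q ≤ n} {P : VV q m → QV q (VV q m)} {O : Set (VV q m)}
    (hg : GoodF hqn P O) (hq : 2 ≤ q) (hz : ∀ x ∈ O, x.1 = 0 → P x = 0) :
    ∃ P2 O2, GoodF hqn P2 O2 ∧ LinTo P P2 ∧ (∀ x ∈ O2, x.1 = 0 → P2 x = 0) ∧
      ∀ z, ((0 : EE q), z) ∈ O2 → ∃ c : ℝ, ∀ v,
        fderiv ℝ (fun x => pvec (P2 x)) (0, z) (v, 0) = c • v := by
  set D := fderiv ℝ (fun x => pvec (P x)) with hD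
  have hDs : ContDiffOn ℝ ∞ D O := hg.sm.pvec.fderiv_of_isOpen hg.o (by simp)
  let W : VV q m → (EE q →L[ℝ] EE q) := fun x => (D (0, x.2)).comp (ContinuousLinearMap.inl ℝ _ _)
  let O0 : Set (VV q m) := {x | ((0 : EE q), x.2) ∈ O}
  have hO0 : IsOpen O0 := hg.o.preimage (by fun_prop : Continuous fun x : VV q m => ((0 : EE q), x.2))
  have hWs : ContDiffOn ℝ ∞ W O0 := by
    have h1 : ContDiffOn ℝ ∞ (fun x : VV q m => D (0, x.2)) O0 :=
      hDs.comp (by fun_prop : ContDiff ℝ ∞ fun x : VV q m => ((0 : EE q), x.2)).contDiffOn fun x hx => hx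
    exact h1.clm_comp contDiffOn_const
  have hW0 : W 0 = 1 := ContinuousLinearMap.ext fun u => hg.d (u, 0)
  obtain ⟨R, U, hU, h1U, hR1, hRs, hRR, hRu, hRst⟩ := mat_sqrt (EE q)
  let O1 : Set (VV q m) := O0 ∩ W ⁻¹' U
  have hO1 : IsOpen O1 := hWs.continuousOn.isOpen_inter_preimage hO0 hU
  have h01 : (0 : VV q m) ∈ O1 := ⟨hg.mem, by rw [mem_preimage, hW0]; exact h1U⟩
  let S : VV q m → (EE q →L[ℝ] EE q) := fun x => R (W x)
  have hSs : ContDiffOn ℝ ∞ S O1 := hRs.comp (hWs.mono inter_subset_left) fun x hx => hx.2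
  have hS0 : S 0 = 1 := by simp only [S, hW0, hR1]
  let φ : VV q m → VV q m := fun x => (S x x.1, x.2)
  have hφs : ContDiffOn ℝ ∞ φ O1 := (hSs.clm_apply contDiffOn_fst).prodMk contDiffOn_snd
  have hφd : ∀ z : ZZ m, ((0 : EE q), z) ∈ O1 → ∀ v, fderiv ℝ φ (0, z) v = (S (0, z) v.1, v.2) := by
    intro z hzO v
    have h1 := ((hSs.contDiffAt (hO1.mem_nhds hzO)).differentiableAt (by simp)).hasFDerivAt
    have h2 := h1.clm_apply (hasFDerivAt_fst (p := ((0 : EE q), z)))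
    have h3 := h2.prodMk (hasFDerivAt_snd (p := ((0 : EE q), z)))
    rw [show fderiv ℝ φ (0, z) = _ from h3.fderiv]
    simp
  have hφd0 : fderiv ℝ φ 0 = ContinuousLinearMap.id ℝ _ := by
    refine ContinuousLinearMap.ext fun v => ?_
    have := hφd 0 h01 v
    rw [show ((0 : EE q), (0 : ZZ m)) = 0 from rfl, hS0] at this
    rw [this]; rfl
  obtain ⟨ψ, N, M, hL, h0N, hN, hG, hLin⟩ := good_push (φ := φ) hg hO1 h01
    (by simp [φ]) hφs (fun v => by rw [hφd0]; rfl) (by rw [hφd0]; exact Function.bijective_id)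
  have hψ : ∀ z : ZZ m, ((0 : EE q), z) ∈ M → ψ (0, z) = (0, z) := by
    intro z hzM
    have h1 := hL.ri _ hzM
    have hm := (hN (hL.mM _ hzM)).2
    obtain ⟨u, hu⟩ := hRu _ hm.2
    have h2 : (ψ (0, z)).2 = z := congrArg Prod.snd h1
    have h3 : (R (W (ψ (0, z)))) (ψ (0, z)).1 = 0 := congrArg Prod.fst h1
    rw [← hu] at h3
    have h4 := unit_inv_apply' u (ψ (0, z)).1
    rw [h3, map_zero] at h4
    exact Prod.ext h4.symm h2
  have hPψ : SmQ (fun y => P (ψ y)) M := hg.sm.comp hL.sM fun y hy => (hN (hL.mM y hy)).1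
  have hA : ContDiffOn ℝ ∞ (fun y => fderiv ℝ φ (ψ y)) M :=
    (hL.sN.fderiv_of_isOpen hL.oN (by simp)).comp hL.sM hL.mM
  have hP0 : ∀ z : ZZ m, ((0 : EE q), z) ∈ M → P (ψ (0, z)) = 0 := by
    intro z hzM
    have h1 := (hN (hL.mM _ hzM)).1
    rw [hψ z hzM] at h1 ⊢
    exact hz _ h1 rfl
  refine ⟨_, M, hG, hLin, ?_, ?_⟩
  · rintro ⟨y, z⟩ hx rfl
    simp only [pf, hP0 z hx, push_zero]
  intro z hzM
  have hzN : ((0 : EE q), z) ∈ N := by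
    have := hL.mM _ hzM
    rwa [hψ z hzM] at this
  obtain ⟨hzO, hzO1⟩ := hN hzN
  obtain ⟨u, hu⟩ := hRu _ hzO1.2
  have huS : S (0, z) = u := hu.symm
  have hWS : ∀ w, W (0, z) w = (u : EE q →L[ℝ] EE q) ((u : EE q →L[ℝ] EE q) w) := by
    intro w
    have := hRR _ hzO1.2
    rw [← hu] at this
    rw [← this]; rfl
  have hWapp : ∀ w, W (0, z) w = D (0, z) (w, 0) := fun w => rfl
  have hWsym : star (W (0, z)) = W (0, z) := by
    rw [ContinuousLinearMap.star_eq_adjoint]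
    refine ((ContinuousLinearMap.eq_adjoint_iff _ _).2 fun a b => ?_).symm
    rw [hWapp, hWapp]
    rw [W_symm hg hq hz hzO ?_ a b, real_inner_comm]
    intro w
    refine ⟨(↑u⁻¹ : EE q →L[ℝ] EE q) ((↑u⁻¹ : EE q →L[ℝ] EE q) w), ?_⟩
    have := hWS ((↑u⁻¹ : EE q →L[ℝ] EE q) ((↑u⁻¹ : EE q →L[ℝ] EE q) w))
    rw [unit_inv_apply, unit_inv_apply] at this
    exact this
  have hSsym : star (u : EE q →L[ℝ] EE q) = u := by
    have := hRst _ hzO1.2 hWsym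
    rwa [← hu] at this
  have hSin : ∀ a b, inner ℝ ((u : EE q →L[ℝ] EE q) a) b = inner ℝ a ((u : EE q →L[ℝ] EE q) b) := by
    intro a b
    conv_lhs => rw [← hSsym, ContinuousLinearMap.star_eq_adjoint]
    exact ContinuousLinearMap.adjoint_inner_left _ _ _
  refine ⟨dE (u : EE q →L[ℝ] EE q), fun v => ?_⟩
  have h1 := fderiv_pvec_push hL.oM hPψ hA hzM (hP0 z hzM)
  simp only [pf]
  rw [h1]
  have h2 : ∀ y, pvec (push (fderiv ℝ φ (ψ (0, z))) (P (ψ y))) =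
      dE (u : EE q →L[ℝ] EE q) • (↑u⁻¹ : EE q →L[ℝ] EE q) (pvec (P (ψ y))) := by
    intro y
    refine pvec_push _ (u : EE q →L[ℝ] EE q) (fun w => ?_) _ _ fun w => ?_
    · rw [hψ z hzM, hφd z hzO1, huS]
    · rw [← hSin, unit_inv_apply]
  simp only [h2]
  have h3 : HasFDerivAt (fun x => pvec (P x)) (D (0, z)) (ψ (0, z)) := by
    rw [hψ z hzM]; exact hg.pd hzO
  have h4 : HasFDerivAt (fun y => pvec (P (ψ y))) _ (0, z) := h3.comp _ (hL.symm.hasFDerivAt hzM)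
  have h5 : HasFDerivAt (fun y => (↑u⁻¹ : EE q →L[ℝ] EE q) (pvec (P (ψ y)))) _ (0, z) :=
    (↑u⁻¹ : EE q →L[ℝ] EE q).hasFDerivAt.comp _ h4
  have h6 := h5.const_smul (dE (u : EE q →L[ℝ] EE q))
  rw [show fderiv ℝ (fun y => dE (u : EE q →L[ℝ] EE q) • (↑u⁻¹ : EE q →L[ℝ] EE q) (pvec (P (ψ y))))
    (0, z) = _ from h6.fderiv]
  have h7 : fderiv ℝ ψ (0, z) (v, 0) = ((↑u⁻¹ : EE q →L[ℝ] EE q) v, 0) := by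
    have h8 := hL.fderiv_left hzN ((↑u⁻¹ : EE q →L[ℝ] EE q) v, 0)
    rw [hφd z hzO1, huS, unit_inv_apply] at h8
    have h9 : φ (0, z) = (0, z) := by simp [φ]
    rwa [h9] at h8
  change dE (u : EE q →L[ℝ] EE q) • (↑u⁻¹ : EE q →L[ℝ] EE q) (D (0, z) (fderiv ℝ ψ (0, z) (v, 0))) = _
  rw [h7, ← hWapp, hWS, unit_inv_apply, unit_inv_apply']

end M7

section M8
open Set Filter Topology
variable {n q m : ℕ}

theorem exists_Vd {N : Set (VV q m)} (hN : IsOpen N) (h0 : (0 : VV q m) ∈ N) :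
    ∃ δ > 0, Vd (EE q) (ZZ m) δ ⊆ N := by
  obtain ⟨δ, hδ, hb⟩ := Metric.isOpen_iff.1 hN 0 h0
  refine ⟨δ, hδ, fun x hx => hb ?_⟩
  rw [mem_ball_zero_iff, Prod.norm_def]
  exact max_lt hx.1 hx.2

theorem frame_span {v : Fin q → VV q m} {w : VV q m} (hw : w ∈ Submodule.span ℝ (range v)) :
    inner ℝ (pvec (plu v)) w.1 = 0 := by
  induction hw using Submodule.span_induction with
  | mem a ha => obtain ⟨k, rfl⟩ := ha; exact pvec_plu_perp _ _
  | zero => simp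
  | add b b' _ _ h h' => simp [inner_add_right, h, h']
  | smul c b _ h => simp [inner_smul_right, h]

theorem frame_ker {F : Type} [NormedAddCommGroup F] [NormedSpace ℝ F] {v : Fin q → VV q m}
    {w : VV q m} (L : VV q m →L[ℝ] F) (hL : ∀ k, L (v k) = 0)
    (hw : w ∈ Submodule.span ℝ (range v)) : L w = 0 := by
  induction hw using Submodule.span_induction with
  | mem a ha => obtain ⟨k, rfl⟩ := ha; exact hL k
  | zero => simp
  | add b b' _ _ h h' => simp [h, h']
  | smul c b _ h => simp [h]

theorem frame_vert {v : Fin q → VV q m} (hp : pvec (plu v) ≠ 0) {ζ : ZZ m}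
    (hw : ((0 : EE q), ζ) ∈ Submodule.span ℝ (range v)) : ζ = 0 := by
  obtain ⟨c, hc⟩ := (Submodule.mem_span_range_iff_exists_fun ℝ).1 hw
  by_cases h0 : c = 0
  · have := congrArg Prod.snd hc
    simpa [h0] using this.symm
  · exfalso
    refine hp (pvec_eq_zero v c ?_ h0)
    have := congrArg Prod.fst hc
    rwa [Prod.fst_sum] at this

theorem stepThree {hqn : q ≤ n} {P : VV q m → QV q (VV q m)} {O : Set (VV q m)}
    (hg : GoodF hqn P O) (hq : 2 ≤ q) (hz : ∀ x ∈ O, x.1 = 0 → P x = 0)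
    (hc : ∀ z, ((0 : EE q), z) ∈ O → ∃ c : ℝ, ∀ v,
        fderiv ℝ (fun x => pvec (P x)) (0, z) (v, 0) = c • v) :
    ∃ (ε : ℝ) (f : VV q m → ZZ m × ℝ), 0 < ε ∧ Vd (EE q) (ZZ m) ε ⊆ O ∧
      ContDiffOn ℝ ∞ f (Vd (EE q) (ZZ m) ε) ∧
      (∀ x ∈ Vd (EE q) (ZZ m) ε, ∀ B : EE q →L[ℝ] EE q, star B = -B →
        fderiv ℝ f x (B (pvec (P x)), Xi (P x) B) = 0) ∧
      (∀ z, f (0, z) = (z, 0)) ∧ (∀ z, ‖z‖ < ε → ∀ v, (fderiv ℝ f (0, z) (v, 0)).2 = 0) ∧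
      ∃ c : ℝ, c ≠ 0 ∧ Tendsto (fun s : ℝ => (f (s • be 0, 0)).2 / s ^ 2) (𝓝[≠] 0) (𝓝 c) := by
  set D := fderiv ℝ (fun x => pvec (P x)) with hD
  have hDs : ContDiffOn ℝ ∞ D O := hg.sm.pvec.fderiv_of_isOpen hg.o (by simp)
  have hbe : inner ℝ (be 0 : EE q) (be 0) = 1 := by rw [inner_be]; simp [be]
  let c : VV q m → ℝ := fun x => inner ℝ (D (0, x.2) (be 0, 0)) (be 0)
  let O0 : Set (VV q m) := {x | ((0 : EE q), x.2) ∈ O}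
  have hO0 : IsOpen O0 := hg.o.preimage (by fun_prop : Continuous fun x : VV q m => ((0 : EE q), x.2))
  have hcs : ContDiffOn ℝ ∞ c O0 := by
    have h1 : ContDiffOn ℝ ∞ (fun x : VV q m => D (0, x.2)) O0 :=
      hDs.comp (by fun_prop : ContDiff ℝ ∞ fun x : VV q m => ((0 : EE q), x.2)).contDiffOn fun x hx => hx
    exact (h1.clm_apply contDiffOn_const).inner ℝ contDiffOn_const
  have hc0 : c 0 = 1 := by
    change inner ℝ (D 0 (be 0, 0)) (be 0) = 1
    rw [hg.d]; exact hbe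
  have hcD : ∀ z, ((0 : EE q), z) ∈ O → ∀ v, D (0, z) (v, 0) = c (0, z) • v := by
    intro z hzO v
    obtain ⟨a, ha⟩ := hc z hzO
    have : c (0, z) = a := by
      change inner ℝ (D (0, z) (be 0, 0)) (be 0) = a
      rw [ha, inner_smul_left, hbe]; simp
    rw [ha, this]
  let O1 : Set (VV q m) := (O0 ∩ c ⁻¹' {0}ᶜ) ∩ O
  have hO1 : IsOpen O1 := (hcs.continuousOn.isOpen_inter_preimage hO0 isOpen_compl_singleton).inter hg.o
  have h01 : (0 : VV q m) ∈ O1 := ⟨⟨hg.mem, by simp [hc0]⟩, hg.mem⟩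
  obtain ⟨χ, hχ, -, hχs, N, hN, h0N, hNO, hχ1⟩ := cutoff (isCompact_singleton (x := (0 : VV q m))) hO1
    (by simpa using h01)
  obtain ⟨δ, hδ, hVN⟩ := exists_Vd hN (h0N rfl)
  have hVO : ∀ x ∈ Vd (EE q) (ZZ m) δ, x ∈ O1 := fun x hx => hNO (hVN hx)
  have hci : ContDiffOn ℝ ∞ (fun x => (c x)⁻¹) O1 :=
    (hcs.mono fun x hx => hx.1.1).inv fun x hx => hx.1.2
  let p : VV q m → EE q := fun x => χ x • ((c x)⁻¹ • pvec (P x))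
  let Ξ : VV q m → (EE q →L[ℝ] EE q) →L[ℝ] ZZ m := fun x => χ x • ((c x)⁻¹ • Xi (P x))
  have h0V : ∀ z : ZZ m, ‖z‖ < δ → ((0 : EE q), z) ∈ Vd (EE q) (ZZ m) δ :=
    fun z hz => ⟨by simpa using hδ, hz⟩
  have hps : ContDiffOn ℝ ∞ (fun x => (c x)⁻¹ • pvec (P x)) O1 :=
    hci.smul (hg.sm.pvec.mono inter_subset_right)
  have hXs : ContDiffOn ℝ ∞ (fun x => (c x)⁻¹ • Xi (P x)) O1 :=
    contDiffOn_clm_apply.2 fun B => hci.smul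
      ((hg.sm.Xi.mono inter_subset_right).clm_apply contDiffOn_const)
  have hd : FieldData δ p Ξ := by
    refine ⟨hδ, cut_smul hχ hO1 hχs hps, cut_smul hχ hO1 hχs hXs, ?_, ?_, ?_⟩
    · intro z hzδ
      simp only [p, hz _ (hVO _ (h0V z hzδ)).2 rfl, pvec_zero, smul_zero]
    · intro z hzδ
      simp only [Ξ, hz _ (hVO _ (h0V z hzδ)).2 rfl, Xi_zero, smul_zero]
    · intro z hzδ v
      have hm := hVO _ (h0V z hzδ)
      have e : p =ᶠ[𝓝 (0, z)] fun x => (c x)⁻¹ • pvec (P x) := by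
        filter_upwards [hN.mem_nhds (hVN (h0V z hzδ))] with x hx
        simp only [p, hχ1 x hx, one_smul]
      rw [e.fderiv_eq]
      have h1 := ((hci.contDiffAt (hO1.mem_nhds hm)).differentiableAt (by simp)).hasFDerivAt
      have h2 := h1.smul (hg.pd hm.2)
      rw [show fderiv ℝ (fun x => (c x)⁻¹ • pvec (P x)) (0, z) = _ from h2.fderiv]
      simp only [hz _ hm.2 rfl, pvec_zero, _root_.add_apply, _root_.smul_apply,
        ContinuousLinearMap.smulRight_apply, smul_zero, add_zero]
      rw [← hD, hcD z hm.2, smul_smul, inv_mul_cancel₀ hm.1.2, one_smul]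
  have hI : Integ (Fin n → ℝ) δ p Ξ := by
    intro x hx hpx
    have hm := hVO x hx
    have hpv : pvec (P x) ≠ 0 := by
      intro h; apply hpx; simp only [p, h, smul_zero]
    have hPx : P x ≠ 0 := by
      intro h; apply hpv; rw [h, pvec_zero]
    obtain ⟨N', v, g, hN', hxN', hv, hgs, hPv, hgv, hgk, -, -⟩ := (hg.ch x hm.2 hPx).frame
    refine ⟨g, N', hN', hxN', hgs, ?_, ?_, ?_⟩
    · intro x' hx' B hB
      have h1 : ((B (p x'), Ξ x' B) : VV q m) = (χ x' * (c x')⁻¹) • (B (pvec (P x')), Xi (P x') B) := by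
        refine Prod.ext ?_ ?_
        · simp only [p, map_smul, Prod.smul_mk, mul_smul]
        · simp only [Ξ, _root_.smul_apply, Prod.smul_mk, mul_smul]
      rw [h1, map_smul, hPv x' hx', frame_ker _ (hgv x' hx') (field_mem_span _ hB), smul_zero]
    · intro w hw
      have h1 := frame_span (hgk x hxN' w hw)
      simp only [p]
      rw [hPv x hxN', inner_smul_left, inner_smul_left, h1]; simp
    · intro ζ hζ
      rw [hPv x hxN'] at hpv
      exact frame_vert hpv (hgk x hxN' _ hζ)
  have hfr : 3 ≤ Module.finrank ℝ (EE q) := by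
    rw [finrank_euclideanSpace_fin]; omega
  have hbn : ‖(be 0 : EE q)‖ = 1 := by
    have := real_inner_self_eq_norm_sq (be 0 : EE q)
    rw [hbe] at this
    nlinarith [norm_nonneg (be 0 : EE q)]
  obtain ⟨ε, f, hε, hεδ, hf, hfX, hf0, hfd, hlim⟩ := first_integrals hd hI hfr hbn
  have hV : ∀ x ∈ Vd (EE q) (ZZ m) ε, x ∈ Vd (EE q) (ZZ m) δ :=
    fun x hx => ⟨hx.1.trans_le hεδ, hx.2.trans_le hεδ⟩
  refine ⟨ε, f, hε, fun x hx => (hVO x (hV x hx)).2, hf, ?_, hf0, hfd, hlim⟩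
  intro x hx B hB
  have h1 : ((B (p x), Ξ x B) : VV q m) = (c x)⁻¹ • (B (pvec (P x)), Xi (P x) B) := by
    have hx1 := hχ1 x (hVN (hV x hx))
    refine Prod.ext ?_ ?_
    · simp only [p, map_smul, Prod.smul_mk, hx1, one_smul]
    · simp only [Ξ, _root_.smul_apply, Prod.smul_mk, hx1, one_smul]
  have h2 := hfX x hx B hB
  rw [h1, map_smul] at h2
  have hcx : (c x)⁻¹ ≠ 0 := inv_ne_zero (hVO x (hV x hx)).1.2
  exact (smul_eq_zero.1 h2).resolve_left hcx

end M8

section M9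
open Set Filter Topology
variable {n q m : ℕ}

theorem Vd_seg {ε : ℝ} {x : VV q m} (hx : x ∈ Vd (EE q) (ZZ m) ε) {s : ℝ} (hs : s ∈ Icc (0:ℝ) 1) :
    (s • x.1, x.2) ∈ Vd (EE q) (ZZ m) ε := by
  refine ⟨?_, hx.2⟩
  change ‖s • x.1‖ < ε
  rw [norm_smul, Real.norm_of_nonneg hs.1]
  exact lt_of_le_of_lt (mul_le_of_le_one_left (norm_nonneg _) hs.2) hx.1

theorem morse_H {ε : ℝ} {ρ : VV q m → ℝ} (hε : 0 < ε) (hρ : ContDiffOn ℝ ∞ ρ (Vd (EE q) (ZZ m) ε))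
    (h0 : ∀ z, ρ (0, z) = 0) (hd : ∀ z, ‖z‖ < ε → ∀ v, fderiv ℝ ρ (0, z) (v, 0) = 0) :
    ∃ H : VV q m → (EE q →L[ℝ] EE q), ContDiffOn ℝ ∞ H (Vd (EE q) (ZZ m) ε) ∧
      (∀ x ∈ Vd (EE q) (ZZ m) ε, ρ x = inner ℝ (H x x.1) x.1) ∧
      ∀ x u w, inner ℝ (H x u) w = inner ℝ (H x w) u := by
  have hV := Vd_open (E := EE q) (Z := ZZ m) ε
  have hat : ∀ x ∈ Vd (EE q) (ZZ m) ε, ∀ s ∈ Icc (0:ℝ) 1, ContDiffAt ℝ ∞ ρ (s • x.1, x.2) :=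
    fun x hx s hs => hρ.contDiffAt (hV.mem_nhds (Vd_seg hx hs))
  have h1s : ∀ x ∈ Vd (EE q) (ZZ m) ε, ContDiffAt ℝ ∞ (hadA ρ) x := fun x hx =>
    hadA_contDiffAt ρ x (hat x hx)
  set G := hadA (hadA ρ) with hG
  have hGs : ContDiffOn ℝ ∞ G (Vd (EE q) (ZZ m) ε) := fun x hx =>
    (hadA_contDiffAt _ x fun s hs => h1s _ (Vd_seg hx hs)).contDiffWithinAt
  have hρG : ∀ x ∈ Vd (EE q) (ZZ m) ε, ρ x = G x x.1 x.1 := by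
    intro x hx
    have e1 := hadA_spec ρ x.1 x.2 fun s hs => (hat x hx s hs).of_le (by simp)
    have e2 := hadA_spec (hadA ρ) x.1 x.2 fun s hs => (h1s _ (Vd_seg hx hs)).of_le (by simp)
    have e3 : hadA ρ (0, x.2) = 0 := by
      rw [hadA_zero]
      exact ContinuousLinearMap.ext fun v => hd x.2 hx.2 v
    rw [e3, sub_zero] at e2
    rw [h0, sub_zero, e2] at e1
    exact e1
  let H : VV q m → (EE q →L[ℝ] EE q) := fun x => ∑ i : Fin (q+1),
    ((1/2 : ℝ) • ((G x).flip (be i) + G x (be i))).smulRight (be i)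
  have hH : ∀ x u w, inner ℝ (H x u) w = (1/2) * (G x u w + G x w u) := by
    intro x u w
    have e : ∀ L : EE q →L[ℝ] ℝ, L w = ∑ i, L (be i) * w i := by
      intro L
      conv_lhs => rw [E_sum w]
      simp [map_sum, mul_comm]
    have e2 : G x w u = ∑ i, G x (be i) u * w i := by
      have := e ((G x).flip u)
      simpa using this
    rw [e (G x u), e2, ← Finset.sum_add_distrib, Finset.mul_sum]
    simp only [H, _root_.sum_apply, sum_inner, ContinuousLinearMap.smulRight_apply, inner_smul_left,
      _root_.smul_apply, _root_.add_apply, ContinuousLinearMap.flip_apply, smul_eq_mul]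
    refine Finset.sum_congr rfl fun i _ => ?_
    rw [real_inner_comm, inner_be]
    simp; ring
  refine ⟨H, ?_, ?_, ?_⟩
  · refine contDiffOn_clm_apply.2 fun u => ?_
    simp only [H, _root_.sum_apply, ContinuousLinearMap.smulRight_apply,
      _root_.smul_apply, _root_.add_apply, ContinuousLinearMap.flip_apply]
    refine ContDiffOn.sum fun i _ => ?_
    have h1 : ContDiffOn ℝ ∞ (fun x => G x u (be i) + G x (be i) u) (Vd (EE q) (ZZ m) ε) :=
      ((hGs.clm_apply contDiffOn_const).clm_apply contDiffOn_const).add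
        ((hGs.clm_apply contDiffOn_const).clm_apply contDiffOn_const)
    exact (h1.const_smul (1/2 : ℝ)).smul contDiffOn_const
  · intro x hx
    rw [hH, hρG x hx]; ring
  · intro x u w
    rw [hH, hH, add_comm]

theorem scalar_of_perp {K : EE q →L[ℝ] EE q} (hs : ∀ u w, inner ℝ (K u) w = inner ℝ (K w) u)
    (h : ∀ u w, inner ℝ u w = 0 → inner ℝ (K u) w = 0) :
    K = (inner ℝ (K (be 0)) (be 0)) • (1 : EE q →L[ℝ] EE q) := by
  have hbe : inner ℝ (be 0 : EE q) (be 0) = 1 := by rw [inner_be]; simp [be]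
  have hQ : ∀ u w, inner ℝ u u = inner ℝ w w → inner ℝ (K u) u = inner ℝ (K w) w := by
    intro u w huw
    have h1 := h (u + w) (u - w) (by
      rw [inner_add_left, inner_sub_right, inner_sub_right, real_inner_comm w u, huw]; ring)
    simp only [map_add, inner_add_left, inner_sub_right] at h1
    rw [hs w u] at h1
    linarith
  set κ := inner ℝ (K (be 0)) (be 0) with hκ
  have hQ2 : ∀ u, inner ℝ (K u) u = κ * inner ℝ u u := by
    intro u
    have h1 := hQ u (‖u‖ • be 0) (by
      rw [inner_smul_left, inner_smul_right, hbe, real_inner_self_eq_norm_sq]; simp; ring)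
    rw [h1, map_smul, inner_smul_left, inner_smul_right, real_inner_self_eq_norm_sq]
    simp only [conj_trivial]
    rw [← hκ]; ring
  refine ContinuousLinearMap.ext fun u => ?_
  refine ext_inner_right ℝ fun w => ?_
  have h1 := hQ2 (u + w)
  simp only [map_add, inner_add_left, inner_add_right] at h1
  rw [hQ2 u, hQ2 w, hs w u, real_inner_comm u w] at h1
  have : (κ • (1 : EE q →L[ℝ] EE q)) u = κ • u := rfl
  rw [this, inner_smul_left]
  simp only [conj_trivial]
  linarith

set_option maxHeartbeats 800000 in
theorem quad_lim {ε : ℝ} {H : VV q m → (EE q →L[ℝ] EE q)} {b : VV q m → EE q} {ξ : VV q m → ZZ m}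
    {b' : VV q m →L[ℝ] EE q} (hε : 0 < ε) (hH : ContDiffOn ℝ ∞ H (Vd (EE q) (ZZ m) ε))
    (hb : HasFDerivAt b b' 0) (hξ : ContinuousAt ξ 0) (hb0 : b 0 = 0) (hξ0 : ξ 0 = 0)
    (h : ∀ x ∈ Vd (EE q) (ZZ m) ε, 2 * inner ℝ (H x x.1) (b x) +
      inner ℝ (fderiv ℝ H x (b x, ξ x) x.1) x.1 = 0) (y0 : EE q) :
    inner ℝ (H 0 y0) (b' (y0, 0)) = 0 := by
  have hV := Vd_open (E := EE q) (Z := ZZ m) ε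
  have h0V : (0 : VV q m) ∈ Vd (EE q) (ZZ m) ε := ⟨by simpa using hε, by simpa using hε⟩
  have hrc : Tendsto (fun t : ℝ => ((t • y0, 0) : VV q m)) (𝓝[≠] 0) (𝓝 0) := by
    have : Continuous fun t : ℝ => ((t • y0, 0) : VV q m) := by fun_prop
    have h := this.tendsto 0
    simp only [zero_smul] at h
    exact h.mono_left nhdsWithin_le_nhds
  have l0 : Tendsto (fun t : ℝ => t⁻¹ • b (t • y0, 0)) (𝓝[≠] 0) (𝓝 (b' (y0, 0))) := by
    have h1 : HasFDerivAt b b' (((0:ℝ) • y0, 0) : VV q m) := by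
      rw [zero_smul]; exact hb
    have hray : HasDerivAt (fun t : ℝ => ((t • y0, 0) : VV q m)) (y0, 0) 0 := by
      have h1 : HasDerivAt (fun t : ℝ => t • y0) y0 0 := by
        simpa using (hasDerivAt_id (0:ℝ)).smul_const y0
      exact h1.prodMk (hasDerivAt_const _ _)
    have h2 : HasDerivAt (fun t : ℝ => b (t • y0, 0)) _ 0 := h1.comp_hasDerivAt 0 hray
    refine h2.tendsto_slope.congr fun t => ?_
    rw [slope_def_module, zero_smul, show (((0 : EE q), (0 : ZZ m)) : VV q m) = 0 from rfl, hb0]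
    simp
  have l1 : Tendsto (fun t : ℝ => inner ℝ (H (t • y0, 0) y0) (t⁻¹ • b (t • y0, 0)))
      (𝓝[≠] 0) (𝓝 (inner ℝ (H 0 y0) (b' (y0, 0)))) := by
    have a1 : Tendsto (fun t : ℝ => H (t • y0, 0) y0) (𝓝[≠] 0) (𝓝 (H 0 y0)) := by
      have : ContinuousAt (fun x => H x y0) 0 :=
        (hH.continuousOn.continuousAt (hV.mem_nhds h0V)).clm_apply continuousAt_const
      exact this.tendsto.comp hrc
    exact a1.inner l0
  have l2 : Tendsto (fun t : ℝ => inner ℝ (fderiv ℝ H (t • y0, 0) (b (t • y0, 0),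
      ξ (t • y0, 0)) y0) y0) (𝓝[≠] 0) (𝓝 0) := by
    have hdc : ContinuousAt (fderiv ℝ H) 0 := (hH.continuousOn_fderiv_of_isOpen hV
      (by simp)).continuousAt (hV.mem_nhds h0V)
    have : ContinuousAt (fun x => inner ℝ (fderiv ℝ H x (b x, ξ x) y0) y0) 0 :=
      ((hdc.clm_apply (hb.continuousAt.prodMk hξ)).clm_apply continuousAt_const).inner
        continuousAt_const
    have h := this.tendsto.comp hrc
    simp only [hb0, hξ0, Prod.mk_zero_zero, map_zero, _root_.zero_apply, inner_zero_left] at h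
    exact h
  have l3 := (l1.const_mul 2).add l2
  have l4 : Tendsto (fun _ : ℝ => (0:ℝ)) (𝓝[≠] 0) (𝓝 (2 * inner ℝ (H 0 y0) (b' (y0, 0)) + 0)) := by
    refine l3.congr' ?_
    filter_upwards [hrc.eventually (hV.mem_nhds h0V), self_mem_nhdsWithin] with t ht ht0
    have ht0' : t ≠ 0 := ht0
    have ht' : ((t • y0, 0) : VV q m) ∈ Vd (EE q) (ZZ m) ε := ht
    have h1 := h (t • y0, 0) ht'
    simp only [map_smul, inner_smul_left, inner_smul_right, conj_trivial] at h1 ⊢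
    generalize inner ℝ (H (t • y0, 0) y0) (b (t • y0, 0)) = u1 at h1 ⊢
    generalize inner ℝ ((fderiv ℝ H (t • y0, 0)) (b (t • y0, 0), ξ (t • y0, 0)) y0) y0 = u2 at h1 ⊢
    have : t * (t * (2 * (t⁻¹ * u1) + u2)) = 0 := by
      linear_combination h1 + (2 * t * u1) * (mul_inv_cancel₀ ht0')
    simpa [ht0'] using this
  have := tendsto_nhds_unique l4 tendsto_const_nhds
  linarith

/-- The normal form of the quadratic part of the integral. -/
theorem H_scalar {hqn : q ≤ n} {P : VV q m → QV q (VV q m)} {O : Set (VV q m)}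
    (hg : GoodF hqn P O) {ε : ℝ} {ρ : VV q m → ℝ} {H : VV q m → (EE q →L[ℝ] EE q)} (hε : 0 < ε)
    (hH : ContDiffOn ℝ ∞ H (Vd (EE q) (ZZ m) ε))
    (hρ : ∀ x ∈ Vd (EE q) (ZZ m) ε, ρ x = inner ℝ (H x x.1) x.1)
    (hs : ∀ x u w, inner ℝ (H x u) w = inner ℝ (H x w) u)
    (hX : ∀ x ∈ Vd (EE q) (ZZ m) ε, ∀ B : EE q →L[ℝ] EE q, star B = -B →
        fderiv ℝ ρ x (B (pvec (P x)), Xi (P x) B) = 0) :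
    H 0 = (inner ℝ (H 0 (be 0)) (be 0)) • (1 : EE q →L[ℝ] EE q) := by
  have hV := Vd_open (E := EE q) (Z := ZZ m) ε
  have h0V : (0 : VV q m) ∈ Vd (EE q) (ZZ m) ε := ⟨by simpa using hε, by simpa using hε⟩
  have hder : ∀ x ∈ Vd (EE q) (ZZ m) ε, ∀ w : VV q m, fderiv ℝ ρ x w =
      2 * inner ℝ (H x x.1) w.1 + inner ℝ (fderiv ℝ H x w x.1) x.1 := by
    intro x hx w
    have h1 := ((hH.contDiffAt (hV.mem_nhds hx)).differentiableAt (by simp)).hasFDerivAt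
    have h2 := (h1.clm_apply (hasFDerivAt_fst (p := x))).inner ℝ (hasFDerivAt_fst (p := x))
    have e : ρ =ᶠ[𝓝 x] fun x => inner ℝ (H x x.1) x.1 := by
      filter_upwards [hV.mem_nhds hx] with y hy using hρ y hy
    rw [e.fderiv_eq, h2.fderiv]
    simp [fderivInnerCLM_apply, inner_add_left]
    rw [hs x w.1 x.1]; ring
  refine scalar_of_perp (hs 0) fun y0 u hu => ?_
  have main : ∀ B : EE q →L[ℝ] EE q, star B = -B → inner ℝ (H 0 y0) (B y0) = 0 := by
    intro B hB
    have hpc := B.hasFDerivAt.comp (f := fun x => pvec (P x)) (0 : VV q m) (hg.pd hg.mem)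
    have hXc : ContinuousAt (fun x => Xi (P x) B) 0 :=
      (hg.sm.Xi.contDiffAt (hg.o.mem_nhds hg.mem)).continuousAt.clm_apply continuousAt_const
    have := quad_lim (ξ := fun x => Xi (P x) B) hε hH hpc hXc (by simp [hg.z, pvec_zero])
      (by simp [hg.z, Xi_zero]) (fun x hx => (hder x hx _).symm.trans (hX x hx B hB)) y0
    rwa [ContinuousLinearMap.comp_apply, hg.d] at this
  have h1 := main (wedge u y0) (wedge_skew _ _)
  rw [wedge_apply, real_inner_comm y0 u, hu, zero_smul, sub_zero, inner_smul_right] at h1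
  rcases mul_eq_zero.1 h1 with h2 | h2
  · rw [inner_self_eq_zero.1 h2]; simp
  · exact h2

end M9

section M10
open Set Filter Topology
variable {n q m : ℕ}

theorem span_X {v : Fin q → VV q m} (hp : pvec (plu v) ≠ 0) {w : VV q m}
    (hw : w ∈ Submodule.span ℝ (range v)) : ∃ B : EE q →L[ℝ] EE q, star B = -B ∧
      w = (B (pvec (plu v)), Xi (plu v) B) := by
  set p := pvec (plu v) with hpd
  have hpp : inner ℝ p p ≠ 0 := fun h => hp (inner_self_eq_zero.1 h)
  have hwp : inner ℝ w.1 p = 0 := by rw [real_inner_comm]; exact frame_span hw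
  refine ⟨wedge ((inner ℝ p p)⁻¹ • w.1) p, wedge_skew _ _, ?_⟩
  have h1 := field_mem_span v (wedge_skew ((inner ℝ p p)⁻¹ • w.1) p)
  have hB : wedge ((inner ℝ p p)⁻¹ • w.1) p p = w.1 := by
    rw [wedge_apply, inner_smul_left, hwp, smul_smul, mul_inv_cancel₀ hpp]
    simp
  rw [← hpd, hB] at h1
  have h2 := Submodule.sub_mem _ hw h1
  have h3 := frame_vert hp (ζ := w.2 - Xi (plu v) (wedge ((inner ℝ p p)⁻¹ • w.1) p)) (by
    convert h2 using 1
    exact Prod.ext (by simp) rfl)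
  exact Prod.ext hB.symm (sub_eq_zero.1 h3)

theorem plu_tang {v : Fin q → VV q m} (h2 : ∀ k, (v k).2 = 0) {y : EE q} (hy : y ≠ 0)
    (h1 : ∀ k, inner ℝ y (v k).1 = 0) : plu v = mdl (pvec (plu v)) ∧
      ∀ w, inner ℝ y w = 0 → inner ℝ (pvec (plu v)) w = 0 := by
  constructor
  · refine eq_mdl _ fun α ⟨i, hi⟩ => ?_
    rw [plu_apply]
    refine Matrix.det_eq_zero_of_row_eq_zero i fun j => ?_
    have : v j = ((v j).1, 0) := Prod.ext rfl (h2 j)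
    simp only [Matrix.of_apply]
    rw [this]; exact hi _
  · intro w hw
    rw [pvec_plu]
    refine Matrix.exists_vecMul_eq_zero_iff.1 ⟨fun i => y i, ?_, ?_⟩
    · intro h; exact hy (PiLp.ext fun i => congrFun h i)
    · funext j
      refine Fin.cases ?_ (fun k => ?_) j
      · simpa [Matrix.vecMul, dotProduct, inner_sum] using hw
      · simpa [Matrix.vecMul, dotProduct, inner_sum] using h1 k

theorem stepFour {hqn : q ≤ n} {P : VV q m → QV q (VV q m)} {O : Set (VV q m)}
    (hg : GoodF hqn P O) (hq : 2 ≤ q) (hz : ∀ x ∈ O, x.1 = 0 → P x = 0)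
    (hc : ∀ z, ((0 : EE q), z) ∈ O → ∃ c : ℝ, ∀ v,
        fderiv ℝ (fun x => pvec (P x)) (0, z) (v, 0) = c • v) :
    ∃ P1 O1, GoodF hqn P1 O1 ∧ LinTo P P1 ∧ ∀ y ∈ O1, P1 y = mdl (pvec (P1 y)) ∧
      ∀ w, inner ℝ y.1 w = 0 → inner ℝ (pvec (P1 y)) w = 0 := by
  obtain ⟨ε, f, hε, hVO, hf, hX, hf0, hfd, c, hc0, hlim⟩ := stepThree hg hq hz hc
  obtain ⟨O', hO', h0', hO'O, hpv⟩ := S1a hg hq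
  have hV := Vd_open (E := EE q) (Z := ZZ m) ε
  have h0V : (0 : VV q m) ∈ Vd (EE q) (ZZ m) ε := ⟨by simpa using hε, by simpa using hε⟩
  have hfa : ∀ x ∈ Vd (EE q) (ZZ m) ε, HasFDerivAt f (fderiv ℝ f x) x := fun x hx =>
    ((hf.contDiffAt (hV.mem_nhds hx)).differentiableAt (by simp)).hasFDerivAt
  have hρa : ∀ x ∈ Vd (EE q) (ZZ m) ε, ∀ w, fderiv ℝ (fun x => (f x).2) x w = (fderiv ℝ f x w).2 := by
    intro x hx w
    rw [(hfa x hx).snd.fderiv]; rfl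
  obtain ⟨H, hHs, hρH, hsym⟩ := morse_H (ρ := fun x => (f x).2) hε hf.snd (fun z => by rw [hf0])
    (fun z hz' v => by
      rw [hρa _ ⟨by simpa using hε, hz'⟩]; exact hfd z hz' v)
  have hHsc := H_scalar hg hε hHs hρH hsym (fun x hx B hB => by rw [hρa x hx, hX x hx B hB]; rfl)
  have hκ : inner ℝ (H 0 (be 0)) (be 0) = c := by
    refine tendsto_nhds_unique ?_ hlim
    have hrc : Tendsto (fun s : ℝ => ((s • be 0, 0) : VV q m)) (𝓝[≠] 0) (𝓝 0) := by
      have : Continuous fun t : ℝ => ((t • be 0, 0) : VV q m) := by fun_prop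
      have h := this.tendsto 0
      simp only [zero_smul] at h
      exact h.mono_left nhdsWithin_le_nhds
    have hcont : ContinuousAt (fun x => inner ℝ (H x (be 0)) (be 0)) (0 : VV q m) :=
      ((hHs.continuousOn.continuousAt (hV.mem_nhds h0V)).clm_apply continuousAt_const).inner
        continuousAt_const
    refine (hcont.tendsto.comp hrc).congr' ?_
    filter_upwards [hrc.eventually (hV.mem_nhds h0V), self_mem_nhdsWithin] with t ht ht0
    have ht0' : t ≠ 0 := ht0
    have ht' : ((t • be 0, 0) : VV q m) ∈ Vd (EE q) (ZZ m) ε := ht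
    have h1 := hρH (t • be 0, 0) ht'
    simp only [map_smul, inner_smul_left, inner_smul_right, conj_trivial] at h1
    simp only [Function.comp]
    rw [h1]
    generalize inner ℝ (H (t • be 0, 0) (be 0)) (be 0) = u1
    field_simp
  rw [hκ] at hHsc
  obtain ⟨R, U, hU, h1U, hR1, hRs, hRR, hRu, hRst⟩ := mat_sqrt (EE q)
  set K : VV q m → (EE q →L[ℝ] EE q) := fun x => c⁻¹ • H x with hK
  have hKs : ContDiffOn ℝ ∞ K (Vd (EE q) (ZZ m) ε) := hHs.const_smul c⁻¹
  have hK0 : K 0 = 1 := by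
    change c⁻¹ • H 0 = 1
    rw [hHsc, smul_smul, inv_mul_cancel₀ hc0, one_smul]
  have hKst : ∀ x, star (K x) = K x := by
    intro x
    rw [ContinuousLinearMap.star_eq_adjoint]
    refine ((ContinuousLinearMap.eq_adjoint_iff _ _).2 fun a b => ?_).symm
    change inner ℝ (c⁻¹ • H x a) b = inner ℝ a (c⁻¹ • H x b)
    rw [inner_smul_left, inner_smul_right, hsym, real_inner_comm]; rfl
  let O1 : Set (VV q m) := (Vd (EE q) (ZZ m) ε ∩ K ⁻¹' U) ∩ O'
  have hO1 : IsOpen O1 := (hKs.continuousOn.isOpen_inter_preimage hV hU).inter hO'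
  have h01 : (0 : VV q m) ∈ O1 := ⟨⟨h0V, by rw [mem_preimage, hK0]; exact h1U⟩, h0'⟩
  let S : VV q m → (EE q →L[ℝ] EE q) := fun x => R (K x)
  have hSs : ContDiffOn ℝ ∞ S O1 := hRs.comp (hKs.mono fun x hx => hx.1.1) fun x hx => hx.1.2
  have hS0 : S 0 = 1 := by simp only [S, hK0, hR1]
  have hSst : ∀ x ∈ O1, ∀ u w, inner ℝ (S x u) w = inner ℝ u (S x w) := by
    intro x hx u w
    have h1 := hRst _ hx.1.2 (hKst x)
    rw [ContinuousLinearMap.star_eq_adjoint] at h1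
    change inner ℝ (R (K x) u) w = inner ℝ u (R (K x) w)
    rw [← ContinuousLinearMap.adjoint_inner_left, h1]
  let φ : VV q m → VV q m := fun x => (S x x.1, (f x).1)
  have hφs : ContDiffOn ℝ ∞ φ O1 := (hSs.clm_apply contDiffOn_fst).prodMk
    (hf.fst.mono fun x hx => hx.1.1)
  have hφa : ∀ x ∈ O1, HasFDerivAt φ (fderiv ℝ φ x) x := fun x hx =>
    ((hφs.contDiffAt (hO1.mem_nhds hx)).differentiableAt (by simp)).hasFDerivAt
  have hφd : ∀ x ∈ O1, ∀ w, fderiv ℝ φ x w =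
      (S x w.1 + fderiv ℝ S x w x.1, (fderiv ℝ f x w).1) := by
    intro x hx w
    have h1 := ((hSs.contDiffAt (hO1.mem_nhds hx)).differentiableAt (by simp)).hasFDerivAt
    have h2 := h1.clm_apply (hasFDerivAt_fst (p := x))
    have h3 := h2.prodMk (hfa x hx.1.1).fst
    rw [show fderiv ℝ φ x = _ from h3.fderiv]
    simp
  have hf0z : ∀ ζ : ZZ m, (fderiv ℝ f 0 (0, ζ)).1 = ζ := by
    intro ζ
    have h1 : HasFDerivAt (fun z : ZZ m => ((0 : EE q), z)) (ContinuousLinearMap.inr ℝ _ _) 0 :=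
      (ContinuousLinearMap.inr ℝ (EE q) (ZZ m)).hasFDerivAt
    have h2 := (HasFDerivAt.comp (f := fun z : ZZ m => ((0 : EE q), z)) (g := f) (0 : ZZ m)
      (hfa 0 h0V) h1).fst
    have h3 : HasFDerivAt (fun z : ZZ m => z) (ContinuousLinearMap.id ℝ (ZZ m)) 0 := hasFDerivAt_id _
    have h4 : (fun z : ZZ m => ((f ∘ fun z : ZZ m => ((0 : EE q), z)) z).1) = fun z => z := by
      funext z; simp [hf0]
    rw [h4] at h2
    exact DFunLike.congr_fun (h2.unique h3) ζ
  have hφ0 : ∀ v, fderiv ℝ φ 0 v = (v.1, (fderiv ℝ f 0 v).1) := by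
    intro v
    rw [hφd 0 h01, hS0]; simp
  have hbij : Function.Bijective (fderiv ℝ φ 0) := by
    constructor
    · rw [injective_iff_map_eq_zero]
      rintro ⟨u, ζ⟩ h
      rw [hφ0] at h
      have h1 : u = 0 := congrArg Prod.fst h
      have h2 : (fderiv ℝ f 0 (u, ζ)).1 = 0 := congrArg Prod.snd h
      rw [h1, hf0z] at h2
      rw [h1, h2]; rfl
    · rintro ⟨u, ζ⟩
      refine ⟨(u, ζ - (fderiv ℝ f 0 (u, 0)).1), ?_⟩
      rw [hφ0, show ((u, ζ - (fderiv ℝ f 0 (u, 0)).1) : VV q m) =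
        (u, 0) + (0, ζ - (fderiv ℝ f 0 (u, 0)).1) by simp, map_add, Prod.fst_add, Prod.fst_add, hf0z]
      simp
  obtain ⟨ψ, N, M, hL, h0N, hN, hG, hLin⟩ := good_push (φ := φ) hg hO1 h01
    (by
      have : f 0 = 0 := hf0 0
      simp [φ, this]) hφs (fun v => by rw [hφ0]) hbij
  -- the norm of the first component
  have hYY : ∀ x ∈ O1, inner ℝ (φ x).1 (φ x).1 = c⁻¹ * (f x).2 := by
    intro x hx
    change inner ℝ (S x x.1) (S x x.1) = _
    rw [← hSst x hx]
    have : S x (S x x.1) = K x x.1 := by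
      have := hRR _ hx.1.2
      rw [← this]; rfl
    rw [this, hρH x hx.1.1]
    change inner ℝ (c⁻¹ • H x x.1) x.1 = _
    rw [inner_smul_left]; rfl
  have hYd : ∀ x ∈ O1, ∀ w, fderiv ℝ f x w = 0 → inner ℝ (φ x).1 (fderiv ℝ φ x w).1 = 0 := by
    intro x hx w hw
    have h1 := (hφa x hx).fst
    have h2 := h1.inner ℝ h1
    have e : (fun x => inner ℝ (φ x).1 (φ x).1) =ᶠ[𝓝 x] fun x => c⁻¹ * (f x).2 := by
      filter_upwards [hO1.mem_nhds hx] with y hy using hYY y hy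
    have h3 := ((hfa x hx.1.1).snd.const_mul c⁻¹).congr_of_eventuallyEq e
    have h4 := DFunLike.congr_fun (h2.unique h3) w
    simp [fderivInnerCLM_apply, hw] at h4
    have h5 := real_inner_comm (fderiv ℝ φ x w).1 (φ x).1
    linarith
  refine ⟨_, M, hG, hLin, fun y hy => ?_⟩
  obtain ⟨hxO, hx1⟩ := hN (hL.mM y hy)
  have hφψ : φ (ψ y) = y := hL.ri y hy
  by_cases hP : P (ψ y) = 0
  · simp only [pf, hP, push_zero, pvec_zero]
    refine ⟨?_, fun w _ => by simp⟩
    have := eq_mdl (0 : QV q (VV q m)) fun α _ => rfl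
    rwa [pvec_zero] at this
  have hp : pvec (P (ψ y)) ≠ 0 := fun h => hP (hpv _ hx1.2 h)
  obtain ⟨N', v, g, -, hxN', -, -, hPv, -⟩ := (hg.ch _ hxO hP).frame
  have hPv := hPv _ hxN'
  rw [hPv] at hp
  have hfv : ∀ k, fderiv ℝ f (ψ y) (v (ψ y) k) = 0 := by
    intro k
    obtain ⟨B, hB, e⟩ := span_X hp (Submodule.subset_span (mem_range_self k))
    rw [e, ← hPv]
    exact hX _ hx1.1.1 B hB
  have hy1 : y.1 ≠ 0 := by
    intro h
    have h1 : S (ψ y) (ψ y).1 = 0 := (congrArg Prod.fst hφψ).trans h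
    obtain ⟨u, hu⟩ := hRu _ hx1.1.2
    change R (K (ψ y)) (ψ y).1 = 0 at h1
    rw [← hu] at h1
    have h4 := unit_inv_apply' u (ψ y).1
    rw [h1, map_zero] at h4
    exact hP (hz _ hxO h4.symm)
  have e : pf φ ψ P y = plu (fun k => fderiv ℝ φ (ψ y) (v (ψ y) k)) := by
    simp only [pf]; rw [hPv, push_plu]
  rw [e]
  refine plu_tang (fun k => ?_) hy1 (fun k => ?_)
  · rw [hφd _ hx1, hfv k]; rfl
  · have := hYd _ hx1 _ (hfv k)
    rwa [hφψ] at this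

end M10

section M11
open Set Filter Topology
variable {n q m : ℕ}

theorem mdl_smul (c : ℝ) (y : EE q) : (mdl (c • y) : QV q (VV q m)) = c • mdl y := by
  refine AlternatingMap.ext fun α => ?_
  change AlternatingMap.curryLeft (Matrix.detRowAlternating (R := ℝ) (n := Fin (q+1)))
    (c • fun k => y k) (fun i => rowL (α i)) = _
  rw [map_smul]; rfl

theorem mdl_zero : (mdl (0 : EE q) : QV q (VV q m)) = 0 := by
  have := mdl_smul (m := m) 0 (0 : EE q)
  simpa using this

/-- A vector field along the radial direction is a smooth multiple of the radial field. -/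
theorem div_radial {ε : ℝ} {p : VV q m → EE q} (hε : 0 < ε) (hp : ContDiffOn ℝ ∞ p (Vd (EE q) (ZZ m) ε))
    (hd : ∀ v, fderiv ℝ p 0 v = v.1)
    (h : ∀ x ∈ Vd (EE q) (ZZ m) ε, ∀ w, inner ℝ x.1 w = 0 → inner ℝ (p x) w = 0) :
    ∃ (δ : ℝ) (l : VV q m → ℝ), 0 < δ ∧ δ ≤ ε ∧ ContDiffOn ℝ ∞ l (Vd (EE q) (ZZ m) δ) ∧ l 0 = 1 ∧
      ∀ x ∈ Vd (EE q) (ZZ m) δ, p x = l x • x.1 := by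
  have hV := Vd_open (E := EE q) (Z := ZZ m) ε
  have hV2 := Vd_open (E := EE q) (Z := ZZ m) (ε/2)
  have hbe : inner ℝ (be 0 : EE q) (be 0) = 1 := by rw [inner_be]; simp [be]
  have hbn : ‖(be 0 : EE q)‖ = 1 := by simp [be]
  let s : ℝ × VV q m → VV q m := fun r => (r.2.1 + (r.1 - inner ℝ r.2.1 (be 0)) • be 0, r.2.2)
  have hs : ContDiff ℝ ∞ s :=
    ((contDiff_fst.comp contDiff_snd).add ((contDiff_fst.sub
      ((contDiff_fst.comp contDiff_snd).inner ℝ contDiff_const)).smul contDiff_const)).prodMk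
      (contDiff_snd.comp contDiff_snd)
  let f : ℝ × VV q m → ℝ := fun r => inner ℝ (p (s r)) (be 0)
  have hsV : ∀ x ∈ Vd (EE q) (ZZ m) (ε/2), ∀ t ∈ Icc (0:ℝ) 1,
      s (t • inner ℝ x.1 (be 0), x) ∈ Vd (EE q) (ZZ m) ε := by
    intro x hx t ht
    refine ⟨?_, lt_trans hx.2 (by linarith)⟩
    change ‖x.1 + (t • inner ℝ x.1 (be 0) - inner ℝ x.1 (be 0)) • be 0‖ < ε
    have h1 : |inner ℝ x.1 (be 0)| ≤ ‖x.1‖ := by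
      have := abs_real_inner_le_norm x.1 (be 0)
      rwa [hbn, mul_one] at this
    have h2 : |t • inner ℝ x.1 (be 0) - inner ℝ x.1 (be 0)| ≤ |inner ℝ x.1 (be 0)| := by
      rw [smul_eq_mul, ← sub_one_mul, abs_mul]
      refine mul_le_of_le_one_left (abs_nonneg _) ?_
      rw [abs_le]; constructor <;> linarith [ht.1, ht.2]
    have h3 := norm_add_le x.1 ((t • inner ℝ x.1 (be 0) - inner ℝ x.1 (be 0)) • (be 0 : EE q))
    rw [norm_smul, hbn, mul_one, Real.norm_eq_abs] at h3
    have := hx.1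
    linarith
  have hfa : ∀ r, s r ∈ Vd (EE q) (ZZ m) ε → ContDiffAt ℝ ∞ f r := fun r hr =>
    ((hp.contDiffAt (hV.mem_nhds hr)).comp (f := s) r hs.contDiffAt).inner ℝ contDiffAt_const
  let l : VV q m → ℝ := fun x => hadA f (inner ℝ x.1 (be 0), x) 1
  have hls : ContDiffOn ℝ ∞ l (Vd (EE q) (ZZ m) (ε/2)) := by
    intro x hx
    have h1 : ContDiffAt ℝ ∞ (hadA f) (inner ℝ x.1 (be 0), x) :=
      hadA_contDiffAt f _ fun t ht => hfa _ (hsV x hx t ht)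
    have h2 : ContDiffAt ℝ ∞ (fun x : VV q m => ((inner ℝ x.1 (be 0) : ℝ), x)) x :=
      (contDiffAt_fst.inner ℝ contDiffAt_const).prodMk contDiffAt_id
    exact ((h1.comp (f := fun x : VV q m => ((inner ℝ x.1 (be 0) : ℝ), x)) x h2).clm_apply
      contDiffAt_const).contDiffWithinAt
  have hl : ∀ x ∈ Vd (EE q) (ZZ m) (ε/2), inner ℝ (p x) (be 0) = l x * inner ℝ x.1 (be 0) := by
    intro x hx
    have h1 := hadA_spec f (inner ℝ x.1 (be 0)) x fun t ht => (hfa _ (hsV x hx t ht)).of_le (by simp)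
    have h2 : f (inner ℝ x.1 (be 0), x) = inner ℝ (p x) (be 0) := by
      simp [f, s]
    have h3 : f (0, x) = 0 := by
      have h4 := hsV x hx 0 ⟨le_rfl, zero_le_one⟩
      rw [zero_smul] at h4
      refine h _ h4 _ ?_
      simp only [s, inner_add_left, inner_smul_left, hbe]
      simp
    rw [h2, h3, sub_zero] at h1
    rw [h1, mul_comm]
    change hadA f (inner ℝ x.1 (be 0), x) (inner ℝ x.1 (be 0)) = inner ℝ x.1 (be 0) • _
    rw [← map_smul]; simp
  have key : ∀ x ∈ Vd (EE q) (ZZ m) (ε/2), inner ℝ x.1 (be 0) ≠ (0:ℝ) → p x = l x • x.1 := by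
    intro x hx hx0
    have hx1 : inner ℝ x.1 x.1 ≠ (0:ℝ) := fun h' => hx0 (by rw [inner_self_eq_zero.1 h']; simp)
    have hxε : x ∈ Vd (EE q) (ZZ m) ε := ⟨lt_trans hx.1 (by linarith), lt_trans hx.2 (by linarith)⟩
    set μ := inner ℝ (p x) x.1 / inner ℝ x.1 x.1 with hμ
    have h1 : p x = μ • x.1 := by
      have h2 : inner ℝ x.1 (p x - μ • x.1) = 0 := by
        rw [inner_sub_right, inner_smul_right, hμ, div_mul_cancel₀ _ hx1, real_inner_comm, sub_self]
      have h3 := h x hxε _ h2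
      have h4 : inner ℝ (p x - μ • x.1) (p x - μ • x.1) = (0:ℝ) := by
        rw [inner_sub_left, h3, inner_smul_left, h2]; simp
      exact sub_eq_zero.1 (inner_self_eq_zero.1 h4)
    have h5 := hl x hx
    rw [h1, inner_smul_left] at h5
    rw [h1, show μ = l x from mul_right_cancel₀ hx0 h5]
  have h0V : (0 : VV q m) ∈ Vd (EE q) (ZZ m) ε := ⟨by simpa using hε, by simpa using hε⟩
  refine ⟨ε/2, l, by linarith, by linarith, hls, ?_, fun x hx => ?_⟩
  · have h1 : l 0 = fderiv ℝ f (0, 0) (1, 0) := by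
      change hadA f (inner ℝ (0 : EE q) (be 0), 0) 1 = _
      rw [inner_zero_left, hadA_zero]; rfl
    have hs0 : s (0, 0) = 0 := by simp [s]
    have hray : HasDerivAt (fun t : ℝ => ((t • be 0, 0) : VV q m)) (be 0, 0) 0 := by
      have h1 : HasDerivAt (fun t : ℝ => t • (be 0 : EE q)) (be 0) 0 := by
        simpa using (hasDerivAt_id (0:ℝ)).smul_const (be 0 : EE q)
      exact h1.prodMk (hasDerivAt_const _ _)
    have hpa : HasFDerivAt p (fderiv ℝ p 0) (((0:ℝ) • be 0, 0) : VV q m) := by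
      rw [zero_smul]
      exact ((hp.contDiffAt (hV.mem_nhds h0V)).differentiableAt (by simp)).hasFDerivAt
    have h2 : HasDerivAt (fun t : ℝ => inner ℝ (p (t • be 0, 0)) (be 0 : EE q)) _ 0 :=
      (hpa.comp_hasDerivAt 0 hray).inner ℝ (hasDerivAt_const (0:ℝ) (be 0 : EE q))
    have hr2 : HasDerivAt (fun t : ℝ => ((t, 0) : ℝ × VV q m)) (1, 0) 0 :=
      (hasDerivAt_id _).prodMk (hasDerivAt_const _ _)
    have hfa0 : HasFDerivAt f (fderiv ℝ f (0, 0)) ((0, 0) : ℝ × VV q m) :=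
      ((hfa (0, 0) (by rw [hs0]; exact h0V)).differentiableAt (by simp)).hasFDerivAt
    have h3 : HasDerivAt (fun t : ℝ => f (t, 0)) _ 0 :=
      HasFDerivAt.comp_hasDerivAt (l := f) (f := fun t : ℝ => ((t, 0) : ℝ × VV q m)) (0:ℝ) hfa0 hr2
    have h4 : (fun t : ℝ => f (t, 0)) = fun t : ℝ => inner ℝ (p (t • be 0, 0)) (be 0 : EE q) := by
      funext t; simp [f, s]
    rw [h4] at h3
    rw [h1, h3.unique h2, hd]
    simp [hbn]
  · by_cases hx0 : inner ℝ x.1 (be 0) = (0:ℝ)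
    swap
    · exact key x hx hx0
    have hc : Continuous fun t : ℝ => ((x.1 + t • be 0, x.2) : VV q m) := by fun_prop
    have hrc : Tendsto (fun t : ℝ => ((x.1 + t • be 0, x.2) : VV q m)) (𝓝[≠] 0) (𝓝 x) := by
      have h := hc.tendsto 0
      simp only [zero_smul, add_zero] at h
      exact h.mono_left nhdsWithin_le_nhds
    have hxε : x ∈ Vd (EE q) (ZZ m) ε := ⟨lt_trans hx.1 (by linarith), lt_trans hx.2 (by linarith)⟩
    have c1 : ContinuousAt p x := hp.continuousOn.continuousAt (hV.mem_nhds hxε)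
    have c2 : ContinuousAt (fun x => l x • x.1) x :=
      (hls.continuousOn.continuousAt (hV2.mem_nhds hx)).smul continuousAt_fst
    refine tendsto_nhds_unique (c1.tendsto.comp hrc) ((c2.tendsto.comp hrc).congr' ?_)
    filter_upwards [hrc.eventually (hV2.mem_nhds hx), self_mem_nhdsWithin] with t ht ht0
    refine (key (x.1 + t • be 0, x.2) ht ?_).symm
    rw [inner_add_left, inner_smul_left, hx0, hbe]
    simpa using ht0

theorem stepFourB {hqn : q ≤ n} {P : VV q m → QV q (VV q m)} {O : Set (VV q m)} (hg : GoodF hqn P O)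
    (h : ∀ y ∈ O, P y = mdl (pvec (P y)) ∧ ∀ w, inner ℝ y.1 w = 0 → inner ℝ (pvec (P y)) w = 0) :
    ∃ (δ : ℝ) (l : VV q m → ℝ), 0 < δ ∧ ContDiffOn ℝ ∞ l (Vd (EE q) (ZZ m) δ) ∧ l 0 = 1 ∧
      ∀ x ∈ Vd (EE q) (ZZ m) δ, P x = l x • mdl x.1 := by
  obtain ⟨ε, hε, hVO⟩ := exists_Vd hg.o hg.mem
  obtain ⟨δ, l, hδ, hδε, hl, hl0, hpl⟩ := div_radial hε (hg.sm.pvec.mono hVO) hg.d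
    fun x hx => (h x (hVO hx)).2
  refine ⟨δ, l, hδ, hl, hl0, fun x hx => ?_⟩
  have hx' := hVO (Vd_mono hδε hx)
  rw [(h x hx').1, hpl x hx, mdl_smul]

end M11

section M12
open Set Filter Topology
variable {n q m : ℕ}

/-- Liouville's formula. -/
theorem det_deriv {k : ℕ} {A : ℝ → Matrix (Fin k) (Fin k) ℝ} {M : Matrix (Fin k) (Fin k) ℝ} {t : ℝ}
    (hA : ∀ i j, HasDerivAt (fun t => A t i j) ((M * A t) i j) t) :
    HasDerivAt (fun t => (A t).det) (M.trace * (A t).det) t := by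
  let D : (Fin k → Fin k → ℝ) → ℝ := fun X => (Matrix.of X).det
  have hD : ContDiff ℝ ∞ D := by
    simp only [D, Matrix.det_apply, Matrix.of_apply]
    refine ContDiff.sum fun σ _ => ContDiff.const_smul _ (contDiff_prod fun i _ => ?_)
    fun_prop
  have hDa : ∀ X, HasFDerivAt D (fderiv ℝ D X) X := fun X =>
    (hD.contDiffAt.differentiableAt (by simp)).hasFDerivAt
  let X : ℝ → Fin k → Fin k → ℝ := fun t i j => A t i j
  let X' : Fin k → Fin k → ℝ := fun i j => (M * A t) i j
  have hX : HasDerivAt X X' t := hasDerivAt_pi.2 fun i => hasDerivAt_pi.2 fun j => hA i j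
  have h1 : HasDerivAt (fun t => D (X t)) (fderiv ℝ D (X t) X') t :=
    HasFDerivAt.comp_hasDerivAt (l := D) (f := X) t (hDa _) hX
  have h2 : fderiv ℝ D (X t) X' = M.trace * (A t).det := by
    have hl : HasDerivAt (fun h : ℝ => X t + h • X') X' 0 := by
      simpa using ((hasDerivAt_id (0:ℝ)).smul_const X').const_add (X t)
    have h3 : HasDerivAt (fun h : ℝ => D (X t + h • X')) (fderiv ℝ D (X t) X') 0 := by
      have := hDa (X t + (0:ℝ) • X')
      have h4 := HasFDerivAt.comp_hasDerivAt (l := D) (f := fun h : ℝ => X t + h • X') 0 this hl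
      rwa [zero_smul, add_zero] at h4
    have h5 : (fun h : ℝ => D (X t + h • X')) = fun h => (1 + M.trace * h +
        (Polynomial.eval h (Matrix.det (1 + (Polynomial.X : Polynomial ℝ) • M.map Polynomial.C)).divX.divX)
          * h ^ 2) * (A t).det := by
      funext h
      rw [← Matrix.det_one_add_smul, ← Matrix.det_mul]
      change Matrix.det (A t + h • (M * A t)) = _
      rw [add_mul, one_mul, smul_mul_assoc]
    rw [h5] at h3
    set pl := (Matrix.det (1 + (Polynomial.X : Polynomial ℝ) • M.map Polynomial.C)).divX.divX
    have h6 : HasDerivAt (fun h : ℝ => (1 + M.trace * h + (Polynomial.eval h pl) * h ^ 2) * (A t).det)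
        (M.trace * (A t).det) 0 := by
      have := ((((hasDerivAt_id (0:ℝ)).const_mul M.trace).const_add 1).add
        ((pl.hasDerivAt (0:ℝ)).mul (hasDerivAt_pow 2 (0:ℝ)))).mul_const (A t).det
      refine this.congr_deriv ?_
      simp
    exact h3.unique h6
  rw [h2] at h1
  exact h1

theorem const_Icc {f : ℝ → ℝ} (h : ∀ t ∈ Icc (0:ℝ) 1, HasDerivAt f 0 t) : ∀ t ∈ Icc (0:ℝ) 1, f t = f 0 :=
  constant_of_has_deriv_right_zero (fun t ht => (h t ht).continuousAt.continuousWithinAt)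
    fun t ht => (h t ⟨ht.1, ht.2.le⟩).hasDerivWithinAt

theorem clm_sum (L : EE q →L[ℝ] ℝ) (u : EE q) : L u = ∑ i, L (be i) * u i := by
  conv_lhs => rw [E_sum u]
  simp [map_sum, mul_comm]

theorem moser {δ : ℝ} {g gb : VV q m → ℝ} {T : VV q m → EE q} (hδ : 0 < δ)
    (hg : ContDiffOn ℝ ∞ g (Vd (EE q) (ZZ m) δ)) (hgb : ContDiffOn ℝ ∞ gb (Vd (EE q) (ZZ m) δ))
    (hT : ContDiffOn ℝ ∞ T (Vd (EE q) (ZZ m) δ)) (hgp : ∀ x ∈ Vd (EE q) (ZZ m) δ, 0 < g x)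
    (hgbp : ∀ x ∈ Vd (EE q) (ZZ m) δ, 0 < gb x)
    (hTy : ∀ x ∈ Vd (EE q) (ZZ m) δ, inner ℝ x.1 (T x) = 0)
    (hdiv : ∀ x ∈ Vd (EE q) (ZZ m) δ, ∑ i, (fderiv ℝ T x (be i, 0)) i = gb x - g x) :
    ∃ ζ : VV q m → EE q, ContDiff ℝ ∞ ζ ∧ (∀ x, ‖ζ x‖ = ‖x.1‖) ∧ ∀ x ∈ Vd (EE q) (ZZ m) (δ/2),
      gb (ζ x, x.2) * dE ((fderiv ℝ ζ x).comp (ContinuousLinearMap.inl ℝ _ _)) = g x := by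
  have hV := Vd_open (E := EE q) (Z := ZZ m) δ
  let sw : ℝ × ZZ m × EE q →L[ℝ] VV q m :=
    ((ContinuousLinearMap.snd ℝ (ZZ m) (EE q)).prod (ContinuousLinearMap.fst ℝ (ZZ m) (EE q))).comp
      (ContinuousLinearMap.snd ℝ ℝ (ZZ m × EE q))
  have hsw : ∀ r, sw r = (r.2.2, r.2.1) := fun r => rfl
  let gs : ℝ × ZZ m × EE q → ℝ := fun r => (1 - r.1) * g (sw r) + r.1 * gb (sw r)
  have hO1 : IsOpen (sw ⁻¹' Vd (EE q) (ZZ m) δ) := hV.preimage sw.continuous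
  have hgss : ContDiffOn ℝ ∞ gs (sw ⁻¹' Vd (EE q) (ZZ m) δ) := by
    have h1 : ContDiffOn ℝ ∞ (fun r => g (sw r)) (sw ⁻¹' Vd (EE q) (ZZ m) δ) :=
      hg.comp sw.contDiff.contDiffOn fun r hr => hr
    have h2 : ContDiffOn ℝ ∞ (fun r => gb (sw r)) (sw ⁻¹' Vd (EE q) (ZZ m) δ) :=
      hgb.comp sw.contDiff.contDiffOn fun r hr => hr
    exact ((contDiffOn_const.sub contDiffOn_fst).mul h1).add (contDiffOn_fst.mul h2)
  have hTs : ContDiffOn ℝ ∞ (fun r => T (sw r)) (sw ⁻¹' Vd (EE q) (ZZ m) δ) :=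
    hT.comp sw.contDiff.contDiffOn fun r hr => hr
  let O : Set (ℝ × ZZ m × EE q) := (sw ⁻¹' Vd (EE q) (ZZ m) δ) ∩ gs ⁻¹' Ioi 0
  have hO : IsOpen O := hgss.continuousOn.isOpen_inter_preimage hO1 isOpen_Ioi
  let K : Set (ℝ × ZZ m × EE q) :=
    Icc 0 1 ×ˢ (Metric.closedBall 0 (δ/2) ×ˢ Metric.closedBall 0 (δ/2))
  have hK : IsCompact K := isCompact_Icc.prod ((isCompact_closedBall _ _).prod (isCompact_closedBall _ _))
  have hKO : K ⊆ O := by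
    rintro ⟨t, z, y⟩ ⟨ht, hz, hy⟩
    have hz' : ‖z‖ ≤ δ/2 := by simpa using hz
    have hy' : ‖y‖ ≤ δ/2 := by simpa using hy
    have hx : (y, z) ∈ Vd (EE q) (ZZ m) δ := ⟨by change ‖y‖ < δ; linarith, by change ‖z‖ < δ; linarith⟩
    refine ⟨hx, ?_⟩
    change 0 < (1 - t) * g (y, z) + t * gb (y, z)
    have h1 := hgp _ hx
    have h2 := hgbp _ hx
    have ht0 : 0 ≤ t := ht.1
    have ht1 : t ≤ 1 := ht.2
    rcases ht0.eq_or_lt with h0 | h0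
    · rw [← h0]; simpa using h1
    · have := mul_pos h0 h2
      have := mul_nonneg (sub_nonneg.2 ht1) h1.le
      linarith
  obtain ⟨χ, hχ, hχc, hχO, N, hN, hKN, hNO, hχ1⟩ := cutoff hK hO hKO
  let G : ℝ × ZZ m × EE q → EE q := fun r => χ r • (-(gs r)⁻¹ • T (sw r))
  have hGs : ContDiff ℝ ∞ G := by
    refine cut_smul hχ hO hχO ?_
    have h1 : ContDiffOn ℝ ∞ (fun r => -(gs r)⁻¹) O :=
      ((hgss.mono inter_subset_left).inv fun r hr => (ne_of_gt hr.2)).neg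
    exact h1.smul (hTs.mono inter_subset_left)
  have hGc : HasCompactSupport G := hχc.smul_right
  have hGy : ∀ r, inner ℝ r.2.2 (G r) = 0 := by
    intro r
    by_cases hr : r ∈ O
    · have := hTy _ hr.1
      simp only [G, inner_smul_right]
      rw [hsw] at this ⊢
      rw [this]; simp
    · have : χ r = 0 := by
        by_contra h; exact hr (hχO (subset_tsupport _ h))
      simp [G, this]
  obtain ⟨fl, dl, hfs, hf0, hfd, hdl, hdl0, hdld, -, -⟩ := flow_ode G hGs hGc
  have hnorm : ∀ p, ∀ t ∈ Icc (0:ℝ) 1, ‖fl p t‖ = ‖p.2‖ := by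
    intro p t ht
    have h1 : ∀ t ∈ Icc (0:ℝ) 1, HasDerivAt (fun t => inner ℝ (fl p t) (fl p t)) (0:ℝ) t := by
      intro t ht
      have h2 := (hfd p t ht).inner ℝ (hfd p t ht)
      refine h2.congr_deriv ?_
      have h3 := hGy (t, p.1, fl p t)
      rw [real_inner_comm] at h3
      have h4 := hGy (t, p.1, fl p t)
      simp only at h3 h4
      rw [h3, h4, add_zero]
    have h2 := const_Icc h1 t ht
    simp only [hf0, real_inner_self_eq_norm_sq] at h2
    exact (sq_eq_sq₀ (norm_nonneg _) (norm_nonneg _)).1 h2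
  have h1I : (1:ℝ) ∈ Icc (0:ℝ) 1 := ⟨zero_le_one, le_rfl⟩
  have h0I : (0:ℝ) ∈ Icc (0:ℝ) 1 := ⟨le_rfl, zero_le_one⟩
  have hswap : ContDiff ℝ ∞ (fun x : VV q m => (x.2, x.1)) := contDiff_snd.prodMk contDiff_fst
  refine ⟨fun x => fl (x.2, x.1) 1, (hfs 1 h1I).comp hswap, fun x => hnorm _ 1 h1I, fun x hx => ?_⟩
  set p : ZZ m × EE q := (x.2, x.1) with hp
  let r : ℝ → ℝ × ZZ m × EE q := fun t => (t, x.2, fl p t)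
  have hrK : ∀ t ∈ Icc (0:ℝ) 1, r t ∈ K := by
    intro t ht
    refine ⟨ht, ?_, ?_⟩
    · simpa [r] using hx.2.le
    · have := hnorm p t ht
      simp only [r, mem_closedBall_zero_iff, this]
      exact hx.1.le
  let A : ℝ → Matrix (Fin (q+1)) (Fin (q+1)) ℝ := fun t => Matrix.of fun i j => (dl p (0, be j) t) i
  let M : ℝ → Matrix (Fin (q+1)) (Fin (q+1)) ℝ := fun t =>
    Matrix.of fun i j => (fderiv ℝ G (r t) (0, 0, be j)) i
  have hAd : ∀ t ∈ Icc (0:ℝ) 1, ∀ i j, HasDerivAt (fun t => A t i j) ((M t * A t) i j) t := by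
    intro t ht i j
    have h1 := (dyE i).hasFDerivAt.comp_hasDerivAt t (hdld p (0, be j) t ht)
    refine HasDerivAt.congr_deriv (f := fun t => A t i j) h1 ?_
    have h2 := clm_sum ((dyE i).comp ((fderiv ℝ G (r t)).comp
      ((ContinuousLinearMap.inr ℝ ℝ (ZZ m × EE q)).comp (ContinuousLinearMap.inr ℝ (ZZ m) (EE q)))))
      (dl p (0, be j) t)
    exact h2
  have hdet : ∀ t ∈ Icc (0:ℝ) 1, HasDerivAt (fun t => (A t).det) ((M t).trace * (A t).det) t :=
    fun t ht => det_deriv (hAd t ht)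
  have hcons : ∀ t ∈ Icc (0:ℝ) 1, HasDerivAt (fun t => gs (r t) * (A t).det) 0 t := by
    intro t ht
    have hrt : r t ∈ N := hKN (hrK t ht)
    have hrO := hNO hrt
    have hgsa : HasFDerivAt gs (fderiv ℝ gs (r t)) (r t) :=
      ((hgss.contDiffAt (hO1.mem_nhds hrO.1)).differentiableAt (by simp)).hasFDerivAt
    have hrd : HasDerivAt r (1, 0, G (r t)) t :=
      (hasDerivAt_id t).prodMk ((hasDerivAt_const _ _).prodMk (hfd p t ht))
    have h1 : HasDerivAt (fun t => gs (r t)) (fderiv ℝ gs (r t) (1, 0, G (r t))) t :=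
      HasFDerivAt.comp_hasDerivAt (l := gs) (f := r) t hgsa hrd
    have h2 : fderiv ℝ gs (r t) (1, 0, 0) = gb (sw (r t)) - g (sw (r t)) := by
      have hc : HasDerivAt (fun s : ℝ => ((s, x.2, fl p t) : ℝ × ZZ m × EE q)) (1, 0, 0) t :=
        (hasDerivAt_id t).prodMk (hasDerivAt_const _ _)
      have h3 : HasDerivAt (fun s : ℝ => gs (s, x.2, fl p t)) (fderiv ℝ gs (r t) (1, 0, 0)) t :=
        HasFDerivAt.comp_hasDerivAt (l := gs) (f := fun s : ℝ => ((s, x.2, fl p t) : ℝ × ZZ m × EE q))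
          t hgsa hc
      have h4 : HasDerivAt (fun s : ℝ => (1 - s) * g (sw (r t)) + s * gb (sw (r t)))
          (-1 * g (sw (r t)) + 1 * gb (sw (r t))) t :=
        (((hasDerivAt_id t).const_sub 1).mul_const _).add ((hasDerivAt_id t).mul_const _)
      rw [h3.unique h4]; ring
    have h3 : fderiv ℝ gs (r t) (0, 0, G (r t)) + gs (r t) * (M t).trace =
        - (gb (sw (r t)) - g (sw (r t))) := by
      have hGa : HasFDerivAt G (fderiv ℝ G (r t)) (r t) :=
        (hGs.contDiffAt.differentiableAt (by simp)).hasFDerivAt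
      have hTa : HasFDerivAt (fun r => T (sw r)) ((fderiv ℝ T (sw (r t))).comp sw) (r t) :=
        HasFDerivAt.comp (g := T) (f := sw) (r t) ((hT.contDiffAt
          (hV.mem_nhds hrO.1)).differentiableAt (by simp)).hasFDerivAt sw.hasFDerivAt
      have e : (fun r => gs r • G r) =ᶠ[𝓝 (r t)] fun r => -T (sw r) := by
        filter_upwards [hN.mem_nhds hrt] with r' hr'
        have : gs r' ≠ 0 := ne_of_gt (hNO hr').2
        simp only [G, hχ1 r' hr', neg_smul, smul_neg, smul_smul, one_mul, mul_inv_cancel₀ this,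
          one_smul]
      have h4 := (hgsa.smul hGa).unique (hTa.neg.congr_of_eventuallyEq e)
      have h5 : ∀ i : Fin (q+1), gs (r t) * M t i i + fderiv ℝ gs (r t) (0, 0, be i) * (G (r t)) i =
          - (fderiv ℝ T (sw (r t)) (be i, 0)) i := by
        intro i
        have := congrArg (fun v : EE q => v i) (DFunLike.congr_fun h4 (0, 0, be i))
        exact this
      have h6 := Finset.sum_congr (rfl : (Finset.univ : Finset (Fin (q+1))) = Finset.univ)
        fun i _ => h5 i
      rw [Finset.sum_add_distrib, ← Finset.mul_sum, Finset.sum_neg_distrib, hdiv _ hrO.1] at h6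
      have h7 := clm_sum ((fderiv ℝ gs (r t)).comp
        ((ContinuousLinearMap.inr ℝ ℝ (ZZ m × EE q)).comp (ContinuousLinearMap.inr ℝ (ZZ m) (EE q))))
        (G (r t))
      have h8 : fderiv ℝ gs (r t) (0, 0, G (r t)) =
        ∑ i, fderiv ℝ gs (r t) (0, 0, be i) * (G (r t)) i := h7
      rw [← h8] at h6
      rw [← h6, add_comm]; rfl
    refine (h1.mul (hdet t ht)).congr_deriv ?_
    have h4 : fderiv ℝ gs (r t) (1, 0, G (r t)) =
        fderiv ℝ gs (r t) (1, 0, 0) + fderiv ℝ gs (r t) (0, 0, G (r t)) := by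
      rw [← map_add]; simp
    rw [h4, h2]
    linear_combination (A t).det * h3
  have h1 := const_Icc hcons 1 h1I
  have hA0 : (A 0).det = 1 := by
    have : A 0 = 1 := by
      ext i j
      simp only [A, Matrix.of_apply, hdl0, Matrix.one_apply, be]
      simp [eq_comm]
    rw [this, Matrix.det_one]
  have hA1 : (A 1).det = dE ((fderiv ℝ (fun x : VV q m => fl (x.2, x.1) 1) x).comp
      (ContinuousLinearMap.inl ℝ _ _)) := by
    have h2 : ∀ u, fderiv ℝ (fun x : VV q m => fl (x.2, x.1) 1) x (u, 0) = dl p (0, u) 1 := by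
      intro u
      have h3 : HasFDerivAt (fun p => fl p 1) (fderiv ℝ (fun p => fl p 1) p) p :=
        ((hfs 1 h1I).contDiffAt.differentiableAt (by simp)).hasFDerivAt
      have h4 : HasFDerivAt (fun x : VV q m => (x.2, x.1)) _ x :=
        (hasFDerivAt_snd (𝕜 := ℝ) (p := x)).prodMk (hasFDerivAt_fst (𝕜 := ℝ) (p := x))
      have h5 := HasFDerivAt.comp (g := fun p => fl p 1) (f := fun x : VV q m => (x.2, x.1)) x h3 h4
      rw [show fderiv ℝ (fun x : VV q m => fl (x.2, x.1) 1) x = _ from h5.fderiv]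
      exact hdl p (0, u) 1 h1I
    unfold dE
    congr 1
    ext i j
    exact congrArg (fun v : EE q => v i) (h2 (be j)).symm
  rw [hA0, hA1] at h1
  have e1 : gs (r 1) = gb (fl p 1, x.2) := by simp [gs, r, hsw]
  have e0 : gs (r 0) = g x := by simp [gs, r, hsw, hf0, hp]
  rw [e1, e0, mul_one] at h1
  exact h1

end M12

section M13
open MeasureTheory Set Filter Topology
variable {q m : ℕ}

abbrev KK (q : ℕ) := (EE q →L[ℝ] EE q) × (EE q →L[ℝ] EE q)

/-- Rotational averaging of a density is a divergence of a tangential field. -/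
theorem average (hq : 1 ≤ q) {δ : ℝ} {g : VV q m → ℝ}
    (hg : ContDiffOn ℝ ∞ g (Vd (EE q) (ZZ m) δ)) :
    ∃ (gb : VV q m → ℝ) (T : VV q m → EE q), ContDiffOn ℝ ∞ gb (Vd (EE q) (ZZ m) δ) ∧
      ContDiffOn ℝ ∞ T (Vd (EE q) (ZZ m) δ) ∧
      (∀ x ∈ Vd (EE q) (ZZ m) δ, inner ℝ x.1 (T x) = 0) ∧
      (∀ x ∈ Vd (EE q) (ZZ m) δ, ∑ i, (fderiv ℝ T x (be i, 0)) i = gb x - g x) ∧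
      (∀ x ∈ Vd (EE q) (ZZ m) δ, ∀ y, ‖y‖ = ‖x.1‖ → gb (y, x.2) = gb x) ∧ gb 0 = g 0 := by
  have hr : 1 < Module.rank ℝ (EE q) := by
    rw [← Module.finrank_eq_rank, finrank_euclideanSpace_fin]
    exact_mod_cast (by omega : 1 < q + 1)
  obtain ⟨μ, ν, C, hμ, hν, hμs, hνs, hrep, hinv⟩ := haar_avg hr
  have hO := Vd_open (E := EE q) (Z := ZZ m) δ
  have hmem : ∀ x ∈ Vd (EE q) (ZZ m) δ, ∀ y : EE q, ‖y‖ = ‖x.1‖ →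
      ((y, x.2) : VV q m) ∈ Vd (EE q) (ZZ m) δ := by
    intro x hx y hy
    exact ⟨by rw [hy]; exact hx.1, hx.2⟩
  have hga : ∀ x ∈ Vd (EE q) (ZZ m) δ, ContDiffAt ℝ ∞ g x := fun x hx =>
    hg.contDiffAt (hO.mem_nhds hx)
  have hslc : ∀ x ∈ Vd (EE q) (ZZ m) δ,
      ContinuousOn (fun y : EE q => g (y, x.2)) {y' | ‖y'‖ = ‖x.1‖} := by
    intro x hx y hy
    have h1 : ContinuousAt g (y, x.2) := (hga _ (hmem x hx y hy)).continuousAt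
    exact (ContinuousAt.comp (g := g) (f := fun y : EE q => ((y, x.2) : VV q m)) h1
      (by fun_prop)).continuousWithinAt
  let f : VV q m × KK q → EE q := fun y => g (y.2.1 y.1.1, y.1.2) • (star y.2.1) (y.2.2 (y.2.1 y.1.1))
  have hf : ∀ x ∈ Vd (EE q) (ZZ m) δ, ∀ k ∈ S2 (EE q) C, ContDiffAt ℝ ∞ f (x, k) := by
    intro x hx k hk
    have h1 : ContDiffAt ℝ ∞ g (k.1 x.1, x.2) :=
      hga _ (hmem x hx _ (ContinuousLinearMap.norm_map_of_mem_unitary hk.1 _))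
    have h2 : ContDiffAt ℝ ∞ (fun y : VV q m × KK q => g (y.2.1 y.1.1, y.1.2)) (x, k) :=
      ContDiffAt.comp (x, k) (g := g)
        (f := fun y : VV q m × KK q => ((y.2.1 y.1.1, y.1.2) : VV q m)) h1 (by fun_prop)
    have h3 : ContDiff ℝ ∞ (fun A : EE q →L[ℝ] EE q => star A) :=
      (starL' ℝ : (EE q →L[ℝ] EE q) ≃L[ℝ] (EE q →L[ℝ] EE q)).contDiff
    have h4 : ContDiffAt ℝ ∞ (fun y : VV q m × KK q => star y.2.1) (x, k) :=
      (h3.comp (by fun_prop : ContDiff ℝ ∞ fun y : VV q m × KK q => y.2.1)).contDiffAt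
    exact h2.smul (h4.clm_apply (by fun_prop))
  refine ⟨fun x => ∫ κ, g (κ x.1, x.2) ∂μ, fun x => ∫ k, f (x, k) ∂ν, ?_, ?_, ?_, ?_, ?_, ?_⟩
  · intro x hx
    refine ContDiffAt.contDiffWithinAt ?_
    have := contDiffAt_integral μ unitary_compact (fun y : VV q m × (EE q →L[ℝ] EE q) =>
      g (y.2 y.1.1, y.1.2)) x (by
        intro κ hκ
        have h1 : ContDiffAt ℝ ∞ g (κ x.1, x.2) :=
          hga _ (hmem x hx _ (ContinuousLinearMap.norm_map_of_mem_unitary hκ _))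
        exact ContDiffAt.comp (x, κ) (g := g) (f := fun y : VV q m × (EE q →L[ℝ] EE q) =>
          ((y.2 y.1.1, y.1.2) : VV q m)) h1 (by fun_prop))
    rw [restrict_full hμs] at this
    exact this
  · intro x hx
    have := contDiffAt_integral ν (S2_compact C) f x (hf x hx)
    rw [restrict_full hνs] at this
    exact this.contDiffWithinAt
  · intro x hx
    have h1 : Integrable (fun k => f (x, k)) ν := integ_of (S2_compact C) hνs fun k hk =>
      (ContinuousAt.comp (g := f) (f := fun k : KK q => (x, k)) (hf x hx k hk).continuousAt
        (by fun_prop)).continuousWithinAt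
    rw [← integral_inner h1]
    refine (integral_full hνs (g := fun _ => (0:ℝ)) fun k hk => ?_).trans (by simp)
    simp only [f, inner_smul_right, ContinuousLinearMap.star_eq_adjoint,
      ContinuousLinearMap.adjoint_inner_right, skew_inner hk.2.1, mul_zero]
  · intro x hx
    have h1 := hasFDerivAt_integral ν (S2_compact C) f x
      (fun k hk => (hf x hx k hk).of_le (by exact_mod_cast le_top))
    rw [restrict_full hνs] at h1
    rw [show fderiv ℝ (fun x => ∫ k, f (x, k) ∂ν) x = _ from h1.fderiv]
    let L : (VV q m →L[ℝ] EE q) →L[ℝ] ℝ := ∑ i, (dyE i).comp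
      (ContinuousLinearMap.apply ℝ (EE q) ((be i, 0) : VV q m))
    have hL : ∀ D : VV q m →L[ℝ] EE q, L D = ∑ i, (D (be i, 0)) i := by
      intro D
      simp only [L, _root_.sum_apply]
      rfl
    have hI : Integrable (fun k => (fderiv ℝ f (x, k)).comp (ContinuousLinearMap.inl ℝ _ (KK q))) ν :=
      integ_of (S2_compact C) hνs fun k hk => by
        have h2 : ContinuousAt (fderiv ℝ f) (x, k) :=
          ((hf x hx k hk).fderiv_right (m := 0) (by simp)).continuousAt
        have h3 : ContinuousAt (fun k => fderiv ℝ f (x, k)) k :=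
          ContinuousAt.comp (g := fderiv ℝ f) (f := fun k : KK q => (x, k)) h2 (by fun_prop)
        exact (h3.clm_comp continuousAt_const).continuousWithinAt
    rw [← hL, ← ContinuousLinearMap.integral_comp_comm L hI]
    let g' : EE q → EE q →L[ℝ] ℝ := fun y => (fderiv ℝ g (y, x.2)).comp (ContinuousLinearMap.inl ℝ _ _)
    have hg1 : ∀ y, ‖y‖ = ‖x.1‖ → HasFDerivAt g (fderiv ℝ g (y, x.2)) (y, x.2) := fun y hy =>
      ((hga _ (hmem x hx y hy)).differentiableAt (by simp)).hasFDerivAt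
    have hR := hrep ℝ (fun y => g (y, x.2)) g' x.1 (fun y hy => by
      have h2 : HasFDerivAt (fun y : EE q => ((y, x.2) : VV q m)) (ContinuousLinearMap.inl ℝ _ _) y :=
        (hasFDerivAt_id y).prodMk (hasFDerivAt_const x.2 y)
      exact HasFDerivAt.comp (g := g) (f := fun y : EE q => ((y, x.2) : VV q m)) y (hg1 y hy) h2)
      (fun y hy => by
        have h2 : ContinuousAt (fderiv ℝ g) (y, x.2) :=
          ((hga _ (hmem x hx y hy)).fderiv_right (m := 0) (by simp)).continuousAt
        have h3 : ContinuousAt (fun y => fderiv ℝ g (y, x.2)) y :=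
          ContinuousAt.comp (g := fderiv ℝ g) (f := fun y : EE q => ((y, x.2) : VV q m)) h2
            (by fun_prop)
        exact (h3.clm_comp continuousAt_const).continuousWithinAt)
    have hgi : Integrable (fun κ : EE q →L[ℝ] EE q => g (κ x.1, x.2)) μ :=
      integ_of unitary_compact hμs (orb_contOn (hslc x hx))
    rw [integral_sub hgi (integrable_const _)] at hR
    simp only [integral_const, probReal_univ, one_smul, Prod.mk.eta] at hR
    rw [hR]
    refine integral_full hνs fun k hk => ?_
    rw [hL]
    let A : EE q →L[ℝ] EE q := (star k.1).comp (k.2.comp k.1)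
    have hA : star A = -A := by
      change star (star k.1 * (k.2 * k.1)) = -(star k.1 * (k.2 * k.1))
      rw [star_mul, star_mul, star_star, hk.2.1]
      noncomm_ring
    have hkA : k.1 (A x.1) = k.2 (k.1 x.1) := by
      have : k.1 * star k.1 = 1 := Unitary.mul_star_self_of_mem hk.1
      exact congrArg (fun B : EE q →L[ℝ] EE q => B (k.2 (k.1 x.1))) this
    have hn := ContinuousLinearMap.norm_map_of_mem_unitary hk.1 x.1
    have hB : HasFDerivAt (fun x : VV q m => ((k.1 x.1, x.2) : VV q m))
        ((k.1.comp (ContinuousLinearMap.fst ℝ _ _)).prod (ContinuousLinearMap.snd ℝ _ _)) x :=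
      (k.1.hasFDerivAt.comp x (hasFDerivAt_fst (𝕜 := ℝ) (p := x))).prodMk
        (hasFDerivAt_snd (𝕜 := ℝ) (p := x))
    have h4 := HasFDerivAt.comp (g := g) (f := fun x : VV q m => ((k.1 x.1, x.2) : VV q m)) x
      (hg1 _ hn) hB
    have h5 : HasFDerivAt (fun x : VV q m => A x.1) (A.comp (ContinuousLinearMap.fst ℝ _ _)) x :=
      A.hasFDerivAt.comp x (hasFDerivAt_fst (𝕜 := ℝ) (p := x))
    have h6 := HasFDerivAt.smul h4 h5
    have h7 : HasFDerivAt (fun x => f (x, k)) ((fderiv ℝ f (x, k)).comp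
        (ContinuousLinearMap.inl ℝ _ (KK q))) x :=
      HasFDerivAt.comp (g := f) (f := fun x : VV q m => (x, k)) x
        ((hf x hx k hk).differentiableAt (by simp)).hasFDerivAt
        ((hasFDerivAt_id x).prodMk (hasFDerivAt_const k x))
    rw [h7.unique h6]
    have h8 : ∀ i, (A (be i)) i = 0 := fun i => by
      rw [← inner_be, real_inner_comm]; exact skew_inner hA _
    change ∑ i, (g (k.1 x.1, x.2) * (A (be i)) i + fderiv ℝ g (k.1 x.1, x.2) (k.1 (be i), 0) *
      (A x.1) i) = g' (k.1 x.1) (k.2 (k.1 x.1))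
    simp only [h8, mul_zero, zero_add]
    rw [← hkA]
    exact (clm_sum ((g' (k.1 x.1)).comp k.1) (A x.1)).symm
  · intro x hx y hy
    exact (hinv ℝ (fun y => g (y, x.2)) x.1 y hy (hslc x hx)).symm
  · change ∫ κ : EE q →L[ℝ] EE q, g (κ (0 : EE q), (0 : ZZ m)) ∂μ = g 0
    simp only [map_zero, integral_const, probReal_univ, one_smul]
    rfl

end M13

section M14
open Set Filter Topology
variable {n q m : ℕ}

theorem dE_inj {B : EE q →L[ℝ] EE q} (h : dE B ≠ 0) {u : EE q} (hu : B u = 0) : u = 0 := by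
  have h1 : (fun k => u k) = 0 := by
    refine Matrix.eq_zero_of_mulVec_eq_zero h ?_
    funext i
    simp only [Matrix.mulVec, dotProduct, Matrix.of_apply]
    refine (clm_sum ((dyE i).comp B) u).symm.trans ?_
    simp [hu]
  ext k
  exact congrFun h1 k

/-- Fibred changes of variables between multiples of the model. -/
theorem fib_lin {P : VV q m → QV q (VV q m)} {l l' : VV q m → ℝ} {ζ : VV q m → EE q} {δ : ℝ}
    (hδ : 0 < δ) (hP : ∀ x ∈ Vd (EE q) (ZZ m) δ, P x = l x • mdl x.1)
    (hζ : ContDiffOn ℝ ∞ ζ (Vd (EE q) (ZZ m) δ)) (hζ0 : ∀ z, ζ (0, z) = 0)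
    (h0 : dE ((fderiv ℝ ζ 0).comp (ContinuousLinearMap.inl ℝ _ _)) ≠ 0)
    (h : ∀ x ∈ Vd (EE q) (ZZ m) δ, ∃ η : EE q, (∀ u, inner ℝ η (fderiv ℝ ζ x (u, 0)) = inner ℝ x.1 u) ∧
      (l x * dE ((fderiv ℝ ζ x).comp (ContinuousLinearMap.inl ℝ _ _))) • η = l' (ζ x, x.2) • ζ x) :
    LinTo P (fun x => l' x • mdl x.1) := by
  have hO := Vd_open (E := EE q) (Z := ZZ m) δ
  have hd : ∀ x ∈ Vd (EE q) (ZZ m) δ, HasFDerivAt (fun x => ((ζ x, x.2) : VV q m))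
      ((fderiv ℝ ζ x).prod (ContinuousLinearMap.snd ℝ _ _)) x := fun x hx =>
    ((hζ.contDiffAt (hO.mem_nhds hx)).differentiableAt (by simp)).hasFDerivAt.prodMk
      (hasFDerivAt_snd (𝕜 := ℝ) (p := x))
  have h0V : (0 : VV q m) ∈ Vd (EE q) (ZZ m) δ := ⟨by simpa using hδ, by simpa using hδ⟩
  refine ⟨fun x => (ζ x, x.2), _, hO, h0V, Prod.ext (hζ0 0) rfl,
    hζ.prodMk contDiff_snd.contDiffOn, ?_, fun x hx => ?_⟩
  · rw [show fderiv ℝ (fun x : VV q m => ((ζ x, x.2) : VV q m)) 0 = _ from (hd 0 h0V).fderiv]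
    set A := (fderiv ℝ ζ 0).prod (ContinuousLinearMap.snd ℝ (EE q) (ZZ m))
    have hi : Function.Injective A := by
      refine (injective_iff_map_eq_zero A).2 fun v hv => ?_
      have h2 : v.2 = 0 := congrArg Prod.snd hv
      have h1 : fderiv ℝ ζ 0 v = 0 := congrArg Prod.fst hv
      have h3 : v = (v.1, 0) := Prod.ext rfl h2
      rw [h3] at h1
      exact Prod.ext (dE_inj h0 h1) h2
    exact ⟨hi, (LinearMap.injective_iff_surjective (f := (A : VV q m →ₗ[ℝ] VV q m))).1 hi⟩
  · rw [show fderiv ℝ (fun x : VV q m => ((ζ x, x.2) : VV q m)) x = _ from (hd x hx).fderiv, hP x hx]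
    obtain ⟨η, h1, h2⟩ := h x hx
    have h3 := push_mdl ((fderiv ℝ ζ x).prod (ContinuousLinearMap.snd ℝ (EE q) (ZZ m)))
      ((fderiv ℝ ζ x).comp (ContinuousLinearMap.inl ℝ _ _)) (fun u => rfl) x.1 η h1
    change l x • push _ (mdl x.1) = _
    rw [h3, smul_smul]
    change (l x * dE ((fderiv ℝ ζ x).comp (ContinuousLinearMap.inl ℝ _ _))) • mdl η = _
    rw [← mdl_smul, h2, mdl_smul]

theorem pos_nhd {δ : ℝ} (hδ : 0 < δ) {g : VV q m → ℝ} (hg : ContinuousOn g (Vd (EE q) (ZZ m) δ))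
    (h0 : g 0 = 1) : ∃ ε > 0, ε ≤ δ ∧ ∀ x ∈ Vd (EE q) (ZZ m) ε, 0 < g x := by
  have h0V : (0 : VV q m) ∈ Vd (EE q) (ZZ m) δ := ⟨by simpa using hδ, by simpa using hδ⟩
  obtain ⟨ε, hε, h⟩ := exists_Vd (hg.isOpen_inter_preimage (Vd_open δ) isOpen_Ioi)
    ⟨h0V, (by change 0 < g 0; rw [h0]; norm_num)⟩
  exact ⟨min ε δ, lt_min hε hδ, min_le_right _ _, fun x hx => (h (Vd_mono (min_le_left _ _) hx)).2⟩

theorem stepFive (hq : 1 ≤ q) {P : VV q m → QV q (VV q m)} {l : VV q m → ℝ} {δ : ℝ}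
    (hδ : 0 < δ) (hl : ContDiffOn ℝ ∞ l (Vd (EE q) (ZZ m) δ)) (hl0 : l 0 = 1)
    (hP : ∀ x ∈ Vd (EE q) (ZZ m) δ, P x = l x • mdl x.1) :
    ∃ (ε : ℝ) (gb : VV q m → ℝ), 0 < ε ∧ ContDiffOn ℝ ∞ gb (Vd (EE q) (ZZ m) ε) ∧ gb 0 = 1 ∧
      (∀ x ∈ Vd (EE q) (ZZ m) ε, 0 < gb x) ∧
      (∀ x ∈ Vd (EE q) (ZZ m) ε, ∀ y, ‖y‖ = ‖x.1‖ → gb (y, x.2) = gb x) ∧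
      LinTo P (fun x => (gb x)⁻¹ • mdl x.1) := by
  obtain ⟨ε, hε, hεδ, hlp⟩ := pos_nhd hδ hl.continuousOn hl0
  have hgs : ContDiffOn ℝ ∞ (fun x => (l x)⁻¹) (Vd (EE q) (ZZ m) ε) :=
    (hl.mono (Vd_mono hεδ)).inv fun x hx => (hlp x hx).ne'
  obtain ⟨gb, T, hgb, hT, hTy, hdiv, hinv, hgb0⟩ := average hq hgs
  rw [hl0, inv_one] at hgb0
  obtain ⟨ρ, hρ, hρε, hgp⟩ := pos_nhd hε hgb.continuousOn hgb0
  have hsub := Vd_mono (E := EE q) (Z := ZZ m) hρε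
  obtain ⟨ζ, hζ, hζn, hdet⟩ := moser hρ (hgs.mono hsub) (hgb.mono hsub) (hT.mono hsub)
    (fun x hx => inv_pos.2 (hlp x (hsub hx))) hgp (fun x hx => hTy x (hsub hx))
    fun x hx => hdiv x (hsub hx)
  refine ⟨ρ, gb, hρ, hgb.mono hsub, hgb0, hgp, fun x hx => hinv x (hsub hx), ?_⟩
  have hs2 := Vd_mono (E := EE q) (Z := ZZ m) (by linarith : ρ / 2 ≤ ρ)
  refine fib_lin (l := l) (ζ := ζ) (l' := fun x => (gb x)⁻¹) (half_pos hρ)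
    (fun x hx => hP x (Vd_mono hεδ (hsub (hs2 hx)))) hζ.contDiffOn
    (fun z => norm_eq_zero.1 (by rw [hζn, norm_zero])) ?_ fun x hx => ⟨ζ x, fun u => ?_, ?_⟩
  · have := hdet 0 ⟨by simpa using half_pos hρ, by simpa using half_pos hρ⟩
    rw [hl0, inv_one] at this
    exact right_ne_zero_of_mul (by rw [this]; norm_num)
  · have hd : HasFDerivAt ζ (fderiv ℝ ζ x) x := (hζ.differentiable (by simp) x).hasFDerivAt
    have h1 := hd.inner ℝ hd
    have h2 : HasFDerivAt (fun x : VV q m => inner ℝ x.1 x.1) _ x :=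
      (hasFDerivAt_fst (𝕜 := ℝ) (p := x)).inner ℝ (hasFDerivAt_fst (𝕜 := ℝ) (p := x))
    have h3 : (fun x => inner ℝ (ζ x) (ζ x)) = fun x : VV q m => inner ℝ x.1 x.1 := by
      funext x
      rw [real_inner_self_eq_norm_sq, real_inner_self_eq_norm_sq, hζn]
    rw [h3] at h1
    have h4 := congrArg (fun L : VV q m →L[ℝ] ℝ => L (u, 0)) (h1.unique h2)
    change inner ℝ (ζ x) (fderiv ℝ ζ x (u, 0)) + inner ℝ (fderiv ℝ ζ x (u, 0)) (ζ x) =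
      inner ℝ x.1 u + inner ℝ u x.1 at h4
    rw [real_inner_comm (ζ x), real_inner_comm x.1 u] at h4
    linarith
  · have h1 := hdet x hx
    have h2 := hlp x (hsub (hs2 hx))
    have h3 : 0 < gb (ζ x, x.2) := hgp _ ⟨by rw [hζn]; exact (hs2 hx).1, (hs2 hx).2⟩
    congr 1
    refine eq_inv_of_mul_eq_one_left ?_
    have : l x * (l x)⁻¹ = 1 := mul_inv_cancel₀ h2.ne'
    linear_combination l x * h1 + this

end M14

section M15
open Set Filter Topology
variable {n q m : ℕ}

/-- Rotation-invariant functions have no tangential derivative. -/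
theorem inv_tang {k : VV q m → ℝ} {x : VV q m} (hd : DifferentiableAt ℝ k x) (hinv : ∀ y, ‖y‖ = ‖x.1‖ → k (y, x.2) = k x) {u : EE q}
    (hu : inner ℝ x.1 u = 0) (hx0 : x.1 ≠ 0) : fderiv ℝ k x (u, 0) = 0 := by
  by_cases hu0 : u = 0
  · rw [hu0]; exact map_zero _
  have hn := norm_pos_iff.2 hu0
  have hs : 0 < ‖x.1‖ / ‖u‖ := div_pos (norm_pos_iff.2 hx0) hn
  set s := ‖x.1‖ / ‖u‖ with hs'
  have hsu : ‖s • u‖ = ‖x.1‖ := by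
    rw [norm_smul, Real.norm_of_nonneg hs.le, hs', div_mul_cancel₀ _ hn.ne']
  let c : ℝ → VV q m := fun t => (Real.cos t • x.1 + Real.sin t • s • u, x.2)
  have hc0 : c 0 = x := Prod.ext (by simp [c]) rfl
  have hc : HasDerivAt c (s • u, 0) 0 := by
    have h1 := ((Real.hasDerivAt_cos 0).smul_const x.1).add ((Real.hasDerivAt_sin 0).smul_const (s • u))
    have h2 := h1.prodMk (hasDerivAt_const (0:ℝ) x.2)
    simp only [Real.sin_zero, neg_zero, zero_smul, Real.cos_zero, one_smul, zero_add] at h2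
    exact h2
  have h1 : HasFDerivAt k (fderiv ℝ k x) (c 0) := by rw [hc0]; exact hd.hasFDerivAt
  have h2 := HasFDerivAt.comp_hasDerivAt (l := k) (f := c) 0 h1 hc
  have h3 : k ∘ c = fun _ => k x := by
    funext t
    refine hinv _ ?_
    rw [← sq_eq_sq₀ (norm_nonneg _) (norm_nonneg _), @norm_add_sq_real, norm_smul, norm_smul, hsu,
      inner_smul_left, inner_smul_right, inner_smul_right, hu, mul_pow, mul_pow, Real.norm_eq_abs,
      Real.norm_eq_abs, sq_abs, sq_abs]
    linear_combination ‖x.1‖ ^ 2 * Real.cos_sq_add_sin_sq t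
  rw [h3] at h2
  have h4 := h2.unique (hasDerivAt_const (0:ℝ) (k x))
  have h5 : ((s • u, 0) : VV q m) = s • ((u, 0) : VV q m) := Prod.ext rfl (smul_zero s).symm
  rw [h5, map_smul, smul_eq_mul] at h4
  exact (mul_eq_zero.1 h4).resolve_left hs.ne'

theorem dE_rank_one {κ : ℝ} (hκ : κ ≠ 0) (L : EE q →L[ℝ] ℝ) (y : EE q) {B : EE q →L[ℝ] EE q}
    (hB : ∀ u, B u = κ • u + L u • y) : dE B = κ ^ q * (κ + L y) := by
  have h1 : (Matrix.of fun i j => (B (be j)) i : Matrix (Fin (q+1)) (Fin (q+1)) ℝ) =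
      κ • (1 + Matrix.replicateCol Unit (fun i => κ⁻¹ * y i) *
        Matrix.replicateRow Unit (fun j => L (be j))) := by
    ext i j
    simp only [Matrix.of_apply, hB, Matrix.smul_apply, Matrix.add_apply, Matrix.mul_apply,
      Matrix.replicateCol_apply, Matrix.replicateRow_apply, Finset.univ_unique, Finset.sum_singleton,
      smul_eq_mul, PiLp.add_apply, PiLp.smul_apply, mul_add, be, Matrix.one_apply]
    by_cases hij : i = j <;> simp [hij] <;> field_simp
  rw [dE, h1, Matrix.det_smul, Matrix.det_one_add_replicateCol_mul_replicateRow, Fintype.card_fin,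
    clm_sum L y]
  have h2 : (fun j => L (be j)) ⬝ᵥ (fun i => κ⁻¹ * y i) = κ⁻¹ * ∑ i, L (be i) * y i := by
    rw [dotProduct, Finset.mul_sum]
    exact Finset.sum_congr rfl fun i _ => by ring
  rw [h2]
  field_simp
  ring

theorem stepSix (hq : 2 ≤ q) {gb : VV q m → ℝ} {δ : ℝ} (hδ : 0 < δ)
    (hs : ContDiffOn ℝ ∞ gb (Vd (EE q) (ZZ m) δ)) (h0 : gb 0 = 1)
    (hp : ∀ x ∈ Vd (EE q) (ZZ m) δ, 0 < gb x)
    (hinv : ∀ x ∈ Vd (EE q) (ZZ m) δ, ∀ y, ‖y‖ = ‖x.1‖ → gb (y, x.2) = gb x) :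
    LinTo (fun x : VV q m => (gb x)⁻¹ • mdl x.1) (fun x => (mdl x.1 : QV q (VV q m))) := by
  have hO := Vd_open (E := EE q) (Z := ZZ m) δ
  have h0V : (0 : VV q m) ∈ Vd (EE q) (ZZ m) δ := ⟨by simpa using hδ, by simpa using hδ⟩
  obtain ⟨r, rfl⟩ : ∃ r, q = r + 2 := ⟨q - 2, by omega⟩
  let k : VV (r+2) m → ℝ := fun x => gb x ^ ((r + 1 : ℕ) : ℝ)⁻¹
  have hk : ContDiffOn ℝ ∞ k (Vd (EE (r+2)) (ZZ m) δ) := fun x hx =>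
    (hs x hx).rpow_const_of_ne (hp x hx).ne'
  have hkp : ∀ x ∈ Vd (EE (r+2)) (ZZ m) δ, 0 < k x := fun x hx => Real.rpow_pos_of_pos (hp x hx) _
  have hkg : ∀ x ∈ Vd (EE (r+2)) (ZZ m) δ, k x ^ (r + 1) = gb x := fun x hx =>
    Real.rpow_inv_natCast_pow (hp x hx).le (by omega)
  have hk0 : k 0 = 1 := by simp [k, h0]
  have hka : ∀ x ∈ Vd (EE (r+2)) (ZZ m) δ, HasFDerivAt k (fderiv ℝ k x) x := fun x hx =>
    ((hk.contDiffAt (hO.mem_nhds hx)).differentiableAt (by simp)).hasFDerivAt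
  have hDc : ContinuousOn (fun x => k x + fderiv ℝ k x (x.1, 0)) (Vd (EE (r+2)) (ZZ m) δ) :=
    hk.continuousOn.add ((hk.continuousOn_fderiv_of_isOpen hO (by simp)).clm_apply (by fun_prop))
  obtain ⟨ε, hε, hεδ, hpos⟩ := pos_nhd hδ hDc (by
    rw [show (((0 : VV (r+2) m).1, 0) : VV (r+2) m) = 0 from rfl, map_zero, hk0, add_zero])
  have hsub := Vd_mono (E := EE (r+2)) (Z := ZZ m) hεδ
  have hd : ∀ x ∈ Vd (EE (r+2)) (ZZ m) δ, HasFDerivAt (fun x : VV (r+2) m => k x • x.1) _ x := fun x hx =>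
    HasFDerivAt.smul (hka x hx) (hasFDerivAt_fst (𝕜 := ℝ) (p := x))
  have hfd : ∀ x ∈ Vd (EE (r+2)) (ZZ m) δ, ∀ u, fderiv ℝ (fun x : VV (r+2) m => k x • x.1) x (u, 0) =
      k x • u + fderiv ℝ k x (u, 0) • x.1 := by
    intro x hx u
    rw [show fderiv ℝ (fun x : VV (r+2) m => k x • x.1) x = _ from (hd x hx).fderiv]
    rfl
  have hdet : ∀ x ∈ Vd (EE (r+2)) (ZZ m) δ, dE ((fderiv ℝ (fun x : VV (r+2) m => k x • x.1) x).comp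
      (ContinuousLinearMap.inl ℝ _ _)) = k x ^ (r+2) * (k x + fderiv ℝ k x (x.1, 0)) := fun x hx =>
    dE_rank_one (hkp x hx).ne' ((fderiv ℝ k x).comp (ContinuousLinearMap.inl ℝ _ _)) x.1 (hfd x hx)
  have key := fib_lin (P := fun x : VV (r+2) m => (gb x)⁻¹ • mdl x.1) (l := fun x => (gb x)⁻¹)
    (ζ := fun x => k x • x.1) (l' := fun _ => 1) hε (fun x _ => rfl)
    ((hk.mono hsub).smul contDiff_fst.contDiffOn) (fun z => smul_zero _) (by
      rw [hdet 0 h0V]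
      exact mul_ne_zero (pow_ne_zero _ (hkp 0 h0V).ne') (hpos 0 ⟨by simpa using hε, by simpa using hε⟩).ne')
    (fun x hx => by
      have hx' := hsub hx
      refine ⟨(k x + fderiv ℝ k x (x.1, 0))⁻¹ • x.1, fun u => ?_, ?_⟩
      · rw [hfd x hx', inner_smul_left, inner_add_right, inner_smul_right, inner_smul_right]
        by_cases hx0 : x.1 = 0
        · simp [hx0]
        have hxx : inner ℝ x.1 x.1 ≠ (0:ℝ) := inner_self_ne_zero.2 hx0
        set w := u - (inner ℝ x.1 u / inner ℝ x.1 x.1) • x.1 with hw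
        have hw0 : inner ℝ x.1 w = 0 := by
          rw [hw, inner_sub_right, inner_smul_right, div_mul_cancel₀ _ hxx, sub_self]
        have h1 := inv_tang (hka x hx').differentiableAt
          (fun y hy => by simp only [k, hinv x hx' y hy]) hw0 hx0
        have h2 : ((w, 0) : VV (r+2) m) = (u, 0) - (inner ℝ x.1 u / inner ℝ x.1 x.1) • (x.1, 0) :=
          Prod.ext rfl (by simp)
        rw [h2, map_sub, map_smul, smul_eq_mul, sub_eq_zero] at h1
        have h3 := (hpos x hx).ne'
        rw [h1]
        simp only [conj_trivial]
        generalize inner ℝ x.1 u = a at *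
        generalize inner ℝ x.1 x.1 = b at *
        generalize fderiv ℝ k x (x.1, 0) = c at *
        field_simp
      · have h3 := (hpos x hx).ne'
        have h4 := (hkp x hx').ne'
        rw [hdet x hx', ← hkg x hx', smul_smul, one_smul]
        congr 1
        generalize fderiv ℝ k x (x.1, 0) = c at *
        field_simp
        ring)
  simpa only [one_smul] using key

/-- The full chain. -/
theorem chain {hqn : q ≤ n} {P : VV q m → QV q (VV q m)} {O : Set (VV q m)} (hg : GoodF hqn P O)
    (hq : 2 ≤ q) : LinTo P (fun x => (mdl x.1 : QV q (VV q m))) := by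
  obtain ⟨P1, O1, hg1, hl1, hz1⟩ := S1 hg hq
  obtain ⟨P2, O2, hg2, hl2, hz2, hc2⟩ := stepTwo hg1 hq hz1
  obtain ⟨P3, O3, hg3, hl3, h3⟩ := stepFour hg2 hq hz2 hc2
  obtain ⟨δ, l, hδ, hl, hl0, hP⟩ := stepFourB hg3 h3
  obtain ⟨ε, gb, hε, hgb, hgb0, hgp, hinv, hl5⟩ := stepFive (by omega) hδ hl hl0 hP
  exact hl1.trans (hl2.trans (hl3.trans (hl5.trans (stepSix hq hε hgb hgb0 hgp hinv))))

end M15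

section F1
open Set Filter Topology
variable {n q m : ℕ}

/-- coordinate covectors of a multi-index -/
noncomputable def cJ (J : Idx n q) (i : Fin q) : (Fin n → ℝ) →L[ℝ] ℝ :=
  ContinuousLinearMap.proj (J.1.orderEmbOfFin J.2 i)

/-- coordinates -/
noncomputable def ofQ (Q : QV q (Fin n → ℝ)) : MultiVec n q := fun J => Q (cJ J)

noncomputable def toQ : MultiVec n q →ₗ[ℝ] QV q (Fin n → ℝ) :=
  ∑ I : Idx n q, (LinearMap.proj I).smulRight
    (plu fun k => (Pi.single (I.1.orderEmbOfFin I.2 k) 1 : Fin n → ℝ))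

theorem toQ_apply (w : MultiVec n q) (α : Fin q → (Fin n → ℝ) →L[ℝ] ℝ) :
    toQ w α = ∑ I : Idx n q, w I * (plu fun k =>
      (Pi.single (I.1.orderEmbOfFin I.2 k) 1 : Fin n → ℝ)) α := by
  simp only [toQ, LinearMap.sum_apply, LinearMap.smulRight_apply, LinearMap.proj_apply]
  exact map_sum (⟨⟨fun R : QV q (Fin n → ℝ) => R α, rfl⟩, fun _ _ => rfl⟩ : QV q (Fin n → ℝ) →+ ℝ) _ _

theorem det_idx (J : Idx n q) (f : Fin q → Fin n) (hf : StrictMono f) :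
    (Matrix.of fun i l => if J.1.orderEmbOfFin J.2 i = f l then (1:ℝ) else 0).det =
      if J.1 = Finset.univ.image f then 1 else 0 := by
  split_ifs with h
  · have h1 : f = J.1.orderEmbOfFin J.2 := Finset.orderEmbOfFin_unique J.2
      (fun x => by rw [h]; exact Finset.mem_image_of_mem f (Finset.mem_univ x)) hf
    have h2 : (Matrix.of fun i l => if J.1.orderEmbOfFin J.2 i = f l then (1:ℝ) else 0) = 1 := by
      ext i l
      rw [Matrix.of_apply, h1, Matrix.one_apply]
      simp
    rw [h2, Matrix.det_one]
  · obtain ⟨j, hj, hj'⟩ : ∃ j ∈ J.1, j ∉ Finset.univ.image f := by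
      by_contra hc
      push Not at hc
      refine h (Finset.eq_of_subset_of_card_le hc ?_)
      rw [Finset.card_image_of_injective _ hf.injective, J.2, Finset.card_univ, Fintype.card_fin]
    obtain ⟨i, hi⟩ : ∃ i, J.1.orderEmbOfFin J.2 i = j := by
      have := Finset.range_orderEmbOfFin J.1 J.2
      have hj2 : j ∈ Set.range (J.1.orderEmbOfFin J.2) := by rw [this]; exact hj
      exact hj2
    refine Matrix.det_eq_zero_of_row_eq_zero i fun l => ?_
    rw [Matrix.of_apply, hi, if_neg]
    rintro rfl
    exact hj' (Finset.mem_image_of_mem f (Finset.mem_univ l))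

theorem plu_cJ (J : Idx n q) (f : Fin q → Fin n) (hf : StrictMono f) :
    (plu fun k => (Pi.single (f k) 1 : Fin n → ℝ)) (cJ J) =
      if J.1 = Finset.univ.image f then 1 else 0 := by
  rw [← det_idx J f hf, plu_apply]
  congr 1
  ext i l
  simp only [Matrix.of_apply, cJ, ContinuousLinearMap.proj_apply, Pi.single_apply]

theorem ofQ_toQ (w : MultiVec n q) : ofQ (toQ w) = w := by
  funext J
  rw [ofQ, toQ_apply, Finset.sum_eq_single J]
  · rw [plu_cJ J _ (J.1.orderEmbOfFin J.2).strictMono, if_pos, mul_one]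
    ext j
    simp
  · intro I _ hI
    rw [plu_cJ J _ (I.1.orderEmbOfFin I.2).strictMono, if_neg, mul_zero]
    intro h
    refine hI (Subtype.ext ?_)
    rw [h]
    ext j
    simp
  · simp

theorem ofQ_inj {Q Q' : QV q (Fin n → ℝ)} (h : ofQ Q = ofQ Q') : Q = Q' := by
  have hs : ∀ α : (Fin n → ℝ) →L[ℝ] ℝ, α = ∑ i, α (Pi.single i 1) •
      (ContinuousLinearMap.proj i : (Fin n → ℝ) →L[ℝ] ℝ) := by
    intro α
    refine ContinuousLinearMap.ext fun v => ?_
    conv_lhs => rw [pi_eq_sum_univ' v]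
    simp [mul_comm]
  have hc : ∀ r : Fin q → Fin n, Q (fun i => ContinuousLinearMap.proj (r i)) =
      Q' (fun i => ContinuousLinearMap.proj (r i)) := by
    intro r
    by_cases hr : Function.Injective r
    swap
    · simp only [Function.Injective] at hr
      push Not at hr
      obtain ⟨a, b, hab, hne⟩ := hr
      have hab' : (ContinuousLinearMap.proj (r a) : (Fin n → ℝ) →L[ℝ] ℝ) =
        ContinuousLinearMap.proj (r b) := by rw [hab]
      exact (Q.map_eq_zero_of_eq _ hab' hne).trans (Q'.map_eq_zero_of_eq _ hab' hne).symm
    let J : Idx n q := ⟨Finset.univ.image r, by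
      rw [Finset.card_image_of_injective _ hr, Finset.card_univ, Fintype.card_fin]⟩
    have hs : ∀ i, ∃ k, J.1.orderEmbOfFin J.2 k = r i := fun i => by
      have h1 : r i ∈ Set.range (J.1.orderEmbOfFin J.2) := by
        rw [Finset.range_orderEmbOfFin]
        exact Finset.mem_image_of_mem r (Finset.mem_univ i)
      exact h1
    choose σ hσ using hs
    have hσi : Function.Injective σ := fun a b hab => hr (by rw [← hσ, ← hσ, hab])
    have hr' : (fun i => (ContinuousLinearMap.proj (r i) : (Fin n → ℝ) →L[ℝ] ℝ)) =
        cJ J ∘ (Equiv.ofBijective σ (Finite.injective_iff_bijective.1 hσi)) := by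
      funext i; simp [cJ, hσ]
    rw [hr', AlternatingMap.map_perm, AlternatingMap.map_perm]
    congr 1
    exact congrFun h J
  ext α
  rw [show α = fun i => ∑ j, α i (Pi.single j 1) •
    (ContinuousLinearMap.proj j : (Fin n → ℝ) →L[ℝ] ℝ) from funext fun i => hs (α i)]
  have h1 := fun R : QV q (Fin n → ℝ) => R.toMultilinearMap.map_sum (fun i j => α i (Pi.single j 1) •
    (ContinuousLinearMap.proj j : (Fin n → ℝ) →L[ℝ] ℝ))
  refine (h1 Q).trans (Eq.trans (Finset.sum_congr rfl fun r _ => ?_) (h1 Q').symm)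
  rw [MultilinearMap.map_smul_univ, MultilinearMap.map_smul_univ]
  exact congrArg _ (hc r)

theorem ofQ_push (φ : (Fin n → ℝ) → Fin n → ℝ) (x : Fin n → ℝ) (w : MultiVec n q) :
    ofQ (push (fderiv ℝ φ x) (toQ w)) = extPow n q (jac φ x) w := by
  funext J
  rw [ofQ, push_apply, toQ_apply, extPow]
  exact Finset.sum_congr rfl fun I _ => mul_comm _ _

theorem ofQ_fb (hqn : q ≤ n) : ofQ (plu (fb hqn)) = stdVec n q := by
  funext J
  have h1 := plu_cJ J (Fin.castLE hqn) (Fin.strictMono_castLE hqn)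
  refine h1.trans ?_
  have h2 : Finset.univ.image (Fin.castLE hqn) = Finset.univ.filter (fun i : Fin n => (i : ℕ) < q) := by
    ext i
    simp only [Finset.mem_image, Finset.mem_univ, true_and, Finset.mem_filter]
    exact ⟨fun ⟨k, hk⟩ => hk ▸ k.2, fun h => ⟨⟨i, h⟩, rfl⟩⟩
  rw [h2]
  rfl

/-- The splitting of coordinates. -/
noncomputable def spl : (Fin (q+1+m) → ℝ) ≃L[ℝ] VV q m :=
  LinearEquiv.toContinuousLinearEquiv
  { toFun := fun x => (WithLp.toLp 2 fun i => x (Fin.castAdd m i), fun j => x (Fin.natAdd (q+1) j))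
    map_add' := fun _ _ => rfl
    map_smul' := fun _ _ => rfl
    invFun := fun v => Fin.append (fun i => v.1 i) v.2
    left_inv := fun x => by simp [Fin.append_castAdd_natAdd]
    right_inv := fun v => by simp }

theorem model_eq (y : Fin (q+1+m) → ℝ) : push
    (spl (q := q) (m := m)).symm.toContinuousLinearMap (mdl (spl (m := m) y).1) = toQ (modelPi (q+1+m) q (q+1) y) := by
  refine ofQ_inj ?_
  rw [ofQ_toQ]
  funext J
  rw [ofQ, push_apply, mdl_apply, Matrix.det_succ_row_zero, modelPi, Fin.sum_univ_add]
  have h0 : ∑ j : Fin m, (if ((Fin.natAdd (q+1) j : Fin (q+1+m)) : ℕ) < q + 1 ∧ (J : Finset _) =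
      (topIdx (q+1+m) q).erase (Fin.natAdd (q+1) j) then (-1 : ℝ) ^ ((Fin.natAdd (q+1) j : Fin _) : ℕ) *
        eps (q+1) (Fin.natAdd (q+1) j) * y (Fin.natAdd (q+1) j) else 0) = 0 :=
    Finset.sum_eq_zero fun j _ => if_neg fun h => by have := h.1; simp at this; omega
  rw [h0, add_zero]
  refine Finset.sum_congr rfl fun k _ => ?_
  have h1 := det_idx J (fun l => Fin.castAdd m (k.succAbove l))
    ((Fin.strictMono_castAdd m).comp (Fin.strictMono_succAbove k))
  have h2 : Finset.univ.image (fun l => Fin.castAdd m (k.succAbove l)) =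
      (topIdx (q+1+m) q).erase (Fin.castAdd m k) := by
    ext i
    simp only [Finset.mem_image, Finset.mem_univ, true_and, Finset.mem_erase, topIdx, Finset.mem_filter]
    constructor
    · rintro ⟨l, rfl⟩
      exact ⟨fun h => Fin.succAbove_ne k l ((Fin.castAdd_injective _ _) h), (k.succAbove l).2⟩
    · rintro ⟨h3, h4⟩
      obtain ⟨l, hl⟩ := Fin.exists_succAbove_eq (x := ⟨i, h4⟩) (y := k) (fun h => h3 (by
        rw [← h]; rfl))
      exact ⟨l, by rw [hl]; rfl⟩
  rw [h2] at h1
  have h3 : ((Matrix.of (Fin.cons (fun k => (spl (m := m) y).1 k) (fun i k =>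
      ((cJ J i).comp (spl (m := m)).symm.toContinuousLinearMap) (be k, 0)) :
        Fin (q+1) → Fin (q+1) → ℝ)).submatrix Fin.succ k.succAbove) =
      Matrix.of fun i l => if J.1.orderEmbOfFin J.2 i = Fin.castAdd m (k.succAbove l) then (1:ℝ) else 0 := by
    ext i l
    change (Fin.append (fun i => (be (k.succAbove l) : EE q) i) (0 : Fin m → ℝ))
      (J.1.orderEmbOfFin J.2 i) = _
    rw [Matrix.of_apply]
    generalize J.1.orderEmbOfFin J.2 i = a
    induction a using Fin.addCases with
    | left a => simp [be]
    | right a =>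
      rw [Fin.append_right, if_neg]
      · rfl
      · intro h
        have := congrArg Fin.val h
        have := (k.succAbove l).2
        simp at *
        omega
  erw [h3, h1]
  have h4 : eps (q+1) (Fin.castAdd m k) = 1 := if_pos k.2
  have h5 : ((Fin.castAdd m k : Fin (q+1+m)) : ℕ) < q + 1 := k.2
  simp only [h4, h5, true_and, mul_one]
  split_ifs
  · rw [mul_one]; rfl
  · rw [mul_zero]

end F1

section F2
open Set Filter Topology
variable {n q m : ℕ}

theorem nambu_chart (hqn : q ≤ n) {P : (Fin n → ℝ) → MultiVec n q} {W : Set (Fin n → ℝ)}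
    {φ : (Fin n → ℝ) → Fin n → ℝ} (hφ : IsSmoothDiffeoOn φ W) {p : Fin n → ℝ} (hp : p ∈ W)
    (h : ∀ x ∈ W, extPow n q (jac φ x) (P x) = stdVec n q) :
    NChart hqn (fun x => toQ (P x)) p := by
  obtain ⟨hW, hI, hs, ψ, hψ, hl, hr⟩ := hφ
  have hLD : LD φ ψ W (φ '' W) := ⟨hW, hI, hs, hψ, fun x hx => mem_image_of_mem φ hx,
    fun y ⟨x, hx, hxy⟩ => by rw [← hxy, hl x hx]; exact hx, hl, hr⟩
  refine ⟨φ, ψ, W, φ '' W, hLD, hp, fun s hs => ?_⟩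
  have h1 : push (fderiv ℝ φ (ψ s)) (toQ (P (ψ s))) = plu (fb hqn) := by
    refine ofQ_inj ?_
    rw [ofQ_push, ofQ_fb, h _ (hLD.mM s hs)]
  have h2 : (fderiv ℝ ψ s).comp (fderiv ℝ φ (ψ s)) = ContinuousLinearMap.id ℝ _ := by
    refine ContinuousLinearMap.ext fun v => ?_
    have := hLD.fderiv_left (hLD.mM s hs) v
    rwa [hr s hs] at this
  have h3 := congrArg (push (fderiv ℝ ψ s)) h1
  rw [push_push, h2, push_id] at h3
  exact h3

theorem good_of {U : Set (Fin (q+1+m) → ℝ)} (hU : IsOpen U) (h0U : (0 : Fin (q+1+m) → ℝ) ∈ U)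
    {P : (Fin (q+1+m) → ℝ) → MultiVec (q+1+m) q} (hN : IsNambu (q+1+m) q P U)
    (hP0 : P 0 = 0) (hlin : ∀ v, fderiv ℝ P 0 v = modelPi (q+1+m) q (q + 1) v) :
    GoodF (by omega : q ≤ q+1+m) (fun x : VV q m => push (spl (q := q) (m := m)).toContinuousLinearMap
      (toQ (P (spl.symm x)))) (spl.symm ⁻¹' U) := by
  set S := spl (q := q) (m := m)
  refine ⟨hU.preimage S.symm.continuous, by simpa using h0U, fun α => ?_, fun x hx hx0 => ?_, ?_, fun v => ?_⟩
  · simp only [push_apply, toQ_apply]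
    refine ContDiffOn.sum fun I _ => ContDiffOn.mul ?_ contDiffOn_const
    have h1 : ContDiffOn ℝ ∞ (fun x => P (S.symm x)) (S.symm ⁻¹' U) :=
      hN.1.comp S.symm.contDiff.contDiffOn fun x hx => hx
    exact contDiffOn_pi.1 h1 I
  · have h0 : P (S.symm x) ≠ 0 := fun h => hx0 (by rw [h, map_zero, push_zero])
    obtain ⟨W, hpW, hWU, φ, hφ, hE⟩ := hN.2 _ hx h0
    have h1 := nambu_chart (by omega : q ≤ q+1+m) hφ hpW hE
    have hLD : LD (S : (Fin (q+1+m) → ℝ) → VV q m) S.symm univ univ :=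
      ⟨isOpen_univ, isOpen_univ, S.contDiff.contDiffOn, S.symm.contDiff.contDiffOn,
        fun _ _ => trivial, fun _ _ => trivial, fun x _ => S.symm_apply_apply x,
        fun x _ => S.apply_symm_apply x⟩
    have h2 := h1.push hLD (mem_univ _)
    rw [S.apply_symm_apply] at h2
    have h3 : pf S S.symm (fun x => toQ (P x)) = fun x => push S.toContinuousLinearMap
        (toQ (P (S.symm x))) := by
      funext y
      rw [pf, S.fderiv]
    rwa [h3] at h2
  · rw [map_zero, hP0, map_zero, push_zero]
  · let Λ : MultiVec (q+1+m) q →L[ℝ] EE q := LinearMap.toContinuousLinearMap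
      { toFun := fun w => pvec (push S.toContinuousLinearMap (toQ w))
        map_add' := fun w w' => by
          rw [map_add]
          ext j
          simp only [PiLp.add_apply, pvec_apply, push_apply, AlternatingMap.add_apply, mul_add]
        map_smul' := fun c w => by
          rw [map_smul]
          ext j
          simp only [PiLp.smul_apply, pvec_apply, push_apply, AlternatingMap.smul_apply, smul_eq_mul,
            RingHom.id_apply]
          ring }
    have hPd : HasFDerivAt P (fderiv ℝ P 0) (S.symm 0) := by
      rw [map_zero]
      exact ((hN.1.contDiffAt (hU.mem_nhds h0U)).differentiableAt (by simp)).hasFDerivAt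
    have h1 : HasFDerivAt (fun x => Λ (P (S.symm x))) _ 0 := HasFDerivAt.comp (g := Λ)
      (f := fun x => P (S.symm x)) 0 Λ.hasFDerivAt
      (HasFDerivAt.comp (g := P) (f := S.symm) 0 hPd S.symm.hasFDerivAt)
    rw [show fderiv ℝ (fun x => pvec (push S.toContinuousLinearMap (toQ (P (S.symm x))))) 0 = _ from
      h1.fderiv]
    change pvec (push S.toContinuousLinearMap (toQ (fderiv ℝ P 0 (S.symm v)))) = v.1
    rw [hlin, ← model_eq, push_push, S.apply_symm_apply]
    have h2 : S.toContinuousLinearMap.comp S.symm.toContinuousLinearMap =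
        ContinuousLinearMap.id ℝ _ := ContinuousLinearMap.ext fun v => S.apply_symm_apply v
    rw [h2, push_id, pvec_mdl]

end F2

/-- (smooth linearization in the elliptic case, from
Dufour–Zung 1999, recalled as result 3) in the paper). A smooth Nambu structure
of order `q ≥ 2` vanishing at `0` whose linear part at `0` is the elliptic model
`Π_{q+1,q}` (signature `(q+1,0)`) is locally smoothly linearizable at `0`. -/
theorem smooth_linearization_elliptic (n q : ℕ) (hq : 2 ≤ q) (hn : q < n)
    (U : Set (Fin n → ℝ)) (hU : IsOpen U) (h0U : (0 : Fin n → ℝ) ∈ U)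
    (P : (Fin n → ℝ) → MultiVec n q) (hN : IsNambu n q P U)
    (hP0 : P 0 = 0) (hlin : ∀ v : Fin n → ℝ, fderiv ℝ P 0 v = modelPi n q (q + 1) v) :
    ∃ W : Set (Fin n → ℝ), W ⊆ U ∧ (0 : Fin n → ℝ) ∈ W ∧
      ∃ φ : (Fin n → ℝ) → (Fin n → ℝ), IsSmoothDiffeoOn φ W ∧ φ 0 = 0 ∧
        ∀ x ∈ W, extPow n q (jac φ x) (P x) = modelPi n q (q + 1) (φ x) := by
  obtain ⟨m, rfl⟩ : ∃ m, n = q + 1 + m := ⟨n - (q + 1), by omega⟩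
  obtain ⟨φ, O, hO, h0, hφ0, hφ, hb, hP⟩ := chain (good_of hU h0U hN hP0 hlin) hq
  set S := spl (q := q) (m := m)
  have hO' : IsOpen (S ⁻¹' O) := hO.preimage S.continuous
  let Φ : (Fin (q+1+m) → ℝ) → Fin (q+1+m) → ℝ := fun x => S.symm (φ (S x))
  have hΦ : ContDiffOn ℝ ∞ Φ (S ⁻¹' O) :=
    S.symm.contDiff.comp_contDiffOn (hφ.comp S.contDiff.contDiffOn fun x hx => hx)
  have hd : ∀ x ∈ S ⁻¹' O, fderiv ℝ Φ x = S.symm.toContinuousLinearMap.comp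
      ((fderiv ℝ φ (S x)).comp S.toContinuousLinearMap) := by
    intro x hx
    have h1 : HasFDerivAt φ (fderiv ℝ φ (S x)) (S x) :=
      ((hφ.contDiffAt (hO.mem_nhds hx)).differentiableAt (by simp)).hasFDerivAt
    have h2 := HasFDerivAt.comp (g := φ) (f := S) x h1 S.hasFDerivAt
    exact (HasFDerivAt.comp (g := S.symm) (f := fun x => φ (S x)) x S.symm.hasFDerivAt h2).fderiv
  have h0' : (0 : Fin (q+1+m) → ℝ) ∈ S ⁻¹' O := by simpa using h0
  have hb' : Function.Bijective (fderiv ℝ Φ 0) := by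
    rw [hd 0 h0', map_zero]
    exact S.symm.bijective.comp (hb.comp S.bijective)
  obtain ⟨ψ, N, M, hL, h0N, hNO⟩ := LD_of_bij (hO'.inter hU) (hΦ.mono Set.inter_subset_left)
    ⟨h0', h0U⟩ hb'
  have hM : Φ '' N = M := by
    ext y
    exact ⟨fun ⟨x, hx, hxy⟩ => hxy ▸ hL.mN x hx, fun hy => ⟨ψ y, hL.mM y hy, hL.ri y hy⟩⟩
  refine ⟨N, fun x hx => (hNO hx).2, h0N, Φ, ⟨hL.oN, hM ▸ hL.oM, hL.sN, ψ, hM ▸ hL.sM, hL.li,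
    hM ▸ hL.ri⟩, by simp only [Φ, map_zero, hφ0], fun x hx => ?_⟩
  have hxO := (hNO hx).1
  have h1 := hP (S x) hxO
  simp only [S.symm_apply_apply] at h1
  have h2 := congrArg (push S.symm.toContinuousLinearMap) h1
  have h3 := model_eq (q := q) (m := m) (Φ x)
  rw [show spl (q := q) (m := m) (Φ x) = φ (S x) from S.apply_symm_apply _] at h3
  rw [← ofQ_push, hd x hxO]
  exact (congrArg ofQ (h2.trans h3)).trans (ofQ_toQ _)

end NambuLin
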